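/- Let κ > 0 and let U ⊆ ℝ² be an open connected set whose complement K = ℝ² \ U is compact. Let Ω ⊂ ℝ² be a bounded open set containing K. Let D ⊂ ℝ² be a bounded open domain whose boundary Γ = ∂D is connected and real-analytic, with closure(D) ⊆ U, and assume κ is not a Dirichlet eigenvalue for D. Let Λ be a nonempty relatively open subset of Γ. For j = 1, 2 let v_j ∈ L^∞(ℝ²) vanish almost everywhere on the closure of U (so that its support lies in K ⊆ Ω), satisfy the unique-solvability condition at energy κ, and let R_j : ℝ² × ℝ² → ℂ be an outgoing Green function for v_j at energy κ. If Im R₁(x,y) = Im R₂(x,y) for all x, y ∈ Λ, then v₁ = v₂ almost everywhere on ℝ². -/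

import Mathlib

noncomputable section

open Real MeasureTheory Set

/-- The plane `ℝ²`. -/
abbrev R2 : Type := EuclideanSpace ℝ (Fin 2)

/-- The Bessel function `J₀` of the first kind of order zero, defined by its power series. -/
def J0 (r : ℝ) : ℝ :=
  ∑' m : ℕ, (-1 : ℝ) ^ m * (r / 2) ^ (2 * m) / (Nat.factorial m : ℝ) ^ 2

/-- The Bessel function `Y₀` of the second kind of order zero, defined by its series,
where `γ` is the Euler–Mascheroni constant and `h_m = Σ_{k=1}^m 1/k`. -/
def Y0 (r : ℝ) : ℝ :=
  (2 / π) * (Real.log (r / 2) + Real.eulerMascheroniConstant) * J0 r +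
    (2 / π) * ∑' m : ℕ, (-1 : ℝ) ^ (m + 1) * (∑ k ∈ Finset.range m, (1 : ℝ) / (k + 1)) *
      (r / 2) ^ (2 * m) / (Nat.factorial m : ℝ) ^ 2

/-- The Hankel function `H₀ = J₀ + iY₀` of the first kind of order zero. -/
def H0 (r : ℝ) : ℂ := (J0 r : ℂ) + Complex.I * (Y0 r : ℂ)

/-- The outgoing Green function `G⁺(x, κ) = (i/4) H₀(κ|x|)` of the two-dimensional
Helmholtz equation. -/
def Gplus (κ : ℝ) (x : R2) : ℂ := (Complex.I / 4) * H0 (κ * ‖x‖)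

/-- `R` is an outgoing Green function for the potential `v` (supported in `Ω`) at energy `κ`:
for each `y`, `R(·, y)` is `L²` on `Ω` and satisfies the Lippmann–Schwinger type
integral equation `R(x,y) = −G⁺(x−y,κ) + ∫_Ω G⁺(x−z,κ) v(z) R(z,y) dz` for all `x ≠ y`. -/
def IsOutgoingGreen (κ : ℝ) (Ω : Set R2) (v : R2 → ℂ) (R : R2 → R2 → ℂ) : Prop :=
  ∀ y : R2,
    MemLp (fun x => R x y) 2 (volume.restrict Ω) ∧
    ∀ x : R2, x ≠ y →
      R x y = -Gplus κ (x - y) + ∫ z in Ω, Gplus κ (x - z) * v z * R z y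

/-- The unique-solvability condition at energy `κ`: for each `y` there is at most one
`w ∈ L²(Ω)` satisfying the integral equation
`w(x) = −G⁺(x−y,κ) + ∫_Ω G⁺(x−z,κ) v(z) w(z) dz` a.e. on `Ω`. -/
def UniqueSolvability (κ : ℝ) (Ω : Set R2) (v : R2 → ℂ) : Prop :=
  ∀ y : R2, ∀ w₁ w₂ : R2 → ℂ,
    MemLp w₁ 2 (volume.restrict Ω) → MemLp w₂ 2 (volume.restrict Ω) →
    (∀ᵐ x ∂volume.restrict Ω,
      w₁ x = -Gplus κ (x - y) + ∫ z in Ω, Gplus κ (x - z) * v z * w₁ z) →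
    (∀ᵐ x ∂volume.restrict Ω,
      w₂ x = -Gplus κ (x - y) + ∫ z in Ω, Gplus κ (x - z) * v z * w₂ z) →
    w₁ =ᵐ[volume.restrict Ω] w₂

/-- The Laplacian of a complex-valued function on `ℝ²`, as the sum of the second
derivatives along the standard coordinate directions. -/
def laplacian2 (f : R2 → ℂ) (x : R2) : ℂ :=
  ∑ i : Fin 2,
    fderiv ℝ (fun y => fderiv ℝ f y (EuclideanSpace.single i 1)) x (EuclideanSpace.single i 1)

/-- `Γ` is a real-analytic closed curve in `ℝ²`: the image of a real-analytic
`2π`-periodic map `γ : ℝ → ℝ²` with non-vanishing derivative, injective on `[0, 2π)`. -/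
def IsRealAnalyticClosedCurve (Γ : Set R2) : Prop :=
  ∃ γ : ℝ → R2, (∀ t : ℝ, AnalyticAt ℝ γ t) ∧ Function.Periodic γ (2 * π) ∧
    (∀ t : ℝ, deriv γ t ≠ 0) ∧ Set.InjOn γ (Set.Ico 0 (2 * π)) ∧ Γ = Set.range γ

/-- `κ` is not a Dirichlet eigenvalue for the bounded open set `D`: every function
continuous on `closure D`, `C²` on `D`, satisfying `Δu + κ²u = 0` on `D` and
vanishing on `∂D`, vanishes identically on `D`. -/
def NotDirichletEigenvalue (κ : ℝ) (D : Set R2) : Prop :=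
  ∀ u : R2 → ℂ, ContinuousOn u (closure D) → ContDiffOn ℝ 2 u D →
    (∀ x ∈ D, laplacian2 u x + (κ : ℂ) ^ 2 * u x = 0) →
    (∀ x ∈ frontier D, u x = 0) → ∀ x ∈ D, u x = 0

section

open Real MeasureTheory Set

namespace GKL

/-- Coefficients of an everywhere convergent power series. -/
def EntireCoeff (c : ℕ → ℂ) : Prop := ∀ R : ℝ, 0 ≤ R → Summable fun n => ‖c n‖ * R ^ n

/-- The sum of a power series. -/
def psum (c : ℕ → ℂ) (t : ℂ) : ℂ := ∑' n, c n * t ^ n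

/-- Coefficients of the derivative of a power series. -/
def dcoeff (c : ℕ → ℂ) (n : ℕ) : ℂ := (n + 1) * c (n + 1)

lemma EntireCoeff.summable {c : ℕ → ℂ} (hc : EntireCoeff c) (t : ℂ) :
    Summable fun n => c n * t ^ n := by
  refine Summable.of_norm ?_
  simpa using hc ‖t‖ (norm_nonneg _)

lemma EntireCoeff.dcoeff {c : ℕ → ℂ} (hc : EntireCoeff c) : EntireCoeff (dcoeff c) := by
  intro R hR
  have h := (summable_nat_add_iff 1).2 (hc (2 * (R + 1)) (by positivity))
  refine Summable.of_nonneg_of_le (fun n => by positivity) (fun n => ?_) h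
  have h1 : ((n : ℝ) + 1) ≤ 2 ^ (n + 1) := by
    exact_mod_cast (Nat.lt_two_pow_self (n := n + 1)).le
  have h2 : R ^ n ≤ (R + 1) ^ (n + 1) := by
    calc R ^ n ≤ (R + 1) ^ n := by gcongr; linarith
      _ ≤ (R + 1) ^ (n + 1) := pow_le_pow_right₀ (by linarith) (by omega)
  have h3 : ‖((n : ℂ) + 1)‖ = (n : ℝ) + 1 := by
    have := Complex.norm_natCast (n + 1)
    push_cast at this; exact this
  simp only [GKL.dcoeff, norm_mul, h3]
  calc ((n : ℝ) + 1) * ‖c (n + 1)‖ * R ^ n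
      ≤ 2 ^ (n + 1) * ‖c (n + 1)‖ * (R + 1) ^ (n + 1) := by gcongr
    _ = ‖c (n + 1)‖ * (2 * (R + 1)) ^ (n + 1) := by rw [mul_pow]; ring

lemma EntireCoeff.hasDerivAt {c : ℕ → ℂ} (hc : EntireCoeff c) (t : ℂ) :
    HasDerivAt (psum c) (psum (GKL.dcoeff c) t) t := by
  set R := ‖t‖ + 1
  have hR : 0 < R := by positivity
  have key := hasDerivAt_tsum_of_isPreconnected (𝕜 := ℂ)
    (u := fun n : ℕ => ‖(n : ℂ) * c n‖ * R ^ (n - 1)) (g := fun (n : ℕ) z => c n * z ^ n)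
    (g' := fun (n : ℕ) z => c n * ((n : ℂ) * z ^ (n - 1))) (t := Metric.ball 0 R) (y₀ := t) (y := t)
    ?_ Metric.isOpen_ball (convex_ball _ _).isPreconnected
    (fun n y _ => by simpa using (hasDerivAt_pow n y).const_mul (c n)) ?_
    (by simp [R]) (hc.summable t) (by simp [R])
  · have hs : Summable fun n => c n * ((n : ℂ) * t ^ (n - 1)) := by
      refine (summable_nat_add_iff 1).1 ?_
      refine (hc.dcoeff.summable t).congr fun n => ?_
      simp [GKL.dcoeff]; ring
    have e : psum (GKL.dcoeff c) t = ∑' n, c n * ((n : ℂ) * t ^ (n - 1)) := by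
      rw [hs.tsum_eq_zero_add]
      simp only [psum, GKL.dcoeff]
      simp
      exact tsum_congr fun n => by ring
    rw [e]
    exact key
  · refine (summable_nat_add_iff 1).1 ?_
    refine (hc.dcoeff R hR.le).congr fun n => ?_
    simp [GKL.dcoeff]
  · intro n y hy
    have hy' : ‖y‖ ≤ R := by simpa using (Metric.mem_ball.1 hy).le
    rw [norm_mul, norm_mul, norm_pow, norm_mul]
    calc ‖c n‖ * (‖(n : ℂ)‖ * ‖y‖ ^ (n - 1)) ≤ ‖c n‖ * (‖(n : ℂ)‖ * R ^ (n - 1)) := by gcongr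
      _ = _ := by ring

lemma EntireCoeff.deriv_eq {c : ℕ → ℂ} (hc : EntireCoeff c) :
    deriv (psum c) = psum (GKL.dcoeff c) := funext fun t => (hc.hasDerivAt t).deriv

lemma EntireCoeff.differentiable {c : ℕ → ℂ} (hc : EntireCoeff c) :
    Differentiable ℂ (psum c) := fun t => (hc.hasDerivAt t).differentiableAt

/-- The Bessel operator `t u'' + u' + q u` on power series. -/
lemma EntireCoeff.bessel {c : ℕ → ℂ} (hc : EntireCoeff c) (q t : ℂ) :
    t * deriv (deriv (psum c)) t + deriv (psum c) t + q * psum c t =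
      psum (fun n => ((n : ℂ) + 1) ^ 2 * c (n + 1) + q * c n) t := by
  rw [hc.deriv_eq, hc.dcoeff.deriv_eq]
  have h1 := (hc.dcoeff.dcoeff.summable t).mul_left t
  have h2 := hc.dcoeff.summable t
  have h3 := (hc.summable t).mul_left q
  have h1' : t * psum (GKL.dcoeff (GKL.dcoeff c)) t =
      ∑' n : ℕ, (n : ℂ) * GKL.dcoeff c n * t ^ n := by
    have hs : Summable fun n : ℕ => (n : ℂ) * GKL.dcoeff c n * t ^ n := by
      refine (summable_nat_add_iff 1).1 (h1.congr fun n => ?_)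
      simp only [GKL.dcoeff]; push_cast; ring
    rw [hs.tsum_eq_zero_add, psum, ← tsum_mul_left]
    simp only [GKL.dcoeff]
    simp
    exact tsum_congr fun n => by ring
  have hs1 : Summable fun n : ℕ => (n : ℂ) * GKL.dcoeff c n * t ^ n := by
    refine (summable_nat_add_iff 1).1 (h1.congr fun n => ?_)
    simp only [GKL.dcoeff]; push_cast; ring
  rw [h1', psum, psum, psum, ← tsum_mul_left, ← hs1.tsum_add h2, ← (hs1.add h2).tsum_add h3]
  exact tsum_congr fun n => by simp only [GKL.dcoeff]; ring

/-- Coefficients of `J₀(κ √t)`. -/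
def besselA (κ : ℝ) (n : ℕ) : ℝ := (-(κ ^ 2 / 4)) ^ n / (n.factorial : ℝ) ^ 2

def harm (n : ℕ) : ℝ := ∑ k ∈ Finset.range n, (1 : ℝ) / (k + 1)

lemma harm_nonneg (n : ℕ) : 0 ≤ harm n := Finset.sum_nonneg fun k _ => by positivity

lemma harm_le (n : ℕ) : harm n ≤ n := by
  calc harm n ≤ ∑ k ∈ Finset.range n, (1 : ℝ) := by
        refine Finset.sum_le_sum fun k _ => ?_
        rw [div_le_one (by positivity)]; linarith [(Nat.cast_nonneg k : (0:ℝ) ≤ k)]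
    _ = n := by simp

lemma abs_besselA_le (κ : ℝ) (n : ℕ) : |besselA κ n| ≤ (κ ^ 2 / 4) ^ n / (n.factorial : ℝ) := by
  rw [besselA, abs_div, abs_pow, abs_neg, abs_of_nonneg (by positivity : (0:ℝ) ≤ κ ^ 2 / 4),
    abs_of_nonneg (by positivity : (0:ℝ) ≤ (n.factorial : ℝ) ^ 2)]
  have h1 : (1:ℝ) ≤ n.factorial := by exact_mod_cast Nat.succ_le_of_lt n.factorial_pos
  gcongr
  nlinarith

lemma entireCoeff_of_le {c : ℕ → ℂ} {M a : ℝ} (ha : 0 ≤ a)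
    (h : ∀ n : ℕ, ‖c n‖ ≤ M * (n + 1) * (a ^ n / (n.factorial : ℝ))) : EntireCoeff c := by
  intro R hR
  have hs := (Real.summable_pow_div_factorial (2 * (a * R))).mul_left M
  refine Summable.of_nonneg_of_le (fun n => by positivity) (fun n => ?_) hs
  have h1 : ((n : ℝ) + 1) ≤ 2 ^ n := by exact_mod_cast (Nat.lt_two_pow_self (n := n))
  have hM : 0 ≤ M := by simpa using (norm_nonneg _).trans (h 0)
  calc ‖c n‖ * R ^ n ≤ (M * (n + 1) * (a ^ n / (n.factorial : ℝ))) * R ^ n := by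
        gcongr; exact h n
    _ ≤ (M * 2 ^ n * (a ^ n / (n.factorial : ℝ))) * R ^ n := by gcongr
    _ = _ := by rw [mul_pow, mul_pow]; ring

lemma besselA_succ (κ : ℝ) (n : ℕ) :
    ((n : ℝ) + 1) ^ 2 * besselA κ (n + 1) = -(κ ^ 2 / 4) * besselA κ n := by
  have : (n.factorial : ℝ) ≠ 0 := by positivity
  have h2 : ((n : ℝ) + 1) ≠ 0 := by positivity
  simp only [besselA, Nat.factorial_succ, pow_succ]
  push_cast
  field_simp

/-- Coefficients of `A`, the logarithmic part of the Green function. -/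
def coeffA (κ : ℝ) (n : ℕ) : ℂ := ((-(1 / (4 * π)) * besselA κ n : ℝ) : ℂ)

/-- Coefficients of `E`, the regular part of the Green function. -/
def coeffE (κ : ℝ) (n : ℕ) : ℂ :=
  (Complex.I / 4 - (((1 / (2 * π)) * (Real.log (κ / 2) + Real.eulerMascheroniConstant) : ℝ) : ℂ)) *
    (besselA κ n : ℂ) + (((1 / (2 * π)) * harm n * besselA κ n : ℝ) : ℂ)

lemma entire_coeffA (κ : ℝ) : EntireCoeff (coeffA κ) := by
  refine entireCoeff_of_le (M := 1) (a := κ ^ 2 / 4) (by positivity) fun n => ?_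
  rw [coeffA, Complex.norm_real, norm_mul, Real.norm_eq_abs, Real.norm_eq_abs]
  have h1 : |(-(1 / (4 * π)))| ≤ 1 := by
    rw [abs_neg, abs_of_nonneg (by positivity), div_le_one (by positivity)]
    linarith [Real.pi_gt_three]
  have h2 := abs_besselA_le κ n
  have h3 : (1 : ℝ) ≤ 1 * (n + 1) := by linarith [(Nat.cast_nonneg n : (0:ℝ) ≤ n)]
  exact mul_le_mul (h1.trans h3) h2 (abs_nonneg _) (by positivity)

lemma entire_coeffE (κ : ℝ) : EntireCoeff (coeffE κ) := by
  set z := Complex.I / 4 -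
    (((1 / (2 * π)) * (Real.log (κ / 2) + Real.eulerMascheroniConstant) : ℝ) : ℂ) with hz
  refine entireCoeff_of_le (M := ‖z‖ + 1) (a := κ ^ 2 / 4) (by positivity) fun n => ?_
  have h2 := abs_besselA_le κ n
  have h1 : |(1 / (2 * π))| ≤ 1 := by
    rw [abs_of_nonneg (by positivity), div_le_one (by positivity)]
    linarith [Real.pi_gt_three]
  have h0 : (0:ℝ) ≤ n := Nat.cast_nonneg n
  have h3 : |harm n| ≤ n := by rw [abs_of_nonneg (harm_nonneg n)]; exact harm_le n
  rw [coeffE, ← hz]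
  refine (norm_add_le _ _).trans ?_
  rw [norm_mul, Complex.norm_real, Complex.norm_real, norm_mul, norm_mul, Real.norm_eq_abs,
    Real.norm_eq_abs, Real.norm_eq_abs]
  calc ‖z‖ * |besselA κ n| + |(1 / (2 * π))| * |harm n| * |besselA κ n|
      ≤ ‖z‖ * |besselA κ n| + 1 * n * |besselA κ n| := by gcongr
    _ = (‖z‖ + n) * |besselA κ n| := by ring
    _ ≤ ((‖z‖ + 1) * (n + 1)) * |besselA κ n| := by
        gcongr
        nlinarith [norm_nonneg z]
    _ ≤ _ := by gcongr

/-- The logarithmic part `A` of the Green function: `G(x) = A(|x|²) log |x|² + E(|x|²)`. -/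
def gA (κ : ℝ) : ℂ → ℂ := psum (coeffA κ)
/-- The regular part `E` of the Green function. -/
def gE (κ : ℝ) : ℂ → ℂ := psum (coeffE κ)

lemma gA_diff (κ : ℝ) : Differentiable ℂ (gA κ) := (entire_coeffA κ).differentiable
lemma gE_diff (κ : ℝ) : Differentiable ℂ (gE κ) := (entire_coeffE κ).differentiable
lemma gA'_diff (κ : ℝ) : Differentiable ℂ (deriv (gA κ)) := by
  rw [gA, (entire_coeffA κ).deriv_eq]; exact (entire_coeffA κ).dcoeff.differentiable
lemma gE'_diff (κ : ℝ) : Differentiable ℂ (deriv (gE κ)) := by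
  rw [gE, (entire_coeffE κ).deriv_eq]; exact (entire_coeffE κ).dcoeff.differentiable

lemma gA_ode (κ : ℝ) (t : ℂ) :
    t * deriv (deriv (gA κ)) t + deriv (gA κ) t + (κ ^ 2 / 4 : ℂ) * gA κ t = 0 := by
  rw [gA, (entire_coeffA κ).bessel]
  have : (fun n : ℕ => ((n : ℂ) + 1) ^ 2 * coeffA κ (n + 1) + (κ ^ 2 / 4 : ℂ) * coeffA κ n) =
      fun _ => 0 := by
    funext n
    have := congrArg (fun r : ℝ => (r : ℂ)) (besselA_succ κ n)
    push_cast at this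
    simp only [coeffA]
    push_cast
    linear_combination (-(1 / (4 * π)) : ℂ) * this
  rw [this]; simp [psum]

lemma gE_ode (κ : ℝ) (t : ℂ) :
    t * deriv (deriv (gE κ)) t + deriv (gE κ) t + (κ ^ 2 / 4 : ℂ) * gE κ t =
      -2 * deriv (gA κ) t := by
  rw [gE, (entire_coeffE κ).bessel, gA, (entire_coeffA κ).deriv_eq, psum, psum, ← tsum_mul_left]
  refine tsum_congr fun n => ?_
  have := congrArg (fun r : ℝ => (r : ℂ)) (besselA_succ κ n)
  push_cast at this
  have hn : ((n : ℂ) + 1) ≠ 0 := by exact_mod_cast Nat.succ_ne_zero n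
  have hp : (π : ℂ) ≠ 0 := by exact_mod_cast Real.pi_ne_zero
  have hh : (harm (n + 1) : ℂ) = harm n + 1 / ((n : ℂ) + 1) := by
    rw [harm, Finset.sum_range_succ, ← harm]; push_cast; rfl
  simp only [coeffE, coeffA, dcoeff]
  push_cast
  rw [hh]
  have e1 : (1 / ((n : ℂ) + 1)) * ((n : ℂ) + 1) = 1 := by field_simp
  generalize (1 / ((n : ℂ) + 1)) = w at *
  linear_combination ((Complex.I / 4 - 1 / (2 * π) * (Real.log (κ / 2) +
    Real.eulerMascheroniConstant)) + 1 / (2 * π) * harm n : ℂ) * t ^ n * this +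
    1 / (2 * π) * ((n : ℂ) + 1) * besselA κ (n + 1) * t ^ n * e1

lemma psum_zero (c : ℕ → ℂ) : psum c 0 = c 0 := by
  rw [psum, tsum_eq_single 0 (fun n hn => by simp [hn])]; simp

lemma gA_zero (κ : ℝ) : gA κ 0 = -(1 / (4 * π)) := by
  rw [gA, psum_zero]; simp [coeffA, besselA]

/-- Real version of `A`. -/
def gAr (κ : ℝ) (t : ℝ) : ℝ := -(1 / (4 * π)) * ∑' n, besselA κ n * t ^ n

lemma gA_ofReal (κ : ℝ) (t : ℝ) : gA κ t = (gAr κ t : ℂ) := by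
  rw [gA, psum, gAr, ← tsum_mul_left, Complex.ofReal_tsum]
  refine tsum_congr fun n => ?_
  simp [coeffA]; ring

lemma gE_ofReal_im (κ : ℝ) (t : ℝ) : (gE κ t).im = -π * gAr κ t := by
  have hs := (entire_coeffE κ).summable t
  rw [gE, psum, Complex.im_tsum hs, gAr, ← mul_assoc, ← tsum_mul_left]
  refine tsum_congr fun n => ?_
  rw [← Complex.ofReal_pow, Complex.im_mul_ofReal]
  have : (coeffE κ n).im = 1 / 4 * besselA κ n := by
    rw [coeffE, Complex.add_im, Complex.im_mul_ofReal, Complex.ofReal_im, Complex.sub_im,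
      Complex.ofReal_im]
    simp
  rw [this]
  have := Real.pi_ne_zero
  field_simp

lemma bessel_term (κ r : ℝ) (n : ℕ) :
    (-1 : ℝ) ^ n * (κ * r / 2) ^ (2 * n) / (n.factorial : ℝ) ^ 2 =
      besselA κ n * (r ^ 2) ^ n := by
  have : (-(κ ^ 2 / 4)) ^ n * (r ^ 2) ^ n = (-1 : ℝ) ^ n * (κ * r / 2) ^ (2 * n) := by
    rw [pow_mul, ← mul_pow, ← mul_pow]; congr 1; ring
  rw [← this, besselA]; ring

lemma J0_eq (κ r : ℝ) : J0 (κ * r) = ∑' n, besselA κ n * (r ^ 2) ^ n :=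
  tsum_congr fun n => bessel_term κ r n

/-- The radial profile of the Green function. -/
def gF (κ : ℝ) (t : ℂ) : ℂ := gA κ t * Complex.log t + gE κ t

lemma entire_besselA (κ : ℝ) : EntireCoeff (fun n => (besselA κ n : ℂ)) := by
  intro R hR
  refine ((entire_coeffA κ R hR).mul_left (4 * π)).congr fun n => ?_
  rw [coeffA, Complex.norm_real, Complex.norm_real, norm_mul, norm_neg,
    Real.norm_of_nonneg (by positivity : (0:ℝ) ≤ 1 / (4 * π))]
  have := Real.pi_ne_zero
  field_simp

lemma entire_harm (κ : ℝ) : EntireCoeff (fun n => ((harm n * besselA κ n : ℝ) : ℂ)) := by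
  refine entireCoeff_of_le (M := 1) (a := κ ^ 2 / 4) (by positivity) fun n => ?_
  rw [Complex.norm_real, norm_mul, Real.norm_eq_abs, Real.norm_eq_abs,
    abs_of_nonneg (harm_nonneg n)]
  exact mul_le_mul (by linarith [harm_le n]) (abs_besselA_le κ n) (abs_nonneg _) (by positivity)

lemma Gplus_eq (κ : ℝ) (hκ : 0 < κ) (x : R2) (hx : x ≠ 0) :
    Gplus κ x = gF κ ((‖x‖ ^ 2 : ℝ) : ℂ) := by
  have hx' : 0 < ‖x‖ := norm_pos_iff.2 hx
  have hπ : (π : ℂ) ≠ 0 := by exact_mod_cast Real.pi_ne_zero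
  rw [Gplus, H0, Y0, gF, gA_ofReal, gAr, ← J0_eq]
  set r := ‖x‖
  have hlog : Real.log (κ * r / 2) = Real.log (κ / 2) + Real.log r := by
    rw [← Real.log_mul (by positivity) (by positivity)]; congr 1; ring
  have hlog2 : Complex.log ((r ^ 2 : ℝ) : ℂ) = 2 * (Real.log r : ℂ) := by
    rw [← Complex.ofReal_log (by positivity), Real.log_pow]; push_cast; ring
  have hsum : ∑' m : ℕ, (-1 : ℝ) ^ (m + 1) * (∑ k ∈ Finset.range m, (1 : ℝ) / (k + 1)) *
      (κ * r / 2) ^ (2 * m) / (Nat.factorial m : ℝ) ^ 2 =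
      - ∑' m, harm m * besselA κ m * (r ^ 2) ^ m := by
    rw [← tsum_neg]
    refine tsum_congr fun m => ?_
    rw [mul_assoc (harm m), ← bessel_term, harm]; ring
  have hE : gE κ ((r ^ 2 : ℝ) : ℂ) = (Complex.I / 4 - (((1 / (2 * π)) * (Real.log (κ / 2) +
      Real.eulerMascheroniConstant) : ℝ) : ℂ)) * (J0 (κ * r) : ℂ) +
      ((1 / (2 * π) : ℝ) : ℂ) * ((∑' m, harm m * besselA κ m * (r ^ 2) ^ m : ℝ) : ℂ) := by
    rw [J0_eq, Complex.ofReal_tsum, Complex.ofReal_tsum, ← tsum_mul_left, ← tsum_mul_left,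
      ← Summable.tsum_add, gE, psum]
    · refine tsum_congr fun n => ?_
      rw [coeffE]; push_cast; ring
    · refine Summable.mul_left _ ?_
      refine ((entire_besselA κ).summable ((r ^ 2 : ℝ) : ℂ)).congr fun n => ?_
      push_cast; ring
    · refine Summable.mul_left _ ?_
      refine ((entire_harm κ).summable ((r ^ 2 : ℝ) : ℂ)).congr fun n => ?_
      push_cast; ring
  rw [hE, hlog, hlog2, hsum]
  generalize (∑' m, harm m * besselA κ m * (r ^ 2) ^ m) = S
  push_cast
  field_simp
  ring_nf
  simp only [Complex.I_sq]
  ring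

lemma gF_im (κ t : ℝ) (ht : 0 < t) : (gF κ t).im = -π * gAr κ t := by
  rw [gF, gA_ofReal, ← Complex.ofReal_log ht.le, ← Complex.ofReal_mul, Complex.add_im,
    Complex.ofReal_im, gE_ofReal_im, zero_add]

end GKL

end

section

open Real MeasureTheory Set
open scoped ENNReal

namespace GKL

/-! ### Integral operators -/

lemma lintegral_mul_sq_le {α : Type*} [MeasurableSpace α] (μ : Measure α) {a b : α → ℝ≥0∞}
    (ha : AEMeasurable a μ) (hb : AEMeasurable b μ) :
    (∫⁻ x, a x * b x ∂μ) ^ 2 ≤ (∫⁻ x, a x ^ 2 ∂μ) * ∫⁻ x, b x ^ 2 ∂μ := by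
  have h := ENNReal.lintegral_mul_le_Lp_mul_Lq μ Real.HolderConjugate.two_two ha hb
  simp only [Pi.mul_apply] at h
  have h2 := pow_le_pow_left' h 2
  refine h2.trans (le_of_eq ?_)
  rw [mul_pow]
  have e : ∀ X : ℝ≥0∞, (X ^ (1 / 2 : ℝ)) ^ 2 = X := fun X => by
    rw [← ENNReal.rpow_natCast, ← ENNReal.rpow_mul]; norm_num
  rw [e, e]
  simp only [ENNReal.rpow_two]

lemma lintegral_weighted_sq_le {α : Type*} [MeasurableSpace α] (μ : Measure α) {a b : α → ℝ≥0∞}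
    (ha : AEMeasurable a μ) (hb : AEMeasurable b μ) :
    (∫⁻ x, a x * b x ∂μ) ^ 2 ≤ (∫⁻ x, a x ∂μ) * ∫⁻ x, a x * b x ^ 2 ∂μ := by
  have e : ∀ X : ℝ≥0∞, (X ^ (1 / 2 : ℝ)) ^ 2 = X := fun X => by
    rw [← ENNReal.rpow_natCast, ← ENNReal.rpow_mul]; norm_num
  have h := lintegral_mul_sq_le μ (a := fun x => a x ^ (1 / 2 : ℝ))
    (b := fun x => a x ^ (1 / 2 : ℝ) * b x) (ha.pow_const _) ((ha.pow_const _).mul hb)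
  simp only [mul_pow, e, ← mul_assoc] at h
  refine le_trans (le_of_eq ?_) h
  congr 1
  refine lintegral_congr fun x => ?_
  rw [← sq, e]

lemma schur_test {α : Type*} [MeasurableSpace α] (μ : Measure α) [SFinite μ]
    {K : α → α → ℝ≥0∞} (hK : Measurable (Function.uncurry K)) {f : α → ℝ≥0∞}
    (hf : AEMeasurable f μ) {C₁ C₂ : ℝ≥0∞} (h1 : ∀ x, ∫⁻ z, K x z ∂μ ≤ C₁)
    (h2 : ∀ z, ∫⁻ x, K x z ∂μ ≤ C₂) :
    ∫⁻ x, (∫⁻ z, K x z * f z ∂μ) ^ 2 ∂μ ≤ C₁ * C₂ * ∫⁻ z, f z ^ 2 ∂μ := by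
  have hKx : ∀ x, Measurable (K x) := fun x => hK.comp measurable_prodMk_left
  have hKz : ∀ z, Measurable fun x => K x z := fun z => hK.comp measurable_prodMk_right
  have hm : AEMeasurable (Function.uncurry fun x z => K x z * f z ^ 2) (μ.prod μ) :=
    hK.aemeasurable.mul ((hf.pow_const 2).comp_snd)
  calc ∫⁻ x, (∫⁻ z, K x z * f z ∂μ) ^ 2 ∂μ
      ≤ ∫⁻ x, C₁ * ∫⁻ z, K x z * f z ^ 2 ∂μ ∂μ := by
        refine lintegral_mono fun x => ?_
        refine (lintegral_weighted_sq_le μ (hKx x).aemeasurable hf).trans ?_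
        gcongr
        exact h1 x
    _ = C₁ * ∫⁻ x, ∫⁻ z, K x z * f z ^ 2 ∂μ ∂μ := by
        refine lintegral_const_mul'' _ ?_
        exact hm.lintegral_prod_right'
    _ = C₁ * ∫⁻ z, ∫⁻ x, K x z * f z ^ 2 ∂μ ∂μ := by rw [lintegral_lintegral_swap hm]
    _ ≤ C₁ * ∫⁻ z, C₂ * f z ^ 2 ∂μ := by
        gcongr with z
        rw [lintegral_mul_const _ (hKz z)]
        gcongr
        exact h2 z
    _ = C₁ * C₂ * ∫⁻ z, f z ^ 2 ∂μ := by
        rw [lintegral_const_mul'' _ (hf.pow_const 2), mul_assoc]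

lemma eLpNorm_two_sq {α E : Type*} [MeasurableSpace α] [NormedAddCommGroup E] (μ : Measure α)
    (f : α → E) : eLpNorm f 2 μ ^ 2 = ∫⁻ x, ‖f x‖ₑ ^ 2 ∂μ := by
  have := eLpNorm_nnreal_pow_eq_lintegral (μ := μ) (f := f) (p := 2) (by norm_num)
  simpa using this

lemma memLp_two_iff {α E : Type*} [MeasurableSpace α] [NormedAddCommGroup E] {μ : Measure α}
    {f : α → E} : MemLp f 2 μ ↔ AEStronglyMeasurable f μ ∧ ∫⁻ x, ‖f x‖ₑ ^ 2 ∂μ < ∞ := by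
  rw [MemLp, ← eLpNorm_two_sq]
  simp

/-- Convolution with the kernel `k`. -/
def cv (k f : ℂ → ℂ) (x : ℂ) : ℂ := ∫ z, k (x - z) * f z

/-- Square integrable functions supported in the closed ball of radius `R`. -/
structure L2B (R : ℝ) (f : ℂ → ℂ) : Prop where
  memLp : MemLp f 2 volume
  supp : ∀ z, R < ‖z‖ → f z = 0

lemma L2B.lint {R : ℝ} {f : ℂ → ℂ} (hf : L2B R f) : ∫⁻ x, ‖f x‖ₑ ^ 2 < ∞ :=
  (memLp_two_iff.1 hf.memLp).2

lemma L2B.norm_sq {R : ℝ} {f : ℂ → ℂ} (hf : L2B R f) : Integrable fun z => ‖f z‖ ^ 2 :=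
  hf.memLp.integrable_norm_pow (by norm_num)

lemma L2B.integrable {R : ℝ} {f : ℂ → ℂ} (hf : L2B R f) : Integrable f := by
  have h : MemLp f 1 (volume.restrict (Metric.closedBall 0 R)) := by
    have : IsFiniteMeasure (volume.restrict (Metric.closedBall (0:ℂ) R)) :=
      ⟨by simpa using (isCompact_closedBall (0:ℂ) R).measure_lt_top (μ := volume)⟩
    exact (hf.memLp.mono_measure Measure.restrict_le_self).mono_exponent (by norm_num)
  have h2 := memLp_one_iff_integrable.1 h
  refine (integrableOn_iff_integrable_of_support_subset (s := Metric.closedBall 0 R) ?_).1 h2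
  intro z hz
  by_contra hc
  exact hz (hf.supp z (by simpa using hc))

lemma L2B.mono {R R' : ℝ} (h : R ≤ R') {f : ℂ → ℂ} (hf : L2B R f) : L2B R' f :=
  ⟨hf.memLp, fun z hz => hf.supp z (h.trans_lt hz)⟩

lemma L2B.add {R : ℝ} {f g : ℂ → ℂ} (hf : L2B R f) (hg : L2B R g) :
    L2B R (fun z => f z + g z) :=
  ⟨hf.memLp.add hg.memLp, fun z hz => by simp [hf.supp z hz, hg.supp z hz]⟩

lemma L2B.sub {R : ℝ} {f g : ℂ → ℂ} (hf : L2B R f) (hg : L2B R g) :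
    L2B R (fun z => f z - g z) :=
  ⟨hf.memLp.sub hg.memLp, fun z hz => by simp [hf.supp z hz, hg.supp z hz]⟩

/-- Multiplication by an (essentially) bounded function. -/
lemma L2B.bdd_mul {R : ℝ} {f v : ℂ → ℂ} (hf : L2B R f) (hv : MemLp v ⊤ volume) :
    L2B R (fun z => v z * f z) :=
  ⟨hf.memLp.mul hv, fun z hz => by simp [hf.supp z hz]⟩

lemma L2B.of_bounded {R C : ℝ} {f : ℂ → ℂ} (hm : AEStronglyMeasurable f volume)
    (hb : ∀ z, ‖f z‖ ≤ C) (hs : ∀ z, R < ‖z‖ → f z = 0) : L2B R f := by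
  refine ⟨?_, hs⟩
  have hC : 0 ≤ C := (norm_nonneg _).trans (hb 0)
  have hi : MemLp ((Metric.closedBall (0:ℂ) R).indicator fun _ => (C : ℂ)) 2 volume :=
    memLp_indicator_const 2 Metric.isClosed_closedBall.measurableSet _
      (Or.inr (isCompact_closedBall (0:ℂ) R).measure_lt_top.ne)
  refine hi.mono hm (Filter.Eventually.of_forall fun z => ?_)
  by_cases h : z ∈ Metric.closedBall (0:ℂ) R
  · rw [indicator_of_mem h]; simpa [abs_of_nonneg hC] using hb z
  · rw [hs z (by simpa using h)]; simp

/-- Restriction to a closed ball. -/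
def cut (R : ℝ) (f : ℂ → ℂ) : ℂ → ℂ := (Metric.closedBall (0:ℂ) R).indicator f

lemma cut_of_le {R : ℝ} {f : ℂ → ℂ} {z : ℂ} (h : ‖z‖ ≤ R) : cut R f z = f z :=
  indicator_of_mem (by simpa using h) _

lemma cut_of_lt {R : ℝ} {f : ℂ → ℂ} {z : ℂ} (h : R < ‖z‖) : cut R f z = 0 :=
  indicator_of_notMem (by simpa using h) _

lemma norm_cut_le {R : ℝ} {f : ℂ → ℂ} {z : ℂ} : ‖cut R f z‖ ≤ ‖f z‖ := norm_indicator_le_norm_self _ _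

lemma L2B.cut_eq {R : ℝ} {f : ℂ → ℂ} (hf : L2B R f) : cut R f = f := by
  funext z
  rcases le_or_gt ‖z‖ R with h | h
  · exact cut_of_le h
  · rw [cut_of_lt h, hf.supp z h]

lemma cut_integrable {k : ℂ → ℂ} (hk : LocallyIntegrable k) (R : ℝ) : Integrable (cut R k) :=
  (integrable_indicator_iff Metric.isClosed_closedBall.measurableSet).2
    (hk.integrableOn_isCompact (isCompact_closedBall _ _))

lemma aesm_kernel {k : ℂ → ℂ} (hk : AEStronglyMeasurable k volume) :
    AEStronglyMeasurable (fun p : ℂ × ℂ => k (p.1 - p.2)) (volume.prod volume) :=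
  hk.comp_quasiMeasurePreserving (quasiMeasurePreserving_sub_of_right_invariant volume volume)

lemma integrable_kernel {k : ℂ → ℂ} (hk : LocallyIntegrable k) {R : ℝ} {f g : ℂ → ℂ}
    (hf : L2B R f) (hg : L2B R g) :
    Integrable (fun p : ℂ × ℂ => k (p.1 - p.2) * f p.2 * g p.1) (volume.prod volume) := by
  have hkm : AEStronglyMeasurable k volume := hk.aestronglyMeasurable
  have hc := (cut_integrable hk (R + R)).norm
  have h1 := Integrable.convolution_integrand (ContinuousLinearMap.mul ℝ ℝ) hf.norm_sq hc
    (μ := volume) (ν := volume)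
  have h2 := (Integrable.convolution_integrand (ContinuousLinearMap.mul ℝ ℝ) hg.norm_sq
    hc.comp_neg (μ := volume) (ν := volume)).swap
  refine (h1.add h2).mono' (((aesm_kernel hkm).mul hf.memLp.1.comp_snd).mul hg.memLp.1.comp_fst)
    (Filter.Eventually.of_forall fun p => ?_)
  simp only [Pi.add_apply, Function.comp_apply, Prod.fst_swap, Prod.snd_swap,
    ContinuousLinearMap.mul_apply', neg_sub, norm_mul]
  rcases le_or_gt ‖p.1‖ R with h | h
  · rcases le_or_gt ‖p.2‖ R with h' | h'
    · rw [cut_of_le ((norm_sub_le _ _).trans (add_le_add h h'))]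
      nlinarith [norm_nonneg (k (p.1 - p.2)), sq_nonneg (‖f p.2‖ - ‖g p.1‖),
        mul_nonneg (norm_nonneg (k (p.1 - p.2))) (sq_nonneg (‖f p.2‖ - ‖g p.1‖)),
        mul_nonneg (norm_nonneg (k (p.1 - p.2))) (add_nonneg (sq_nonneg ‖f p.2‖) (sq_nonneg ‖g p.1‖))]
    · rw [hf.supp _ h']; simp; positivity
  · rw [hg.supp _ h]; simp; positivity

/-- Convolution against a kernel is adjoint to convolution against the reflected kernel. -/
lemma integral_cv_mul {k : ℂ → ℂ} (hk : LocallyIntegrable k) {R : ℝ} {f g : ℂ → ℂ}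
    (hf : L2B R f) (hg : L2B R g) :
    ∫ x, cv k f x * g x = ∫ z, f z * cv (fun w => k (-w)) g z := by
  have h := integral_integral_swap (f := fun x z => k (x - z) * f z * g x)
    (integrable_kernel hk hf hg)
  simp only [cv, ← integral_mul_const, ← integral_const_mul]
  rw [h]
  refine integral_congr_ae (Filter.Eventually.of_forall fun z => ?_)
  refine integral_congr_ae (Filter.Eventually.of_forall fun x => ?_)
  simp only [neg_sub]; ring

lemma cv_mul_integrable {k : ℂ → ℂ} (hk : LocallyIntegrable k) {R : ℝ} {f g : ℂ → ℂ}
    (hf : L2B R f) (hg : L2B R g) : Integrable fun x => cv k f x * g x := by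
  have h := (integrable_kernel hk hf hg).integral_prod_left
  simpa only [cv, ← integral_mul_const] using h

lemma cv_aesm {k : ℂ → ℂ} (hk : LocallyIntegrable k) {f : ℂ → ℂ}
    (hf : AEStronglyMeasurable f volume) : AEStronglyMeasurable (cv k f) volume :=
  ((aesm_kernel hk.aestronglyMeasurable).mul hf.comp_snd).integral_prod_right'

lemma ae_integrable_cv {k : ℂ → ℂ} (hk : LocallyIntegrable k) {R : ℝ} {f : ℂ → ℂ}
    (hf : L2B R f) : ∀ᵐ x, Integrable fun z => k (x - z) * f z := by
  have : ∀ n : ℕ, ∀ᵐ x : ℂ, ‖x‖ ≤ n → Integrable fun z => k (x - z) * f z := by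
    intro n
    set S : ℝ := max R n
    have hg : L2B S (cut S fun _ => 1) := L2B.of_bounded (C := 1)
      ((aestronglyMeasurable_const).indicator Metric.isClosed_closedBall.measurableSet)
      (fun z => norm_cut_le.trans (by simp)) (fun z hz => cut_of_lt hz)
    filter_upwards [(integrable_kernel hk (hf.mono (le_max_left R n)) hg).prod_right_ae] with x hx h
    rw [cut_of_le (h.trans (le_max_right _ _))] at hx
    simpa using hx
  filter_upwards [ae_all_iff.2 this] with x hx
  obtain ⟨n, hn⟩ := exists_nat_ge ‖x‖
  exact hx n hn

lemma lintegral_cut_cv_le {k : ℂ → ℂ} (hk : Measurable k) {R S : ℝ} {f : ℂ → ℂ}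
    (hf : L2B R f) :
    ∫⁻ x, ‖cut S (cv k f) x‖ₑ ^ 2 ≤
      (∫⁻ z, ‖cut (S + R) k z‖ₑ) ^ 2 * ∫⁻ x, ‖f x‖ₑ ^ 2 := by
  have hcm : Measurable (cut (S + R) k) := hk.indicator Metric.isClosed_closedBall.measurableSet
  have hm : Measurable (Function.uncurry fun x z : ℂ => ‖cut (S + R) k (x - z)‖ₑ) :=
    (hcm.comp (measurable_fst.sub measurable_snd)).enorm
  have h := schur_test volume hm (f := fun z => ‖f z‖ₑ) hf.memLp.1.enorm
    (C₁ := ∫⁻ z, ‖cut (S + R) k z‖ₑ) (C₂ := ∫⁻ z, ‖cut (S + R) k z‖ₑ)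
    (fun x => (lintegral_sub_left_eq_self (fun z => ‖cut (S + R) k z‖ₑ) x).le)
    (fun z => (lintegral_sub_right_eq_self (fun z => ‖cut (S + R) k z‖ₑ) z).le)
  rw [sq]
  refine le_trans (lintegral_mono fun x => ?_) h
  rcases le_or_gt ‖x‖ S with hx | hx
  · rw [cut_of_le hx]
    refine pow_le_pow_left' ?_ 2
    refine (enorm_integral_le_lintegral_enorm _).trans (lintegral_mono fun z => ?_)
    rw [enorm_mul]
    rcases le_or_gt ‖z‖ R with hz | hz
    · rw [cut_of_le ((norm_sub_le _ _).trans (add_le_add hx hz))]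
    · simp [hf.supp z hz]
  · simp [cut_of_lt hx]

lemma L2B.cv {k : ℂ → ℂ} (hk : LocallyIntegrable k) (hkm : Measurable k) {R : ℝ} (S : ℝ)
    {f : ℂ → ℂ} (hf : L2B R f) : L2B S (cut S (cv k f)) := by
  refine ⟨memLp_two_iff.2 ⟨(cv_aesm hk hf.memLp.1).indicator
    Metric.isClosed_closedBall.measurableSet, ?_⟩, fun z hz => cut_of_lt hz⟩
  refine (lintegral_cut_cv_le hkm hf).trans_lt (ENNReal.mul_lt_top (ENNReal.pow_lt_top ?_) hf.lint)
  exact (cut_integrable hk _).2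

lemma cv_congr {k f g : ℂ → ℂ} (h : f =ᵐ[volume] g) : cv k f = cv k g := by
  funext x
  exact integral_congr_ae (h.mono fun z hz => by simp [hz])

end GKL

end

section

open Real MeasureTheory Set Filter Topology
open scoped ENNReal ContDiff

namespace GKL

/-! ### Differential operators and fundamental solutions -/

/-- Directional derivative. -/
def dd (v : ℂ) (f : ℂ → ℂ) (z : ℂ) : ℂ := fderiv ℝ f z v

/-- The Laplacian on `ℂ`. -/
def lap (f : ℂ → ℂ) (z : ℂ) : ℂ := dd 1 (dd 1 f) z + dd Complex.I (dd Complex.I f) z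

/-- The Cauchy–Riemann operator `∂̄`. -/
def dbar (f : ℂ → ℂ) (z : ℂ) : ℂ := (dd 1 f z + Complex.I * dd Complex.I f z) / 2

/-- The Wirtinger derivative `∂`. -/
def dz (f : ℂ → ℂ) (z : ℂ) : ℂ := (dd 1 f z - Complex.I * dd Complex.I f z) / 2

lemma dd_contDiff {f : ℂ → ℂ} (hf : ContDiff ℝ ∞ f) (v : ℂ) : ContDiff ℝ ∞ (dd v f) :=
  (hf.fderiv_right (by simp)).clm_apply contDiff_const

lemma lap_contDiff {f : ℂ → ℂ} (hf : ContDiff ℝ ∞ f) : ContDiff ℝ ∞ (lap f) :=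
  (dd_contDiff (dd_contDiff hf _) _).add (dd_contDiff (dd_contDiff hf _) _)

lemma dbar_contDiff {f : ℂ → ℂ} (hf : ContDiff ℝ ∞ f) : ContDiff ℝ ∞ (dbar f) :=
  ((dd_contDiff hf _).add (contDiff_const.mul (dd_contDiff hf _))).div_const _

lemma dd_compact {f : ℂ → ℂ} (hf : HasCompactSupport f) (v : ℂ) : HasCompactSupport (dd v f) :=
  hf.fderiv_apply ℝ v

lemma lap_compact {f : ℂ → ℂ} (hf : HasCompactSupport f) : HasCompactSupport (lap f) :=
  (dd_compact (dd_compact hf _) _).add (dd_compact (dd_compact hf _) _)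

lemma dbar_compact {f : ℂ → ℂ} (hf : HasCompactSupport f) : HasCompactSupport (dbar f) := by
  have := ((dd_compact hf 1).add ((dd_compact hf Complex.I).mul_left
    (f := fun _ => Complex.I))).mul_right (f' := fun _ => (2 : ℂ)⁻¹)
  exact this

lemma dd_mul {f g : ℂ → ℂ} {z : ℂ} (hf : DifferentiableAt ℝ f z) (hg : DifferentiableAt ℝ g z)
    (v : ℂ) : dd v (fun z => f z * g z) z = f z * dd v g z + dd v f z * g z := by
  simp only [dd]
  rw [fderiv_fun_mul hf hg]
  simp; ring

lemma dd_add {f g : ℂ → ℂ} {z : ℂ} (hf : DifferentiableAt ℝ f z) (hg : DifferentiableAt ℝ g z)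
    (v : ℂ) : dd v (fun z => f z + g z) z = dd v f z + dd v g z := by
  simp only [dd]
  rw [fderiv_fun_add hf hg]; rfl

lemma dd_const_mul {f : ℂ → ℂ} {z : ℂ} (hf : DifferentiableAt ℝ f z) (c v : ℂ) :
    dd v (fun z => c * f z) z = c * dd v f z := by
  simp only [dd]
  rw [fderiv_const_mul hf]; rfl

lemma integral_mul_dd {u φ : ℂ → ℂ} (hu : ContDiff ℝ ∞ u) (hφ : ContDiff ℝ ∞ φ)
    (hc : HasCompactSupport φ) (v : ℂ) : ∫ z, u z * dd v φ z = -∫ z, dd v u z * φ z := by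
  refine integral_mul_fderiv_eq_neg_fderiv_mul_of_integrable ?_ ?_ ?_
    (fun x _ => hu.differentiable (by simp) x) (fun x _ => hφ.differentiable (by simp) x)
  · exact ((dd_contDiff hu v).continuous.mul hφ.continuous).integrable_of_hasCompactSupport
      hc.mul_left
  · exact (hu.continuous.mul (dd_contDiff hφ v).continuous).integrable_of_hasCompactSupport
      (dd_compact hc v).mul_left
  · exact (hu.continuous.mul hφ.continuous).integrable_of_hasCompactSupport hc.mul_left

lemma int_cc {u φ : ℂ → ℂ} (hu : ContDiff ℝ ∞ u) (hφ : ContDiff ℝ ∞ φ)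
    (hc : HasCompactSupport φ) : Integrable fun z => u z * φ z :=
  (hu.continuous.mul hφ.continuous).integrable_of_hasCompactSupport hc.mul_left

lemma integral_mul_lap {u φ : ℂ → ℂ} (hu : ContDiff ℝ ∞ u) (hφ : ContDiff ℝ ∞ φ)
    (hc : HasCompactSupport φ) : ∫ z, u z * lap φ z = ∫ z, lap u z * φ z := by
  have h : ∀ v, ∫ z, u z * dd v (dd v φ) z = ∫ z, dd v (dd v u) z * φ z := fun v => by
    rw [integral_mul_dd hu (dd_contDiff hφ v) (dd_compact hc v),
      integral_mul_dd (dd_contDiff hu v) hφ hc, neg_neg]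
  have h1 : ∀ v, ContDiff ℝ ∞ (dd v (dd v φ)) := fun v => dd_contDiff (dd_contDiff hφ v) v
  have h2 : ∀ v, ContDiff ℝ ∞ (dd v (dd v u)) := fun v => dd_contDiff (dd_contDiff hu v) v
  simp only [lap, mul_add, add_mul]
  rw [integral_add (int_cc hu (h1 _) (dd_compact (dd_compact hc _) _))
    (int_cc hu (h1 _) (dd_compact (dd_compact hc _) _)),
    integral_add (int_cc (h2 _) hφ hc) (int_cc (h2 _) hφ hc), h, h]

lemma integral_mul_dbar {u φ : ℂ → ℂ} (hu : ContDiff ℝ ∞ u) (hφ : ContDiff ℝ ∞ φ)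
    (hc : HasCompactSupport φ) : ∫ z, u z * dbar φ z = -∫ z, dbar u z * φ z := by
  have e1 : ∀ z, u z * dbar φ z =
      (1 / 2) * (u z * dd 1 φ z) + (Complex.I / 2) * (u z * dd Complex.I φ z) := fun z => by
    simp only [dbar]; ring
  have e2 : ∀ z, dbar u z * φ z =
      (1 / 2) * (dd 1 u z * φ z) + (Complex.I / 2) * (dd Complex.I u z * φ z) := fun z => by
    simp only [dbar]; ring
  simp only [e1, e2]
  rw [integral_add ((int_cc hu (dd_contDiff hφ _) (dd_compact hc _)).const_mul _)
    ((int_cc hu (dd_contDiff hφ _) (dd_compact hc _)).const_mul _),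
    integral_add ((int_cc (dd_contDiff hu _) hφ hc).const_mul _)
    ((int_cc (dd_contDiff hu _) hφ hc).const_mul _)]
  simp only [integral_const_mul]
  rw [integral_mul_dd hu hφ hc, integral_mul_dd hu hφ hc]; ring

/-! Radial functions -/

lemma hasFDerivAt_normSq (z v : ℂ) :
    ∃ L : ℂ →L[ℝ] ℝ, HasFDerivAt (fun w : ℂ => ‖w‖ ^ 2) L z ∧
      L v = 2 * (z.re * v.re + z.im * v.im) := by
  refine ⟨_, (hasStrictFDerivAt_norm_sq z).hasFDerivAt, ?_⟩
  simp [Complex.inner]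
  ring

lemma dd_radial {h : ℝ → ℂ} {h' : ℂ} {z : ℂ} (hh : HasDerivAt h h' (‖z‖ ^ 2)) (v : ℂ) :
    dd v (fun w => h (‖w‖ ^ 2)) z = h' * (2 * (z.re * v.re + z.im * v.im) : ℝ) := by
  obtain ⟨L, hL, hv⟩ := hasFDerivAt_normSq z v
  have := hh.hasFDerivAt.comp z hL
  rw [dd, show (fun w : ℂ => h (‖w‖ ^ 2)) = h ∘ fun w => ‖w‖ ^ 2 from rfl, this.fderiv]
  simp [hv]; ring

lemma dd_linear (a b : ℝ) (v z : ℂ) :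
    dd v (fun w => ((2 * (w.re * a + w.im * b) : ℝ) : ℂ)) z = (2 * (v.re * a + v.im * b) : ℝ) := by
  set L : ℂ →L[ℝ] ℂ := Complex.ofRealCLM.comp
    ((2 : ℝ) • (a • Complex.reCLM + b • Complex.imCLM))
  have : (fun w : ℂ => ((2 * (w.re * a + w.im * b) : ℝ) : ℂ)) = L := by
    funext w; simp [L]; ring
  rw [dd, this, ContinuousLinearMap.fderiv]
  simp [L]; ring

lemma lap_radial {h h' h'' : ℝ → ℂ} {z : ℂ} (hh : ∀ s, 0 ≤ s → HasDerivAt h (h' s) s)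
    (hh' : ∀ s, 0 ≤ s → HasDerivAt h' (h'' s) s) :
    lap (fun w => h (‖w‖ ^ 2)) z = 4 * ((‖z‖ ^ 2 : ℝ) * h'' (‖z‖ ^ 2) + h' (‖z‖ ^ 2)) := by
  have e : ∀ v, dd v (fun w => h (‖w‖ ^ 2)) =
      fun w => h' (‖w‖ ^ 2) * ((2 * (w.re * v.re + w.im * v.im) : ℝ) : ℂ) := fun v =>
    funext fun w => dd_radial (hh _ (by positivity)) v
  have e2 : ∀ v, dd v (dd v fun w => h (‖w‖ ^ 2)) z =
      h' (‖z‖ ^ 2) * (2 * (v.re * v.re + v.im * v.im) : ℝ) +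
      h'' (‖z‖ ^ 2) * (2 * (z.re * v.re + z.im * v.im) : ℝ) ^ 2 := fun v => by
    have d1 : DifferentiableAt ℝ (fun w : ℂ => h' (‖w‖ ^ 2)) z := by
      obtain ⟨L, hL, -⟩ := hasFDerivAt_normSq z v
      exact ((hh' _ (by positivity)).hasFDerivAt.comp z hL).differentiableAt
    have d2 : DifferentiableAt ℝ
        (fun w : ℂ => ((2 * (w.re * v.re + w.im * v.im) : ℝ) : ℂ)) z := by
      have r1 : DifferentiableAt ℝ (fun w : ℂ => w.re) z := Complex.reCLM.differentiableAt
      have r2 : DifferentiableAt ℝ (fun w : ℂ => w.im) z := Complex.imCLM.differentiableAt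
      have h3 : DifferentiableAt ℝ (fun w : ℂ => (2 * (w.re * v.re + w.im * v.im) : ℝ)) z := by
        fun_prop
      exact Complex.ofRealCLM.differentiableAt.comp z h3
    rw [e v, dd_mul d1 d2, dd_linear, dd_radial (hh' _ (by positivity))]
    ring
  rw [lap, e2, e2, Complex.sq_norm, Complex.normSq_apply]
  simp
  ring

lemma integral_lorentz : IntegrableOn (fun r : ℝ => r * (1 / (1 + r ^ 2) ^ 2)) (Ioi 0) ∧
    ∫ r in Ioi (0:ℝ), r * (1 / (1 + r ^ 2) ^ 2) = 1 / 2 := by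
  have hd : ∀ x ∈ Ioi (0:ℝ), HasDerivAt (fun r : ℝ => -(1 / 2) * (1 + r ^ 2)⁻¹)
      (x * (1 / (1 + x ^ 2) ^ 2)) x := fun x _ => by
    have h1 : HasDerivAt (fun r : ℝ => 1 + r ^ 2) (2 * x) x := by
      simpa using (hasDerivAt_pow 2 x).const_add 1
    refine ((h1.inv (by positivity)).const_mul (-(1 / 2) : ℝ)).congr_deriv ?_
    field_simp
  have hc : ContinuousWithinAt (fun r : ℝ => -(1 / 2) * (1 + r ^ 2)⁻¹) (Ici 0) 0 := by
    refine Continuous.continuousWithinAt ?_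
    refine continuous_const.mul (Continuous.inv₀ (by fun_prop) fun x => by positivity)
  have ht : Tendsto (fun r : ℝ => -(1 / 2) * (1 + r ^ 2)⁻¹) atTop (𝓝 0) := by
    have : Tendsto (fun r : ℝ => 1 + r ^ 2) atTop atTop :=
      tendsto_atTop_add_const_left _ _ (tendsto_pow_atTop (by norm_num))
    simpa using this.inv_tendsto_atTop.const_mul (-(1 / 2) : ℝ)
  have hn : ∀ x ∈ Ioi (0:ℝ), 0 ≤ x * (1 / (1 + x ^ 2) ^ 2) := fun x hx => by
    have : 0 < x := hx
    positivity
  refine ⟨integrableOn_Ioi_deriv_of_nonneg hc hd hn ht, ?_⟩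
  rw [integral_Ioi_of_hasDerivAt_of_nonneg hc hd hn ht]
  norm_num

lemma lorentz_integrable : Integrable fun w : ℂ => (1 / (1 + ‖w‖ ^ 2) ^ 2 : ℝ) := by
  refine (integrable_fun_norm_addHaar volume (f := fun r : ℝ => 1 / (1 + r ^ 2) ^ 2)).2 ?_
  simpa [Complex.finrank_real_complex] using integral_lorentz.1

lemma lorentz_integral : ∫ w : ℂ, (1 / (1 + ‖w‖ ^ 2) ^ 2 : ℝ) = π := by
  have h := integral_fun_norm_addHaar (E := ℂ) volume (fun r : ℝ => 1 / (1 + r ^ 2) ^ 2)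
  rw [h]
  have h2 := integral_lorentz.2
  simp only [Complex.finrank_real_complex, Measure.real, Complex.volume_ball, smul_eq_mul] at *
  norm_num at *
  rw [h2]
  ring

/-- The sequence of regularization parameters. -/
def ep (n : ℕ) : ℝ := 1 / ((n : ℝ) + 1)

lemma ep_pos (n : ℕ) : 0 < ep n := by unfold ep; positivity
lemma ep_le (n : ℕ) : ep n ≤ 1 := by
  rw [ep, div_le_one (by positivity)]; linarith [(Nat.cast_nonneg n : (0:ℝ) ≤ n)]
lemma ep_tendsto : Tendsto ep atTop (𝓝 0) := tendsto_one_div_add_atTop_nhds_zero_nat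

lemma approx_id {H : ℝ → ℂ} (hH : Continuous H) {φ : ℂ → ℂ} (hφ : Continuous φ)
    (hc : HasCompactSupport φ) :
    Tendsto (fun n => ∫ z : ℂ, (((ep n) ^ 2 / (‖z‖ ^ 2 + (ep n) ^ 2) ^ 2 : ℝ) : ℂ) *
      H (‖z‖ ^ 2 + (ep n) ^ 2) * φ z) atTop (𝓝 (π * H 0 * φ 0)) := by
  have e : ∀ n, ∫ z : ℂ, (((ep n) ^ 2 / (‖z‖ ^ 2 + (ep n) ^ 2) ^ 2 : ℝ) : ℂ) *
      H (‖z‖ ^ 2 + (ep n) ^ 2) * φ z = ∫ w : ℂ, ((1 / (1 + ‖w‖ ^ 2) ^ 2 : ℝ) : ℂ) *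
      H ((ep n) ^ 2 * (1 + ‖w‖ ^ 2)) * φ (ep n • w) := fun n => by
    have hp := ep_pos n
    have h := Measure.integral_comp_smul (E := ℂ) volume
      (fun z : ℂ => (((ep n) ^ 2 / (‖z‖ ^ 2 + (ep n) ^ 2) ^ 2 : ℝ) : ℂ) *
      H (‖z‖ ^ 2 + (ep n) ^ 2) * φ z) (ep n)
    rw [Complex.finrank_real_complex, abs_of_nonneg (by positivity)] at h
    rw [inv_smul_eq_iff₀ (by positivity) |>.1 h.symm, ← integral_smul]
    refine integral_congr_ae (Eventually.of_forall fun w => ?_)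
    simp only [Complex.real_smul]
    rw [norm_mul, Complex.norm_real, Real.norm_of_nonneg hp.le]
    have e1 : (ep n * ‖w‖) ^ 2 + ep n ^ 2 = ep n ^ 2 * (1 + ‖w‖ ^ 2) := by ring
    rw [e1, ← mul_assoc, ← mul_assoc, ← Complex.ofReal_mul]
    congr 3
    field_simp
  simp only [e]
  obtain ⟨R, hR⟩ := hc.isCompact.isBounded.subset_closedBall 0
  obtain ⟨M, hM⟩ := (isCompact_Icc (a := (0:ℝ)) (b := 1 + R ^ 2)).exists_bound_of_continuousOn
    hH.continuousOn
  obtain ⟨N, hN⟩ := hφ.bounded_above_of_compact_support hc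
  have hlim : ∫ w : ℂ, ((1 / (1 + ‖w‖ ^ 2) ^ 2 : ℝ) : ℂ) * H 0 * φ 0 = π * H 0 * φ 0 := by
    rw [integral_mul_const, integral_mul_const, integral_complex_ofReal, lorentz_integral]
  rw [← hlim]
  have hcc : Continuous fun w : ℂ => ((1 / (1 + ‖w‖ ^ 2) ^ 2 : ℝ) : ℂ) := by
    refine Complex.continuous_ofReal.comp ?_
    exact continuous_const.div (by fun_prop) fun w => by positivity
  refine tendsto_integral_of_dominated_convergence
    (fun w => (1 / (1 + ‖w‖ ^ 2) ^ 2) * (M * N)) (fun n => ?_) (lorentz_integrable.mul_const _)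
    (fun n => Eventually.of_forall fun w => ?_) (Eventually.of_forall fun w => ?_)
  · refine Continuous.aestronglyMeasurable ?_
    exact (hcc.mul (hH.comp (by fun_prop))).mul (hφ.comp (by fun_prop))
  · rw [norm_mul, norm_mul, Complex.norm_real, Real.norm_of_nonneg (by positivity), mul_assoc]
    refine mul_le_mul_of_nonneg_left ?_ (by positivity)
    by_cases h : ep n • w ∈ tsupport φ
    · have h1 : ‖ep n • w‖ ≤ R := by simpa using hR h
      rw [norm_smul, Real.norm_of_nonneg (ep_pos n).le] at h1
      have h2 : ep n ^ 2 * (1 + ‖w‖ ^ 2) ∈ Icc (0:ℝ) (1 + R ^ 2) := by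
        refine ⟨by positivity, ?_⟩
        have h3 : ep n ^ 2 ≤ 1 := pow_le_one₀ (ep_pos n).le (ep_le n)
        have h4 : (ep n * ‖w‖) ^ 2 ≤ R ^ 2 :=
          pow_le_pow_left₀ (mul_nonneg (ep_pos n).le (norm_nonneg w)) h1 2
        nlinarith
      exact mul_le_mul (hM _ h2) (hN _) (norm_nonneg _) ((norm_nonneg _).trans (hM _ h2))
    · rw [image_eq_zero_of_notMem_tsupport h, norm_zero, mul_zero]
      have h0 : 0 ≤ M := (norm_nonneg _).trans (hM 0 ⟨le_rfl, by positivity⟩)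
      have h1 : 0 ≤ N := (norm_nonneg _).trans (hN 0)
      positivity
  · have h1 : Tendsto (fun n => ep n ^ 2 * (1 + ‖w‖ ^ 2)) atTop (𝓝 0) := by
      simpa using (ep_tendsto.pow 2).mul_const (1 + ‖w‖ ^ 2)
    have h2 : Tendsto (fun n => ep n • w) atTop (𝓝 0) := by
      simpa using ep_tendsto.smul_const w
    exact (tendsto_const_nhds.mul ((hH.tendsto 0).comp h1)).mul ((hφ.tendsto 0).comp h2)

/-- The Green function on `ℂ`. -/
def gG (κ : ℝ) (z : ℂ) : ℂ := gF κ ((‖z‖ ^ 2 : ℝ) : ℂ)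

/-- Real-variable radial profile of the Green function. -/
def gFr (κ : ℝ) (t : ℝ) : ℂ := gA κ t * (Real.log t : ℂ) + gE κ t

lemma gF_ofReal (κ : ℝ) {t : ℝ} (ht : 0 ≤ t) : gF κ t = gFr κ t := by
  rw [gF, gFr, Complex.ofReal_log ht]

lemma gG_eq (κ : ℝ) (z : ℂ) : gG κ z = gFr κ (‖z‖ ^ 2) := gF_ofReal κ (by positivity)

lemma gG_neg (κ : ℝ) (z : ℂ) : gG κ (-z) = gG κ z := by simp [gG]

/-- First derivative of the profile. -/
def gFr1 (κ : ℝ) (t : ℝ) : ℂ :=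
  deriv (gA κ) t * (Real.log t : ℂ) + gA κ t * (t⁻¹ : ℝ) + deriv (gE κ) t

/-- Second derivative of the profile. -/
def gFr2 (κ : ℝ) (t : ℝ) : ℂ :=
  deriv (deriv (gA κ)) t * (Real.log t : ℂ) + 2 * deriv (gA κ) t * (t⁻¹ : ℝ) -
    gA κ t * ((t ^ 2)⁻¹ : ℝ) + deriv (deriv (gE κ)) t

lemma hasDerivAt_gFr (κ : ℝ) {t : ℝ} (ht : 0 < t) : HasDerivAt (gFr κ) (gFr1 κ t) t := by
  have h1 := (gA_diff κ t).hasDerivAt.comp_ofReal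
  have h2 := (gE_diff κ t).hasDerivAt.comp_ofReal
  have h3 := (Real.hasDerivAt_log ht.ne').ofReal_comp
  exact ((h1.mul h3).add h2).congr_deriv (by simp [gFr1])

lemma hasDerivAt_gFr1 (κ : ℝ) {t : ℝ} (ht : 0 < t) : HasDerivAt (gFr1 κ) (gFr2 κ t) t := by
  have h0 := (gA_diff κ t).hasDerivAt.comp_ofReal
  have h1 := (gA'_diff κ t).hasDerivAt.comp_ofReal
  have h2 := (gE'_diff κ t).hasDerivAt.comp_ofReal
  have h3 := (Real.hasDerivAt_log ht.ne').ofReal_comp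
  have h4 := (hasDerivAt_inv ht.ne').ofReal_comp
  refine (((h1.mul h3).add (h0.mul h4)).add h2).congr_deriv ?_
  simp [gFr2]; ring

lemma gFr_ode (κ : ℝ) {t : ℝ} (ht : 0 < t) :
    t * gFr2 κ t + gFr1 κ t = -(κ ^ 2 / 4 : ℂ) * gFr κ t := by
  have h1 := gA_ode κ t
  have h2 := gE_ode κ t
  have ht' : (t : ℂ) ≠ 0 := by exact_mod_cast ht.ne'
  simp only [gFr2, gFr1, gFr]
  push_cast
  have e : (t : ℂ) * (t : ℂ)⁻¹ = 1 := mul_inv_cancel₀ ht'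
  rw [show ((t : ℂ) ^ 2)⁻¹ = (t : ℂ)⁻¹ * (t : ℂ)⁻¹ by rw [sq, mul_inv]]
  linear_combination (Real.log t : ℂ) * h1 + h2 +
    (2 * deriv (gA κ) t - gA κ t * (t : ℂ)⁻¹) * e

lemma measurable_gG (κ : ℝ) : Measurable (gG κ) := by
  have hA := (gA_diff κ).continuous.measurable
  have hE := (gE_diff κ).continuous.measurable
  have : Measurable fun z : ℂ => ((‖z‖ ^ 2 : ℝ) : ℂ) := by fun_prop
  exact ((hA.comp this).mul (Complex.measurable_log.comp this)).add (hE.comp this)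

lemma gFr_bound (κ R : ℝ) : ∃ C, 0 ≤ C ∧ ∀ t, 0 < t → t ≤ R → ‖gFr κ t‖ ≤ C * t ^ (-(1/4) : ℝ) := by
  have hc : Continuous fun t : ℝ => (gA κ t) := (gA_diff κ).continuous.comp Complex.continuous_ofReal
  have hc' : Continuous fun t : ℝ => (gE κ t) := (gE_diff κ).continuous.comp Complex.continuous_ofReal
  set S := max R 1
  obtain ⟨M, hM⟩ := (isCompact_Icc (a := (0:ℝ)) (b := S)).exists_bound_of_continuousOn hc.continuousOn
  obtain ⟨N, hN⟩ := (isCompact_Icc (a := (0:ℝ)) (b := S)).exists_bound_of_continuousOn hc'.continuousOn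
  have hS : 1 ≤ S := le_max_right _ _
  have hM0 : 0 ≤ M := (norm_nonneg _).trans (hM 0 ⟨le_rfl, by linarith⟩)
  have hN0 : 0 ≤ N := (norm_nonneg _).trans (hN 0 ⟨le_rfl, by linarith⟩)
  refine ⟨(M * (4 + S) + N) * S, by positivity, fun t ht htR => ?_⟩
  have htS : t ∈ Icc 0 S := ⟨ht.le, htR.trans (le_max_left _ _)⟩
  have hq : (0:ℝ) < t ^ (-(1/4) : ℝ) := Real.rpow_pos_of_pos ht _
  have h1 : 1 ≤ S * t ^ (-(1/4) : ℝ) := by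
    rcases le_or_gt t 1 with h | h
    · have := Real.one_le_rpow_of_pos_of_le_one_of_nonpos ht h (by norm_num : (-(1/4) : ℝ) ≤ 0)
      nlinarith
    · have : t⁻¹ ≤ t ^ (-(1/4) : ℝ) := by
        rw [← Real.rpow_neg_one]
        exact Real.rpow_le_rpow_of_exponent_le h.le (by norm_num)
      calc 1 = t * t⁻¹ := (mul_inv_cancel₀ ht.ne').symm
        _ ≤ S * t ^ (-(1/4) : ℝ) := mul_le_mul htS.2 this (by positivity) (by linarith)
  have h2 : |Real.log t| ≤ (4 + S) * (S * t ^ (-(1/4) : ℝ)) := by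
    rcases le_or_gt t 1 with h | h
    · have h3 := (Real.abs_log_mul_self_rpow_lt t (1/4) ht h (by norm_num)).le
      rw [abs_mul, abs_of_pos (Real.rpow_pos_of_pos ht _)] at h3
      have h4 : t ^ (1/4 : ℝ) * t ^ (-(1/4) : ℝ) = 1 := by
        rw [← Real.rpow_add ht]; norm_num
      have h5 : |Real.log t| ≤ 4 * t ^ (-(1/4) : ℝ) := by
        calc |Real.log t| = (|Real.log t| * t ^ (1/4 : ℝ)) * t ^ (-(1/4) : ℝ) := by
              rw [mul_assoc, h4, mul_one]
          _ ≤ 4 * t ^ (-(1/4) : ℝ) := by gcongr; linarith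
      nlinarith
    · rw [abs_of_nonneg (Real.log_nonneg h.le)]
      have := Real.log_le_sub_one_of_pos ht
      have h6 := htS.2
      nlinarith
  rw [gFr]
  calc ‖gA κ t * (Real.log t : ℂ) + gE κ t‖ ≤ ‖gA κ t‖ * |Real.log t| + ‖gE κ t‖ := by
        refine (norm_add_le _ _).trans ?_
        rw [norm_mul, Complex.norm_real, Real.norm_eq_abs]
    _ ≤ M * ((4 + S) * (S * t ^ (-(1/4) : ℝ))) + N * (S * t ^ (-(1/4) : ℝ)) := by
        gcongr
        · exact hM t htS
        · exact (hN t htS).trans (le_mul_of_one_le_right hN0 h1)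
    _ = _ := by ring

lemma gG_bound (κ R : ℝ) : ∃ C, 0 ≤ C ∧ ∀ z : ℂ, z ≠ 0 → ‖z‖ ≤ R → ‖gG κ z‖ ≤ C * ‖z‖ ^ (-(1/2) : ℝ) := by
  obtain ⟨C, hC, h⟩ := gFr_bound κ (R ^ 2)
  refine ⟨C, hC, fun z hz hR => ?_⟩
  have hz' : 0 < ‖z‖ := norm_pos_iff.2 hz
  have := h (‖z‖ ^ 2) (by positivity) (by gcongr)
  rw [gG_eq]
  convert this using 2
  rw [← Real.rpow_natCast, ← Real.rpow_mul hz'.le]; norm_num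

lemma locInt_of_bound {k : ℂ → ℂ} (hm : Measurable k) {α : ℝ} (hα : α < 2)
    (hb : ∀ R, ∃ C, ∀ z : ℂ, z ≠ 0 → ‖z‖ ≤ R → ‖k z‖ ≤ C * ‖z‖ ^ (-α)) :
    LocallyIntegrable k := by
  refine locallyIntegrable_iff.2 fun K hK => ?_
  obtain ⟨R, hR⟩ := hK.isBounded.subset_ball 0
  obtain ⟨C, hC⟩ := hb R
  refine IntegrableOn.mono_set ?_ hR
  refine integrableOn_ball_of_norm_le_rpow (α := α) (C := C) (by simp [Complex.finrank_real_complex])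
    (by simpa [Complex.finrank_real_complex] using hα) ?_ hm.aestronglyMeasurable
  filter_upwards [ae_restrict_mem Metric.isOpen_ball.measurableSet,
    ae_restrict_of_ae (compl_mem_ae_iff.2 (measure_singleton (0:ℂ)))] with z hz h0
  exact hC z h0 (by simpa using (Metric.mem_ball.1 hz).le)

lemma locInt_gG (κ : ℝ) : LocallyIntegrable (gG κ) :=
  locInt_of_bound (measurable_gG κ) (α := 1/2) (by norm_num) fun R => by
    obtain ⟨C, -, h⟩ := gG_bound κ R
    exact ⟨C, h⟩

/-- The Cauchy kernel. -/
def ck (z : ℂ) : ℂ := 1 / (π * z)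

lemma measurable_ck : Measurable ck := by unfold ck; fun_prop

lemma norm_ck (z : ℂ) : ‖ck z‖ = (1 / π) * ‖z‖⁻¹ := by
  simp [ck, abs_of_pos Real.pi_pos]; ring

lemma locInt_ck : LocallyIntegrable ck :=
  locInt_of_bound measurable_ck (α := 1) (by norm_num) fun R => ⟨1 / π, fun z _ _ => by
    rw [norm_ck, Real.rpow_neg_one]⟩

lemma contDiff_reg (ε : ℝ) (hε : 0 < ε) (κ : ℝ) :
    ContDiff ℝ ∞ fun z : ℂ => gFr κ (‖z‖ ^ 2 + ε ^ 2) := by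
  have hn : ContDiff ℝ ∞ fun z : ℂ => ‖z‖ ^ 2 + ε ^ 2 := (contDiff_norm_sq ℝ).add contDiff_const
  have hn' : ContDiff ℝ ∞ fun z : ℂ => ((‖z‖ ^ 2 + ε ^ 2 : ℝ) : ℂ) :=
    Complex.ofRealCLM.contDiff.comp hn
  have hA : ContDiff ℝ ∞ (gA κ) := (gA_diff κ).contDiff.restrict_scalars ℝ
  have hE : ContDiff ℝ ∞ (gE κ) := (gE_diff κ).contDiff.restrict_scalars ℝ
  have hl : ContDiff ℝ ∞ fun z : ℂ => ((Real.log (‖z‖ ^ 2 + ε ^ 2) : ℝ) : ℂ) :=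
    Complex.ofRealCLM.contDiff.comp (hn.log fun z => by positivity)
  exact ((hA.comp hn').mul hl).add (hE.comp hn')

/-- `G` is a fundamental solution of the Helmholtz equation. -/
theorem green_fund (κ : ℝ) {φ : ℂ → ℂ} (hφ : ContDiff ℝ ∞ φ) (hc : HasCompactSupport φ) :
    ∫ z, gG κ z * (lap φ z + κ ^ 2 * φ z) = -φ 0 := by
  set H : ℝ → ℂ := fun t => deriv (deriv (gA κ)) t * (t * (t * Real.log t) : ℝ) +
    2 * deriv (gA κ) t * t - gA κ t + deriv (deriv (gE κ)) t * t ^ 2 with hHdef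
  have hH : Continuous H := by
    have c1 : Continuous fun t : ℝ => deriv (deriv (gA κ)) t :=
      ((gA'_diff κ).contDiff.continuous_deriv le_rfl (n := 1)).comp Complex.continuous_ofReal
    have c2 : Continuous fun t : ℝ => deriv (deriv (gE κ)) t :=
      ((gE'_diff κ).contDiff.continuous_deriv le_rfl (n := 1)).comp Complex.continuous_ofReal
    have c3 : Continuous fun t : ℝ => deriv (gA κ) t :=
      (gA'_diff κ).continuous.comp Complex.continuous_ofReal
    have c4 : Continuous fun t : ℝ => gA κ t :=
      (gA_diff κ).continuous.comp Complex.continuous_ofReal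
    have c5 : Continuous fun t : ℝ => t * Real.log t := Real.continuous_mul_log
    have c6 : Continuous fun t : ℝ => ((t * (t * Real.log t) : ℝ) : ℂ) :=
      Complex.continuous_ofReal.comp (continuous_id.mul c5)
    have c7 := Complex.continuous_ofReal
    exact (((c1.mul c6).add ((continuous_const.mul c3).mul c7)).sub c4).add (c2.mul (c7.pow 2))
  have hH0 : H 0 = 1 / (4 * π) := by simp [hHdef, gA_zero]
  set ψ : ℂ → ℂ := fun z => lap φ z + κ ^ 2 * φ z with hψ
  have hψc : ContDiff ℝ ∞ ψ := (lap_contDiff hφ).add (contDiff_const.mul hφ)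
  have hψs : HasCompactSupport ψ := (lap_compact hc).add hc.mul_left
  have e : ∀ n, ∫ z : ℂ, gFr κ (‖z‖ ^ 2 + ep n ^ 2) * ψ z =
      -4 * ∫ z : ℂ, (((ep n) ^ 2 / (‖z‖ ^ 2 + (ep n) ^ 2) ^ 2 : ℝ) : ℂ) *
        H (‖z‖ ^ 2 + (ep n) ^ 2) * φ z := fun n => by
    have hp := ep_pos n
    have hg := contDiff_reg (ep n) hp κ
    have h1 := integral_mul_lap hg hφ hc
    have h2 : ∀ z : ℂ, lap (fun z : ℂ => gFr κ (‖z‖ ^ 2 + ep n ^ 2)) z =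
        4 * ((‖z‖ ^ 2 : ℝ) * gFr2 κ (‖z‖ ^ 2 + ep n ^ 2) + gFr1 κ (‖z‖ ^ 2 + ep n ^ 2)) :=
      fun z => lap_radial (h := fun s => gFr κ (s + ep n ^ 2))
        (h' := fun s => gFr1 κ (s + ep n ^ 2)) (h'' := fun s => gFr2 κ (s + ep n ^ 2))
        (fun s hs => (hasDerivAt_gFr κ (by positivity)).comp_add_const s _)
        (fun s hs => (hasDerivAt_gFr1 κ (by positivity)).comp_add_const s _)
    have e3 : ∫ z : ℂ, gFr κ (‖z‖ ^ 2 + ep n ^ 2) * ψ z =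
        ∫ z : ℂ, (lap (fun z : ℂ => gFr κ (‖z‖ ^ 2 + ep n ^ 2)) z * φ z +
          κ ^ 2 * (gFr κ (‖z‖ ^ 2 + ep n ^ 2) * φ z)) := by
      rw [integral_add (int_cc (lap_contDiff hg) hφ hc) ((int_cc hg hφ hc).const_mul _), ← h1,
        ← integral_add (int_cc hg (lap_contDiff hφ) (lap_compact hc))
          ((int_cc hg hφ hc).const_mul _)]
      refine integral_congr_ae (Eventually.of_forall fun z => ?_)
      simp only [hψ]; ring
    rw [e3, ← integral_const_mul]
    refine integral_congr_ae (Eventually.of_forall fun z => ?_)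
    simp only
    rw [h2]
    have ht : 0 < ‖z‖ ^ 2 + ep n ^ 2 := by positivity
    have hode := gFr_ode κ ht
    have hHt : ((((‖z‖ ^ 2 + ep n ^ 2) ^ 2)⁻¹ : ℝ) : ℂ) * H (‖z‖ ^ 2 + ep n ^ 2) =
        gFr2 κ (‖z‖ ^ 2 + ep n ^ 2) := by
      simp only [hHdef, gFr2]
      generalize ‖z‖ ^ 2 + ep n ^ 2 = t at ht
      have ht' : (t : ℂ) ≠ 0 := by exact_mod_cast ht.ne'
      push_cast
      field_simp
    rw [div_eq_mul_inv, Complex.ofReal_mul, mul_assoc ((ep n ^ 2 : ℝ) : ℂ), hHt]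
    push_cast at hode ⊢
    linear_combination (4 * φ z) * hode
  have hlim : Tendsto (fun n => ∫ z : ℂ, gFr κ (‖z‖ ^ 2 + ep n ^ 2) * ψ z) atTop
      (𝓝 (-4 * (π * H 0 * φ 0))) := by
    simp only [e]
    exact (approx_id hH hφ.continuous hc).const_mul _
  have hlim2 : Tendsto (fun n => ∫ z : ℂ, gFr κ (‖z‖ ^ 2 + ep n ^ 2) * ψ z) atTop
      (𝓝 (∫ z, gG κ z * ψ z)) := by
    obtain ⟨R, hR⟩ := hψs.isCompact.isBounded.subset_ball 0
    obtain ⟨C, hC, hb⟩ := gFr_bound κ (R ^ 2 + 1)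
    obtain ⟨N, hN⟩ := hψc.continuous.bounded_above_of_compact_support hψs
    have hN0 : 0 ≤ N := (norm_nonneg _).trans (hN 0)
    have hne : ∀ᵐ z : ℂ, z ≠ 0 := compl_mem_ae_iff.2 (measure_singleton (0:ℂ))
    refine tendsto_integral_of_dominated_convergence
      ((Metric.ball (0:ℂ) R).indicator fun z => C * ‖z‖ ^ (-(1/2) : ℝ) * N) (fun n => ?_) ?_
      (fun n => ?_) ?_
    · exact ((contDiff_reg (ep n) (ep_pos n) κ).continuous.mul
        hψc.continuous).aestronglyMeasurable
    · rw [integrable_indicator_iff Metric.isOpen_ball.measurableSet]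
      refine integrableOn_ball_of_norm_le_rpow (α := 1/2) (C := C * N)
        (by simp [Complex.finrank_real_complex])
        (by norm_num [Complex.finrank_real_complex]) (Eventually.of_forall fun z => ?_)
        (((measurable_norm.pow_const _).const_mul _).mul_const _).aestronglyMeasurable
      rw [Real.norm_of_nonneg (by positivity)]
      apply le_of_eq; ring
    · filter_upwards [hne] with z hz
      have hz' : 0 < ‖z‖ := norm_pos_iff.2 hz
      by_cases h : z ∈ Metric.ball (0:ℂ) R
      · rw [indicator_of_mem h, norm_mul]
        have h1 : ‖z‖ < R := by simpa using h
        have h2 : ‖z‖ ^ 2 + ep n ^ 2 ≤ R ^ 2 + 1 := by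
          have := pow_le_one₀ (ep_pos n).le (ep_le n) (n := 2)
          have := pow_le_pow_left₀ hz'.le h1.le 2
          linarith
        have h3 : (‖z‖ ^ 2 + ep n ^ 2) ^ (-(1/4) : ℝ) ≤ ‖z‖ ^ (-(1/2) : ℝ) := by
          have : ‖z‖ ^ (-(1/2) : ℝ) = (‖z‖ ^ 2) ^ (-(1/4) : ℝ) := by
            rw [← Real.rpow_natCast, ← Real.rpow_mul hz'.le]; norm_num
          rw [this]
          exact Real.rpow_le_rpow_of_nonpos (by positivity) (by have := sq_nonneg (ep n); linarith)
            (by norm_num)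
        calc _ ≤ (C * (‖z‖ ^ 2 + ep n ^ 2) ^ (-(1/4) : ℝ)) * N :=
              mul_le_mul (hb _ (by positivity) h2) (hN z) (norm_nonneg _) (by positivity)
          _ ≤ _ := by gcongr
      · rw [indicator_of_notMem h, image_eq_zero_of_notMem_tsupport fun hh => h (hR hh)]
        simp
    · filter_upwards [hne] with z hz
      have hz' : 0 < ‖z‖ := norm_pos_iff.2 hz
      rw [gG_eq]
      refine Tendsto.mul_const _ ?_
      refine ((hasDerivAt_gFr κ (t := ‖z‖ ^ 2) (by positivity)).continuousAt.tendsto).comp ?_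
      simpa using (ep_tendsto.pow 2).const_add (‖z‖ ^ 2)
  rw [tendsto_nhds_unique hlim2 hlim, hH0]
  have : (π : ℂ) ≠ 0 := by exact_mod_cast Real.pi_ne_zero
  field_simp

/-- The Cauchy kernel is a fundamental solution of `∂̄`. -/
theorem cauchy_fund {φ : ℂ → ℂ} (hφ : ContDiff ℝ ∞ φ) (hc : HasCompactSupport φ) :
    ∫ z, ck z * dbar φ z = -φ 0 := by
  set u : ℕ → ℂ → ℂ := fun n z =>
    (1 / π : ℂ) * (star z * (((‖z‖ ^ 2 + ep n ^ 2)⁻¹ : ℝ) : ℂ)) with hu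
  have hstar : ContDiff ℝ ∞ fun z : ℂ => star z := Complex.conjCLE.contDiff
  have hn : ∀ n, ContDiff ℝ ∞ fun z : ℂ => ((((‖z‖ ^ 2 + ep n ^ 2)⁻¹ : ℝ)) : ℂ) := fun n =>
    Complex.ofRealCLM.contDiff.comp
      (((contDiff_norm_sq ℝ).add contDiff_const).inv fun z => by
        have := ep_pos n; positivity)
  have huc : ∀ n, ContDiff ℝ ∞ (u n) := fun n => contDiff_const.mul (hstar.mul (hn n))
  have hdstar : ∀ v z : ℂ, dd v (fun z : ℂ => star z) z = star v := fun v z => by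
    have : (fun z : ℂ => star z) = Complex.conjCLE := rfl
    rw [dd, this, ContinuousLinearEquiv.fderiv]; rfl
  have hdu : ∀ n z, dbar (u n) z =
      (1 / π : ℂ) * (((ep n) ^ 2 / (‖z‖ ^ 2 + (ep n) ^ 2) ^ 2 : ℝ) : ℂ) := fun n z => by
    have hp := ep_pos n
    have hd : ∀ v, dd v (u n) z = (1 / π : ℂ) * (star z *
        (-((((‖z‖ ^ 2 + ep n ^ 2) ^ 2)⁻¹ : ℝ) : ℂ) * (2 * (z.re * v.re + z.im * v.im) : ℝ)) +
        star v * (((‖z‖ ^ 2 + ep n ^ 2)⁻¹ : ℝ) : ℂ)) := fun v => by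
      have d1 := (hstar.differentiable (by simp)) z
      have d2 := ((hn n).differentiable (by simp)) z
      have hh : HasDerivAt (fun s : ℝ => (((s + ep n ^ 2)⁻¹ : ℝ) : ℂ))
          (-((((‖z‖ ^ 2 + ep n ^ 2) ^ 2)⁻¹ : ℝ) : ℂ)) (‖z‖ ^ 2) := by
        have := ((hasDerivAt_id (‖z‖ ^ 2)).add_const (ep n ^ 2)).inv
          (by simp only [id]; positivity)
        refine this.ofReal_comp.congr_deriv ?_
        simp; ring
      have e := dd_const_mul (v := v) (c := (1 / π : ℂ)) (d1.mul d2)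
      have e2 := dd_mul (v := v) d1 d2
      rw [hdstar, dd_radial hh] at e2
      exact e.trans (congrArg _ e2)
    have hs : star z * z = ((‖z‖ ^ 2 : ℝ) : ℂ) := by
      rw [Complex.star_def, ← Complex.normSq_eq_conj_mul_self, Complex.normSq_eq_norm_sq]
    have hz : ((z.re : ℂ) + Complex.I * z.im) = z := by rw [mul_comm]; exact Complex.re_add_im z
    have ht : ((‖z‖ ^ 2 + ep n ^ 2 : ℝ) : ℂ) ≠ 0 := by
      have : 0 < ‖z‖ ^ 2 + ep n ^ 2 := by positivity
      exact_mod_cast this.ne'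
    rw [dbar, hd, hd]
    simp only [Complex.one_re, Complex.one_im, Complex.I_re, Complex.I_im, mul_one, mul_zero,
      add_zero, zero_add, star_one]
    have hI : star Complex.I = -Complex.I := by simp
    rw [hI]
    push_cast at hs ht ⊢
    rw [div_eq_mul_inv ((ep n : ℂ) ^ 2)]
    have e1 : ((‖z‖ : ℂ) ^ 2 + (ep n : ℂ) ^ 2)⁻¹ =
        (((‖z‖ : ℂ) ^ 2 + (ep n : ℂ) ^ 2) ^ 2)⁻¹ * ((‖z‖ : ℂ) ^ 2 + (ep n : ℂ) ^ 2) := by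
      field_simp
    rw [e1]
    generalize (((‖z‖ : ℂ) ^ 2 + (ep n : ℂ) ^ 2) ^ 2)⁻¹ = T
    rw [← hs]
    linear_combination (-(1 / π : ℂ) * star z * T) * hz -
      (1 / π : ℂ) * T * (star z * z + (ep n : ℂ) ^ 2) / 2 * Complex.I_sq
  have hlim : Tendsto (fun n => ∫ z : ℂ, u n z * dbar φ z) atTop (𝓝 (-φ 0)) := by
    have := ((approx_id (H := fun _ => (1 / π : ℂ)) continuous_const hφ.continuous hc)).neg
    have hpi : (π : ℂ) ≠ 0 := by exact_mod_cast Real.pi_ne_zero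
    convert this using 2
    · rw [integral_mul_dbar (huc _) hφ hc]
      congr 1
      refine integral_congr_ae (Eventually.of_forall fun z => ?_)
      simp only [hdu]; ring
    · field_simp
  have hlim2 : Tendsto (fun n => ∫ z : ℂ, u n z * dbar φ z) atTop (𝓝 (∫ z, ck z * dbar φ z)) := by
    have hψc := dbar_contDiff hφ
    have hψs := dbar_compact hc
    obtain ⟨N, hN⟩ := hψc.continuous.bounded_above_of_compact_support hψs
    have hne : ∀ᵐ z : ℂ, z ≠ 0 := compl_mem_ae_iff.2 (measure_singleton (0:ℂ))
    have hi : Integrable fun z => ck z * dbar φ z := by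
      have := locInt_ck.integrable_smul_right_of_hasCompactSupport hψc.continuous hψs
      simpa using this
    refine tendsto_integral_of_dominated_convergence _ (fun n => ?_) hi.norm (fun n => ?_) ?_
    · exact ((huc n).continuous.mul hψc.continuous).aestronglyMeasurable
    · filter_upwards [hne] with z hz
      have hz' : 0 < ‖z‖ := norm_pos_iff.2 hz
      rw [norm_mul (u n z), norm_mul (ck z)]
      refine mul_le_mul_of_nonneg_right ?_ (norm_nonneg _)
      rw [norm_ck]
      simp only [hu, norm_mul, norm_star, Complex.norm_real]
      rw [norm_div, norm_one, Complex.norm_real, Real.norm_of_nonneg Real.pi_pos.le,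
        Real.norm_of_nonneg (by positivity)]
      gcongr
      have : (‖z‖ ^ 2 + ep n ^ 2)⁻¹ ≤ (‖z‖ ^ 2)⁻¹ := by
        gcongr; have := sq_nonneg (ep n); linarith
      calc _ ≤ ‖z‖ * (‖z‖ ^ 2)⁻¹ := by gcongr
        _ = _ := by field_simp
    · filter_upwards [hne] with z hz
      have hz' : 0 < ‖z‖ := norm_pos_iff.2 hz
      refine Tendsto.mul_const _ ?_
      have h1 : Tendsto (fun n => (((‖z‖ ^ 2 + ep n ^ 2)⁻¹ : ℝ) : ℂ)) atTop
          (𝓝 (((‖z‖ ^ 2)⁻¹ : ℝ) : ℂ)) := by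
        refine (Complex.continuous_ofReal.tendsto _).comp (Tendsto.inv₀ ?_ (by positivity))
        simpa using (ep_tendsto.pow 2).const_add (‖z‖ ^ 2)
      have h2 := (h1.const_mul (star z)).const_mul (1 / π : ℂ)
      convert h2 using 2
      have hs : star z * z = ((‖z‖ ^ 2 : ℝ) : ℂ) := by
        rw [Complex.star_def, ← Complex.normSq_eq_conj_mul_self, Complex.normSq_eq_norm_sq]
      have hsz : star z ≠ 0 := by simpa using hz
      rw [Complex.ofReal_inv, ← hs, ck]
      have hpi : (π : ℂ) ≠ 0 := by exact_mod_cast Real.pi_ne_zero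
      field_simp
  exact tendsto_nhds_unique hlim2 hlim

lemma cv_eq_integral (k f : ℂ → ℂ) (x : ℂ) : cv k f x = ∫ w, k w * f (x - w) := by
  rw [← integral_sub_left_eq_self _ volume x]
  simp [cv]

lemma cv_eq_convolution (k f : ℂ → ℂ) :
    cv k f = convolution k f (ContinuousLinearMap.mul ℝ ℂ) volume := by
  funext x
  rw [cv_eq_integral]; rfl

lemma cv_contDiff {k χ : ℂ → ℂ} (hk : LocallyIntegrable k) (hχ : ContDiff ℝ ∞ χ)
    (hc : HasCompactSupport χ) : ContDiff ℝ ∞ (cv k χ) := by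
  rw [cv_eq_convolution]
  exact hc.contDiff_convolution_right _ hk hχ

lemma dd_cv {k χ : ℂ → ℂ} (hk : LocallyIntegrable k) (hχ : ContDiff ℝ ∞ χ)
    (hc : HasCompactSupport χ) (v : ℂ) : dd v (cv k χ) = cv k (dd v χ) := by
  funext x
  rw [cv_eq_convolution, cv_eq_convolution, dd,
    (hc.hasFDerivAt_convolution_right (ContinuousLinearMap.mul ℝ ℂ) hk
      (hχ.of_le (by simp)) x).fderiv]
  exact convolution_precompR_apply _ hk (hc.fderiv ℝ) (hχ.continuous_fderiv (by simp)) x v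

lemma cv_integrable {k χ : ℂ → ℂ} (hk : LocallyIntegrable k) (hχ : Continuous χ)
    (hc : HasCompactSupport χ) (x : ℂ) : Integrable fun z => k (x - z) * χ z := by
  have h : LocallyIntegrable fun z => k (x - z) := by
    refine locallyIntegrable_iff.2 fun K hK => ?_
    have h2 := hk.integrableOn_isCompact (hK.image (continuous_const.sub continuous_id : Continuous fun z : ℂ => x - z))
    have hmp : MeasurePreserving (fun z : ℂ => x - z) volume volume :=
      Measure.measurePreserving_sub_left volume x
    have := (hmp.integrableOn_comp_preimage (Homeomorph.subLeft x).measurableEmbedding (f := k)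
      (s := (fun z : ℂ => x - z) '' K)).2 h2
    exact this.mono_set (subset_preimage_image _ _)
  have := h.integrable_smul_right_of_hasCompactSupport hχ hc
  simpa using this

lemma cv_add {k f g : ℂ → ℂ} {x : ℂ} (hf : Integrable fun z => k (x - z) * f z)
    (hg : Integrable fun z => k (x - z) * g z) :
    cv k (fun z => f z + g z) x = cv k f x + cv k g x := by
  simp only [cv, mul_add]; exact integral_add hf hg

lemma cv_const_mul (k f : ℂ → ℂ) (c x : ℂ) : cv k (fun z => c * f z) x = c * cv k f x := by
  simp only [cv, ← integral_const_mul]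
  congr 1; funext z; ring

lemma dd_reflect (v : ℂ) (f : ℂ → ℂ) (x z : ℂ) :
    dd v (fun w => f (x - w)) z = -dd v f (x - z) := by
  have h1 : (fun w => f (x - w)) = fun w => (fun y => f (x + y)) (-w) := by
    funext w; simp [sub_eq_add_neg]
  have h2 := (ContinuousLinearEquiv.neg ℝ (M := ℂ)).comp_right_fderiv (f := fun y => f (x + y))
    (x := z)
  simp only [dd]
  rw [h1]
  change (fderiv ℝ ((fun y => f (x + y)) ∘ (ContinuousLinearEquiv.neg ℝ (M := ℂ))) z) v = _
  rw [h2, fderiv_comp_add_left]; simp [sub_eq_add_neg]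

lemma dd_neg (v : ℂ) (f : ℂ → ℂ) (z : ℂ) : dd v (fun w => -f w) z = -dd v f z := by
  simp only [dd]
  rw [show (fun w => -f w) = -f from rfl, fderiv_neg]; rfl

lemma lap_reflect (f : ℂ → ℂ) (x z : ℂ) : lap (fun w => f (x - w)) z = lap f (x - z) := by
  have h : ∀ v, dd v (fun w => f (x - w)) = fun z => -dd v f (x - z) := fun v =>
    funext fun z => dd_reflect v f x z
  simp only [lap, h]
  rw [dd_neg, dd_neg, dd_reflect, dd_reflect]; ring

lemma dbar_reflect (f : ℂ → ℂ) (x z : ℂ) : dbar (fun w => f (x - w)) z = -dbar f (x - z) := by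
  simp only [dbar, dd_reflect]; ring

lemma hasCompactSupport_reflect {φ : ℂ → ℂ} (hc : HasCompactSupport φ) (x : ℂ) :
    HasCompactSupport fun w => φ (x - w) :=
  hc.comp_homeomorph (Homeomorph.subLeft x)

lemma contDiff_reflect {φ : ℂ → ℂ} (h : ContDiff ℝ ∞ φ) (x : ℂ) :
    ContDiff ℝ ∞ fun w => φ (x - w) := h.comp (contDiff_const.sub contDiff_id)

theorem cv_green {φ : ℂ → ℂ} (hφ : ContDiff ℝ ∞ φ) (hc : HasCompactSupport φ) (κ : ℝ) (x : ℂ) :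
    cv (gG κ) (fun z => lap φ z + κ ^ 2 * φ z) x = -φ x := by
  rw [cv_eq_integral]
  have := green_fund κ (contDiff_reflect hφ x) (hasCompactSupport_reflect hc x)
  simpa only [lap_reflect, sub_zero] using this

theorem cv_cauchy {φ : ℂ → ℂ} (hφ : ContDiff ℝ ∞ φ) (hc : HasCompactSupport φ) (x : ℂ) :
    cv ck (dbar φ) x = φ x := by
  rw [cv_eq_integral]
  have := cauchy_fund (contDiff_reflect hφ x) (hasCompactSupport_reflect hc x)
  simp only [dbar_reflect, sub_zero, mul_neg, integral_neg, neg_inj] at this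
  exact this

lemma lap_cv {k χ : ℂ → ℂ} (hk : LocallyIntegrable k) (hχ : ContDiff ℝ ∞ χ)
    (hc : HasCompactSupport χ) : lap (cv k χ) = cv k (lap χ) := by
  funext x
  have h : ∀ v, dd v (dd v (cv k χ)) = cv k (dd v (dd v χ)) := fun v => by
    rw [dd_cv hk hχ hc, dd_cv hk (dd_contDiff hχ v) (dd_compact hc v)]
  have hi : ∀ v, Integrable fun z => k (x - z) * dd v (dd v χ) z := fun v =>
    cv_integrable hk (dd_contDiff (dd_contDiff hχ v) v).continuous (dd_compact (dd_compact hc v) v) x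
  rw [lap, h, h, ← cv_add (hi _) (hi _)]; rfl

lemma helmholtz_cv_green {χ : ℂ → ℂ} (hχ : ContDiff ℝ ∞ χ) (hc : HasCompactSupport χ) (κ : ℝ)
    (x : ℂ) : lap (cv (gG κ) χ) x + κ ^ 2 * cv (gG κ) χ x = -χ x := by
  rw [lap_cv (locInt_gG κ) hχ hc, ← cv_const_mul, ← cv_add, cv_green hχ hc]
  · exact cv_integrable (locInt_gG κ) (lap_contDiff hχ).continuous (lap_compact hc) x
  · exact cv_integrable (locInt_gG κ) (continuous_const.mul hχ.continuous)
      (hc.mul_left (f := fun _ => (κ ^ 2 : ℂ))) x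

lemma dbar_cv_cauchy {χ : ℂ → ℂ} (hχ : ContDiff ℝ ∞ χ) (hc : HasCompactSupport χ)
    (x : ℂ) : dbar (cv ck χ) x = χ x := by
  have hi : ∀ v, Integrable fun z => ck (x - z) * dd v χ z := fun v =>
    cv_integrable locInt_ck (dd_contDiff hχ v).continuous (dd_compact hc v) x
  have hi2 : Integrable fun z => ck (x - z) * (Complex.I * dd Complex.I χ z) := by
    refine ((hi Complex.I).const_mul Complex.I).congr (Eventually.of_forall fun z => ?_)
    simp only; ring
  have e := cv_cauchy hχ hc x
  rw [show dbar χ = fun z => (1 / 2) * (dd 1 χ z + Complex.I * dd Complex.I χ z) from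
    funext fun z => by simp only [dbar]; ring, cv_const_mul, cv_add (hi 1) hi2, cv_const_mul] at e
  rw [← e, dbar, dd_cv locInt_ck hχ hc, dd_cv locInt_ck hχ hc]; ring

/-- Compactly supported smooth functions are in `L2B`. -/
lemma L2B.of_smooth {φ : ℂ → ℂ} (hφ : Continuous φ) (hc : HasCompactSupport φ) :
    ∃ R, L2B R φ := by
  obtain ⟨R, hR⟩ := hc.isCompact.isBounded.subset_closedBall 0
  refine ⟨R, hφ.memLp_of_hasCompactSupport hc, fun z hz => ?_⟩
  refine image_eq_zero_of_notMem_tsupport fun h => ?_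
  have := hR h
  simp only [mem_closedBall_zero_iff] at this
  linarith

lemma cv_gG_reflect (κ : ℝ) (g : ℂ → ℂ) : cv (fun w => gG κ (-w)) g = cv (gG κ) g := by
  simp only [gG_neg]

/-- The distributional equation `(Δ + κ²)(G * f) = -f`. -/
theorem integral_cv_green {R : ℝ} {f : ℂ → ℂ} (hf : L2B R f) (κ : ℝ) {φ : ℂ → ℂ}
    (hφ : ContDiff ℝ ∞ φ) (hc : HasCompactSupport φ) :
    ∫ x, cv (gG κ) f x * (lap φ x + κ ^ 2 * φ x) = -∫ z, f z * φ z := by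
  have c1 : Continuous fun x => lap φ x + κ ^ 2 * φ x :=
    (lap_contDiff hφ).continuous.add (continuous_const.mul hφ.continuous)
  have c2 : HasCompactSupport fun x => lap φ x + κ ^ 2 * φ x :=
    (lap_compact hc).add (f' := fun x => κ ^ 2 * φ x) (hc.mul_left (f := fun _ => (κ ^ 2 : ℂ)))
  obtain ⟨S, hS⟩ := L2B.of_smooth c1 c2
  rw [integral_cv_mul (locInt_gG κ) (hf.mono (le_max_left R S)) (hS.mono (le_max_right R S)),
    cv_gG_reflect]
  simp only [cv_green hφ hc, mul_neg, integral_neg]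

/-- The weak equation `(Δ + κ²) P = -g` tested against all smooth functions. -/
def WF (κ : ℝ) (P g : ℂ → ℂ) : Prop :=
  ∀ φ : ℂ → ℂ, ContDiff ℝ ∞ φ → ∫ z, g z * φ z = -∫ z, P z * (lap φ z + κ ^ 2 * φ z)

lemma dd_eventuallyEq {f g : ℂ → ℂ} {z : ℂ} (h : f =ᶠ[𝓝 z] g) (v : ℂ) :
    dd v f =ᶠ[𝓝 z] dd v g := by
  filter_upwards [h.eventuallyEq_nhds] with w hw
  simp only [dd, hw.fderiv_eq]

lemma lap_eventuallyEq {f g : ℂ → ℂ} {z : ℂ} (h : f =ᶠ[𝓝 z] g) : lap f z = lap g z := by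
  simp only [lap]
  rw [(dd_eventuallyEq (dd_eventuallyEq h _) _).eq_of_nhds,
    (dd_eventuallyEq (dd_eventuallyEq h _) _).eq_of_nhds]

lemma exists_cutoff (R : ℝ) : ∃ η : ℂ → ℂ, ContDiff ℝ ∞ η ∧ HasCompactSupport η ∧
    (∀ z, ‖z‖ < R + 1 → η z = 1) := by
  rcases le_or_gt (R + 1) 0 with h | h
  · exact ⟨0, contDiff_const, HasCompactSupport.zero, fun z hz => by
      linarith [norm_nonneg z]⟩
  · let b : ContDiffBump (0 : ℂ) := ⟨R + 1, R + 2, h, by linarith⟩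
    refine ⟨fun z => (b z : ℂ), Complex.ofRealCLM.contDiff.comp b.contDiff, ?_, fun z hz => ?_⟩
    · exact b.hasCompactSupport.comp_left (g := fun x : ℝ => (x : ℂ)) rfl
    · have := b.one_of_mem_closedBall (x := z) (by simpa [b] using hz.le)
      simp [this]

/-- It suffices to test against compactly supported functions if everything has bounded support. -/
lemma WF.of_compact {κ R : ℝ} {P g : ℂ → ℂ} (hP : ∀ z, R < ‖z‖ → P z = 0)
    (hg : ∀ z, R < ‖z‖ → g z = 0)
    (h : ∀ φ : ℂ → ℂ, ContDiff ℝ ∞ φ → HasCompactSupport φ →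
      ∫ z, g z * φ z = -∫ z, P z * (lap φ z + κ ^ 2 * φ z)) : WF κ P g := by
  intro φ hφ
  obtain ⟨η, h1, h2, h3⟩ := exists_cutoff R
  have := h (fun z => η z * φ z) (h1.mul hφ) (h2.mul_right)
  have e : ∀ z, ‖z‖ ≤ R → (fun z => η z * φ z) =ᶠ[𝓝 z] φ := fun z hz => by
    have : {w : ℂ | ‖w‖ < R + 1} ∈ 𝓝 z :=
      (isOpen_lt continuous_norm continuous_const).mem_nhds (by simp; linarith)
    filter_upwards [this] with w hw
    rw [h3 w hw, one_mul]
  have e1 : ∀ z, g z * (η z * φ z) = g z * φ z := fun z => by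
    rcases le_or_gt ‖z‖ R with hz | hz
    · have := (e z hz).eq_of_nhds; rw [this]
    · simp [hg z hz]
  have e2 : ∀ z, P z * (lap (fun z => η z * φ z) z + κ ^ 2 * (η z * φ z)) =
      P z * (lap φ z + κ ^ 2 * φ z) := fun z => by
    rcases le_or_gt ‖z‖ R with hz | hz
    · have := (e z hz).eq_of_nhds; rw [this, lap_eventuallyEq (e z hz)]
    · simp [hP z hz]
  simpa only [e1, e2] using this

lemma WF.of_green {κ R : ℝ} {P g : ℂ → ℂ} (hg : L2B R g) (hP : ∀ z, R < ‖z‖ → P z = 0)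
    (h : P =ᵐ[volume] cv (gG κ) g) : WF κ P g := by
  refine WF.of_compact hP hg.supp fun φ hφ hc => ?_
  rw [integral_congr_ae (f := fun z => P z * (lap φ z + κ ^ 2 * φ z))
    (g := fun z => cv (gG κ) g z * (lap φ z + κ ^ 2 * φ z))
    (h.mono fun z hz => by simp only [hz]), integral_cv_green hg κ hφ hc, neg_neg]

/-- The regular radial solution. -/
def jJ (κ : ℝ) (z : ℂ) : ℂ := gA κ ((‖z‖ ^ 2 : ℝ) : ℂ)

lemma jJ_contDiff (κ : ℝ) : ContDiff ℝ ∞ (jJ κ) := by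
  have h1 : ContDiff ℝ ∞ (gA κ) := ((gA_diff κ).contDiff (n := ∞)).restrict_scalars ℝ
  exact h1.comp (Complex.ofRealCLM.contDiff.comp (contDiff_norm_sq ℝ))

lemma jJ_helmholtz (κ : ℝ) (z : ℂ) : lap (jJ κ) z + κ ^ 2 * jJ κ z = 0 := by
  have h := lap_radial (z := z) (h := fun s : ℝ => gA κ s)
    (h' := fun s : ℝ => deriv (gA κ) s) (h'' := fun s : ℝ => deriv (deriv (gA κ)) s)
    (fun s _ => (gA_diff κ s).hasDerivAt.comp_ofReal)
    (fun s _ => (gA'_diff κ s).hasDerivAt.comp_ofReal)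
  have h2 := gA_ode κ ((‖z‖ ^ 2 : ℝ) : ℂ)
  rw [show jJ κ = fun w => gA κ ((‖w‖ ^ 2 : ℝ) : ℂ) from rfl, h]
  linear_combination 4 * h2

lemma WF.jJ_cv {κ : ℝ} {P g : ℂ → ℂ} (h : WF κ P g) (x : ℂ) : cv (jJ κ) g x = 0 := by
  have := h (fun z => jJ κ (x - z)) (contDiff_reflect (jJ_contDiff κ) x)
  simp only [lap_reflect, jJ_helmholtz, mul_zero, integral_zero, neg_zero] at this
  rw [← this, cv]
  congr 1; funext z; ring

lemma WF.eq_green {κ R : ℝ} {P g : ℂ → ℂ} (h : WF κ P g) (hP : LocallyIntegrable P)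
    (hg : L2B R g) : P =ᵐ[volume] cv (gG κ) g := by
  have hG : LocallyIntegrable (cv (gG κ) g) := by
    refine locallyIntegrable_iff.2 fun K hK => ?_
    obtain ⟨S, hS⟩ := hK.isBounded.subset_closedBall 0
    have h1 := (hg.cv (locInt_gG κ) (measurable_gG κ) S).integrable
    exact ((integrable_indicator_iff Metric.isClosed_closedBall.measurableSet).1 h1).mono_set hS
  refine ae_eq_of_integral_contDiff_smul_eq hP hG fun χ hχ hc => ?_
  set X : ℂ → ℂ := fun z => (χ z : ℂ)
  have hX : ContDiff ℝ ∞ X := Complex.ofRealCLM.contDiff.comp hχ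
  have hXc : HasCompactSupport X := hc.comp_left (g := fun x : ℝ => (x : ℂ)) rfl
  obtain ⟨S, hS⟩ := L2B.of_smooth hX.continuous hXc
  have h1 := h (cv (gG κ) X) (cv_contDiff (locInt_gG κ) hX hXc)
  simp only [helmholtz_cv_green hX hXc, mul_neg, integral_neg, neg_neg] at h1
  have h2 := integral_cv_mul (locInt_gG κ) (hg.mono (le_max_left R S)) (hS.mono (le_max_right R S))
  rw [cv_gG_reflect, h1] at h2
  simp only [Complex.real_smul]
  calc _ = ∫ a, P a * X a := by congr 1; funext z; exact mul_comm _ _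
    _ = _ := by rw [← h2]; congr 1; funext z; exact mul_comm _ _

lemma cv_comm (k f : ℂ → ℂ) : cv k f = cv f k := by
  funext x
  rw [cv_eq_integral, cv]
  congr 1; funext z; exact mul_comm _ _

lemma dd_star (v : ℂ) (f : ℂ → ℂ) (z : ℂ) : dd v (fun w => star (f w)) z = star (dd v f z) := by
  have : (fun w => star (f w)) = Complex.conjCLE ∘ f := rfl
  simp only [dd]
  rw [this, ContinuousLinearEquiv.comp_fderiv]; rfl

lemma lap_star (f : ℂ → ℂ) (z : ℂ) : lap (fun w => star (f w)) z = star (lap f z) := by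
  have h : ∀ v, dd v (fun w => star (f w)) = fun z => star (dd v f z) := fun v =>
    funext fun z => dd_star v f z
  simp only [lap, h, dd_star, star_add]

lemma contDiff_star {f : ℂ → ℂ} (h : ContDiff ℝ ∞ f) : ContDiff ℝ ∞ fun z => star (f z) :=
  Complex.conjCLE.contDiff.comp h

lemma compact_star {f : ℂ → ℂ} (h : HasCompactSupport f) : HasCompactSupport fun z => star (f z) :=
  h.comp_left (g := fun z : ℂ => star z) (star_zero _)

/-- Convolution of an entire smooth kernel with a function of bounded support is smooth. -/
lemma cv_contDiff_of_smooth {k f : ℂ → ℂ} (hk : ContDiff ℝ ∞ k) {R : ℝ} (hf : L2B R f) :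
    ContDiff ℝ ∞ (cv k f) := by
  refine contDiff_iff_contDiffAt.2 fun x => ?_
  obtain ⟨η, h1, h2, h3⟩ := exists_cutoff (‖x‖ + R)
  have h := cv_contDiff hf.integrable.locallyIntegrable (h1.mul hk) h2.mul_right
  refine h.contDiffAt.congr_of_eventuallyEq ?_
  have : {w : ℂ | ‖w‖ < ‖x‖ + 1} ∈ 𝓝 x :=
    (isOpen_lt continuous_norm continuous_const).mem_nhds (by simp)
  filter_upwards [this] with w hw
  rw [cv_comm f, cv, cv]
  congr 1; funext z
  rcases le_or_gt ‖z‖ R with hz | hz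
  · rw [h3 _ (by have := norm_sub_le w z; have hw' : ‖w‖ < ‖x‖ + 1 := hw; linarith), one_mul]
  · simp [hf.supp z hz]

lemma cv_smooth_integrable {k g : ℂ → ℂ} (hk : Continuous k) {R : ℝ} (hg : L2B R g) (x : ℂ) :
    Integrable fun z => k (x - z) * g z := by
  obtain ⟨η, h1, h2, h3⟩ := exists_cutoff (‖x‖ + R)
  have := hg.integrable.locallyIntegrable.integrable_smul_right_of_hasCompactSupport
    (g := fun z => η (x - z) * k (x - z))
    ((h1.continuous.comp (continuous_const.sub continuous_id)).mul
      (hk.comp (continuous_const.sub continuous_id)))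
    (hasCompactSupport_reflect (φ := fun z => η z * k z) h2.mul_right x)
  refine this.congr (Eventually.of_forall fun z => ?_)
  rcases le_or_gt ‖z‖ R with hz | hz
  · simp only [smul_eq_mul]
    rw [h3 _ (by have := norm_sub_le x z; linarith), one_mul, mul_comm]
  · simp [hg.supp z hz]

lemma gG_re_im (κ : ℝ) {z : ℂ} (hz : z ≠ 0) : ((gG κ z).im : ℂ) = -π * jJ κ z := by
  have hz' : 0 < ‖z‖ := norm_pos_iff.2 hz
  rw [gG, gF_im κ (‖z‖ ^ 2) (by positivity), jJ, gA_ofReal]; simp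

lemma L2B.re {R : ℝ} {f : ℂ → ℂ} (hf : L2B R f) : L2B R fun z => ((f z).re : ℂ) :=
  ⟨(hf.memLp.re).ofReal, fun z hz => by simp [hf.supp z hz]⟩

lemma L2B.im {R : ℝ} {f : ℂ → ℂ} (hf : L2B R f) : L2B R fun z => ((f z).im : ℂ) :=
  ⟨(hf.memLp.im).ofReal, fun z hz => by simp [hf.supp z hz]⟩

lemma two_I_im (z : ℂ) : (z.im : ℂ) = (2 * Complex.I)⁻¹ * (z - star z) := by
  have : z - star z = (2 * z.im : ℝ) * Complex.I := Complex.sub_conj z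
  rw [this]
  have := Complex.I_ne_zero
  push_cast
  field_simp

lemma wf_im {κ R : ℝ} {f : ℂ → ℂ} (hf : L2B R f)
    (h : ∀ z, R < ‖z‖ → (cv (gG κ) f z).im = 0) :
    WF κ (fun z => ((cv (gG κ) f z).im : ℂ)) (fun z => ((f z).im : ℂ)) := by
  refine WF.of_compact (R := R) (fun z hz => by simp [h z hz]) hf.im.supp fun φ hφ hc => ?_
  set ψ : ℂ → ℂ := fun x => lap φ x + κ ^ 2 * φ x with hψ
  have c1 : Continuous ψ :=
    (lap_contDiff hφ).continuous.add (continuous_const.mul hφ.continuous)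
  have c2 : HasCompactSupport ψ :=
    (lap_compact hc).add (f' := fun x => κ ^ 2 * φ x) (hc.mul_left (f := fun _ => (κ ^ 2 : ℂ)))
  have c1' : Continuous fun z => star (ψ z) := c1.star
  have e1 := integral_cv_green hf κ hφ hc
  have e2 := integral_cv_green hf κ (contDiff_star hφ) (compact_star hc)
  have eψ : ∀ x, lap (fun w => star (φ w)) x + (κ : ℂ) ^ 2 * star (φ x) = star (ψ x) := fun x => by
    rw [lap_star]; simp [hψ]
  simp only [eψ] at e2
  have e2' := congrArg star e2
  have conj_int : ∀ F : ℂ → ℂ, star (∫ z, F z) = ∫ z, star (F z) := fun F =>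
    (integral_conj (f := F)).symm
  rw [star_neg, conj_int, conj_int] at e2'
  simp only [star_mul', star_star] at e2'
  obtain ⟨S, hS⟩ := L2B.of_smooth c1 c2
  obtain ⟨S', hS'⟩ := L2B.of_smooth c1' (compact_star c2)
  have i1 : Integrable fun x => cv (gG κ) f x * ψ x :=
    cv_mul_integrable (locInt_gG κ) (hf.mono (le_max_left R S)) (hS.mono (le_max_right R S))
  have i2 : Integrable fun x => star (cv (gG κ) f x) * ψ x := by
    have i2 := cv_mul_integrable (locInt_gG κ) (hf.mono (le_max_left R S'))
      (hS'.mono (le_max_right R S'))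
    have := (Complex.conjCLE : ℂ →L[ℝ] ℂ).integrable_comp i2
    refine this.congr (Eventually.of_forall fun z => ?_)
    simp
  have i3 : Integrable fun x => f x * φ x := by
    have := hf.integrable.locallyIntegrable.integrable_smul_right_of_hasCompactSupport
      hφ.continuous hc
    refine this.congr (Eventually.of_forall fun z => ?_)
    simp [mul_comm]
  have i4 : Integrable fun x => star (f x) * φ x := by
    have := ((Complex.conjCLE : ℂ →L[ℝ] ℂ).integrable_comp
      hf.integrable).locallyIntegrable.integrable_smul_right_of_hasCompactSupport
      hφ.continuous hc
    refine this.congr (Eventually.of_forall fun z => ?_)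
    simp [mul_comm]
  have r1 : ∀ z, ((cv (gG κ) f z).im : ℂ) * ψ z =
      (2 * Complex.I)⁻¹ * (cv (gG κ) f z * ψ z - star (cv (gG κ) f z) * ψ z) := fun z => by
    rw [two_I_im]; ring
  have r2 : ∀ z, ((f z).im : ℂ) * φ z =
      (2 * Complex.I)⁻¹ * (f z * φ z - star (f z) * φ z) := fun z => by
    rw [two_I_im]; ring
  have e1' : ∫ z, cv (gG κ) f z * ψ z = -∫ z, f z * φ z := e1
  change _ = -∫ z, ((cv (gG κ) f z).im : ℂ) * ψ z
  simp only [r1, r2]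
  rw [integral_const_mul, integral_const_mul, integral_sub i1 i2, integral_sub i3 i4, e1', e2']
  ring

lemma cv_jJ_im_re {κ R : ℝ} {f : ℂ → ℂ} (hf : L2B R f) {x : ℂ}
    (hi : Integrable fun z => gG κ (x - z) * f z) :
    ((cv (gG κ) f x).im : ℂ) = -π * cv (jJ κ) (fun z => ((f z).re : ℂ)) x +
      ((cv (gG κ) (fun z => ((f z).im : ℂ)) x).re : ℂ) := by
  have hj := fun g (hg : L2B R g) => cv_smooth_integrable (jJ_contDiff κ).continuous hg x
  have hne : ∀ᵐ z : ℂ, x - z ≠ 0 := by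
    have : ∀ᵐ z : ℂ, z ≠ x := compl_mem_ae_iff.2 (measure_singleton x)
    filter_upwards [this] with z hz h
    exact hz (sub_eq_zero.1 h).symm
  have him : Integrable fun z => ((gG κ (x - z) * f z).im : ℂ) := (hi.im).ofReal
  have hGi : (fun z => ((gG κ (x - z) * ((f z).im : ℂ)).re : ℂ)) =ᵐ[volume]
      fun z => ((gG κ (x - z) * f z).im : ℂ) + π * (jJ κ (x - z) * ((f z).re : ℂ)) := by
    filter_upwards [hne] with z hz
    have := gG_re_im κ hz
    have e : ((gG κ (x - z) * f z).im : ℂ) = ((gG κ (x - z) * ((f z).im : ℂ)).re : ℂ) +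
        ((gG κ (x - z)).im : ℂ) * ((f z).re : ℂ) := by
      rw [← Complex.ofReal_mul, ← Complex.ofReal_add]
      congr 1; simp [Complex.mul_im]
    rw [e, this]; ring
  have hi2 : Integrable fun z => gG κ (x - z) * ((f z).im : ℂ) := by
    refine (hi.norm).mono' ?_ (Eventually.of_forall fun z => ?_)
    · exact (((measurable_gG κ).comp (measurable_const.sub measurable_id)).aestronglyMeasurable).mul
        hf.im.memLp.1
    · rw [norm_mul, norm_mul]
      gcongr
      rw [Complex.norm_real]; exact Complex.abs_im_le_norm _
  have e1 : ((cv (gG κ) f x).im : ℂ) = ∫ z, ((gG κ (x - z) * f z).im : ℂ) := by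
    exact (congrArg _ (integral_im hi)).symm.trans integral_ofReal.symm
  have e2 : ((cv (gG κ) (fun z => ((f z).im : ℂ)) x).re : ℂ) =
      ∫ z, ((gG κ (x - z) * ((f z).im : ℂ)).re : ℂ) := by
    exact (congrArg _ (integral_re hi2)).symm.trans integral_ofReal.symm
  rw [e1, e2, integral_congr_ae hGi, integral_add him ((hj _ hf.re).const_mul _),
    integral_const_mul]
  simp only [cv]
  ring

/-- If the imaginary part of `G * f` has bounded support, then `J * f = 0`. -/
theorem jJ_cv_eq_zero {κ R : ℝ} {f : ℂ → ℂ} (hf : L2B R f)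
    (h : ∀ z, R < ‖z‖ → (cv (gG κ) f z).im = 0) (x : ℂ) : cv (jJ κ) f x = 0 := by
  have hw := wf_im hf h
  have hL : L2B R fun z => ((cv (gG κ) f z).im : ℂ) := by
    have h1 := (hf.cv (locInt_gG κ) (measurable_gG κ) R).im
    convert h1 using 1
    funext z
    rcases le_or_gt ‖z‖ R with hz | hz
    · rw [cut_of_le hz]
    · rw [cut_of_lt hz, h z hz]; simp
  have h1 := hw.jJ_cv
  have h2 := hw.eq_green hL.integrable.locallyIntegrable hf.im
  have hre : ∀ x, cv (jJ κ) (fun z => ((f z).re : ℂ)) x = 0 := by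
    have hc := (cv_contDiff_of_smooth (jJ_contDiff κ) hf.re).continuous
    have : cv (jJ κ) (fun z => ((f z).re : ℂ)) =ᵐ[volume] fun _ => 0 := by
      filter_upwards [h2, ae_integrable_cv (locInt_gG κ) hf] with x hx hi
      have e := cv_jJ_im_re hf hi
      rw [← hx, Complex.ofReal_re] at e
      have hpi : (π : ℂ) ≠ 0 := by exact_mod_cast Real.pi_ne_zero
      have : (π : ℂ) * cv (jJ κ) (fun z => ((f z).re : ℂ)) x = 0 := by linear_combination e
      exact (mul_eq_zero.1 this).resolve_left hpi
    have := (hc.ae_eq_iff_eq volume continuous_const).1 this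
    exact fun x => congrFun this x
  have hj := fun g (hg : L2B R g) => cv_smooth_integrable (jJ_contDiff κ).continuous hg x
  have e : f = fun z => ((f z).re : ℂ) + Complex.I * ((f z).im : ℂ) := by
    funext z; rw [mul_comm]; exact (Complex.re_add_im _).symm
  rw [e, cv_add (hj _ hf.re), hre x, cv_const_mul, h1 x]
  · simp
  · refine ((hj _ hf.im).const_mul Complex.I).congr (Eventually.of_forall fun z => ?_)
    simp only; ring

/-- The formal power series `∑ aₙ uⁿ` in a Banach algebra. -/
def algSeries {𝒜 : Type*} [NormedCommRing 𝒜] [NormedAlgebra ℝ 𝒜] (a : ℕ → 𝒜) :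
    FormalMultilinearSeries ℝ 𝒜 𝒜 := fun n =>
  (ContinuousLinearMap.mul ℝ 𝒜 (a n)).compContinuousMultilinearMap
    (ContinuousMultilinearMap.mkPiAlgebraFin ℝ n 𝒜)

lemma algSeries_apply {𝒜 : Type*} [NormedCommRing 𝒜] [NormedAlgebra ℝ 𝒜] (a : ℕ → 𝒜) (n : ℕ)
    (u : 𝒜) : algSeries a n (fun _ => u) = a n * u ^ n := by
  simp [algSeries, List.ofFn_const]

lemma algSeries_hasSum {𝒜 : Type*} [NormedCommRing 𝒜] [NormedAlgebra ℝ 𝒜] [CompleteSpace 𝒜]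
    (a : ℕ → 𝒜) {M r : ℝ} (hr : 0 < r) (h : ∀ n, ‖a n‖ * r ^ n ≤ M) :
    AnalyticAt ℝ (algSeries a).sum 0 ∧
      ∀ u : 𝒜, ‖u‖ < r → HasSum (fun n => a n * u ^ n) ((algSeries a).sum u) := by
  have hb : ∀ n, ‖algSeries a n‖ * r ^ n ≤ M * (1 + ‖(1 : 𝒜)‖) := fun n => by
    have h1 : ‖algSeries a n‖ ≤ ‖a n‖ * (1 + ‖(1 : 𝒜)‖) := by
      refine ContinuousMultilinearMap.opNorm_le_bound (by positivity) fun m => ?_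
      have : algSeries a n m = a n * (List.ofFn m).prod := by simp [algSeries]
      rw [this]
      refine (norm_mul_le _ _).trans ?_
      rw [mul_assoc]
      gcongr
      rcases n with _ | n
      · simp
      · have := List.norm_prod_le' (l := List.ofFn m) (by simp)
        rw [List.map_ofFn, List.prod_ofFn (f := _ ∘ _)] at this
        refine this.trans ?_
        have h0 : 0 ≤ ∏ i, ‖m i‖ := Finset.prod_nonneg fun _ _ => norm_nonneg _
        have h2 := norm_nonneg (1 : 𝒜)
        simp only [Function.comp]
        nlinarith
    have h0 := norm_nonneg (1 : 𝒜)
    calc _ ≤ ‖a n‖ * (1 + ‖(1 : 𝒜)‖) * r ^ n := by gcongr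
      _ = (‖a n‖ * r ^ n) * (1 + ‖(1 : 𝒜)‖) := by ring
      _ ≤ _ := by gcongr; exact h n
  have hrad : ENNReal.ofReal r ≤ (algSeries a).radius := by
    have := (algSeries a).le_radius_of_bound (r := r.toNNReal) (M * (1 + ‖(1 : 𝒜)‖))
      (by intro n; rw [Real.coe_toNNReal r hr.le]; exact hb n)
    simpa [ENNReal.ofReal] using this
  have hpos : 0 < (algSeries a).radius := lt_of_lt_of_le (by simpa using hr) hrad
  have hS := (algSeries a).hasFPowerSeriesOnBall hpos
  refine ⟨hS.analyticAt, fun u hu => ?_⟩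
  have hmem : u ∈ Metric.eball (0 : 𝒜) (algSeries a).radius := by
    refine Metric.eball_subset_eball hrad ?_
    rw [mem_eball_zero_iff, ← ofReal_norm]
    exact (ENNReal.ofReal_lt_ofReal_iff hr).2 hu
  have := hS.hasSum hmem
  simpa [algSeries_apply] using this

lemma gF_differentiableOn (κ : ℝ) : DifferentiableOn ℂ (gF κ) Complex.slitPlane := by
  intro t ht
  exact (((gA_diff κ).differentiableAt.mul (Complex.differentiableAt_log ht)).add
    (gE_diff κ).differentiableAt).differentiableWithinAt

lemma taylor_gF_bound (κ : ℝ) {δ T : ℝ} (hδ : 0 < δ) :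
    ∃ M, ∀ t : ℝ, δ ≤ t → t ≤ T → ∀ n : ℕ,
      ‖iteratedDeriv n (gF κ) t / n.factorial‖ * (δ / 2) ^ n ≤ M := by
  set S : Set ℂ := {w | δ / 2 ≤ w.re ∧ ‖w‖ ≤ T + δ}
  have hS : IsCompact S := by
    refine (isCompact_closedBall (0 : ℂ) (T + δ)).of_isClosed_subset ?_ ?_
    · exact (isClosed_le continuous_const Complex.continuous_re).inter
        (isClosed_le continuous_norm continuous_const)
    · intro w hw
      have hw' : δ / 2 ≤ w.re ∧ ‖w‖ ≤ T + δ := hw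
      simpa using hw'.2
  have hsub : S ⊆ Complex.slitPlane := fun w hw => by
    have hw' : δ / 2 ≤ w.re ∧ ‖w‖ ≤ T + δ := hw
    exact Or.inl (by linarith [hw'.1])
  obtain ⟨M, hM⟩ := hS.exists_bound_of_continuousOn ((gF_differentiableOn κ).continuousOn.mono hsub)
  refine ⟨M, fun t ht hT n => ?_⟩
  have hball : Metric.closedBall (t : ℂ) (δ / 2) ⊆ S := fun w hw => by
    have hw' : ‖w - t‖ ≤ δ / 2 := by simpa [dist_eq_norm] using hw
    constructor
    · have := (Complex.abs_re_le_norm (w - t)).trans hw'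
      rw [abs_le] at this
      simp at this
      linarith [this.1]
    · calc ‖w‖ = ‖(w - t) + t‖ := by ring_nf
        _ ≤ ‖w - t‖ + ‖(t : ℂ)‖ := norm_add_le _ _
        _ ≤ δ / 2 + t := by
          gcongr
          rw [Complex.norm_real, Real.norm_of_nonneg (by linarith)]
        _ ≤ _ := by linarith
  have := Complex.norm_iteratedDeriv_le_of_forall_mem_sphere_norm_le (c := (t : ℂ)) (C := M) n
    (half_pos hδ) (f := gF κ)
    (DifferentiableOn.diffContOnCl_ball ((gF_differentiableOn κ).mono hsub) hball)
    (fun z hz => hM z (hball (Metric.sphere_subset_closedBall hz)))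
  rw [norm_div, Complex.norm_natCast]
  have hf : (0:ℝ) < n.factorial := by positivity
  rw [div_mul_eq_mul_div, div_le_iff₀ hf]
  have h2 : 0 < (δ / 2) ^ n := by positivity
  rw [le_div_iff₀ h2] at this
  linarith

lemma gF_taylor (κ : ℝ) {δ t : ℝ} (hδ : 0 < δ) (ht : δ ≤ t) {d : ℂ} (hd : ‖d‖ < δ / 2) :
    HasSum (fun n : ℕ => iteratedDeriv n (gF κ) t / n.factorial * d ^ n) (gF κ (t + d)) := by
  have hball : Metric.ball (t : ℂ) (δ / 2) ⊆ Complex.slitPlane := fun w hw => by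
    have hw' : ‖w - t‖ < δ / 2 := by simpa [dist_eq_norm] using hw
    have := (Complex.abs_re_le_norm (w - t)).trans hw'.le
    rw [abs_le] at this
    simp at this
    exact Or.inl (by linarith [this.1])
  have := Complex.hasSum_taylorSeries_on_ball (f := gF κ) (c := (t : ℂ)) (r := (δ / 2).toNNReal)
    (z := t + d) ((gF_differentiableOn κ).mono (by rwa [Real.coe_toNNReal _ (by linarith)]))
    (by simpa [dist_eq_norm, Real.coe_toNNReal _ (half_pos hδ).le] using hd)
  have e : (fun n : ℕ => iteratedDeriv n (gF κ) t / n.factorial * d ^ n) = fun n : ℕ =>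
      (n.factorial : ℂ)⁻¹ • ((t : ℂ) + d - t) ^ n • iteratedDeriv n (gF κ) t := by
    funext n
    rw [smul_eq_mul, smul_eq_mul, add_sub_cancel_left]; ring
  rw [e]; exact this

/-- Green potentials are real-analytic away from the support of the density. -/
theorem analyticAt_cv_green (κ : ℝ) {R δ : ℝ} (hδ : 0 < δ) {f : ℂ → ℂ} (hf : L2B R f) {x₀ : ℂ}
    (h : ∀ᵐ z, z ∈ Metric.ball x₀ δ → f z = 0) : AnalyticAt ℝ (cv (gG κ) f) x₀ := by
  set Z : Set ℂ := Metric.closedBall 0 R \ Metric.ball x₀ δ with hZ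
  have hZc : IsCompact Z := (isCompact_closedBall _ _).diff Metric.isOpen_ball
  have : CompactSpace Z := isCompact_iff_compactSpace.1 hZc
  have hZd : ∀ z ∈ Z, δ ≤ ‖x₀ - z‖ ∧ ‖x₀ - z‖ ≤ ‖x₀‖ + R := fun z hz => by
    have h1 : ‖z‖ ≤ R := by simpa using hz.1
    have h2 : ¬ dist z x₀ < δ := hz.2
    rw [dist_comm, dist_eq_norm] at h2
    exact ⟨not_lt.1 h2, (norm_sub_le _ _).trans (by linarith)⟩
  obtain ⟨M, hM⟩ := taylor_gF_bound κ (T := (‖x₀‖ + R) ^ 2) (pow_pos hδ 2)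
  have hZt : ∀ z ∈ Z, δ ^ 2 ≤ ‖x₀ - z‖ ^ 2 ∧ ‖x₀ - z‖ ^ 2 ≤ (‖x₀‖ + R) ^ 2 := fun z hz => by
    obtain ⟨h1, h2⟩ := hZd z hz
    exact ⟨by gcongr, by gcongr⟩
  have hcont : ∀ n : ℕ, Continuous fun z : Z =>
      iteratedDeriv n (gF κ) ((‖x₀ - z‖ ^ 2 : ℝ) : ℂ) / n.factorial := fun n => by
    refine Continuous.div_const ?_ _
    have hA : AnalyticOnNhd ℂ (gF κ) Complex.slitPlane :=
      (gF_differentiableOn κ).analyticOnNhd Complex.isOpen_slitPlane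
    have h1 : ContinuousOn (iteratedDeriv n (gF κ)) Complex.slitPlane := by
      rw [iteratedDeriv_eq_iterate]
      exact (hA.iterated_deriv n).continuousOn
    refine h1.comp_continuous (by fun_prop) fun z => Or.inl ?_
    have := (hZt z z.2).1
    rw [Complex.ofReal_re]
    exact lt_of_lt_of_le (pow_pos hδ 2) this
  let a : ℕ → C(Z, ℂ) := fun n => ⟨_, hcont n⟩
  have ha : ∀ n, ‖a n‖ * (δ ^ 2 / 2) ^ n ≤ max M 0 := fun n => by
    have h2 : 0 < (δ ^ 2 / 2) ^ n := by positivity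
    rw [← le_div_iff₀ h2, ContinuousMap.norm_le _ (by positivity)]
    intro z
    rw [le_div_iff₀ h2]
    exact (hM _ (hZt z z.2).1 (hZt z z.2).2 n).trans (le_max_left _ _)
  obtain ⟨hA, hs⟩ := algSeries_hasSum a (half_pos (pow_pos hδ 2)) ha
  let D : ℂ → C(Z, ℂ) := fun x => ⟨fun z => ((‖x - z‖ ^ 2 - ‖x₀ - z‖ ^ 2 : ℝ) : ℂ), by fun_prop⟩
  have hD : AnalyticAt ℝ D x₀ := by
    let p : C(Z, ℂ) := ⟨fun z => (z : ℂ), by fun_prop⟩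
    let q : C(Z, ℂ) := ⟨fun z => starRingEnd ℂ z, by fun_prop⟩
    let c : C(Z, ℂ) := ⟨fun z => ((‖x₀ - z‖ ^ 2 : ℝ) : ℂ), by fun_prop⟩
    have e : D = fun x => (algebraMap ℂ C(Z, ℂ) x - p) *
        (algebraMap ℂ C(Z, ℂ) (Complex.conjCLE x) - q) - c := by
      funext x; ext z
      simp only [D, p, q, c, ContinuousMap.coe_mk, ContinuousMap.sub_apply, ContinuousMap.mul_apply]
      rw [Complex.ofReal_sub, ← Complex.normSq_eq_norm_sq, Complex.normSq_eq_conj_mul_self]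
      simp; ring
    have hal : ∀ y, AnalyticAt ℝ (fun x => algebraMap ℂ C(Z, ℂ) x) y := fun y =>
      ((Algebra.linearMap ℂ C(Z, ℂ)).restrictScalars ℝ).toContinuousLinearMap.analyticAt y
    rw [e]
    exact ((hal _).sub analyticAt_const |>.mul
      (((hal _).comp (Complex.conjCLE.toContinuousLinearMap.analyticAt _)).sub
        analyticAt_const)).sub analyticAt_const
  have hD0 : D x₀ = 0 := by ext z; simp [D]
  let ℓ : C(Z, ℂ) →ₗ[ℝ] ℂ :=
    { toFun := fun g => ∫ z : Z, g z * f z ∂(Measure.comap Subtype.val volume)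
      map_add' := fun g g' => by
        have hfi : Integrable (fun z : Z => f z) (Measure.comap Subtype.val volume) :=
          (integrableOn_iff_comap_subtypeVal hZc.measurableSet).1 hf.integrable.integrableOn
        have hi : ∀ g : C(Z, ℂ), Integrable (fun z : Z => g z * f z)
            (Measure.comap Subtype.val volume) := fun g =>
          hfi.bdd_mul (c := ‖g‖) g.continuous.aestronglyMeasurable
            (Eventually.of_forall fun z => g.norm_coe_le_norm z)
        rw [← integral_add (hi _) (hi _)]
        congr 1; funext z; simp; ring
      map_smul' := fun c g => by
        rw [RingHom.id_apply, ← integral_smul]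
        congr 1; funext z; simp [mul_assoc] }
  have hfi : Integrable (fun z : Z => f z) (Measure.comap Subtype.val volume) :=
    (integrableOn_iff_comap_subtypeVal hZc.measurableSet).1 hf.integrable.integrableOn
  let L : C(Z, ℂ) →L[ℝ] ℂ := ℓ.mkContinuous
    (∫ z : Z, ‖f z‖ ∂(Measure.comap Subtype.val volume)) fun g => by
      refine (norm_integral_le_integral_norm _).trans ?_
      rw [← integral_mul_const]
      refine integral_mono_of_nonneg (Eventually.of_forall fun z => norm_nonneg _)
        (hfi.norm.mul_const _) (Eventually.of_forall fun z => ?_)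
      simp only [norm_mul]
      rw [mul_comm]
      gcongr
      exact g.norm_coe_le_norm z
  have hLA : AnalyticAt ℝ (fun x => L ((algSeries a).sum (D x))) x₀ := by
    refine (L.analyticAt _).comp ?_
    have hA' : AnalyticAt ℝ (algSeries a).sum (D x₀) := by rw [hD0]; exact hA
    exact hA'.comp hD
  refine hLA.congr ?_
  have hsm : ∀ᶠ x in 𝓝 x₀, ‖D x‖ < δ ^ 2 / 2 := by
    have : Tendsto (fun x => ‖D x‖) (𝓝 x₀) (𝓝 0) := by
      have := hD.continuousAt.norm
      rw [ContinuousAt, hD0, norm_zero] at this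
      exact this
    exact this.eventually (gt_mem_nhds (by positivity))
  filter_upwards [hsm] with x hx
  have hval : ∀ z : Z, (algSeries a).sum (D x) z = gG κ (x - z) := fun z => by
    have h1 := (hs _ hx).map (ContinuousMap.evalCLM ℂ z) (ContinuousMap.evalCLM ℂ z).continuous
    have hz : ‖D x z‖ < δ ^ 2 / 2 := lt_of_le_of_lt ((D x).norm_coe_le_norm z) hx
    have h2 := gF_taylor κ (pow_pos hδ 2) (hZt z z.2).1 hz
    have h3 := h1.unique (by convert h2 using 2; simp [a])
    rw [show ContinuousMap.evalCLM ℂ z ((algSeries a).sum (D x)) = (algSeries a).sum (D x) z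
      from rfl] at h3
    rw [h3, gG]
    congr 1
    simp [D]
  show ∫ z : Z, _ * f z ∂_ = _
  rw [cv]
  calc _ = ∫ z : Z, gG κ (x - z) * f z ∂(Measure.comap Subtype.val volume) := by
        congr 1; funext z; rw [hval]
    _ = ∫ z in Z, gG κ (x - z) * f z := integral_subtype_comap hZc.measurableSet
        (fun z => gG κ (x - z) * f z)
    _ = _ := by
      rw [← integral_indicator hZc.measurableSet]
      refine integral_congr_ae ?_
      filter_upwards [h] with z hz
      by_cases hzZ : z ∈ Z
      · rw [indicator_of_mem hzZ]
      · rw [indicator_of_notMem hzZ]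
        have : f z = 0 := by
          by_cases hb : z ∈ Metric.ball x₀ δ
          · exact hz hb
          · refine hf.supp z (not_le.1 fun hle => hzZ ⟨by simpa using hle, hb⟩)
        rw [this, mul_zero]

lemma dd_cv_smooth {k f : ℂ → ℂ} (hk : ContDiff ℝ ∞ k) {R : ℝ} (hf : L2B R f) (v x : ℂ) :
    dd v (cv k f) x = cv (dd v k) f x := by
  obtain ⟨η, h1, h2, h3⟩ := exists_cutoff (‖x‖ + R)
  have hev : ∀ w z : ℂ, ‖w‖ < ‖x‖ + 1 → ‖z‖ ≤ R → (fun z => η z * k z) =ᶠ[𝓝 (w - z)] k := by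
    intro w z hw hz
    have : {u : ℂ | ‖u‖ < ‖x‖ + R + 1} ∈ 𝓝 (w - z) :=
      (isOpen_lt continuous_norm continuous_const).mem_nhds
        (by have := norm_sub_le w z; show ‖w - z‖ < _; linarith)
    filter_upwards [this] with u hu
    rw [h3 u hu, one_mul]
  have hcv : cv k f =ᶠ[𝓝 x] cv f (fun z => η z * k z) := by
    have : {w : ℂ | ‖w‖ < ‖x‖ + 1} ∈ 𝓝 x :=
      (isOpen_lt continuous_norm continuous_const).mem_nhds (by simp)
    filter_upwards [this] with w hw
    rw [cv_comm f, cv, cv]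
    congr 1; funext z
    rcases le_or_gt ‖z‖ R with hz | hz
    · rw [(hev w z hw hz).eq_of_nhds]
    · simp [hf.supp z hz]
  rw [(dd_eventuallyEq hcv v).eq_of_nhds,
    dd_cv hf.integrable.locallyIntegrable (h1.mul hk) h2.mul_right, cv_comm f, cv, cv]
  congr 1; funext z
  rcases le_or_gt ‖z‖ R with hz | hz
  · rw [(dd_eventuallyEq (hev x z (by simp) hz) v).eq_of_nhds]
  · simp [hf.supp z hz]

/-- Iterated derivatives of the regular profile. -/
def gD (κ : ℝ) (n : ℕ) : ℂ → ℂ := iteratedDeriv n (gA κ)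

lemma gD_zero (κ : ℝ) : gD κ 0 = gA κ := iteratedDeriv_zero

lemma gD_diff (κ : ℝ) (n : ℕ) : Differentiable ℂ (gD κ n) :=
  (((gA_diff κ).contDiff (n := ⊤)).differentiable_iteratedDeriv n (by exact_mod_cast WithTop.coe_lt_top _))

lemma gD_succ (κ : ℝ) (n : ℕ) : deriv (gD κ n) = gD κ (n + 1) := iteratedDeriv_succ.symm

lemma gD_hasDerivAt (κ : ℝ) (n : ℕ) (t : ℂ) : HasDerivAt (gD κ n) (gD κ (n + 1) t) t := by
  rw [← gD_succ]; exact (gD_diff κ n t).hasDerivAt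

lemma gD_ode (κ : ℝ) (n : ℕ) (t : ℂ) :
    t * gD κ (n + 2) t + (n + 1) * gD κ (n + 1) t + (κ ^ 2 / 4 : ℂ) * gD κ n t = 0 := by
  induction n generalizing t with
  | zero =>
    have := gA_ode κ t
    rw [← gD_zero, gD_succ, gD_succ] at this
    simpa using this
  | succ n ih =>
    have h : HasDerivAt (fun t => t * gD κ (n + 2) t + (n + 1) * gD κ (n + 1) t +
        (κ ^ 2 / 4 : ℂ) * gD κ n t) (1 * gD κ (n + 2) t + t * gD κ (n + 3) t +
        (n + 1) * gD κ (n + 2) t + (κ ^ 2 / 4 : ℂ) * gD κ (n + 1) t) t :=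
      (((hasDerivAt_id t).mul (gD_hasDerivAt κ (n + 2) t)).add
        ((gD_hasDerivAt κ (n + 1) t).const_mul _)).add ((gD_hasDerivAt κ n t).const_mul _)
    have h0 : (fun t => t * gD κ (n + 2) t + (n + 1) * gD κ (n + 1) t +
        (κ ^ 2 / 4 : ℂ) * gD κ n t) = fun _ => 0 := funext ih
    rw [h0] at h
    have := h.unique (hasDerivAt_const t (0 : ℂ))
    push_cast
    linear_combination this

lemma gD_zero_ne {κ : ℝ} (hκ : κ ≠ 0) (n : ℕ) : gD κ n 0 ≠ 0 := by
  induction n with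
  | zero =>
    rw [gD_zero, gA_zero]
    have : (π : ℂ) ≠ 0 := by exact_mod_cast Real.pi_ne_zero
    simp [this]
  | succ n ih =>
    intro h
    have := gD_ode κ n 0
    rw [h] at this
    have hκ' : (κ : ℂ) ≠ 0 := by exact_mod_cast hκ
    have : (κ ^ 2 / 4 : ℂ) * gD κ n 0 = 0 := by linear_combination this
    rcases mul_eq_zero.1 this with h | h
    · exact absurd h (by simp [hκ'])
    · exact ih h

/-- The coordinate `z` (for `σ = 1`) or its conjugate (for `σ = -1`). -/
def cw (σ : ℂ) : ℂ →L[ℝ] ℂ :=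
  Complex.ofRealCLM.comp Complex.reCLM + (σ * Complex.I) • Complex.ofRealCLM.comp Complex.imCLM

lemma cw_apply (σ z : ℂ) : cw σ z = z.re + σ * Complex.I * z.im := by simp [cw]

/-- Cylindrical solutions of the Helmholtz equation. -/
def kn (κ : ℝ) (σ : ℂ) (n : ℕ) (z : ℂ) : ℂ := gD κ n ((‖z‖ ^ 2 : ℝ) : ℂ) * cw σ z ^ n

lemma kn_contDiff (κ : ℝ) (σ : ℂ) (n : ℕ) : ContDiff ℝ ∞ (kn κ σ n) := by
  have h1 : ContDiff ℝ ∞ (gD κ n) := ((gD_diff κ n).contDiff (n := ∞)).restrict_scalars ℝ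
  have h2 : ContDiff ℝ ∞ fun z : ℂ => ((‖z‖ ^ 2 : ℝ) : ℂ) :=
    Complex.ofRealCLM.contDiff.comp (contDiff_norm_sq ℝ)
  exact (h1.comp h2).mul ((cw σ).contDiff.pow n)

lemma dd_kn (κ : ℝ) (σ : ℂ) (n : ℕ) (v z : ℂ) : dd v (kn κ σ n) z =
    gD κ n ((‖z‖ ^ 2 : ℝ) : ℂ) * (n * cw σ z ^ (n - 1) * cw σ v) +
      gD κ (n + 1) ((‖z‖ ^ 2 : ℝ) : ℂ) * (2 * (z.re * v.re + z.im * v.im) : ℝ) * cw σ z ^ n := by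
  have hD := (gD_hasDerivAt κ n ((‖z‖ ^ 2 : ℝ) : ℂ)).comp_ofReal
  have h1 : ContDiff ℝ ∞ (gD κ n) := ((gD_diff κ n).contDiff (n := ∞)).restrict_scalars ℝ
  have h2 : ContDiff ℝ ∞ fun z : ℂ => ((‖z‖ ^ 2 : ℝ) : ℂ) :=
    Complex.ofRealCLM.contDiff.comp (contDiff_norm_sq ℝ)
  have hp : HasFDerivAt (fun z => cw σ z ^ n) ((n * cw σ z ^ (n - 1)) • cw σ) z := by
    have := (cw σ).hasFDerivAt (x := z) |>.pow n
    simpa using this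
  have := dd_mul (f := fun z : ℂ => gD κ n ((‖z‖ ^ 2 : ℝ) : ℂ)) (g := fun z => cw σ z ^ n) (z := z)
    ((h1.comp h2).differentiable (by simp) z) hp.differentiableAt v
  unfold kn
  rw [this]
  congr 1
  · rw [dd, hp.fderiv]; simp
  · rw [dd_radial (h := fun t : ℝ => gD κ n t) hD]

lemma kn_succ (κ : ℝ) {σ : ℂ} (hσ : σ ^ 2 = 1) (n : ℕ) (z : ℂ) :
    kn κ σ (n + 1) z =
      (dd 1 (kn κ σ n) z + σ * Complex.I * dd Complex.I (kn κ σ n) z) / 2 := by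
  rw [dd_kn, dd_kn, kn]
  simp only [cw_apply]
  simp
  have hI : Complex.I ^ 2 = -1 := Complex.I_sq
  have : σ * Complex.I * (σ * Complex.I) = -1 := by rw [← sq, mul_pow, hσ, hI]; ring
  ring_nf
  rw [hI, hσ]
  ring

/-- The moments of a density annihilated by the regular kernel vanish. -/
lemma cv_kn_eq_zero {κ R : ℝ} {f : ℂ → ℂ} (hf : L2B R f) (h : ∀ x, cv (jJ κ) f x = 0)
    {σ : ℂ} (hσ : σ ^ 2 = 1) (n : ℕ) (x : ℂ) : cv (kn κ σ n) f x = 0 := by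
  induction n generalizing x with
  | zero =>
    rw [← h x]; congr 1; funext z; simp [kn, gD_zero, jJ]
  | succ n ih =>
    have h0 : cv (kn κ σ n) f = fun _ => 0 := funext ih
    have hd : ∀ v, cv (dd v (kn κ σ n)) f x = 0 := fun v => by
      rw [← dd_cv_smooth (kn_contDiff κ σ n) hf, h0]; simp [dd]
    have hi : ∀ v, Integrable fun z => dd v (kn κ σ n) (x - z) * f z := fun v =>
      cv_smooth_integrable (dd_contDiff (kn_contDiff κ σ n) v).continuous hf x
    have e : cv (kn κ σ (n + 1)) f x = (1 / 2) * cv (dd 1 (kn κ σ n)) f x +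
        (σ * Complex.I / 2) * cv (dd Complex.I (kn κ σ n)) f x := by
      simp only [cv]
      rw [← integral_const_mul, ← integral_const_mul, ← integral_add ((hi _).const_mul _)
        ((hi _).const_mul _)]
      congr 1; funext z
      rw [kn_succ κ hσ]; ring
    rw [e, hd, hd]; simp

lemma integral_kn_eq_zero {κ R : ℝ} {f : ℂ → ℂ} (hf : L2B R f) (h : ∀ x, cv (jJ κ) f x = 0)
    {σ : ℂ} (hσ : σ ^ 2 = 1) (n : ℕ) : ∫ z, kn κ σ n z * f z = 0 := by
  have := cv_kn_eq_zero hf h hσ n 0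
  rw [cv] at this
  have e : ∀ z, kn κ σ n (0 - z) * f z = (-1) ^ n * (kn κ σ n z * f z) := fun z => by
    rw [zero_sub, kn, kn, norm_neg, map_neg, neg_pow]; ring
  simp only [e] at this
  rw [integral_const_mul] at this
  exact (mul_eq_zero.1 this).resolve_left (by simp)

/-- Stability estimate for the Goursat problem `∂ᵤ∂ᵥ y = c y` on the unit square. -/
lemma goursat_bound {y p : ℝ → ℝ → ℂ} {c : ℂ} {c₀ ε : ℝ} (hc : ‖c‖ ≤ c₀)
    (hcont : ContinuousOn (fun q : ℝ × ℝ => y q.1 q.2) (Icc 0 1 ×ˢ Icc 0 1))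
    (h1 : ∀ u ∈ Icc (0:ℝ) 1, ∀ v ∈ Icc (0:ℝ) 1, HasDerivAt (fun v => y u v) (p u v) v)
    (h2 : ∀ u ∈ Icc (0:ℝ) 1, ∀ v ∈ Icc (0:ℝ) 1, HasDerivAt (fun u => p u v) (c * y u v) u)
    (hu : ∀ u ∈ Icc (0:ℝ) 1, ‖y u 0‖ ≤ ε) (hv : ∀ v ∈ Icc (0:ℝ) 1, ‖y 0 v‖ ≤ ε) :
    ‖y 1 1‖ ≤ 6 * ε * Real.exp (2 * (1 + 2 * c₀)) := by
  set l := 1 + 2 * c₀ with hl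
  have hc0 : 0 ≤ c₀ := (norm_nonneg _).trans hc
  have hl1 : 1 ≤ l := by linarith
  have hε : 0 ≤ ε := (norm_nonneg _).trans (hu 0 (by simp))
  obtain ⟨q, hq, hmax⟩ := (isCompact_Icc.prod isCompact_Icc).exists_isMaxOn (s := Icc (0:ℝ) 1 ×ˢ Icc (0:ℝ) 1)
    ⟨(0, 0), by simp⟩ (f := fun q : ℝ × ℝ => ‖y q.1 q.2‖ * Real.exp (-(l * q.1)) * Real.exp (-(l * q.2)))
    ((hcont.norm.mul (by fun_prop)).mul (by fun_prop))
  set N := ‖y q.1 q.2‖ * Real.exp (-(l * q.1)) * Real.exp (-(l * q.2)) with hN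
  have hN0 : 0 ≤ N := by positivity
  have hyN : ∀ u ∈ Icc (0:ℝ) 1, ∀ v ∈ Icc (0:ℝ) 1, ‖y u v‖ ≤ N * Real.exp (l * u) * Real.exp (l * v) := by
    intro u hu v hv
    have : ‖y u v‖ * Real.exp (-(l * u)) * Real.exp (-(l * v)) ≤ N := hmax (show (u, v) ∈ _ from ⟨hu, hv⟩)
    calc ‖y u v‖ = (‖y u v‖ * Real.exp (-(l * u)) * Real.exp (-(l * v))) * Real.exp (l * u) *
          Real.exp (l * v) := by
          rw [Real.exp_neg, Real.exp_neg]; field_simp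
      _ ≤ _ := by gcongr
  have hexp : ∀ (a : ℝ) (x : ℝ), HasDerivAt (fun x => a * Real.exp (l * x) / l)
      (a * Real.exp (l * x)) x := fun a x => by
    have := (((hasDerivAt_id x).const_mul l).exp.const_mul a).div_const l
    refine this.congr_deriv ?_
    simp only [id]; field_simp
  have hp : ∀ u ∈ Icc (0:ℝ) 1, ∀ v ∈ Icc (0:ℝ) 1,
      ‖p u v - p 0 v‖ ≤ c₀ * N * Real.exp (l * v) * Real.exp (l * u) / l := by
    intro u hu v hv
    refine image_norm_le_of_norm_deriv_right_le_deriv_boundary (a := 0) (b := 1)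
      (f := fun u => p u v - p 0 v) (f' := fun u => c * y u v)
      (B := fun u => c₀ * N * Real.exp (l * v) * Real.exp (l * u) / l)
      (B' := fun u => c₀ * N * Real.exp (l * v) * Real.exp (l * u))
      (fun w hw => ((h2 w hw v hv).sub_const _).continuousAt.continuousWithinAt)
      (fun w hw => ((h2 w ⟨hw.1, hw.2.le⟩ v hv).sub_const _).hasDerivWithinAt) ?_
      (fun x => hexp _ x) (fun w hw => ?_) hu
    · simp; positivity
    · rw [norm_mul]
      calc ‖c‖ * ‖y w v‖ ≤ c₀ * (N * Real.exp (l * w) * Real.exp (l * v)) := by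
            gcongr; exact hyN w ⟨hw.1, hw.2.le⟩ v hv
        _ = _ := by ring
  have hy : ∀ u ∈ Icc (0:ℝ) 1, ∀ v ∈ Icc (0:ℝ) 1,
      ‖y u v - y 0 v - (y u 0 - y 0 0)‖ ≤
        (c₀ * N * Real.exp (l * u) / l) * Real.exp (l * v) / l := by
    intro u hu v hv
    refine image_norm_le_of_norm_deriv_right_le_deriv_boundary (a := 0) (b := 1)
      (f := fun v => y u v - y 0 v - (y u 0 - y 0 0)) (f' := fun v => p u v - p 0 v)
      (B := fun v => (c₀ * N * Real.exp (l * u) / l) * Real.exp (l * v) / l)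
      (B' := fun v => (c₀ * N * Real.exp (l * u) / l) * Real.exp (l * v))
      (fun w hw => (((h1 u hu w hw).sub (h1 0 (by simp) w hw)).sub_const _).continuousAt.continuousWithinAt)
      (fun w hw => (((h1 u hu w ⟨hw.1, hw.2.le⟩).sub (h1 0 (by simp) w ⟨hw.1, hw.2.le⟩)).sub_const _).hasDerivWithinAt) ?_
      (fun x => hexp _ x) (fun w hw => ?_) hv
    · simp; positivity
    · refine (hp u hu w ⟨hw.1, hw.2.le⟩).trans (le_of_eq (by ring))
  have hl2 : c₀ / l ^ 2 ≤ 1 / 2 := by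
    rw [div_le_iff₀ (by positivity)]; nlinarith
  have hNe : N ≤ 6 * ε := by
    have h3 := hy q.1 hq.1 q.2 hq.2
    have h4 : ‖y q.1 q.2‖ ≤ 3 * ε + (c₀ / l ^ 2) * N * Real.exp (l * q.1) * Real.exp (l * q.2) := by
      have e : y q.1 q.2 = (y q.1 q.2 - y 0 q.2 - (y q.1 0 - y 0 0)) + (y 0 q.2 + y q.1 0 - y 0 0) := by
        ring
      have h5 : ‖y 0 q.2 + y q.1 0 - y 0 0‖ ≤ 3 * ε := by
        refine (norm_sub_le _ _).trans ?_
        have := norm_add_le (y 0 q.2) (y q.1 0)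
        linarith [hv q.2 hq.2, hu q.1 hq.1, hu 0 (by simp)]
      rw [e]
      refine (norm_add_le _ _).trans ?_
      have e2 : c₀ * N * Real.exp (l * q.1) / l * Real.exp (l * q.2) / l =
        (c₀ / l ^ 2) * N * Real.exp (l * q.1) * Real.exp (l * q.2) := by field_simp
      rw [e2] at h3
      linarith
    have hE1 : Real.exp (-(l * q.1)) ≤ 1 := Real.exp_le_one_iff.2 (by
      have := hq.1.1; nlinarith)
    have hE2 : Real.exp (-(l * q.2)) ≤ 1 := Real.exp_le_one_iff.2 (by
      have := hq.2.1; nlinarith)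
    have h6 : N ≤ 3 * ε * (Real.exp (-(l * q.1)) * Real.exp (-(l * q.2))) + (c₀ / l ^ 2) * N := by
      calc N ≤ (3 * ε + (c₀ / l ^ 2) * N * Real.exp (l * q.1) * Real.exp (l * q.2)) *
            Real.exp (-(l * q.1)) * Real.exp (-(l * q.2)) := by rw [hN]; gcongr
        _ = _ := by rw [Real.exp_neg, Real.exp_neg]; field_simp
    have h7 : Real.exp (-(l * q.1)) * Real.exp (-(l * q.2)) ≤ 1 :=
      mul_le_one₀ hE1 (by positivity) hE2
    nlinarith
  calc ‖y 1 1‖ ≤ N * Real.exp (l * 1) * Real.exp (l * 1) := hyN 1 (by simp) 1 (by simp)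
    _ = N * Real.exp (2 * l) := by rw [mul_assoc, ← Real.exp_add]; ring_nf
    _ ≤ _ := by gcongr

/-- Holomorphic solutions of `∂_ζ ∂_ξ W = -(κ²/4) W` on the bidisc of radius `r`. -/
structure GS (κ r : ℝ) (W Wd : ℂ → ℂ → ℂ) : Prop where
  cont : ContinuousOn (fun q : ℂ × ℂ => W q.1 q.2) (Metric.ball 0 r ×ˢ Metric.ball 0 r)
  d1 : ∀ ζ ξ : ℂ, ‖ζ‖ < r → ‖ξ‖ < r → HasDerivAt (fun ξ => W ζ ξ) (Wd ζ ξ) ξ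
  d2 : ∀ ζ ξ : ℂ, ‖ζ‖ < r → ‖ξ‖ < r →
    HasDerivAt (fun ζ => Wd ζ ξ) (-(κ ^ 2 / 4 : ℂ) * W ζ ξ) ζ

lemma GS.sub {κ r : ℝ} {W Wd V Vd : ℂ → ℂ → ℂ} (h : GS κ r W Wd) (h' : GS κ r V Vd) :
    GS κ r (fun ζ ξ => W ζ ξ - V ζ ξ) (fun ζ ξ => Wd ζ ξ - Vd ζ ξ) :=
  ⟨h.cont.sub h'.cont, fun ζ ξ h1 h2 => (h.d1 ζ ξ h1 h2).sub (h'.d1 ζ ξ h1 h2),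
    fun ζ ξ h1 h2 => ((h.d2 ζ ξ h1 h2).sub (h'.d2 ζ ξ h1 h2)).congr_deriv (by ring)⟩

lemma GS.sum {κ r : ℝ} {W Wd : ℕ → ℂ → ℂ → ℂ} (h : ∀ n, GS κ r (W n) (Wd n)) (c : ℕ → ℂ) (N : ℕ) :
    GS κ r (fun ζ ξ => ∑ n ∈ Finset.range N, c n * W n ζ ξ)
      (fun ζ ξ => ∑ n ∈ Finset.range N, c n * Wd n ζ ξ) := by
  refine ⟨continuousOn_finsetSum _ fun n _ => continuousOn_const.mul (h n).cont,
    fun ζ ξ h1 h2 => HasDerivAt.fun_sum fun n _ => ((h n).d1 ζ ξ h1 h2).const_mul _,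
    fun ζ ξ h1 h2 => ?_⟩
  refine (HasDerivAt.fun_sum fun n _ => ((h n).d2 ζ ξ h1 h2).const_mul (c n)).congr_deriv ?_
  rw [Finset.mul_sum]
  exact Finset.sum_congr rfl fun n _ => by ring

lemma GS.bound {κ r ρ ε : ℝ} {W Wd : ℂ → ℂ → ℂ} (h : GS κ r W Wd) (hρ : ρ < r)
    (h1 : ∀ ζ : ℂ, ‖ζ‖ ≤ ρ → ‖W ζ 0‖ ≤ ε) (h2 : ∀ ξ : ℂ, ‖ξ‖ ≤ ρ → ‖W 0 ξ‖ ≤ ε) {z : ℂ}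
    (hz : ‖z‖ ≤ ρ) :
    ‖W z (starRingEnd ℂ z)‖ ≤ 6 * ε * Real.exp (2 * (1 + 2 * (κ ^ 2 / 4 * ρ ^ 2))) := by
  have hu : ∀ u ∈ Icc (0:ℝ) 1, ‖(u : ℂ) * z‖ ≤ ρ := fun u hu => by
    rw [norm_mul, Complex.norm_real, Real.norm_of_nonneg hu.1]
    calc u * ‖z‖ ≤ 1 * ‖z‖ := by gcongr; exact hu.2
      _ ≤ ρ := by linarith
  have hv : ∀ u ∈ Icc (0:ℝ) 1, ‖(u : ℂ) * starRingEnd ℂ z‖ ≤ ρ := fun u h => by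
    have := hu u h
    rwa [norm_mul, RCLike.norm_conj, ← norm_mul]
  have := goursat_bound (y := fun u v => W (u * z) (v * starRingEnd ℂ z))
    (p := fun u v => starRingEnd ℂ z * Wd (u * z) (v * starRingEnd ℂ z))
    (c := starRingEnd ℂ z * z * -(κ ^ 2 / 4 : ℂ)) (c₀ := κ ^ 2 / 4 * ρ ^ 2) (ε := ε) ?_ ?_ ?_ ?_ ?_ ?_
  · simpa using this
  · rw [norm_mul, norm_mul, RCLike.norm_conj, norm_neg,
      show (κ ^ 2 / 4 : ℂ) = ((κ ^ 2 / 4 : ℝ) : ℂ) by push_cast; ring, Complex.norm_real,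
      Real.norm_of_nonneg (by positivity)]
    have : ‖z‖ * ‖z‖ ≤ ρ ^ 2 := by rw [← sq]; gcongr
    calc _ ≤ ρ ^ 2 * (κ ^ 2 / 4) := by gcongr
      _ = _ := by ring
  · refine h.cont.comp (f := fun q : ℝ × ℝ => ((q.1 : ℂ) * z, (q.2 : ℂ) * starRingEnd ℂ z))
      (by fun_prop) fun q hq => ?_
    exact ⟨by simpa using (hu _ hq.1).trans_lt hρ, by
      rw [mem_ball_zero_iff]; exact (hv _ hq.2).trans_lt hρ⟩
  · intro u hu' v hv'
    have hd := h.d1 _ _ ((hu u hu').trans_lt hρ) ((hv v hv').trans_lt hρ)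
    have hl : HasDerivAt (fun v : ℝ => (v : ℂ) * starRingEnd ℂ z) (starRingEnd ℂ z) v := by
      simpa using (Complex.ofRealCLM.hasDerivAt (x := v)).mul_const (starRingEnd ℂ z)
    exact (hd.scomp v hl).congr_deriv (by simp)
  · intro u hu' v hv'
    have hd := h.d2 _ _ ((hu u hu').trans_lt hρ) ((hv v hv').trans_lt hρ)
    have hl : HasDerivAt (fun u : ℝ => (u : ℂ) * z) z u := by
      simpa using (Complex.ofRealCLM.hasDerivAt (x := u)).mul_const z
    exact ((hd.scomp u hl).const_mul (starRingEnd ℂ z)).congr_deriv (by simp; ring)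
  · intro u hu'
    simpa using h1 _ (hu u hu')
  · intro v hv'
    simpa using h2 _ (hv v hv')

lemma GS.cyl_left (κ r : ℝ) (n : ℕ) : GS κ r (fun ζ ξ => ζ ^ n * gD κ n (ζ * ξ))
    (fun ζ ξ => ζ ^ (n + 1) * gD κ (n + 1) (ζ * ξ)) := by
  have hc := (gD_diff κ n).continuous
  refine ⟨by fun_prop, fun ζ ξ _ _ => ?_, fun ζ ξ _ _ => ?_⟩
  · have h := ((gD_hasDerivAt κ n (ζ * ξ)).comp ξ ((hasDerivAt_id ξ).const_mul ζ)).const_mul (ζ ^ n)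
    exact h.congr_deriv (by ring)
  · have h := (hasDerivAt_pow (n + 1) ζ).mul
      ((gD_hasDerivAt κ (n + 1) (ζ * ξ)).comp ζ ((hasDerivAt_id ζ).mul_const ξ))
    refine h.congr_deriv ?_
    have := gD_ode κ n (ζ * ξ)
    simp only [Function.comp]
    push_cast
    simp only [id]
    linear_combination ζ ^ n * this

lemma GS.cyl_right (κ r : ℝ) (n : ℕ) : GS κ r (fun ζ ξ => ξ ^ n * gD κ n (ζ * ξ))
    (fun ζ ξ => n * ξ ^ (n - 1) * gD κ n (ζ * ξ) + ξ ^ n * (ζ * gD κ (n + 1) (ζ * ξ))) := by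
  have hc := (gD_diff κ n).continuous
  refine ⟨by fun_prop, fun ζ ξ _ _ => ?_, fun ζ ξ _ _ => ?_⟩
  · have h := (hasDerivAt_pow n ξ).mul
      ((gD_hasDerivAt κ n (ζ * ξ)).comp ξ ((hasDerivAt_id ξ).const_mul ζ))
    exact h.congr_deriv (by simp only [Function.comp]; ring)
  · have h1 := (gD_hasDerivAt κ n (ζ * ξ)).comp ζ ((hasDerivAt_id ζ).mul_const ξ)
    have h2 := (gD_hasDerivAt κ (n + 1) (ζ * ξ)).comp ζ ((hasDerivAt_id ζ).mul_const ξ)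
    have h := (h1.const_mul (n * ξ ^ (n - 1))).add (((hasDerivAt_id ζ).mul h2).const_mul (ξ ^ n))
    refine h.congr_deriv ?_
    have := gD_ode κ n (ζ * ξ)
    simp only [Function.comp, id]
    rcases n with _ | n
    · simp at this ⊢; linear_combination this
    · simp only [Nat.add_sub_cancel]
      push_cast at this ⊢
      linear_combination ξ ^ (n + 1) * this

/-- First derivative of the complex Green profile. -/
def gF1 (κ : ℝ) (t : ℂ) : ℂ := deriv (gA κ) t * Complex.log t + gA κ t * t⁻¹ + deriv (gE κ) t

/-- Second derivative of the complex Green profile. -/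
def gF2 (κ : ℝ) (t : ℂ) : ℂ := deriv (deriv (gA κ)) t * Complex.log t +
  2 * deriv (gA κ) t * t⁻¹ - gA κ t * (t ^ 2)⁻¹ + deriv (deriv (gE κ)) t

lemma hasDerivAt_gF (κ : ℝ) {t : ℂ} (ht : t ∈ Complex.slitPlane) :
    HasDerivAt (gF κ) (gF1 κ t) t :=
  ((((gA_diff κ t).hasDerivAt.mul (Complex.hasDerivAt_log ht)).add
    (gE_diff κ t).hasDerivAt)).congr_deriv (by simp [gF1])

lemma hasDerivAt_gF1 (κ : ℝ) {t : ℂ} (ht : t ∈ Complex.slitPlane) :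
    HasDerivAt (gF1 κ) (gF2 κ t) t :=
  ((((gA'_diff κ t).hasDerivAt.mul (Complex.hasDerivAt_log ht)).add
    ((gA_diff κ t).hasDerivAt.mul (hasDerivAt_inv (Complex.slitPlane_ne_zero ht)))).add
    (gE'_diff κ t).hasDerivAt).congr_deriv (by simp [gF2]; ring)

lemma gF_ode (κ : ℝ) {t : ℂ} (ht : t ≠ 0) :
    t * gF2 κ t + gF1 κ t = -(κ ^ 2 / 4 : ℂ) * gF κ t := by
  have h1 := gA_ode κ t
  have h2 := gE_ode κ t
  simp only [gF2, gF1, gF]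
  have e : t * t⁻¹ = 1 := mul_inv_cancel₀ ht
  rw [show (t ^ 2)⁻¹ = t⁻¹ * t⁻¹ by rw [sq, mul_inv]]
  linear_combination Complex.log t * h1 + h2 + (2 * deriv (gA κ) t - gA κ t * t⁻¹) * e

lemma mem_slitPlane_bidisc {x ζ ξ : ℂ} (hζ : ‖ζ‖ < ‖x‖ / 3) (hξ : ‖ξ‖ < ‖x‖ / 3) :
    (x - ζ) * (starRingEnd ℂ x - ξ) ∈ Complex.slitPlane := by
  refine Or.inl ?_
  have e : (x - ζ) * (starRingEnd ℂ x - ξ) =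
      ((‖x‖ ^ 2 : ℝ) : ℂ) - (ζ * starRingEnd ℂ x + x * ξ - ζ * ξ) := by
    rw [← Complex.normSq_eq_norm_sq, Complex.normSq_eq_conj_mul_self]; ring
  have hb : ‖ζ * starRingEnd ℂ x + x * ξ - ζ * ξ‖ ≤ ‖ζ‖ * ‖x‖ + ‖x‖ * ‖ξ‖ + ‖ζ‖ * ‖ξ‖ := by
    refine (norm_sub_le _ _).trans ?_
    refine (add_le_add_left (norm_add_le _ _) _).trans ?_
    simp
  have h2 := (Complex.re_le_norm (ζ * starRingEnd ℂ x + x * ξ - ζ * ξ)).trans hb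
  rw [e, Complex.sub_re, Complex.ofReal_re]
  have := norm_nonneg ζ
  have := norm_nonneg ξ
  have : 0 < ‖x‖ := by linarith
  nlinarith

lemma GS.green (κ : ℝ) (x : ℂ) : GS κ (‖x‖ / 3)
    (fun ζ ξ => gF κ ((x - ζ) * (starRingEnd ℂ x - ξ)))
    (fun ζ ξ => -(x - ζ) * gF1 κ ((x - ζ) * (starRingEnd ℂ x - ξ))) := by
  refine ⟨?_, fun ζ ξ h1 h2 => ?_, fun ζ ξ h1 h2 => ?_⟩
  · refine (gF_differentiableOn κ).continuousOn.comp
      (f := fun q : ℂ × ℂ => (x - q.1) * (starRingEnd ℂ x - q.2)) (by fun_prop) fun q hq => ?_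
    exact mem_slitPlane_bidisc (by simpa using hq.1) (by simpa using hq.2)
  · have hs := mem_slitPlane_bidisc h1 h2
    have hl : HasDerivAt (fun ξ => (x - ζ) * (starRingEnd ℂ x - ξ)) (-(x - ζ)) ξ := by
      simpa using ((hasDerivAt_id ξ).const_sub (starRingEnd ℂ x)).const_mul (x - ζ)
    have h := (hasDerivAt_gF κ hs).comp ξ hl
    rw [mul_comm] at h
    exact h
  · have hs := mem_slitPlane_bidisc h1 h2
    have hl : HasDerivAt (fun ζ => (x - ζ) * (starRingEnd ℂ x - ξ)) (-(starRingEnd ℂ x - ξ)) ζ := by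
      simpa using ((hasDerivAt_id ζ).const_sub x).mul_const (starRingEnd ℂ x - ξ)
    have hl2 : HasDerivAt (fun ζ => -(x - ζ)) 1 ζ := by
      simpa using (hasDerivAt_id ζ).sub_const x
    refine (hl2.mul ((hasDerivAt_gF1 κ hs).comp ζ hl)).congr_deriv ?_
    have := gF_ode κ (Complex.slitPlane_ne_zero hs)
    simp only [Function.comp]
    linear_combination this

/-- Uniform polynomial approximation of holomorphic functions on smaller discs. -/
lemma exists_taylor_approx {g : ℂ → ℂ} {r ρ : ℝ} (hρ0 : 0 ≤ ρ) (hρ : ρ < r)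
    (hg : ∀ ζ, ‖ζ‖ < r → DifferentiableAt ℂ g ζ) :
    ∃ c : ℕ → ℂ, c 0 = g 0 ∧ ∀ ε > 0, ∀ᶠ N in atTop, ∀ ζ : ℂ, ‖ζ‖ ≤ ρ →
      ‖g ζ - ∑ n ∈ Finset.range N, c n * ζ ^ n‖ ≤ ε := by
  set s := (ρ + r) / 2 with hs
  have hs0 : 0 < s := by rw [hs]; linarith
  have hd : DifferentiableOn ℂ g (Metric.closedBall 0 s.toNNReal) := fun ζ hζ => by
    refine (hg ζ ?_).differentiableWithinAt
    rw [mem_closedBall_zero_iff, Real.coe_toNNReal _ hs0.le] at hζ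
    linarith
  have hp := hd.hasFPowerSeriesOnBall (by simpa using hs0)
  set p := cauchyPowerSeries g 0 s.toNNReal
  have hu := hp.tendstoUniformlyOn (r' := ((ρ + s) / 2).toNNReal) (by
    rw [ENNReal.coe_lt_coe, Real.toNNReal_lt_toNNReal_iff hs0]; linarith)
  refine ⟨fun n => p.coeff n, ?_, fun ε hε => ?_⟩
  · have := hp.coeff_zero (fun _ => 0)
    rw [← this]
    change p 0 1 = _
    congr 1; ext i; exact i.elim0
  · have := Metric.tendstoUniformlyOn_iff.1 hu ε hε
    filter_upwards [this] with N hN ζ hζ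
    have := hN ζ (by
      rw [mem_ball_zero_iff, Real.coe_toNNReal _ (by linarith)]; linarith)
    rw [zero_add, dist_eq_norm] at this
    refine (le_of_eq (congrArg (fun w => ‖g ζ - w‖) ?_)).trans this.le
    change _ = ∑ n ∈ Finset.range N, p n fun _ => ζ
    refine Finset.sum_congr rfl fun n _ => ?_
    rw [FormalMultilinearSeries.apply_eq_pow_smul_coeff, smul_eq_mul, mul_comm]


lemma L2B.gG_shift (κ : ℝ) (x : ℂ) (R : ℝ) : L2B R (cut R fun z => gG κ (x - z)) := by
  have hm : Measurable fun z => gG κ (x - z) := (measurable_gG κ).comp (measurable_const.sub measurable_id)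
  refine ⟨memLp_two_iff.2 ⟨hm.aestronglyMeasurable.indicator
    Metric.isClosed_closedBall.measurableSet, ?_⟩, fun z hz => cut_of_lt hz⟩
  have hs : LocallyIntegrable fun z => gG κ z ^ 2 :=
    locInt_of_bound ((measurable_gG κ).pow_const 2) (α := 1) (by norm_num) fun R => by
      obtain ⟨C, hC, h⟩ := gG_bound κ R
      refine ⟨C ^ 2, fun z hz hR => ?_⟩
      rw [norm_pow]
      refine (pow_le_pow_left₀ (norm_nonneg _) (h z hz hR) 2).trans (le_of_eq ?_)
      rw [mul_pow, ← Real.rpow_natCast, ← Real.rpow_natCast, ← Real.rpow_mul (norm_nonneg _)]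
      norm_num
  have hi : IntegrableOn (fun z => gG κ (x - z) ^ 2) (Metric.closedBall 0 R) := by
    have h1 := hs.integrableOn_isCompact (isCompact_closedBall x R)
    have h2 := ((Measure.measurePreserving_sub_left volume x).integrableOn_comp_preimage
      (MeasurableEquiv.subLeft x).measurableEmbedding).2 h1
    refine h2.mono_set fun z hz => ?_
    have : ‖z‖ ≤ R := by simpa using hz
    simpa [dist_eq_norm] using this
  have h2 := hi.2
  rw [HasFiniteIntegral, ← lintegral_indicator Metric.isClosed_closedBall.measurableSet] at h2
  refine lt_of_le_of_lt (lintegral_mono fun z => ?_) h2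
  by_cases hz : z ∈ Metric.closedBall (0:ℂ) R
  · rw [indicator_of_mem hz, cut_of_le (by simpa using hz), enorm_pow]
  · rw [cut_of_lt (by simpa using hz)]; simp

lemma gG_integrable (κ : ℝ) {R : ℝ} {f : ℂ → ℂ} (hf : L2B R f) (x : ℂ) :
    Integrable fun z => gG κ (x - z) * f z := by
  refine ((L2B.gG_shift κ x R).memLp.integrable_mul hf.memLp).congr (ae_of_all _ fun z => ?_)
  by_cases hz : R < ‖z‖
  · simp [hf.supp z hz]
  · simp [cut_of_le (not_lt.1 hz)]

lemma cw_one (z : ℂ) : cw 1 z = z := by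
  rw [cw_apply, one_mul, mul_comm]; exact Complex.re_add_im z

lemma cw_neg_one (z : ℂ) : cw (-1) z = starRingEnd ℂ z := by
  rw [cw_apply]
  apply Complex.ext <;> simp

lemma L2B.integral_mul_sum {R : ℝ} {f : ℂ → ℂ} (hf : L2B R f) {k : ℕ → ℂ → ℂ}
    (hk : ∀ n, Continuous (k n)) (h : ∀ n, ∫ z, k n z * f z = 0) (c : ℕ → ℂ) (N : ℕ) :
    Integrable (fun z => (∑ n ∈ Finset.range N, c n * k n z) * f z) ∧
      ∫ z, (∑ n ∈ Finset.range N, c n * k n z) * f z = 0 := by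
  have hi : ∀ n, Integrable fun z => c n * (k n z * f z) := fun n => by
    have := (cv_smooth_integrable (k := fun z => k n (-z)) ((hk n).comp continuous_neg) hf 0)
    simpa using this.const_mul (c n)
  have e : (fun z => (∑ n ∈ Finset.range N, c n * k n z) * f z) =
      fun z => ∑ n ∈ Finset.range N, c n * (k n z * f z) := by
    funext z; rw [Finset.sum_mul]; exact Finset.sum_congr rfl fun n _ => by ring
  rw [e]
  refine ⟨integrable_finsetSum _ fun n _ => hi n, ?_⟩
  rw [integral_finsetSum _ fun n _ => hi n]
  exact Finset.sum_eq_zero fun n _ => by rw [integral_const_mul, h n, mul_zero]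

/-- If `J₀ * f` vanishes then so does the outgoing potential of `f` far away. -/
theorem cv_green_eq_zero_of_far {κ R : ℝ} (hκ : κ ≠ 0) (hR : 0 ≤ R) {f : ℂ → ℂ} (hf : L2B R f)
    (h : ∀ x, cv (jJ κ) f x = 0) {x : ℂ} (hx : 3 * R < ‖x‖) : cv (gG κ) f x = 0 := by
  have hr : R < ‖x‖ / 3 := by linarith
  have hg := GS.green κ x
  set w : ℂ → ℂ → ℂ := fun ζ ξ => gF κ ((x - ζ) * (starRingEnd ℂ x - ξ)) with hw
  have h0 : ‖(0:ℂ)‖ < ‖x‖ / 3 := by rw [norm_zero]; linarith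
  obtain ⟨c, hc0, hc⟩ := exists_taylor_approx (g := fun ζ => w ζ 0) hR hr fun ζ hζ => by
    have hs := mem_slitPlane_bidisc hζ h0
    exact ((hasDerivAt_gF κ hs).comp ζ
      (((hasDerivAt_id ζ).const_sub x).mul_const (starRingEnd ℂ x - 0))).differentiableAt
  obtain ⟨d, hd0, hd⟩ := exists_taylor_approx (g := fun ξ => w 0 ξ) hR hr fun ξ hξ =>
    (hg.d1 0 ξ h0 hξ).differentiableAt
  set a : ℕ → ℂ := fun n => c n / gD κ n 0
  set b : ℕ → ℂ := fun n => if n = 0 then 0 else d n / gD κ n 0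
  set M := 6 * Real.exp (2 * (1 + 2 * (κ ^ 2 / 4 * R ^ 2)))
  have key : ∀ ε > 0, ‖cv (gG κ) f x‖ ≤ ε * M * ∫ z, ‖f z‖ := by
    intro ε hε
    obtain ⟨N, hN1, hN2, hN0⟩ := ((hc ε hε).and ((hd ε hε).and (eventually_ge_atTop 1))).exists
    have hP := (hg.sub (GS.sum (GS.cyl_left κ _) a N)).sub (GS.sum (GS.cyl_right κ _) b N)
    have hbd : ∀ z, ‖z‖ ≤ R → _ := fun z hz => hP.bound (ε := ε) hr ?_ ?_ hz
    rotate_left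
    · intro ζ hζ
      convert hN1 ζ hζ using 2
      have e2 : ∑ n ∈ Finset.range N, b n * ((0:ℂ) ^ n * gD κ n (ζ * 0)) = 0 :=
        Finset.sum_eq_zero fun n _ => by
          rcases n with _ | n
          · simp [b]
          · simp
      rw [e2, sub_zero]
      congr 1
      refine Finset.sum_congr rfl fun n _ => ?_
      have := gD_zero_ne hκ n
      simp only [a, mul_zero]
      field_simp
    · intro ξ hξ
      convert hN2 ξ hξ using 2
      obtain ⟨N, rfl⟩ := Nat.exists_eq_add_of_le' hN0
      rw [sub_sub]
      congr 1
      rw [Finset.sum_range_succ', Finset.sum_range_succ', Finset.sum_range_succ']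
      have e1 : ∑ n ∈ Finset.range N, a (n + 1) * ((0:ℂ) ^ (n + 1) * gD κ (n + 1) (0 * ξ)) = 0 :=
        Finset.sum_eq_zero fun n _ => by simp
      have := gD_zero_ne hκ 0
      rw [e1]
      have e0 : c 0 = d 0 := by rw [hc0, hd0]
      have e3 : ∑ n ∈ Finset.range N, b (n + 1) * (ξ ^ (n + 1) * gD κ (n + 1) (0 * ξ)) =
          ∑ n ∈ Finset.range N, d (n + 1) * ξ ^ (n + 1) :=
        Finset.sum_congr rfl fun n _ => by
          have := gD_zero_ne hκ (n + 1)
          simp only [b, zero_mul, Nat.add_eq_zero_iff, one_ne_zero, and_false, if_false]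
          field_simp
      rw [e3]
      simp only [a, b, e0, if_true, zero_mul, pow_zero, mul_one, zero_add, one_mul, add_zero]
      rw [div_mul_cancel₀ _ this, add_comm]
    obtain ⟨i1, z1⟩ := hf.integral_mul_sum (k := kn κ 1)
      (fun n => (kn_contDiff κ 1 n).continuous) (integral_kn_eq_zero hf h (by norm_num)) a N
    obtain ⟨i2, z2⟩ := hf.integral_mul_sum (k := kn κ (-1))
      (fun n => (kn_contDiff κ (-1) n).continuous) (integral_kn_eq_zero hf h (by norm_num)) b N
    have hn : ∀ z : ℂ, z * starRingEnd ℂ z = ((‖z‖ ^ 2 : ℝ) : ℂ) := fun z => by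
      rw [Complex.mul_conj, Complex.normSq_eq_norm_sq]
    have hpt : ∀ z, ‖gG κ (x - z) * f z -
        (∑ n ∈ Finset.range N, a n * kn κ 1 n z) * f z -
        (∑ n ∈ Finset.range N, b n * kn κ (-1) n z) * f z‖ ≤ ε * M * ‖f z‖ := fun z => by
      by_cases hz : R < ‖z‖
      · simp [hf.supp z hz]
      · rw [← sub_mul, ← sub_mul, norm_mul]
        gcongr
        refine (le_of_eq ?_).trans ((hbd z (not_lt.1 hz)).trans (le_of_eq (by ring)))
        congr 2
        · congr 1
          · simp only [hw, gG]
            congr 1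
            rw [← map_sub, hn]
          · exact Finset.sum_congr rfl fun n _ => by rw [kn, cw_one, hn, mul_comm (gD _ _ _)]
        · exact Finset.sum_congr rfl fun n _ => by rw [kn, cw_neg_one, hn, mul_comm (gD _ _ _)]
    have hfi := gG_integrable κ hf x
    have e : cv (gG κ) f x = ∫ z, (gG κ (x - z) * f z -
        (∑ n ∈ Finset.range N, a n * kn κ 1 n z) * f z -
        (∑ n ∈ Finset.range N, b n * kn κ (-1) n z) * f z) := by
      have := integral_sub (hfi.sub i1) i2
      simp only [Pi.sub_apply] at this
      rw [this, integral_sub hfi i1, z1, z2, sub_zero, sub_zero, cv]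
    rw [e, ← integral_const_mul]
    exact norm_integral_le_of_norm_le (hf.integrable.norm.const_mul _) (ae_of_all _ hpt)
  have h2 : Tendsto (fun ε : ℝ => ε * M * ∫ z, ‖f z‖) (𝓝[>] 0) (𝓝 0) := by
    have : Tendsto (fun ε : ℝ => ε * M * ∫ z, ‖f z‖) (𝓝 0) (𝓝 (0 * M * ∫ z, ‖f z‖)) :=
      Continuous.tendsto (by fun_prop) 0
    simpa using this.mono_left nhdsWithin_le_nhds
  exact norm_le_zero_iff.1 (ge_of_tendsto h2 (eventually_mem_nhdsWithin.mono key))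

lemma dd_clm {f : ℂ → ℂ} (hf : ContDiff ℝ ∞ f) (L : ℂ →L[ℝ] ℂ) (v : ℂ) :
    dd v (fun z => L (f z)) = fun z => L (dd v f z) := by
  funext z
  have := L.hasFDerivAt.comp z (hf.differentiable (by simp) z).hasFDerivAt
  rw [dd, show (fun z => L (f z)) = L ∘ f from rfl, this.fderiv]; rfl

lemma lap_clm {f : ℂ → ℂ} (hf : ContDiff ℝ ∞ f) (L : ℂ →L[ℝ] ℂ) (z : ℂ) :
    lap (fun z => L (f z)) z = L (lap f z) := by
  simp only [lap]
  rw [dd_clm hf, dd_clm hf, dd_clm (dd_contDiff hf _), dd_clm (dd_contDiff hf _), map_add]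

/-- A function smooth near `x₀` agrees near `x₀` with a globally smooth function. -/
lemma exists_smooth_germ {s : ℂ → ℂ} {x₀ : ℂ} {δ : ℝ} (hδ : 0 < δ)
    (hs : ∀ x ∈ Metric.ball x₀ δ, AnalyticAt ℝ s x) :
    ∃ t : ℂ → ℂ, ContDiff ℝ ∞ t ∧ ∀ x ∈ Metric.ball x₀ (δ / 4), t x = s x := by
  let b : ContDiffBump x₀ := ⟨δ / 4, δ / 2, by positivity, by linarith⟩
  refine ⟨fun x => (b x : ℂ) * s x, contDiff_iff_contDiffAt.2 fun x => ?_, fun x hx => ?_⟩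
  · by_cases hx : x ∈ Metric.ball x₀ δ
    · exact (Complex.ofRealCLM.contDiff.contDiffAt.comp x b.contDiff.contDiffAt).mul
        (hs x hx).contDiffAt
    · have hx' : x ∉ tsupport b := by
        rw [b.tsupport_eq]
        intro h
        have : dist x x₀ ≤ δ / 2 := h
        exact hx (Metric.mem_ball.2 (by linarith))
      have : (fun x => (b x : ℂ) * s x) =ᶠ[𝓝 x] fun _ => 0 := by
        filter_upwards [(isClosed_tsupport b).isOpen_compl.mem_nhds hx'] with y hy
        rw [image_eq_zero_of_notMem_tsupport hy]; simp
      exact contDiffAt_const.congr_of_eventuallyEq this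
  · have := b.one_of_mem_closedBall (x := x) (Metric.ball_subset_closedBall hx)
    simp [this]

lemma helmholtz_of_vanishing {κ R δ : ℝ} (hδ : 0 < δ) {f : ℂ → ℂ} (hf : L2B R f) {x₀ : ℂ}
    (h : ∀ᵐ z, z ∈ Metric.ball x₀ δ → f z = 0) {t : ℂ → ℂ} (ht : ContDiff ℝ ∞ t)
    (hts : ∀ x ∈ Metric.ball x₀ δ, t x = cv (gG κ) f x) : lap t x₀ + (κ : ℂ) ^ 2 * t x₀ = 0 := by
  have hcont : Continuous fun x => lap t x + (κ : ℂ) ^ 2 * t x :=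
    (lap_contDiff ht).continuous.add (continuous_const.mul ht.continuous)
  have hae : ∀ᵐ x, x ∈ Metric.ball x₀ δ → lap t x + (κ : ℂ) ^ 2 * t x = 0 := by
    refine Metric.isOpen_ball.ae_eq_zero_of_integral_contDiff_smul_eq_zero
      (hcont.locallyIntegrable.locallyIntegrableOn _) fun g hg hgc hgs => ?_
    set φ : ℂ → ℂ := fun x => (g x : ℂ)
    have hφ : ContDiff ℝ ∞ φ := Complex.ofRealCLM.contDiff.comp hg
    have hφc : HasCompactSupport φ := hgc.comp_left (g := fun x : ℝ => (x : ℂ)) (by simp)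
    have h0 : ∀ x, x ∉ Metric.ball x₀ δ → g =ᶠ[𝓝 x] 0 := fun x hx =>
      notMem_tsupport_iff_eventuallyEq.1 fun h => hx (hgs h)
    have h0' : ∀ x, x ∉ Metric.ball x₀ δ → φ =ᶠ[𝓝 x] fun _ => 0 := fun x hx => by
      filter_upwards [h0 x hx] with y hy; simp [φ, hy]
    have hg := integral_cv_green hf κ hφ hφc
    have e1 : ∫ z, f z * φ z = 0 := by
      rw [← integral_zero ℂ ℂ]
      refine integral_congr_ae ?_
      filter_upwards [h] with z hz
      by_cases hb : z ∈ Metric.ball x₀ δ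
      · simp [hz hb]
      · simp [(h0' z hb).eq_of_nhds]
    have hl0 : ∀ z, z ∉ Metric.ball x₀ δ → lap φ z = 0 := fun z hz => by
      rw [lap_eventuallyEq (h0' z hz)]
      have e : ∀ v : ℂ, dd v (fun _ : ℂ => (0:ℂ)) = fun _ => 0 := fun v => by funext; simp [dd]
      simp only [lap, e, add_zero]
    have e2 : ∫ z, cv (gG κ) f z * (lap φ z + (κ : ℂ) ^ 2 * φ z) =
        ∫ z, t z * (lap φ z + (κ : ℂ) ^ 2 * φ z) := by
      refine integral_congr_ae (ae_of_all _ fun z => ?_)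
      by_cases hb : z ∈ Metric.ball x₀ δ
      · simp only [hts z hb]
      · simp [hl0 z hb, (h0' z hb).eq_of_nhds]
    rw [e2, e1, neg_zero] at hg
    have i1 := int_cc ht (lap_contDiff hφ) (lap_compact hφc)
    have i2 := (int_cc ht hφ hφc).const_mul ((κ : ℂ) ^ 2)
    have i3 := int_cc (lap_contDiff ht) hφ hφc
    calc ∫ x, g x • (lap t x + (κ : ℂ) ^ 2 * t x)
        = ∫ x, (lap t x * φ x + (κ : ℂ) ^ 2 * (t x * φ x)) := by
          refine integral_congr_ae (ae_of_all _ fun z => ?_)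
          simp only [φ, Complex.real_smul]; ring
      _ = ∫ x, (t x * lap φ x + (κ : ℂ) ^ 2 * (t x * φ x)) := by
          rw [integral_add i3 i2, integral_add i1 i2, integral_mul_lap ht hφ hφc]
      _ = ∫ z, t z * (lap φ z + (κ : ℂ) ^ 2 * φ z) :=
          integral_congr_ae (ae_of_all _ fun z => by ring)
      _ = 0 := hg
  by_contra hne
  have ho : IsOpen ({x | lap t x + (κ : ℂ) ^ 2 * t x ≠ 0} ∩ Metric.ball x₀ δ) :=
    (isOpen_ne_fun hcont continuous_const).inter Metric.isOpen_ball
  have hp := ho.measure_pos volume ⟨x₀, hne, Metric.mem_ball_self hδ⟩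
  refine hp.ne' (measure_mono_null (fun x hx => ?_) hae)
  exact fun hx' => hx.1 (hx' hx.2)

/-- If the imaginary part of an outgoing potential vanishes on an arc of an analytic curve bounding
a domain without Dirichlet eigenvalue, the potential vanishes off the sources. -/
theorem outgoing_eq_zero {κ R : ℝ} (hκ : 0 < κ) {f : ℂ → ℂ} (hf : L2B R f) {U D V : Set ℂ}
    (hUo : IsOpen U) (hUc : IsPreconnected U) (hUR : ∀ z, R < ‖z‖ → z ∈ U)
    (hf0 : ∀ᵐ z, z ∈ U → f z = 0) (hDo : IsOpen D) (hDne : D.Nonempty) (hDU : closure D ⊆ U)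
    (hDir : ∀ u : ℂ → ℂ, ContinuousOn u (closure D) → ContDiffOn ℝ 2 u D →
      (∀ x ∈ D, lap u x + (κ : ℂ) ^ 2 * u x = 0) → (∀ x ∈ frontier D, u x = 0) → ∀ x ∈ D, u x = 0)
    {γ : ℝ → ℂ} (hγa : ∀ t, AnalyticAt ℝ γ t) (hγd : ∀ t, deriv γ t ≠ 0)
    (hγ : frontier D = range γ) (hV : IsOpen V) {t₀ : ℝ} (ht₀ : γ t₀ ∈ V) (y : ℂ)
    (h : ∀ t, γ t ∈ V → γ t ≠ y → (cv (gG κ) f (γ t)).im = 0) :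
    ∀ x ∈ U, cv (gG κ) f x = 0 := by
  set s := cv (gG κ) f with hs
  have hball : ∀ x ∈ U, ∃ δ > 0, Metric.ball x δ ⊆ U := fun x hx => Metric.isOpen_iff.1 hUo x hx
  have han : ∀ x ∈ U, AnalyticAt ℝ s x := fun x hx => by
    obtain ⟨δ, hδ, hb⟩ := hball x hx
    exact analyticAt_cv_green κ hδ hf (hf0.mono fun z hz hzb => hz (hb hzb))
  have hΓU : ∀ t, γ t ∈ U := fun t =>
    hDU (frontier_subset_closure (hγ ▸ mem_range_self t))
  have hcurve : ∀ t, (s (γ t)).im = 0 := by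
    have ha : AnalyticOnNhd ℝ (fun t => (s (γ t)).im) univ := fun t _ =>
      (Complex.imCLM.analyticAt _).comp ((han _ (hΓU t)).comp (hγa t))
    have hfr : ∀ᶠ t in 𝓝[≠] t₀, (s (γ t)).im = 0 := by
      have h1 : ∀ᶠ t in 𝓝[≠] t₀, γ t ∈ V :=
        ((hγa t₀).continuousAt.eventually (hV.mem_nhds ht₀)).filter_mono nhdsWithin_le_nhds
      have h2 : ∀ᶠ t in 𝓝[≠] t₀, γ t ≠ y :=
        (hγa t₀).differentiableAt.hasDerivAt.eventually_ne (hγd t₀)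
      filter_upwards [h1, h2] with t a b using h t a b
    intro t
    exact ha.eqOn_zero_of_preconnected_of_frequently_eq_zero isPreconnected_univ (mem_univ t₀)
      hfr.frequently (mem_univ t)
  set L : ℂ →L[ℝ] ℂ := Complex.ofRealCLM.comp Complex.imCLM
  have hL : ∀ w, L w = 0 ↔ w.im = 0 := fun w => by simp [L]
  have hD0 : ∀ x ∈ D, L (s x) = 0 := by
    refine hDir (fun x => L (s x)) ?_ ?_ ?_ ?_
    · exact fun x hx => (L.continuous.continuousAt.comp (han x (hDU hx)).continuousAt).continuousWithinAt
    · exact fun x hx => (L.contDiff.contDiffAt.comp x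
        (han x (hDU (subset_closure hx))).contDiffAt).contDiffWithinAt
    · intro x hx
      have hxU := hDU (subset_closure hx)
      obtain ⟨δ, hδ, hb⟩ := hball x hxU
      obtain ⟨t, ht, hts⟩ := exists_smooth_germ hδ fun y hy => han y (hb hy)
      have hh := helmholtz_of_vanishing (κ := κ) (δ := δ / 4) (by positivity) hf
        (hf0.mono fun z hz hzb => hz (hb (Metric.ball_subset_ball (by linarith) hzb))) ht hts
      have heq : (fun x => L (s x)) =ᶠ[𝓝 x] fun x => L (t x) := by
        filter_upwards [Metric.ball_mem_nhds x (show 0 < δ / 4 by positivity)] with y hy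
        rw [hts y hy]
      rw [lap_eventuallyEq heq, heq.eq_of_nhds, lap_clm ht, ← map_zero L, ← hh, map_add]
      congr 1
      simp [L, ← Complex.ofReal_pow]
    · intro x hx
      rw [hγ] at hx
      obtain ⟨t, rfl⟩ := hx
      exact (hL _).2 (hcurve t)
  obtain ⟨x₁, hx₁⟩ := hDne
  have hU0 : ∀ x ∈ U, (s x).im = 0 := by
    have ha : AnalyticOnNhd ℝ (fun x => L (s x)) U := fun x hx => (L.analyticAt _).comp (han x hx)
    have := ha.eqOn_zero_of_preconnected_of_eventuallyEq_zero hUc (hDU (subset_closure hx₁))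
      (by filter_upwards [hDo.mem_nhds hx₁] with x hx using hD0 x hx)
    exact fun x hx => (hL _).1 (this hx)
  have hR' : 0 ≤ max R 0 := le_max_right _ _
  have hf' : L2B (max R 0) f := hf.mono (le_max_left _ _)
  have hJ := jJ_cv_eq_zero (κ := κ) hf fun z hz => hU0 z (hUR z hz)
  have hfar : ∀ x, 3 * max R 0 < ‖x‖ → s x = 0 := fun x hx =>
    cv_green_eq_zero_of_far hκ.ne' hR' hf' hJ hx
  set x₂ : ℂ := ((3 * max R 0 + 1 : ℝ) : ℂ)
  have hx₂ : 3 * max R 0 < ‖x₂‖ := by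
    rw [Complex.norm_real, Real.norm_of_nonneg (by positivity)]; linarith
  have := AnalyticOnNhd.eqOn_zero_of_preconnected_of_eventuallyEq_zero (f := s) (U := U)
    (fun x hx => han x hx) hUc (hUR x₂ (by linarith [le_max_left R 0])) (z₀ := x₂)
    (by filter_upwards [(isOpen_lt continuous_const continuous_norm).mem_nhds hx₂] with x hx
        using hfar x hx)
  exact fun x hx => this hx

/-- The Hilbert space `L²(ℂ)`. -/
abbrev E2 : Type := Lp ℂ 2 (volume : Measure ℂ)

lemma hs_lintegral_le {K : ℂ × ℂ → ℂ} (hK : MemLp K 2 (volume.prod volume)) {f : ℂ → ℂ}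
    (hf : MemLp f 2 volume) :
    ∫⁻ x, (∫⁻ z, ‖K (x, z)‖ₑ * ‖f z‖ₑ) ^ 2 ≤
      eLpNorm K 2 (volume.prod volume) ^ 2 * eLpNorm f 2 volume ^ 2 := by
  rw [eLpNorm_two_sq, eLpNorm_two_sq, lintegral_prod _ (hK.1.enorm.pow_const 2),
    ← lintegral_mul_const'' _ (hK.1.enorm.pow_const 2).lintegral_prod_right']
  refine lintegral_mono_ae ?_
  filter_upwards [hK.1.prodMk_left] with x hx
  exact lintegral_mul_sq_le _ hx.enorm hf.1.enorm

lemma hs_integrable {K : ℂ × ℂ → ℂ} (hK : MemLp K 2 (volume.prod volume)) {f : ℂ → ℂ}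
    (hf : MemLp f 2 volume) : ∀ᵐ x, Integrable fun z => K (x, z) * f z := by
  have h := memLp_two_iff.1 hK
  have h2 := h.2
  rw [lintegral_prod _ (hK.1.enorm.pow_const 2)] at h2
  filter_upwards [hK.1.prodMk_left, ae_lt_top' (hK.1.enorm.pow_const 2).lintegral_prod_right' h2.ne]
    with x hx hx2
  have hm : MemLp (fun z => K (x, z)) 2 volume := memLp_two_iff.2 ⟨hx, hx2⟩
  exact hm.integrable_mul hf

lemma hs_memLp {K : ℂ × ℂ → ℂ} (hK : MemLp K 2 (volume.prod volume)) {f : ℂ → ℂ}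
    (hf : MemLp f 2 volume) : MemLp (fun x => ∫ z, K (x, z) * f z) 2 volume ∧
      eLpNorm (fun x => ∫ z, K (x, z) * f z) 2 volume ≤
        eLpNorm K 2 (volume.prod volume) * eLpNorm f 2 volume := by
  have hb : eLpNorm (fun x => ∫ z, K (x, z) * f z) 2 volume ≤
        eLpNorm K 2 (volume.prod volume) * eLpNorm f 2 volume := by
    rw [← ENNReal.pow_le_pow_left_iff two_ne_zero, mul_pow, eLpNorm_two_sq]
    refine le_trans (lintegral_mono fun x => ?_) (hs_lintegral_le hK hf)
    gcongr
    refine (enorm_integral_le_lintegral_enorm _).trans (le_of_eq ?_)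
    simp only [enorm_mul]
  exact ⟨⟨(hK.1.mul hf.1.comp_snd).integral_prod_right',
    hb.trans_lt (ENNReal.mul_lt_top hK.2 hf.2)⟩, hb⟩

lemma exists_hsOp {K : ℂ × ℂ → ℂ} (hK : MemLp K 2 (volume.prod volume)) :
    ∃ T : E2 →L[ℂ] E2, ‖T‖ ≤ (eLpNorm K 2 (volume.prod volume)).toReal ∧
      ∀ f : E2, T f =ᵐ[volume] fun x => ∫ z, K (x, z) * f z := by
  let T₀ : E2 →ₗ[ℂ] E2 :=
    { toFun := fun f => (hs_memLp hK (Lp.memLp f)).1.toLp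
      map_add' := fun f g => by
        rw [← MemLp.toLp_add, MemLp.toLp_eq_toLp_iff]
        filter_upwards [hs_integrable hK (Lp.memLp f), hs_integrable hK (Lp.memLp g)] with x h1 h2
        rw [Pi.add_apply, ← integral_add h1 h2]
        refine integral_congr_ae ?_
        filter_upwards [Lp.coeFn_add f g] with z hz
        rw [hz, Pi.add_apply, mul_add]
      map_smul' := fun c f => by
        rw [RingHom.id_apply, ← MemLp.toLp_const_smul, MemLp.toLp_eq_toLp_iff]
        refine ae_of_all _ fun x => ?_
        simp only [Pi.smul_apply, smul_eq_mul]
        rw [← integral_const_mul]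
        refine integral_congr_ae ?_
        filter_upwards [Lp.coeFn_smul c f] with z hz
        rw [hz, Pi.smul_apply, smul_eq_mul]; ring }
  have hT : ∀ f, ‖T₀ f‖ ≤ (eLpNorm K 2 (volume.prod volume)).toReal * ‖f‖ := fun f => by
    have h := (hs_memLp hK (Lp.memLp f)).2
    change ‖(hs_memLp hK (Lp.memLp f)).1.toLp‖ ≤ _
    rw [Lp.norm_toLp, Lp.norm_def, ← ENNReal.toReal_mul]
    exact ENNReal.toReal_mono (ENNReal.mul_ne_top hK.2.ne (Lp.memLp f).2.ne) h
  exact ⟨T₀.mkContinuous _ hT, T₀.mkContinuous_norm_le ENNReal.toReal_nonneg hT,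
    fun f => (hs_memLp hK (Lp.memLp f)).1.coeFn_toLp⟩

/-- The Hilbert–Schmidt operator with kernel `K`. -/
def hsOp {K : ℂ × ℂ → ℂ} (hK : MemLp K 2 (volume.prod volume)) : E2 →L[ℂ] E2 :=
  (exists_hsOp hK).choose

lemma hsOp_norm {K : ℂ × ℂ → ℂ} (hK : MemLp K 2 (volume.prod volume)) :
    ‖hsOp hK‖ ≤ (eLpNorm K 2 (volume.prod volume)).toReal := (exists_hsOp hK).choose_spec.1

lemma hsOp_apply {K : ℂ × ℂ → ℂ} (hK : MemLp K 2 (volume.prod volume)) (f : E2) :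
    hsOp hK f =ᵐ[volume] fun x => ∫ z, K (x, z) * f z := (exists_hsOp hK).choose_spec.2 f

lemma hsOp_sub {K K' : ℂ × ℂ → ℂ} (hK : MemLp K 2 (volume.prod volume))
    (hK' : MemLp K' 2 (volume.prod volume)) : hsOp hK - hsOp hK' = hsOp (hK.sub hK') := by
  ext1 f
  rw [sub_apply]
  refine Lp.ext ?_
  filter_upwards [Lp.coeFn_sub (hsOp hK f) (hsOp hK' f), hsOp_apply hK f, hsOp_apply hK' f,
    hsOp_apply (hK.sub hK') f, hs_integrable hK (Lp.memLp f), hs_integrable hK' (Lp.memLp f)]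
    with x h1 h2 h3 h4 i1 i2
  rw [h1, Pi.sub_apply, h2, h3, h4, ← integral_sub i1 i2]
  exact integral_congr_ae (ae_of_all _ fun z => by simp [sub_mul])

lemma isCompactOperator_of_range_subset {T : E2 →L[ℂ] E2} (F : Submodule ℂ E2)
    [FiniteDimensional ℂ F] (h : ∀ f, T f ∈ F) : IsCompactOperator T := by
  have : LocallyCompactSpace F := have := FiniteDimensional.proper ℂ F; inferInstance
  exact (isCompactOperator_of_locallyCompactSpace_dom (T.codRestrict F h)).clm_comp F.subtypeL

lemma hsOp_simple_compact {g : ℂ × ℂ → ℂ} (s : SimpleFunc ℂ ℂ) (A : Set ℂ) (hA : MeasurableSet A)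
    (hAf : volume A < ⊤)
    (hK : MemLp (fun p : ℂ × ℂ => A.indicator (fun x => g (s x, p.2)) p.1) 2 (volume.prod volume)) :
    IsCompactOperator (hsOp hK) := by
  have hm : ∀ a : ℂ, MeasurableSet (s ⁻¹' {a} ∩ A) := fun a => (s.measurableSet_fiber a).inter hA
  have hfin : ∀ a : ℂ, volume (s ⁻¹' {a} ∩ A) ≠ ⊤ := fun a =>
    ((measure_mono inter_subset_right).trans_lt hAf).ne
  let e : ℂ → E2 := fun a => indicatorConstLp 2 (hm a) (hfin a) 1
  have : FiniteDimensional ℂ (Submodule.span ℂ (e '' s.range)) :=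
    FiniteDimensional.span_of_finite ℂ (s.range.finite_toSet.image e)
  refine isCompactOperator_of_range_subset (Submodule.span ℂ (e '' s.range)) fun f => ?_
  have : hsOp hK f = ∑ a ∈ s.range, (∫ z, g (a, z) * f z) • e a := by
    refine Lp.ext ?_
    have h1 := Lp.coeFn_fun_finsetSum s.range (fun a => (∫ z, g (a, z) * f z) • e a)
    have h2 : ∀ᵐ x, ∀ a ∈ s.range, ((∫ z, g (a, z) * f z) • e a : E2) x =
        (∫ z, g (a, z) * f z) * (s ⁻¹' {a} ∩ A).indicator (fun _ => 1) x := by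
      refine (eventually_all_finset _).2 fun a _ => ?_
      filter_upwards [Lp.coeFn_smul (∫ z, g (a, z) * f z) (e a),
        indicatorConstLp_coeFn (p := 2) (hs := hm a) (hμs := hfin a) (c := (1 : ℂ))] with x h3 h4
      rw [h3, Pi.smul_apply, h4, smul_eq_mul]
    filter_upwards [hsOp_apply hK f, h1, h2] with x hx h1 h2
    rw [hx, h1, Finset.sum_congr rfl h2]
    by_cases hxA : x ∈ A
    · rw [Finset.sum_eq_single (s x)]
      · simp [hxA]
      · intro b _ hb
        rw [indicator_of_notMem, mul_zero]
        exact fun h => hb h.1.symm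
      · intro h; exact absurd (s.mem_range_self x) h
    · simp [hxA]
  rw [this]
  exact Submodule.sum_mem _ fun a ha => Submodule.smul_mem _ _ (Submodule.subset_span ⟨a, ha, rfl⟩)

lemma tendsto_hsOp {K : ℂ × ℂ → ℂ} (hK : MemLp K 2 (volume.prod volume)) {k : ℕ → ℂ × ℂ → ℂ}
    (hk : ∀ n, MemLp (k n) 2 (volume.prod volume))
    (h : Tendsto (fun n => eLpNorm (k n - K) 2 (volume.prod volume)) atTop (𝓝 0)) :
    Tendsto (fun n => hsOp (hk n)) atTop (𝓝 (hsOp hK)) := by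
  rw [tendsto_iff_norm_sub_tendsto_zero]
  refine squeeze_zero (fun _ => norm_nonneg _) (fun n => ?_)
    ((ENNReal.tendsto_toReal ENNReal.zero_ne_top).comp h)
  rw [hsOp_sub]
  exact hsOp_norm _

lemma hsOp_compact_of_continuous {g : ℂ × ℂ → ℂ} (hg : Continuous g) (hgc : HasCompactSupport g)
    (hK : MemLp g 2 (volume.prod volume)) : IsCompactOperator (hsOp hK) := by
  obtain ⟨R, hR⟩ := hgc.isCompact.isBounded.subset_closedBall 0
  set A : Set ℂ := Metric.closedBall 0 R
  have hA : MeasurableSet A := Metric.isClosed_closedBall.measurableSet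
  have hAf : volume A < ⊤ := (isCompact_closedBall (0:ℂ) R).measure_lt_top
  have h0 : ∀ x z : ℂ, (x ∉ A ∨ z ∉ A) → g (x, z) = 0 := fun x z h => by
    by_contra hne
    have := hR (subset_tsupport g hne)
    rw [mem_closedBall_zero_iff, Prod.norm_def] at this
    rcases h with h | h
    · exact h (mem_closedBall_zero_iff.2 ((le_max_left _ _).trans this))
    · exact h (mem_closedBall_zero_iff.2 ((le_max_right _ _).trans this))
  obtain ⟨M, hM⟩ := hg.bounded_above_of_compact_support hgc
  set s : ℕ → SimpleFunc ℂ ℂ := SimpleFunc.nearestPt (TopologicalSpace.denseSeq ℂ)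
  set k : ℕ → ℂ × ℂ → ℂ := fun n p => A.indicator (fun x => g (s n x, p.2)) p.1 with hk
  have hmeas : ∀ n, Measurable (k n) := fun n => by
    have h1 : Measurable fun p : ℂ × ℂ => g (s n p.1, p.2) :=
      hg.measurable.comp (((s n).measurable.comp measurable_fst).prodMk measurable_snd)
    have := h1.indicator (hA.prod (MeasurableSet.univ (α := ℂ)))
    convert this using 1
    funext p
    by_cases hp : p.1 ∈ A
    · simp [k, hp]
    · simp [k, hp]
  have hbd : ∀ n p, ‖k n p‖ ≤ (A ×ˢ A).indicator (fun _ => M) p := fun n p => by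
    by_cases hp : p.1 ∈ A
    · by_cases hp2 : p.2 ∈ A
      · simpa [k, hp, hp2] using hM _
      · simp [k, hp, hp2, h0 _ _ (Or.inr hp2)]
    · simp [k, hp]
  have hbd' : ∀ p, ‖g p‖ ≤ (A ×ˢ A).indicator (fun _ => M) p := fun p => by
    by_cases hp : p ∈ A ×ˢ A
    · simpa [hp] using hM p
    · rw [indicator_of_notMem hp, h0 p.1 p.2 (by simpa [or_iff_not_imp_left] using hp), norm_zero]
  have hAA : (volume.prod volume) (A ×ˢ A) < ⊤ := by
    rw [Measure.prod_prod]; exact ENNReal.mul_lt_top hAf hAf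
  have hlp : ∀ c : ℝ, MemLp ((A ×ˢ A).indicator fun _ : ℂ × ℂ => c) 2 (volume.prod volume) :=
    fun c => memLp_indicator_const 2 (hA.prod hA) c (Or.inr hAA.ne)
  have hmem : ∀ n, MemLp (k n) 2 (volume.prod volume) := fun n =>
    (hlp M).mono' (hmeas n).aestronglyMeasurable (ae_of_all _ (hbd n))
  refine isCompactOperator_of_tendsto (tendsto_hsOp hK hmem ?_)
    (Eventually.of_forall fun n => hsOp_simple_compact (s n) A hA hAf (hmem n))
  have hsq : Tendsto (fun n => eLpNorm (k n - g) 2 (volume.prod volume) ^ 2) atTop (𝓝 0) := by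
    simp only [eLpNorm_two_sq]
    have hb2 := memLp_two_iff.1 (hlp (2 * M))
    have := tendsto_lintegral_of_dominated_convergence' (μ := volume.prod volume)
      (F := fun n p => ‖(k n - g) p‖ₑ ^ 2) (f := fun _ => 0)
      (fun p => ‖(A ×ˢ A).indicator (fun _ => 2 * M) p‖ₑ ^ 2)
      (fun n => (((hmeas n).sub hg.measurable).enorm.pow_const 2).aemeasurable) (fun n => ?_)
      hb2.2.ne (ae_of_all _ fun p => ?_)
    · simpa using this
    · refine ae_of_all _ fun p => ?_
      refine pow_le_pow_left' ?_ 2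
      rw [enorm_le_iff_norm_le]
      refine (norm_sub_le _ _).trans ((add_le_add (hbd n p) (hbd' p)).trans ?_)
      by_cases hp : p ∈ A ×ˢ A
      · simp only [indicator_of_mem hp]; rw [← two_mul]; exact le_abs_self _
      · simp [indicator_of_notMem hp]
    · have hp : Tendsto (fun n => k n p) atTop (𝓝 (g p)) := by
        by_cases hp : p.1 ∈ A
        · simp only [k, indicator_of_mem hp]
          have h1 : Tendsto (fun n => s n p.1) atTop (𝓝 p.1) :=
            SimpleFunc.tendsto_nearestPt (by
              rw [(TopologicalSpace.denseRange_denseSeq ℂ).closure_eq]; trivial)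
          exact (hg.tendsto (p.1, p.2)).comp (h1.prodMk_nhds tendsto_const_nhds)
        · have : g p = 0 := h0 p.1 p.2 (Or.inl hp)
          simp only [k, indicator_of_notMem hp, this]; exact tendsto_const_nhds
      have h2 : Tendsto (fun n => ‖(k n - g) p‖ₑ ^ 2) atTop (𝓝 (‖g p - g p‖ₑ ^ 2)) :=
        ENNReal.Tendsto.pow ((hp.sub_const (g p)).enorm)
      simpa using h2
  have := (ENNReal.continuous_rpow_const (y := 1 / 2)).tendsto 0 |>.comp hsq
  simp only [Function.comp_def, ← ENNReal.rpow_natCast, ← ENNReal.rpow_mul] at this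
  simpa using this

/-- Hilbert–Schmidt operators are compact. -/
theorem hsOp_compact {K : ℂ × ℂ → ℂ} (hK : MemLp K 2 (volume.prod volume)) :
    IsCompactOperator (hsOp hK) := by
  have h : ∀ n : ℕ, ∃ g : ℂ × ℂ → ℂ, HasCompactSupport g ∧
      eLpNorm (K - g) 2 (volume.prod volume) ≤ (n + 1 : ℝ≥0∞)⁻¹ ∧ Continuous g ∧
      MemLp g 2 (volume.prod volume) := fun n =>
    hK.exists_hasCompactSupport_eLpNorm_sub_le (by norm_num) (by simp)
  choose g h1 h2 h3 h4 using h
  refine isCompactOperator_of_tendsto (tendsto_hsOp hK h4 ?_)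
    (Eventually.of_forall fun n => hsOp_compact_of_continuous (h3 n) (h1 n) (h4 n))
  refine tendsto_of_tendsto_of_tendsto_of_le_of_le tendsto_const_nhds
    (h := fun n : ℕ => (n + 1 : ℝ≥0∞)⁻¹) ?_ (fun _ => zero_le) fun n => ?_
  · have := (tendsto_add_atTop_iff_nat 1).2 ENNReal.tendsto_inv_nat_nhds_zero
    simpa using this
  · rw [eLpNorm_sub_comm]; exact h2 n

/-- The sources `F y = v R(·, y)` associated with an outgoing Green function of the potential `v`. -/
structure IsSource (κ R : ℝ) (v : ℂ → ℂ) (F : ℂ → ℂ → ℂ) : Prop where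
  l2 : ∀ y, L2B R (F y)
  eq : ∀ y, ∀ᵐ z, F y z = v z * (-gG κ (z - y) + cv (gG κ) (F y) z)

/-- `u` is a solution of `(Δ + κ² + v) u = 0` in a neighbourhood of the closed disc of radius `R`,
in the weak form obtained by testing against functions supported in the disc. -/
structure IsWeakSol (κ R : ℝ) (v u : ℂ → ℂ) : Prop where
  l2 : L2B R u
  eq : ∀ P g : ℂ → ℂ, L2B R P → L2B R g → WF κ P g → ∫ z, g z * u z = ∫ z, P z * (v z * u z)

lemma L2B.integrable_mul {R : ℝ} {f g : ℂ → ℂ} (hf : L2B R f) (hg : L2B R g) :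
    Integrable fun z => f z * g z := hf.memLp.integrable_mul hg.memLp

lemma gG_sub_comm (κ : ℝ) (x z : ℂ) : gG κ (x - z) = gG κ (z - x) := by
  rw [← gG_neg, neg_sub]

lemma gG_integrable' (κ : ℝ) {R : ℝ} {f : ℂ → ℂ} (hf : L2B R f) (x : ℂ) :
    Integrable fun z => gG κ (z - x) * f z := by
  simpa only [gG_sub_comm κ x] using gG_integrable κ hf x

lemma integral_cv_gG_mul (κ : ℝ) {R : ℝ} {f g : ℂ → ℂ} (hf : L2B R f) (hg : L2B R g) :
    ∫ x, cv (gG κ) f x * g x = ∫ z, f z * cv (gG κ) g z := by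
  rw [integral_cv_mul (locInt_gG κ) hf hg]; simp only [gG_neg]

/-- The potential generated by `h`, expressed through the outgoing Green function. -/
lemma cv_green_eq_sub {κ R : ℝ} {v : ℂ → ℂ} {F : ℂ → ℂ → ℂ} (hF : IsSource κ R v F) {h : ℂ → ℂ}
    (hh : L2B R h) (y : ℂ) :
    Integrable (fun z => (-gG κ (z - y) + cv (gG κ) (F y) z) * h z) ∧
    cv (gG κ) h y = (∫ z, cv (gG κ) (F y) z * h z) -
      ∫ z, (-gG κ (z - y) + cv (gG κ) (F y) z) * h z := by
  have i1 := cv_mul_integrable (locInt_gG κ) (hF.l2 y) hh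
  have i2 := gG_integrable' κ hh y
  have i3 : Integrable (fun z => (-gG κ (z - y) + cv (gG κ) (F y) z) * h z) :=
    (i1.sub i2).congr (ae_of_all _ fun z => by simp only [Pi.sub_apply]; ring)
  refine ⟨i3, ?_⟩
  rw [← integral_sub i1 i3, cv]
  congr 1; funext z; rw [gG_sub_comm]; ring

lemma source_symm {κ R : ℝ} {v : ℂ → ℂ} {F : ℂ → ℂ → ℂ} (hF : IsSource κ R v F) (x y : ℂ) :
    cv (gG κ) (F y) x = cv (gG κ) (F x) y := by
  rw [(cv_green_eq_sub hF (hF.l2 y) x).2, (cv_green_eq_sub hF (hF.l2 x) y).2,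
    integral_cv_gG_mul κ (hF.l2 x) (hF.l2 y)]
  congr 1
  · congr 1; funext z; ring
  · refine integral_congr_ae ?_
    filter_upwards [hF.eq x, hF.eq y] with z h1 h2
    rw [h1, h2]; ring

lemma IsSource.ae_eq_zero {κ R : ℝ} {v : ℂ → ℂ} {F : ℂ → ℂ → ℂ} (hF : IsSource κ R v F) {U : Set ℂ}
    (hv : ∀ z ∈ U, v z = 0) (y : ℂ) : ∀ᵐ z, z ∈ U → F y z = 0 :=
  (hF.eq y).mono fun z hz hU => by rw [hz, hv z hU, zero_mul]

lemma cv_gG_sub (κ : ℝ) {R : ℝ} {f g : ℂ → ℂ} (hf : L2B R f) (hg : L2B R g) (x : ℂ) :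
    cv (gG κ) (fun z => f z - g z) x = cv (gG κ) f x - cv (gG κ) g x := by
  simp only [cv, mul_sub]
  exact integral_sub (gG_integrable κ hf x) (gG_integrable κ hg x)

/-- Equality of the imaginary parts on the curve propagates to equality of the Green functions
on the exterior region. -/
theorem source_eq {κ R : ℝ} (hκ : 0 < κ) {v₁ v₂ : ℂ → ℂ} {F₁ F₂ : ℂ → ℂ → ℂ}
    (hF₁ : IsSource κ R v₁ F₁) (hF₂ : IsSource κ R v₂ F₂) {U D V : Set ℂ}
    (hUo : IsOpen U) (hUc : IsPreconnected U) (hUR : ∀ z, R < ‖z‖ → z ∈ U)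
    (hv₁ : ∀ z ∈ U, v₁ z = 0) (hv₂ : ∀ z ∈ U, v₂ z = 0)
    (hDo : IsOpen D) (hDne : D.Nonempty) (hDU : closure D ⊆ U)
    (hDir : ∀ u : ℂ → ℂ, ContinuousOn u (closure D) → ContDiffOn ℝ 2 u D →
      (∀ x ∈ D, lap u x + (κ : ℂ) ^ 2 * u x = 0) → (∀ x ∈ frontier D, u x = 0) → ∀ x ∈ D, u x = 0)
    {γ : ℝ → ℂ} (hγa : ∀ t, AnalyticAt ℝ γ t) (hγd : ∀ t, deriv γ t ≠ 0)
    (hγ : frontier D = range γ) (hV : IsOpen V) {t₀ : ℝ} (ht₀ : γ t₀ ∈ V)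
    (him : ∀ s t, γ s ∈ V → γ t ∈ V → γ t ≠ γ s →
      (cv (gG κ) (F₁ (γ s)) (γ t)).im = (cv (gG κ) (F₂ (γ s)) (γ t)).im) :
    ∀ x ∈ U, ∀ y ∈ U, cv (gG κ) (fun z => F₁ y z - F₂ y z) x = 0 := by
  have h0 : ∀ y, ∀ᵐ z, z ∈ U → F₁ y z - F₂ y z = 0 := fun y => by
    filter_upwards [hF₁.ae_eq_zero hv₁ y, hF₂.ae_eq_zero hv₂ y] with z h1 h2 hz
    rw [h1 hz, h2 hz, sub_zero]
  have hΛ : ∀ s, γ s ∈ V → ∀ x ∈ U, cv (gG κ) (fun z => F₁ (γ s) z - F₂ (γ s) z) x = 0 :=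
    fun s hs => outgoing_eq_zero hκ ((hF₁.l2 _).sub (hF₂.l2 _)) hUo hUc hUR (h0 _) hDo hDne hDU
      hDir hγa hγd hγ hV ht₀ (γ s) fun t ht hne => by
        rw [cv_gG_sub κ (hF₁.l2 _) (hF₂.l2 _), Complex.sub_im, him s t hs ht hne, sub_self]
  intro x hx y hy
  refine outgoing_eq_zero hκ ((hF₁.l2 _).sub (hF₂.l2 _)) hUo hUc hUR (h0 _) hDo hDne hDU
      hDir hγa hγd hγ hV ht₀ y (fun t ht _ => ?_) x hx
  have := hΛ t ht y hy
  rw [cv_gG_sub κ (hF₁.l2 _) (hF₂.l2 _), source_symm hF₁, source_symm hF₂,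
    ← cv_gG_sub κ (hF₁.l2 _) (hF₂.l2 _), this, Complex.zero_im]

/-- Testing the difference of two Green functions against a weak solution. -/
theorem integral_source_eq_zero {κ R : ℝ} {v₁ v₂ : ℂ → ℂ} {F₁ F₂ : ℂ → ℂ → ℂ}
    (hv₁ : MemLp v₁ ⊤ volume)
    (hF₁ : IsSource κ R v₁ F₁) (hF₂ : IsSource κ R v₂ F₂) {u : ℂ → ℂ} (hu : IsWeakSol κ R v₁ u)
    {y : ℂ} (hS : ∀ x, R < ‖x‖ → cv (gG κ) (fun z => F₁ y z - F₂ y z) x = 0) :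
    ∫ z, (-gG κ (z - y) + cv (gG κ) (F₂ y) z) * ((v₁ z - v₂ z) * u z) = 0 := by
  set S := cv (gG κ) (fun z => F₁ y z - F₂ y z) with hSdef
  have hg := (hF₁.l2 y).sub (hF₂.l2 y)
  have hSl : L2B R S := by
    have := hg.cv (locInt_gG κ) (measurable_gG κ) R
    convert this using 1
    funext z
    rcases le_or_gt ‖z‖ R with h | h
    · rw [cut_of_le h]
    · rw [cut_of_lt h, hS z h]
  have h1 := hu.eq S _ hSl hg (WF.of_green hg hS (ae_of_all _ fun _ => rfl))
  have i1 := hg.integrable_mul hu.l2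
  have i2 := hSl.integrable_mul (hu.l2.bdd_mul hv₁)
  rw [← sub_eq_zero, ← integral_sub i1 i2] at h1
  rw [← h1]
  refine integral_congr_ae ?_
  filter_upwards [hF₁.eq y, hF₂.eq y] with z e1 e2
  have e3 : S z = cv (gG κ) (F₁ y) z - cv (gG κ) (F₂ y) z := cv_gG_sub κ (hF₁.l2 y) (hF₂.l2 y) z
  rw [e3, e1, e2]; ring

lemma memLp_green_kernel (κ R : ℝ) {v : ℂ → ℂ} (hv : MemLp v ⊤ volume)
    (hvR : ∀ z, R < ‖z‖ → v z = 0) :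
    MemLp (fun p : ℂ × ℂ => cut R (fun _ => 1) p.1 * (gG κ (p.1 - p.2) * v p.2)) 2
      (volume.prod volume) := by
  have hvL : L2B R v := by
    have h1 : L2B R (cut R fun _ => 1) := L2B.of_bounded (C := 1)
      ((aestronglyMeasurable_const).indicator Metric.isClosed_closedBall.measurableSet)
      (fun z => norm_cut_le.trans (by simp)) (fun z hz => cut_of_lt hz)
    convert h1.bdd_mul hv using 1
    funext z
    rcases le_or_gt ‖z‖ R with h | h
    · rw [cut_of_le h, mul_one]
    · rw [hvR z h, zero_mul]
  have hG : L2B (R + R) (cut (R + R) (gG κ)) := by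
    simpa [gG_neg] using L2B.gG_shift κ 0 (R + R)
  have hm : AEStronglyMeasurable
      (fun p : ℂ × ℂ => cut R (fun _ => 1) p.1 * (gG κ (p.1 - p.2) * v p.2))
      (volume.prod volume) :=
    (AEStronglyMeasurable.comp_fst ((aestronglyMeasurable_const).indicator
      Metric.isClosed_closedBall.measurableSet)).mul
      ((aesm_kernel (measurable_gG κ).aestronglyMeasurable).mul hv.1.comp_snd)
  rw [memLp_two_iff_integrable_sq_norm hm]
  refine (Integrable.convolution_integrand (ContinuousLinearMap.mul ℝ ℝ) hvL.norm_sq hG.norm_sq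
    (μ := volume) (ν := volume)).mono' (hm.norm.pow 2) (ae_of_all _ fun p => ?_)
  simp only [ContinuousLinearMap.mul_apply', norm_pow, norm_norm, norm_mul, mul_pow]
  rcases le_or_gt ‖p.1‖ R with h | h
  · rcases le_or_gt ‖p.2‖ R with h2 | h2
    · rw [cut_of_le h, cut_of_le ((norm_sub_le _ _).trans (add_le_add h h2))]
      simp [mul_comm]
    · simp [hvR _ h2]
  · rw [cut_of_lt h, norm_zero]; simp only [ne_eq, OfNat.ofNat_ne_zero, not_false_eq_true, zero_pow, zero_mul]
    positivity

/-- Solvability of the Lippmann–Schwinger equation from uniqueness. -/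
theorem exists_lippmann_schwinger {κ R : ℝ} {v : ℂ → ℂ} (hv : MemLp v ⊤ volume)
    (hvR : ∀ z, R < ‖z‖ → v z = 0)
    (huniq : ∀ q, L2B R q → (∀ᵐ x, ‖x‖ ≤ R → q x = cv (gG κ) (fun z => v z * q z) x) →
      q =ᵐ[volume] 0) {f : ℂ → ℂ} (hf : L2B R f) :
    ∃ q, L2B R q ∧ ∀ᵐ x, ‖x‖ ≤ R → q x = cv (gG κ) (fun z => v z * q z - f z) x := by
  have hK := memLp_green_kernel κ R hv hvR
  have hcv : ∀ (q : E2) x, ∫ z, (cut R (fun _ => 1) x * (gG κ (x - z) * v z)) * q z =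
      cut R (cv (gG κ) fun z => v z * q z) x := fun q x => by
    rcases le_or_gt ‖x‖ R with h | h
    · simp only [cut_of_le h, cv, one_mul, mul_assoc]
    · simp [cut_of_lt h]
  have hcut : ∀ q : E2, L2B R (cut R q) := fun q =>
    ⟨(Lp.memLp q).indicator Metric.isClosed_closedBall.measurableSet, fun z hz => cut_of_lt hz⟩
  have hvc : ∀ q : ℂ → ℂ, (fun z => v z * cut R q z) = fun z => v z * q z := fun q => by
    funext z
    rcases le_or_gt ‖z‖ R with h | h
    · rw [cut_of_le h]
    · rw [hvR z h, zero_mul, zero_mul]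
  rcases (hsOp_compact hK).hasEigenvalue_or_mem_resolventSet one_ne_zero with h | h
  · obtain ⟨q, hq⟩ := h.exists_hasEigenvector
    have hq1 : hsOp hK q = q := by simpa using hq.apply_eq_smul
    have hqe : ∀ᵐ x, q x = cut R (cv (gG κ) fun z => v z * q z) x := by
      have := hsOp_apply hK q
      rw [hq1] at this
      exact this.mono fun x hx => hx.trans (hcv q x)
    have h0 : cut R q =ᵐ[volume] 0 := by
      refine huniq _ (hcut q) (hqe.mono fun x hx hxR => ?_)
      rw [cut_of_le hxR, hx, cut_of_le hxR, hvc]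
    refine absurd (Lp.ext ?_) hq.2
    filter_upwards [hqe, h0, Lp.coeFn_zero ℂ 2 (volume : Measure ℂ)] with x h1 h2 h3
    rw [h3]
    rcases le_or_gt ‖x‖ R with h | h
    · rwa [cut_of_le h] at h2
    · rw [h1, cut_of_lt h]; rfl
  · rw [spectrum.mem_resolventSet_iff] at h
    obtain ⟨A, hA⟩ := h
    have hGf := hf.cv (locInt_gG κ) (measurable_gG κ) R
    set b : E2 := -hGf.memLp.toLp
    set q : E2 := (↑A⁻¹ : E2 →L[ℂ] E2) b
    have hq : q - hsOp hK q = b := by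
      have h1 : (A : E2 →L[ℂ] E2) q = b := by
        change ((A : E2 →L[ℂ] E2) * ↑A⁻¹) b = b
        rw [Units.mul_inv]; rfl
      rw [hA] at h1
      simpa using h1
    refine ⟨cut R q, hcut q, ?_⟩
    filter_upwards [Lp.coeFn_sub q (hsOp hK q), hsOp_apply hK q, Lp.coeFn_neg hGf.memLp.toLp,
      hGf.memLp.coeFn_toLp] with x h1 h2 h3 h4 hx
    rw [hq, Pi.sub_apply, h3, Pi.neg_apply, h4, h2, hcv, cut_of_le hx, cut_of_le hx] at h1
    rw [cut_of_le hx, cv_gG_sub κ ((hcut q).bdd_mul hv) hf, hvc]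
    linear_combination -h1

/-- The orthogonality relation: the difference of the potentials annihilates products of weak
solutions. -/
theorem integral_mul_weakSol {κ R : ℝ} {v₁ v₂ : ℂ → ℂ} {F₁ F₂ : ℂ → ℂ → ℂ}
    (hv₁ : MemLp v₁ ⊤ volume) (hv₂ : MemLp v₂ ⊤ volume) (hvR : ∀ z, R < ‖z‖ → v₂ z = 0)
    (hF₁ : IsSource κ R v₁ F₁) (hF₂ : IsSource κ R v₂ F₂)
    (hS : ∀ x y, R < ‖x‖ → R < ‖y‖ → cv (gG κ) (fun z => F₁ y z - F₂ y z) x = 0)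
    (huniq : ∀ q, L2B R q → (∀ᵐ x, ‖x‖ ≤ R → q x = cv (gG κ) (fun z => v₂ z * q z) x) →
      q =ᵐ[volume] 0) {u₁ u₂ : ℂ → ℂ} (hu₁ : IsWeakSol κ R v₁ u₁) (hu₂ : IsWeakSol κ R v₂ u₂) :
    ∫ z, (v₁ z - v₂ z) * u₁ z * u₂ z = 0 := by
  set f : ℂ → ℂ := fun z => (v₁ z - v₂ z) * u₁ z with hfdef
  have hf : L2B R f := hu₁.l2.bdd_mul (hv₁.sub hv₂)
  obtain ⟨q, hq, hqe⟩ := exists_lippmann_schwinger hv₂ hvR huniq hf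
  set h : ℂ → ℂ := fun z => v₂ z * q z - f z with hh
  have hhL : L2B R h := (hq.bdd_mul hv₂).sub hf
  set Q := cv (gG κ) h with hQ
  have hQ0 : ∀ y, R < ‖y‖ → Q y = 0 := fun y hy => by
    obtain ⟨i1, e1⟩ := cv_green_eq_sub hF₂ hhL y
    obtain ⟨i2, e2⟩ := cv_green_eq_sub hF₂ hf y
    have h0 := integral_source_eq_zero hv₁ hF₁ hF₂ hu₁ (y := y) fun x hx => hS x y hx hy
    rw [hQ, e1, integral_cv_gG_mul κ (hF₂.l2 y) hhL, sub_eq_zero]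
    have : ∫ z, (-gG κ (z - y) + cv (gG κ) (F₂ y) z) * h z =
        (∫ z, (-gG κ (z - y) + cv (gG κ) (F₂ y) z) * h z) +
        ∫ z, (-gG κ (z - y) + cv (gG κ) (F₂ y) z) * f z := by
      rw [h0, add_zero]
    rw [this, ← integral_add i1 i2]
    refine integral_congr_ae ?_
    filter_upwards [hF₂.eq y, hqe] with z e3 e4
    rcases le_or_gt ‖z‖ R with hz | hz
    · have e5 : q z = cv (gG κ) h z := e4 hz
      rw [← e5, e3, hh]; ring
    · have : v₂ z = 0 := hvR z hz
      rw [e3, hh]; simp [this]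
  have hQL : L2B R Q := by
    convert hhL.cv (locInt_gG κ) (measurable_gG κ) R using 1
    funext z
    rcases le_or_gt ‖z‖ R with h | h
    · rw [cut_of_le h]
    · rw [cut_of_lt h, hQ0 z h]
  have h1 := hu₂.eq Q h hQL hhL (WF.of_green hhL hQ0 (ae_of_all _ fun _ => rfl))
  have i1 := hhL.integrable_mul hu₂.l2
  have i2 := hQL.integrable_mul (hu₂.l2.bdd_mul hv₂)
  rw [eq_comm, ← sub_eq_zero, ← integral_sub i2 i1] at h1
  rw [← h1]
  refine integral_congr_ae ?_
  filter_upwards [hqe] with z e4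
  rcases le_or_gt ‖z‖ R with hz | hz
  · rw [← e4 hz, hh]; simp only [hfdef]; ring
  · simp [hu₂.l2.supp z hz]

open FourierTransform in
/-- Plancherel's theorem for integrable square-integrable functions. -/
lemma eLpNorm_fourier {f : ℂ → ℂ} (h1 : Integrable f) (h2 : MemLp f 2 volume) :
    eLpNorm (𝓕 f) 2 volume = eLpNorm f 2 volume := by
  have key : (𝓕 h2.toLp : E2) =ᵐ[volume] 𝓕 f := by
    have hl1 : LocallyIntegrable (𝓕 h2.toLp : E2) :=
      (Lp.memLp (𝓕 h2.toLp : E2)).locallyIntegrable (by norm_num)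
    have hc : Continuous (𝓕 f) :=
      VectorFourier.fourierIntegral_continuous Real.continuous_fourierChar continuous_inner h1
    refine ae_eq_of_integral_contDiff_smul_eq hl1 hc.locallyIntegrable fun g hg hgc => ?_
    have hg₁ : HasCompactSupport (Complex.ofRealCLM ∘ g) := hgc.comp_left rfl
    have hg₂ : ContDiff ℝ ∞ (Complex.ofRealCLM ∘ g) := by fun_prop
    set G := hg₁.toSchwartzMap hg₂
    have hG : ∀ z, G z = (g z : ℂ) := fun z => rfl
    have e1 := Lp.toTemperedDistribution_apply (𝓕 h2.toLp : E2) G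
    rw [← Lp.fourier_toTemperedDistribution_eq, TemperedDistribution.fourier_apply,
      Lp.toTemperedDistribution_apply] at e1
    have e2 := VectorFourier.integral_fourierIntegral_smul_eq_flip (L := innerₗ ℂ)
      Real.continuous_fourierChar continuous_inner h1 (G.integrable (μ := volume))
    calc ∫ z, g z • (𝓕 h2.toLp : E2) z = ∫ z, G z • (𝓕 h2.toLp : E2) z := by
          simp only [hG, smul_eq_mul, Complex.real_smul]
      _ = ∫ z, (𝓕 G) z • (h2.toLp f) z := e1.symm
      _ = ∫ z, f z • (𝓕 G) z := integral_congr_ae (by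
          filter_upwards [h2.coeFn_toLp] with z hz
          rw [hz, smul_eq_mul, smul_eq_mul, mul_comm])
      _ = ∫ z, 𝓕 f z • G z := by
          rw [SchwartzMap.fourier_coe]
          simpa using! e2.symm
      _ = ∫ z, g z • 𝓕 f z := by
          simp only [hG, smul_eq_mul, Complex.real_smul, mul_comm]
  have := Lp.norm_fourier_eq h2.toLp
  rw [Lp.norm_def, Lp.norm_toLp, ENNReal.toReal_eq_toReal_iff' (Lp.memLp _).2.ne h2.2.ne] at this
  rw [← this]; exact eLpNorm_congr_ae key.symm

/-- The oscillating phase `exp(4 i τ x y)`. -/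
def ph (τ : ℝ) (w : ℂ) : ℂ := Complex.exp (((4 * τ * w.re * w.im : ℝ) : ℂ) * Complex.I)

lemma norm_ph (τ : ℝ) (w : ℂ) : ‖ph τ w‖ = 1 := Complex.norm_exp_ofReal_mul_I _

lemma ph_contDiff (τ : ℝ) : ContDiff ℝ ∞ (ph τ) := by
  have h1 : ContDiff ℝ ∞ fun w : ℂ => w.re := Complex.reCLM.contDiff
  have h2 : ContDiff ℝ ∞ fun w : ℂ => w.im := Complex.imCLM.contDiff
  have h3 : ContDiff ℝ ∞ fun w : ℂ => ((4 * τ * w.re * w.im : ℝ) : ℂ) :=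
    Complex.ofRealCLM.contDiff.comp ((contDiff_const.mul h1).mul h2)
  exact (h3.mul contDiff_const).cexp

lemma ph_neg (τ : ℝ) (w : ℂ) : ph τ (-w) = ph τ w := by simp [ph]

lemma ph_mul_neg (τ : ℝ) (w : ℂ) : ph (-τ) w * ph τ w = 1 := by
  rw [ph, ph, ← Complex.exp_add, ← Complex.exp_zero]; congr 1; push_cast; ring

lemma star_ph (τ : ℝ) (w : ℂ) : star (ph τ w) = ph (-τ) w := by
  simp only [ph, Complex.star_def, ← Complex.exp_conj, map_mul, Complex.conj_ofReal, Complex.conj_I]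
  congr 1; push_cast; ring

/-- The oscillatory integral with phase centred at `z₀`. -/
def osc (τ : ℝ) (h : ℂ → ℂ) (z₀ : ℂ) : ℂ := ∫ z, ph τ (z - z₀) * h z

open FourierTransform in
lemma norm_osc (τ : ℝ) (h : ℂ → ℂ) (z₀ : ℂ) :
    ‖osc τ h z₀‖ = ‖𝓕 (fun z => ph τ z * h z) ((2 * τ / π) • (Complex.I * star z₀))‖ := by
  rw [Real.fourier_eq', osc]
  have : ∀ z, ph τ (z - z₀) * h z = ph τ z₀ * (Complex.exp ((-2 * π *
      inner ℝ z ((2 * τ / π) • (Complex.I * star z₀)) : ℝ) * Complex.I) • (ph τ z * h z)) := by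
    intro z
    rw [smul_eq_mul, ← mul_assoc, ← mul_assoc]
    congr 1
    rw [ph, ph, ph, ← Complex.exp_add, ← Complex.exp_add, Complex.inner]
    congr 1
    rw [← add_mul, ← add_mul]
    congr 1
    norm_cast
    simp
    field_simp
    ring
  rw [integral_congr_ae (ae_of_all _ this), integral_const_mul, norm_mul, norm_ph, one_mul]

lemma osc_sq {τ : ℝ} (hτ : τ ≠ 0) {R : ℝ} {h : ℂ → ℂ} (hh : L2B R h) :
    ∫⁻ z₀, ‖osc τ h z₀‖ₑ ^ 2 = ENNReal.ofReal ((π / (2 * τ)) ^ 2) * ∫⁻ z, ‖h z‖ₑ ^ 2 := by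
  have hm := (ph_contDiff τ).continuous.aestronglyMeasurable (μ := (volume : Measure ℂ))
  have hL : L2B R fun z => ph τ z * h z := by
    refine ⟨hh.memLp.mono (hm.mul hh.memLp.1) (ae_of_all _ fun z => by simp [norm_ph]), fun z hz => by
      simp [hh.supp z hz]⟩
  have h1 := congrArg (· ^ 2) (eLpNorm_fourier hL.integrable hL.memLp)
  simp only [eLpNorm_two_sq] at h1
  have hc : (2 * τ / π) ≠ 0 := by positivity
  have hF : Continuous (FourierTransform.fourier fun z => ph τ z * h z : ℂ → ℂ) :=
    VectorFourier.fourierIntegral_continuous Real.continuous_fourierChar continuous_inner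
      hL.integrable
  have hmp : MeasurePreserving (fun z : ℂ => Complex.I * star z) volume volume := by
    have h2 : MeasurePreserving (fun z : ℂ => rotation (Circle.exp (π / 2)) (Complex.conjLIE z))
        volume volume := (rotation (Circle.exp (π / 2))).measurePreserving.comp
      Complex.conjLIE.measurePreserving
    have e : (fun z : ℂ => Complex.I * star z) =
        fun z : ℂ => rotation (Circle.exp (π / 2)) (Complex.conjLIE z) := by
      funext z
      simp [Complex.exp_pi_div_two_mul_I]
    rwa [e]
  have hn : ∀ z₀, ‖osc τ h z₀‖ₑ ^ 2 = ‖FourierTransform.fourier (fun z => ph τ z * h z)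
      ((2 * τ / π) • (Complex.I * star z₀))‖ₑ ^ 2 := fun z₀ => by
    rw [← ofReal_norm, norm_osc, ofReal_norm]
  rw [lintegral_congr hn, hmp.lintegral_comp
    (f := fun w => ‖FourierTransform.fourier (fun z => ph τ z * h z) ((2 * τ / π) • w)‖ₑ ^ 2)
      ((hF.comp (continuous_const_smul _)).measurable.enorm.pow_const 2)]
  have h3 := lintegral_map (μ := (volume : Measure ℂ))
    (f := fun w => ‖FourierTransform.fourier (fun z => ph τ z * h z) w‖ₑ ^ 2)
    (hF.measurable.enorm.pow_const 2) (measurable_const_smul (2 * τ / π))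
  rw [← h3, Measure.map_addHaar_smul volume hc, lintegral_smul_measure, h1, Complex.finrank_real_complex,
    smul_eq_mul]
  congr 2
  · rw [abs_of_nonneg (by positivity), div_pow, div_pow, inv_div]
  · funext z; rw [enorm_mul, ← ofReal_norm (ph τ z), norm_ph, ENNReal.ofReal_one, one_mul]

/-- Bounded measurable functions supported in a disc. -/
structure Pot (M R : ℝ) (Q : ℂ → ℂ) : Prop where
  meas : Measurable Q
  bdd : ∀ z, ‖Q z‖ ≤ M
  supp : ∀ z, R < ‖z‖ → Q z = 0

/-- The conjugate Cauchy kernel. -/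
def ckb (z : ℂ) : ℂ := star (ck z)

lemma measurable_ckb : Measurable ckb := continuous_star.measurable.comp measurable_ck

lemma norm_ckb (z : ℂ) : ‖ckb z‖ = ‖ck z‖ := norm_star _

lemma locInt_ckb : LocallyIntegrable ckb := by
  refine locInt_ck.mono measurable_ckb.aestronglyMeasurable (ae_of_all _ fun z => (norm_ckb z).le)

lemma Pot.l2 {M R : ℝ} {Q : ℂ → ℂ} (h : Pot M R Q) : L2B R Q :=
  L2B.of_bounded h.meas.aestronglyMeasurable h.bdd h.supp

lemma Pot.mul_ph {M R : ℝ} {Q : ℂ → ℂ} (h : Pot M R Q) (τ : ℝ) (z₀ : ℂ) :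
    Pot M R fun z => ph τ (z - z₀) * Q z where
  meas := (((ph_contDiff τ).continuous.comp (continuous_sub_right z₀)).measurable).mul h.meas
  bdd z := by rw [norm_mul, norm_ph, one_mul]; exact h.bdd z
  supp z hz := by rw [h.supp z hz, mul_zero]

/-- The `L²` size, on the disc of radius `S`, of the conjugate Cauchy transform of the oscillating
function `exp(iτψ) Q`. -/
def dec (S τ : ℝ) (Q : ℂ → ℂ) (z₀ : ℂ) : ℝ≥0∞ :=
  ∫⁻ ζ, ‖cut S (cv ckb fun z => ph τ (z - z₀) * Q z) ζ‖ₑ ^ 2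

lemma ennreal_add_sq_le (a b : ℝ≥0∞) : (a + b) ^ 2 ≤ 4 * (a ^ 2 + b ^ 2) := by
  rcases le_total a b with h | h
  · calc (a + b) ^ 2 ≤ (b + b) ^ 2 := by gcongr
      _ = 4 * b ^ 2 := by ring
      _ ≤ _ := by gcongr; exact le_add_self
  · calc (a + b) ^ 2 ≤ (a + a) ^ 2 := by gcongr
      _ = 4 * a ^ 2 := by ring
      _ ≤ _ := by gcongr; exact le_self_add

/-- The weight `|w|^{-3/2}` on a disc. -/
def wgt (T : ℝ) (w : ℂ) : ℝ≥0∞ :=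
  (Metric.closedBall (0:ℂ) T).indicator (fun w => ENNReal.ofReal (‖w‖ ^ (-(3/2) : ℝ))) w

lemma measurable_wgt (T : ℝ) : Measurable (wgt T) :=
  (Measurable.ennreal_ofReal (by fun_prop)).indicator Metric.isClosed_closedBall.measurableSet

lemma wgt_finite (T : ℝ) : ∫⁻ w, wgt T w < ⊤ := by
  have h : LocallyIntegrable fun w : ℂ => ((‖w‖ ^ (-(3/2) : ℝ) : ℝ) : ℂ) :=
    locInt_of_bound (by fun_prop) (α := 3 / 2) (by norm_num) fun R => ⟨1, fun z hz hR => by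
      rw [Complex.norm_real, Real.norm_of_nonneg (by positivity), one_mul]⟩
  have h2 := (h.integrableOn_isCompact (isCompact_closedBall (0:ℂ) T)).2
  rw [HasFiniteIntegral, ← lintegral_indicator Metric.isClosed_closedBall.measurableSet] at h2
  refine lt_of_le_of_lt (lintegral_mono fun w => ?_) h2
  unfold wgt
  by_cases hw : w ∈ Metric.closedBall (0:ℂ) T
  · rw [indicator_of_mem hw, indicator_of_mem hw, ← ofReal_norm, Complex.norm_real,
      Real.norm_of_nonneg (by positivity)]
  · rw [indicator_of_notMem hw]; exact zero_le

lemma norm_ck_near {δ : ℝ} (hδ : 0 < δ) {w : ℂ} (h : ‖w‖ < δ) :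
    ‖ck w‖ ≤ δ ^ (1/2 : ℝ) * ‖w‖ ^ (-(3/2) : ℝ) := by
  rcases eq_or_ne w 0 with rfl | hw
  · simp [ck]
  have hw' : 0 < ‖w‖ := norm_pos_iff.2 hw
  have h1 : ‖w‖⁻¹ = ‖w‖ ^ (1/2 : ℝ) * ‖w‖ ^ (-(3/2) : ℝ) := by
    rw [← Real.rpow_add hw', ← Real.rpow_neg_one]; norm_num
  have h2 : ‖ck w‖ ≤ ‖w‖⁻¹ := by
    rw [ck, norm_div, norm_one, norm_mul, Complex.norm_real, Real.norm_of_nonneg pi_pos.le, one_div]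
    exact inv_anti₀ hw' (le_mul_of_one_le_left hw'.le (by linarith [pi_gt_three]))
  rw [h1] at h2
  exact h2.trans (by gcongr)

lemma norm_ck_far {δ : ℝ} (hδ : 0 < δ) {w : ℂ} (h : δ ≤ ‖w‖) :
    ‖ck w‖ ^ 2 ≤ δ ^ (-(1/2) : ℝ) * ‖w‖ ^ (-(3/2) : ℝ) := by
  have hw' : 0 < ‖w‖ := hδ.trans_le h
  have h1 : (‖w‖⁻¹) ^ 2 = ‖w‖ ^ (-(1/2) : ℝ) * ‖w‖ ^ (-(3/2) : ℝ) := by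
    rw [← Real.rpow_add hw', ← Real.rpow_neg_one, ← Real.rpow_mul_natCast hw'.le]; norm_num
  have h2 : ‖ck w‖ ≤ ‖w‖⁻¹ := by
    rw [ck, norm_div, norm_one, norm_mul, Complex.norm_real, Real.norm_of_nonneg pi_pos.le, one_div]
    exact inv_anti₀ hw' (le_mul_of_one_le_left hw'.le (by linarith [pi_gt_three]))
  refine (pow_le_pow_left₀ (norm_nonneg _) h2 2).trans ?_
  rw [h1]
  gcongr ?_ * _
  exact Real.rpow_le_rpow_of_nonpos hδ h (by norm_num)

lemma cauchy_osc_le {M R S δ τ : ℝ} {Q : ℂ → ℂ} (hQ : Pot M R Q) (hδ : 0 < δ) (hτ : τ ≠ 0) {ζ : ℂ}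
    (hζ : ‖ζ‖ ≤ S) (R₁ : ℝ) :
    ∫⁻ z₀ in Metric.closedBall 0 R₁, ‖cv ckb (fun z => ph τ (z - z₀) * Q z) ζ‖ₑ ^ 2 ≤
      4 * (ENNReal.ofReal M ^ 2 * ENNReal.ofReal δ * (∫⁻ w, wgt (S + R) w) ^ 2 *
        volume (Metric.closedBall (0:ℂ) R₁) +
      ENNReal.ofReal M ^ 2 * ENNReal.ofReal ((π / (2 * τ)) ^ 2 * δ ^ (-(1/2) : ℝ)) *
        ∫⁻ w, wgt (S + R) w) := by
  have hM : 0 ≤ M := (norm_nonneg _).trans (hQ.bdd 0)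
  set I₀ := ∫⁻ w, wgt (S + R) w
  set B : Set ℂ := Metric.ball 0 δ
  have hB : MeasurableSet B := Metric.isOpen_ball.measurableSet
  set kN : ℂ → ℂ := B.indicator ckb
  set kF : ℂ → ℂ := Bᶜ.indicator ckb
  have hkN : Measurable kN := measurable_ckb.indicator hB
  have hkF : Measurable kF := measurable_ckb.indicator hB.compl
  have hQe : ∀ z, ‖Q z‖ₑ ≤ ENNReal.ofReal M := fun z => by
    rw [← ofReal_norm]; exact ENNReal.ofReal_le_ofReal (hQ.bdd z)
  have hw : ∀ z, ‖z‖ ≤ R → wgt (S + R) (ζ - z) = ENNReal.ofReal (‖ζ - z‖ ^ (-(3/2) : ℝ)) :=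
    fun z hz => indicator_of_mem (by
      rw [mem_closedBall_zero_iff]; exact (norm_sub_le _ _).trans (add_le_add hζ hz)) _
  have hshift : ∫⁻ z, wgt (S + R) (ζ - z) = I₀ := lintegral_sub_left_eq_self _ ζ
  have hwm : Measurable fun z => wgt (S + R) (ζ - z) :=
    (measurable_wgt _).comp (measurable_const.sub measurable_id)
  have hnear : ∫⁻ z, ‖kN (ζ - z)‖ₑ * ‖Q z‖ₑ ≤
      ENNReal.ofReal M * ENNReal.ofReal (δ ^ (1/2 : ℝ)) * I₀ := by
    rw [← hshift, ← lintegral_const_mul _ hwm]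
    refine lintegral_mono fun z => ?_
    rcases le_or_gt ‖z‖ R with hz | hz
    · rw [hw z hz]
      by_cases hb : ζ - z ∈ B
      · have h1 : ‖kN (ζ - z)‖ₑ ≤ ENNReal.ofReal (δ ^ (1/2 : ℝ)) *
            ENNReal.ofReal (‖ζ - z‖ ^ (-(3/2) : ℝ)) := by
          rw [← ENNReal.ofReal_mul (by positivity), ← ofReal_norm]
          refine ENNReal.ofReal_le_ofReal ?_
          simp only [kN, indicator_of_mem hb, norm_ckb]
          exact norm_ck_near hδ (by simpa [B] using hb)
        calc _ ≤ _ := mul_le_mul' h1 (hQe z)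
          _ = _ := by ring
      · simp [kN, indicator_of_notMem hb]
    · simp [hQ.supp z hz]
  have hfar : ∫⁻ z, ‖kF (ζ - z) * Q z‖ₑ ^ 2 ≤
      ENNReal.ofReal M ^ 2 * ENNReal.ofReal (δ ^ (-(1/2) : ℝ)) * I₀ := by
    rw [← hshift, ← lintegral_const_mul _ hwm]
    refine lintegral_mono fun z => ?_
    simp only [enorm_mul, mul_pow]
    rcases le_or_gt ‖z‖ R with hz | hz
    · rw [hw z hz]
      by_cases hb : ζ - z ∈ B
      · have : kF (ζ - z) = 0 := indicator_of_notMem (by simpa using hb) _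
        simp [this]
      · have h1 : ‖kF (ζ - z)‖ₑ ^ 2 ≤ ENNReal.ofReal (δ ^ (-(1/2) : ℝ)) *
            ENNReal.ofReal (‖ζ - z‖ ^ (-(3/2) : ℝ)) := by
          rw [← ENNReal.ofReal_mul (by positivity), ← ofReal_norm,
            ← ENNReal.ofReal_pow (norm_nonneg _)]
          refine ENNReal.ofReal_le_ofReal ?_
          have : kF (ζ - z) = ckb (ζ - z) := indicator_of_mem (by simpa using hb) _
          rw [this, norm_ckb]
          exact norm_ck_far hδ (by simpa [B] using hb)
        calc _ ≤ _ := mul_le_mul' h1 (pow_le_pow_left' (hQe z) 2)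
          _ = _ := by ring
    · simp [hQ.supp z hz]
  have hfarL : L2B R fun z => kF (ζ - z) * Q z :=
    ⟨memLp_two_iff.2 ⟨((hkF.comp (measurable_const.sub measurable_id)).mul hQ.meas).aestronglyMeasurable,
      hfar.trans_lt (ENNReal.mul_lt_top (ENNReal.mul_lt_top (ENNReal.pow_lt_top ENNReal.ofReal_lt_top)
        ENNReal.ofReal_lt_top) (wgt_finite _))⟩, fun z hz => by simp [hQ.supp z hz]⟩
  have hIN : ∀ z₀, Integrable fun z => kN (ζ - z) * (ph τ (z - z₀) * Q z) := fun z₀ => by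
    refine ⟨((hkN.comp (measurable_const.sub measurable_id)).mul
      (hQ.mul_ph τ z₀).meas).aestronglyMeasurable, lt_of_le_of_lt (le_of_eq ?_) (hnear.trans_lt
      (ENNReal.mul_lt_top (ENNReal.mul_lt_top ENNReal.ofReal_lt_top ENNReal.ofReal_lt_top)
        (wgt_finite _)))⟩
    refine lintegral_congr fun z => ?_
    rw [enorm_mul, enorm_mul, ← ofReal_norm (ph _ _), norm_ph, ENNReal.ofReal_one, one_mul]
  have hIF : ∀ z₀, Integrable fun z => ph τ (z - z₀) * (kF (ζ - z) * Q z) := fun z₀ =>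
    hfarL.integrable.mono (((ph_contDiff τ).continuous.comp
      (continuous_sub_right z₀)).aestronglyMeasurable.mul hfarL.memLp.1)
      (ae_of_all _ fun z => by rw [norm_mul, norm_ph, one_mul])
  have hsplit : ∀ z₀, ‖cv ckb (fun z => ph τ (z - z₀) * Q z) ζ‖ₑ ^ 2 ≤
      4 * ((ENNReal.ofReal M * ENNReal.ofReal (δ ^ (1/2 : ℝ)) * I₀) ^ 2 +
        ‖osc τ (fun z => kF (ζ - z) * Q z) z₀‖ₑ ^ 2) := fun z₀ => by
    refine le_trans (pow_le_pow_left' ?_ 2) (ennreal_add_sq_le _ _)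
    have e : cv ckb (fun z => ph τ (z - z₀) * Q z) ζ =
        (∫ z, kN (ζ - z) * (ph τ (z - z₀) * Q z)) + osc τ (fun z => kF (ζ - z) * Q z) z₀ := by
      rw [osc, ← integral_add (hIN z₀) (hIF z₀), cv]
      congr 1; funext z
      by_cases hb : ζ - z ∈ B
      · have h1 : kF (ζ - z) = 0 := indicator_of_notMem (by simpa using hb) _
        have h2 : kN (ζ - z) = ckb (ζ - z) := indicator_of_mem hb _
        rw [h1, h2]; ring
      · have h1 : kF (ζ - z) = ckb (ζ - z) := indicator_of_mem (by simpa using hb) _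
        have h2 : kN (ζ - z) = 0 := indicator_of_notMem hb _
        rw [h1, h2]; ring
    rw [e]
    refine (enorm_add_le _ _).trans ?_
    gcongr
    refine (enorm_integral_le_lintegral_enorm _).trans (le_trans (le_of_eq ?_) hnear)
    refine lintegral_congr fun z => ?_
    rw [enorm_mul, enorm_mul, ← ofReal_norm (ph _ _), norm_ph, ENNReal.ofReal_one, one_mul]
  refine (lintegral_mono fun z₀ => hsplit z₀).trans ?_
  rw [lintegral_const_mul' _ _ (by norm_num), lintegral_add_left measurable_const, lintegral_const,
    Measure.restrict_apply_univ]
  gcongr 4 * (?_ * _ + ?_)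
  · rw [mul_pow, mul_pow, ← ENNReal.ofReal_pow (p := δ ^ (1/2:ℝ)) (by positivity),
      ← Real.rpow_mul_natCast hδ.le]
    norm_num
  · refine (setLIntegral_le_lintegral _ _).trans ?_
    rw [osc_sq hτ hfarL, ENNReal.ofReal_mul (by positivity)]
    calc _ ≤ _ := mul_le_mul_right hfar _
      _ = _ := by ring

lemma measurable_dec_integrand {M R : ℝ} {Q : ℂ → ℂ} (hQ : Pot M R Q) (S τ : ℝ) :
    Measurable fun p : ℂ × ℂ => cut S (cv ckb fun z => ph τ (z - p.1) * Q z) p.2 := by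
  have h : StronglyMeasurable fun p : (ℂ × ℂ) × ℂ =>
      ckb (p.1.2 - p.2) * (ph τ (p.2 - p.1.1) * Q p.2) := by
    refine Measurable.stronglyMeasurable ?_
    have h1 := measurable_ckb
    have h2 := (ph_contDiff τ).continuous.measurable
    have h3 := hQ.meas
    fun_prop
  have h2 := h.integral_prod_right' (ν := (volume : Measure ℂ)).measurable
  have := h2.indicator (measurable_snd (Metric.isClosed_closedBall (x := (0:ℂ)) (ε := S)).measurableSet)
  exact this

lemma measurable_dec {M R : ℝ} {Q : ℂ → ℂ} (hQ : Pot M R Q) (S τ : ℝ) : Measurable (dec S τ Q) :=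
  ((measurable_dec_integrand hQ S τ).enorm.pow_const 2).lintegral_prod_right'

/-- Averaged decay of the oscillating Cauchy transforms. -/
theorem dec_le {M R : ℝ} {Q : ℂ → ℂ} (hQ : Pot M R Q) (S R₁ : ℝ) :
    ∃ C : ℝ≥0∞, C ≠ ⊤ ∧ ∀ τ : ℝ, 1 ≤ |τ| → ∫⁻ z₀ in Metric.closedBall 0 R₁, dec S τ Q z₀ ≤
      C * ENNReal.ofReal (|τ| ^ (-(5/4) : ℝ)) := by
  have hM : 0 ≤ M := (norm_nonneg _).trans (hQ.bdd 0)
  set I₀ := ∫⁻ w, wgt (S + R) w with hI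
  have hI' : I₀ ≠ ⊤ := (wgt_finite _).ne
  have hv : ∀ r : ℝ, volume (Metric.closedBall (0:ℂ) r) ≠ ⊤ := fun r =>
    (isCompact_closedBall (0:ℂ) r).measure_lt_top.ne
  refine ⟨4 * (ENNReal.ofReal M ^ 2 * I₀ ^ 2 * volume (Metric.closedBall (0:ℂ) R₁) +
    ENNReal.ofReal M ^ 2 * ENNReal.ofReal ((π / 2) ^ 2) * I₀) *
      volume (Metric.closedBall (0:ℂ) S), ?_, fun τ hτ => ?_⟩
  · have := hv R₁
    have := hv S
    finiteness
  have hτ0 : 0 < |τ| := by linarith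
  set δ : ℝ := |τ| ^ (-(5/4) : ℝ) with hδ
  have hδ0 : 0 < δ := by positivity
  have h1 : (π / (2 * τ)) ^ 2 * δ ^ (-(1/2) : ℝ) ≤ (π / 2) ^ 2 * δ := by
    have : (π / (2 * τ)) ^ 2 = (π / 2) ^ 2 * |τ| ^ (-2 : ℝ) := by
      rw [Real.rpow_neg hτ0.le, Real.rpow_two, sq_abs]; field_simp
    rw [this, mul_assoc, hδ, ← Real.rpow_mul hτ0.le, ← Real.rpow_add hτ0]
    gcongr
    norm_num
  unfold dec
  rw [lintegral_lintegral_swap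
    ((measurable_dec_integrand hQ S τ).enorm.pow_const 2).aemeasurable]
  calc ∫⁻ ζ, ∫⁻ z₀ in Metric.closedBall 0 R₁, ‖cut S (cv ckb fun z => ph τ (z - z₀) * Q z) ζ‖ₑ ^ 2
      ≤ ∫⁻ ζ, (Metric.closedBall (0:ℂ) S).indicator (fun _ =>
        4 * (ENNReal.ofReal M ^ 2 * ENNReal.ofReal δ * I₀ ^ 2 * volume (Metric.closedBall (0:ℂ) R₁) +
      ENNReal.ofReal M ^ 2 * ENNReal.ofReal ((π / (2 * τ)) ^ 2 * δ ^ (-(1/2) : ℝ)) * I₀)) ζ := by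
        refine lintegral_mono fun ζ => ?_
        rcases le_or_gt ‖ζ‖ S with h | h
        · simp only [cut_of_le h]
          rw [indicator_of_mem (by simpa using h)]
          exact cauchy_osc_le hQ hδ0 (by simpa using hτ0) h R₁
        · simp [cut_of_lt h]
    _ ≤ _ := by
        rw [lintegral_indicator_const Metric.isClosed_closedBall.measurableSet]
        have h2 : ENNReal.ofReal ((π / (2 * τ)) ^ 2 * δ ^ (-(1/2) : ℝ)) ≤
            ENNReal.ofReal ((π / 2) ^ 2) * ENNReal.ofReal δ := by
          rw [← ENNReal.ofReal_mul (by positivity)]; exact ENNReal.ofReal_le_ofReal h1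
        calc _ ≤ 4 * (ENNReal.ofReal M ^ 2 * ENNReal.ofReal δ * I₀ ^ 2 *
              volume (Metric.closedBall (0:ℂ) R₁) + ENNReal.ofReal M ^ 2 *
              (ENNReal.ofReal ((π / 2) ^ 2) * ENNReal.ofReal δ) * I₀) *
                volume (Metric.closedBall (0:ℂ) S) := by gcongr
          _ = _ := by ring

instance : (cocompact ℝ).IsCountablyGenerated := by
  rw [cocompact_eq_atBot_atTop]; infer_instance

/-- Riemann–Lebesgue lemma for the phase `4 τ x y`. -/
theorem tendsto_integral_ph {g : ℂ → ℂ} (hg : Integrable g) :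
    Tendsto (fun τ => ∫ ζ, ph τ ζ * g ζ) (cocompact ℝ) (𝓝 0) := by
  have e := Complex.volume_preserving_equiv_real_prod.symm
  have hg' : Integrable (fun p : ℝ × ℝ => g (Complex.measurableEquivRealProd.symm p))
      ((volume : Measure ℝ).prod volume) :=
    (e.integrable_comp_emb Complex.measurableEquivRealProd.symm.measurableEmbedding).2 hg
  have hp : ∀ τ x y : ℝ, ph τ (Complex.measurableEquivRealProd.symm (x, y)) =
      Complex.exp (((4 * τ * x * y : ℝ) : ℂ) * Complex.I) := fun τ x y => by
    rw [ph]; rfl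
  have hcp : ∀ τ, Measurable fun p : ℝ × ℝ => ph τ (Complex.measurableEquivRealProd.symm p) :=
    fun τ => (ph_contDiff τ).continuous.measurable.comp
      Complex.measurableEquivRealProd.symm.measurable
  have hprod : ∀ τ, Integrable (fun p : ℝ × ℝ => ph τ (Complex.measurableEquivRealProd.symm p) *
      g (Complex.measurableEquivRealProd.symm p)) ((volume : Measure ℝ).prod volume) := fun τ =>
    hg'.mono ((hcp τ).aestronglyMeasurable.mul hg'.1) (ae_of_all _ fun p => by
      rw [norm_mul, norm_ph, one_mul])
  have hrepr : ∀ τ, ∫ ζ, ph τ ζ * g ζ = ∫ x : ℝ, ∫ y : ℝ,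
      ph τ (Complex.measurableEquivRealProd.symm (x, y)) *
        g (Complex.measurableEquivRealProd.symm (x, y)) := fun τ => by
    rw [← e.integral_comp Complex.measurableEquivRealProd.symm.measurableEmbedding,
      Measure.volume_eq_prod, integral_prod _ (hprod τ)]
  simp_rw [hrepr]
  rw [show (0:ℂ) = ∫ x : ℝ, (0:ℂ) by simp]
  refine tendsto_integral_filter_of_dominated_convergence
    (fun x => ∫ y, ‖g (Complex.measurableEquivRealProd.symm (x, y))‖)
    (Eventually.of_forall fun τ => (hprod τ).integral_prod_left.1)
    (Eventually.of_forall fun τ => ae_of_all _ fun x => ?_) hg'.norm.integral_prod_left ?_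
  · refine (norm_integral_le_integral_norm _).trans (le_of_eq ?_)
    simp only [norm_mul, norm_ph, one_mul]
  · have h0 : ∀ᵐ x : ℝ, x ≠ 0 := by simp [ae_iff, measure_singleton]
    filter_upwards [h0] with x hx
    have h1 := Real.tendsto_integral_exp_smul_cocompact
      fun y => g (Complex.measurableEquivRealProd.symm (x, y))
    have h2 : Tendsto (fun τ : ℝ => (-(2 * x / π)) * τ) (cocompact ℝ) (cocompact ℝ) := by
      have : -(2 * x / π) ≠ 0 := by simp [hx, pi_ne_zero]
      exact (Homeomorph.mulLeft₀ _ this).isClosedEmbedding.tendsto_cocompact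
    refine (h1.comp h2).congr fun τ => ?_
    refine integral_congr_ae (ae_of_all _ fun y => ?_)
    simp only [hp, Circle.smul_def, Real.fourierChar_apply, smul_eq_mul]
    congr 2
    push_cast
    have : (π : ℂ) ≠ 0 := by exact_mod_cast pi_ne_zero
    field_simp
    ring

lemma norm_ck_le (w : ℂ) : ‖ck w‖ ≤ ‖w‖⁻¹ := by
  rw [norm_ck]
  refine mul_le_of_le_one_left (by positivity) ?_
  rw [div_le_one pi_pos]; linarith [pi_gt_three]

lemma inv_mul_inv_le {a b d : ℝ} (ha : 0 ≤ a) (hb : 0 ≤ b) (hd : 0 < d) (h : d ≤ a + b) :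
    a⁻¹ * b⁻¹ ≤ 2 * d ^ (-(1/2) : ℝ) * (a ^ (-(3/2) : ℝ) + b ^ (-(3/2) : ℝ)) := by
  wlog hab : b ≤ a generalizing a b
  · have := this hb ha (by linarith) (not_le.1 hab).le
    rw [mul_comm, add_comm (a ^ _)]; exact this
  rcases hb.eq_or_lt with rfl | hb'
  · rw [inv_zero, mul_zero]; positivity
  have ha' : 0 < a := hb'.trans_le hab
  have h1 : a⁻¹ = a ^ (-(1/2) : ℝ) * a ^ (-(1/2) : ℝ) := by
    rw [← Real.rpow_add ha', ← Real.rpow_neg_one]; norm_num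
  have h2 : b ^ (-(3/2) : ℝ) = b ^ (-(1/2) : ℝ) * b⁻¹ := by
    rw [← Real.rpow_neg_one b, ← Real.rpow_add hb']; norm_num
  have h3 : a ^ (-(1/2) : ℝ) ≤ b ^ (-(1/2) : ℝ) :=
    Real.rpow_le_rpow_of_nonpos hb' hab (by norm_num)
  have h4 : a ^ (-(1/2) : ℝ) ≤ 2 * d ^ (-(1/2) : ℝ) := by
    calc a ^ (-(1/2) : ℝ) ≤ (4⁻¹ * d) ^ (-(1/2) : ℝ) :=
          Real.rpow_le_rpow_of_nonpos (by positivity) (by linarith) (by norm_num)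
      _ = _ := by
        rw [Real.mul_rpow (by norm_num) hd.le, Real.rpow_neg (by norm_num),
          Real.inv_rpow (by norm_num), inv_inv, show (4:ℝ) = 2 ^ (2:ℝ) by norm_num,
          ← Real.rpow_mul (by norm_num)]
        norm_num
  have h5 : 0 ≤ a ^ (-(3/2) : ℝ) := by positivity
  calc a⁻¹ * b⁻¹ = a ^ (-(1/2) : ℝ) * (a ^ (-(1/2) : ℝ) * b⁻¹) := by rw [h1]; ring
    _ ≤ (2 * d ^ (-(1/2) : ℝ)) * (b ^ (-(1/2) : ℝ) * b⁻¹) := by gcongr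
    _ ≤ _ := by rw [← h2]; gcongr; linarith

/-- The kernel of the composition of the two Cauchy transforms with a multiplier in between. -/
def kerA (m : ℂ → ℂ) (w z : ℂ) : ℂ := ∫ ζ, ck (w - ζ) * (m ζ * ckb (ζ - z))

lemma lintegral_kerA_le {B S T : ℝ} {m : ℂ → ℂ} (hm : Pot B S m) {w z : ℂ} (hw : ‖w‖ ≤ T)
    (hz : ‖z‖ ≤ T) (hwz : w ≠ z) :
    ∫⁻ ζ, ‖ck (w - ζ) * (m ζ * ckb (ζ - z))‖ₑ ≤
      ENNReal.ofReal (4 * B * ‖w - z‖ ^ (-(1/2) : ℝ)) * ∫⁻ ζ, wgt (T + S) ζ := by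
  have hB : 0 ≤ B := (norm_nonneg _).trans (hm.bdd 0)
  have hd : 0 < ‖w - z‖ := norm_pos_iff.2 (sub_ne_zero.2 hwz)
  have hw1 : ∀ w : ℂ, Measurable fun ζ => wgt (T + S) (w - ζ) := fun w =>
    (measurable_wgt _).comp (measurable_const.sub measurable_id)
  have hpt : ∀ ζ, ‖ck (w - ζ) * (m ζ * ckb (ζ - z))‖ₑ ≤
      ENNReal.ofReal (2 * B * ‖w - z‖ ^ (-(1/2) : ℝ)) *
        (wgt (T + S) (w - ζ) + wgt (T + S) (z - ζ)) := fun ζ => by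
    rcases lt_or_ge S ‖ζ‖ with hζ | hζ
    · simp [hm.supp ζ hζ]
    have e : ∀ w : ℂ, ‖w‖ ≤ T → wgt (T + S) (w - ζ) = ENNReal.ofReal (‖w - ζ‖ ^ (-(3/2) : ℝ)) :=
      fun w hw => indicator_of_mem (by
        rw [mem_closedBall_zero_iff]; exact (norm_sub_le _ _).trans (add_le_add hw hζ)) _
    rw [e w hw, e z hz, ← ENNReal.ofReal_add (by positivity) (by positivity),
      ← ENNReal.ofReal_mul (by positivity), ← ofReal_norm]
    refine ENNReal.ofReal_le_ofReal ?_
    rw [norm_mul, norm_mul, norm_ckb]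
    have h1 := norm_ck_le (w - ζ)
    have h2 := norm_ck_le (ζ - z)
    rw [norm_sub_rev ζ z] at h2
    have h3 := inv_mul_inv_le (norm_nonneg (w - ζ)) (norm_nonneg (z - ζ)) hd (by
      rw [norm_sub_rev z ζ]; exact norm_sub_le_norm_sub_add_norm_sub _ _ _)
    calc ‖ck (w - ζ)‖ * (‖m ζ‖ * ‖ck (ζ - z)‖) ≤ ‖w - ζ‖⁻¹ * (B * ‖z - ζ‖⁻¹) := by
          gcongr; exact hm.bdd ζ
      _ = B * (‖w - ζ‖⁻¹ * ‖z - ζ‖⁻¹) := by ring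
      _ ≤ B * _ := mul_le_mul_of_nonneg_left h3 hB
      _ = _ := by ring
  refine (lintegral_mono hpt).trans (le_of_eq ?_)
  rw [lintegral_const_mul' _ _ ENNReal.ofReal_ne_top, lintegral_add_left (hw1 w),
    lintegral_sub_left_eq_self (wgt (T + S)) w, lintegral_sub_left_eq_self (wgt (T + S)) z,
    ← two_mul, ← mul_assoc, mul_comm _ (2:ℝ≥0∞), show (2:ℝ≥0∞) = ENNReal.ofReal 2 by simp,
    ← ENNReal.ofReal_mul (by norm_num)]
  congr 2; ring

lemma aesm_kerA_integrand {m : ℂ → ℂ} (hm : Measurable m) (w z : ℂ) :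
    Measurable fun ζ => ck (w - ζ) * (m ζ * ckb (ζ - z)) := by
  have h1 := measurable_ck
  have h2 := measurable_ckb
  fun_prop

lemma integrable_kerA {B S : ℝ} {m : ℂ → ℂ} (hm : Pot B S m) {w z : ℂ} (hwz : w ≠ z) :
    Integrable fun ζ => ck (w - ζ) * (m ζ * ckb (ζ - z)) :=
  ⟨(aesm_kerA_integrand hm.meas w z).aestronglyMeasurable,
    (lintegral_kerA_le hm (le_max_left ‖w‖ ‖z‖) (le_max_right ‖w‖ ‖z‖) hwz).trans_lt
      (ENNReal.mul_lt_top ENNReal.ofReal_lt_top (wgt_finite _))⟩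

lemma measurable_kerA {m : ℂ → ℂ} (hm : Measurable m) :
    Measurable fun p : ℂ × ℂ => kerA m p.1 p.2 := by
  have h : StronglyMeasurable fun p : (ℂ × ℂ) × ℂ =>
      ck (p.1.1 - p.2) * (m p.2 * ckb (p.2 - p.1.2)) := by
    refine Measurable.stronglyMeasurable ?_
    have h1 := measurable_ckb
    have h2 := measurable_ck
    fun_prop
  exact (h.integral_prod_right' (ν := (volume : Measure ℂ))).measurable

lemma enorm_kerA_le {B S T : ℝ} {m : ℂ → ℂ} (hm : Pot B S m) {w z : ℂ} (hw : ‖w‖ ≤ T)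
    (hz : ‖z‖ ≤ T) (hwz : w ≠ z) :
    ‖kerA m w z‖ₑ ^ 2 ≤ ENNReal.ofReal (16 * B ^ 2 * π) * (∫⁻ ζ, wgt (T + S) ζ) ^ 2 *
      ‖ck (w - z)‖ₑ := by
  have hB : 0 ≤ B := (norm_nonneg _).trans (hm.bdd 0)
  have hd : 0 < ‖w - z‖ := norm_pos_iff.2 (sub_ne_zero.2 hwz)
  have h := (enorm_integral_le_lintegral_enorm _).trans (lintegral_kerA_le hm hw hz hwz)
  refine (pow_le_pow_left' h 2).trans (le_of_eq ?_)
  rw [mul_pow, ← ENNReal.ofReal_pow (by positivity), ← ofReal_norm (ck _), norm_ck,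
    mul_right_comm (ENNReal.ofReal _), ← ENNReal.ofReal_mul (by positivity)]
  congr 2
  rw [mul_pow, ← Real.rpow_mul_natCast hd.le, show (-(1/2) : ℝ) * (2 : ℕ) = -1 by norm_num,
    Real.rpow_neg_one]
  have := pi_ne_zero
  field_simp
  ring

/-- The Hilbert–Schmidt kernel localised to a disc. -/
def kerT (T : ℝ) (m : ℂ → ℂ) (p : ℂ × ℂ) : ℂ :=
  cut T (fun _ => 1) p.1 * cut T (fun _ => 1) p.2 * kerA m p.1 p.2

lemma measurable_cut_one (T : ℝ) : Measurable (cut T fun _ => 1) :=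
  measurable_const.indicator Metric.isClosed_closedBall.measurableSet

lemma measurable_kerT (T : ℝ) {m : ℂ → ℂ} (hm : Measurable m) : Measurable (kerT T m) :=
  (((measurable_cut_one T).comp measurable_fst).mul ((measurable_cut_one T).comp measurable_snd)).mul
    (measurable_kerA hm)

lemma ae_prod_ne : ∀ᵐ p : ℂ × ℂ ∂(volume.prod volume), p.1 ≠ p.2 := by
  have hm : MeasurableSet {p : ℂ × ℂ | p.1 ≠ p.2} := (isOpen_ne_fun continuous_fst continuous_snd).measurableSet
  rw [Measure.ae_prod_iff_ae_ae hm]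
  refine ae_of_all _ fun x => ?_
  have : ∀ᵐ z : ℂ, z ≠ x := by simp [ae_iff, measure_singleton]
  filter_upwards [this] with z hz using hz.symm

/-- The dominating function for the squared kernels. -/
def kerB (B S T : ℝ) (p : ℂ × ℂ) : ℝ≥0∞ :=
  ENNReal.ofReal (16 * B ^ 2 * π) * (∫⁻ ζ, wgt (T + S) ζ) ^ 2 *
    ‖ck (p.1 - p.2) * cut T (fun _ => 1) p.2 * cut T (fun _ => 1) p.1‖ₑ

lemma cut_one_l2 (T : ℝ) : L2B T (cut T fun _ => 1) :=
  L2B.of_bounded (C := 1) (measurable_cut_one T).aestronglyMeasurable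
    (fun z => norm_cut_le.trans (by simp)) fun z hz => cut_of_lt hz

lemma kerB_finite (B S T : ℝ) : ∫⁻ p, kerB B S T p ∂(volume.prod volume) ≠ ⊤ := by
  unfold kerB
  have h := (integrable_kernel locInt_ck (cut_one_l2 T) (cut_one_l2 T)).2
  have hI := (wgt_finite (T + S)).ne
  rw [lintegral_const_mul' _ _ (by finiteness)]
  exact ENNReal.mul_ne_top (by finiteness) h.ne

lemma kerT_le {B S : ℝ} (T : ℝ) {m : ℂ → ℂ} (hm : Pot B S m) :
    ∀ᵐ p ∂(volume.prod volume), ‖kerT T m p‖ₑ ^ 2 ≤ kerB B S T p := by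
  filter_upwards [ae_prod_ne] with p hp
  unfold kerT kerB
  rcases lt_or_ge T ‖p.1‖ with h1 | h1
  · simp [cut_of_lt h1]
  rcases lt_or_ge T ‖p.2‖ with h2 | h2
  · simp [cut_of_lt h2]
  simpa [cut_of_le h1, cut_of_le h2] using enorm_kerA_le hm h1 h2 hp

lemma kerT_memLp {B S : ℝ} (T : ℝ) {m : ℂ → ℂ} (hm : Pot B S m) :
    MemLp (kerT T m) 2 (volume.prod volume) :=
  memLp_two_iff.2 ⟨(measurable_kerT T hm.meas).aestronglyMeasurable,
    (lintegral_mono_ae (kerT_le T hm)).trans_lt (kerB_finite B S T).lt_top⟩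

lemma Pot.ph_mul {B S : ℝ} {χ : ℂ → ℂ} (h : Pot B S χ) (τ : ℝ) :
    Pot B S fun ζ => ph τ ζ * χ ζ := by simpa using h.mul_ph τ 0

/-- The Hilbert–Schmidt norms tend to zero as the phase becomes highly oscillating. -/
lemma tendsto_kerT {B S : ℝ} (T : ℝ) {χ : ℂ → ℂ} (h : Pot B S χ) :
    Tendsto (fun τ => ∫⁻ p : ℂ × ℂ, ‖kerT T (fun ζ => ph τ ζ * χ ζ) p‖ₑ ^ 2 ∂((volume : Measure ℂ).prod volume))
      (cocompact ℝ) (𝓝 0) := by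
  rw [← lintegral_zero (μ := (volume : Measure ℂ).prod (volume : Measure ℂ))]
  refine tendsto_lintegral_filter_of_dominated_convergence (kerB B S T)
    (Eventually.of_forall fun τ => ((measurable_kerT T (h.ph_mul τ).meas).enorm.pow_const 2))
    (Eventually.of_forall fun τ => kerT_le T (h.ph_mul τ)) (kerB_finite B S T) ?_
  filter_upwards [ae_prod_ne] with p hp
  have h1 := tendsto_integral_ph (integrable_kerA h hp)
  have h2 : Tendsto (fun τ => kerT T (fun ζ => ph τ ζ * χ ζ) p) (cocompact ℝ) (𝓝 0) := by
    have := h1.const_mul (cut T (fun _ => 1) p.1 * cut T (fun _ => 1) p.2)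
    rw [mul_zero] at this
    refine this.congr fun τ => ?_
    rw [kerT, kerA]
    congr 2; funext ζ; ring
  have h3 := ((ENNReal.continuous_pow 2).tendsto _).comp h2.enorm
  simpa [Function.comp_def] using h3

lemma kerA_translate (m : ℂ → ℂ) (z₀ w z : ℂ) :
    kerA (fun ζ => m (ζ - z₀)) w z = kerA m (w - z₀) (z - z₀) := by
  unfold kerA
  rw [← integral_sub_right_eq_self (fun ζ => ck (w - z₀ - ζ) * (m ζ * ckb (ζ - (z - z₀)))) z₀]
  congr 1; funext ζ
  rw [sub_sub_sub_cancel_right, sub_sub_sub_cancel_right]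

lemma lintegral_kerT_translate_le {R R₁ : ℝ} (m : ℂ → ℂ) {z₀ : ℂ} (hz₀ : ‖z₀‖ ≤ R₁) :
    ∫⁻ p : ℂ × ℂ, ‖kerT R (fun ζ => m (ζ - z₀)) p‖ₑ ^ 2 ∂((volume : Measure ℂ).prod volume) ≤
      ∫⁻ p : ℂ × ℂ, ‖kerT (R + R₁) m p‖ₑ ^ 2 ∂((volume : Measure ℂ).prod volume) := by
  rw [← lintegral_sub_right_eq_self (fun p : ℂ × ℂ => ‖kerT (R + R₁) m p‖ₑ ^ 2) (z₀, z₀)]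
  refine lintegral_mono fun p => pow_le_pow_left' ?_ 2
  unfold kerT
  rcases lt_or_ge R ‖p.1‖ with h1 | h1
  · simp [cut_of_lt h1]
  rcases lt_or_ge R ‖p.2‖ with h2 | h2
  · simp [cut_of_lt h2]
  have e1 : ‖(p - (z₀, z₀)).1‖ ≤ R + R₁ := (norm_sub_le _ _).trans (add_le_add h1 hz₀)
  have e2 : ‖(p - (z₀, z₀)).2‖ ≤ R + R₁ := (norm_sub_le _ _).trans (add_le_add h2 hz₀)
  rw [cut_of_le h1, cut_of_le h2, cut_of_le e1, cut_of_le e2, kerA_translate]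
  rfl

/-- The composition of the Cauchy transforms is an integral operator with kernel `kerA`. -/
lemma cauchy_comp_eq {B S R : ℝ} {m f : ℂ → ℂ} (hm : Pot B S m) (hf : L2B R f) :
    ∀ᵐ w, cv ck (fun ζ => m ζ * cv ckb f ζ) w = ∫ z, kerA m w z * f z := by
  have hk : LocallyIntegrable fun w : ℂ => ((‖w‖ ^ (-(1/2) : ℝ) : ℝ) : ℂ) :=
    locInt_of_bound (by fun_prop) (α := 1 / 2) (by norm_num) fun R => ⟨1, fun z hz hR => by
      rw [Complex.norm_real, Real.norm_of_nonneg (by positivity), one_mul]⟩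
  filter_upwards [ae_integrable_cv hk hf] with w hw
  have hB : 0 ≤ B := (norm_nonneg _).trans (hm.bdd 0)
  have hmeas : AEStronglyMeasurable (fun p : ℂ × ℂ => ck (w - p.1) * (m p.1 * ckb (p.1 - p.2)) * f p.2)
      (volume.prod volume) := by
    refine AEStronglyMeasurable.mul (Measurable.aestronglyMeasurable ?_)
      (hf.memLp.1.comp_quasiMeasurePreserving Measure.quasiMeasurePreserving_snd)
    have h1 := measurable_ckb
    have h2 := measurable_ck
    have h3 := hm.meas
    fun_prop
  have hprod : Integrable (fun p : ℂ × ℂ => ck (w - p.1) * (m p.1 * ckb (p.1 - p.2)) * f p.2)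
      (volume.prod volume) := by
    refine ⟨hmeas, ?_⟩
    rw [HasFiniteIntegral, lintegral_prod_symm _ hmeas.enorm]
    set I := ∫⁻ ζ, wgt (max ‖w‖ R + S) ζ
    have hne : ∀ᵐ z : ℂ, z ≠ w := by simp [ae_iff, measure_singleton]
    refine lt_of_le_of_lt (lintegral_mono_ae (g := fun z => ENNReal.ofReal (4 * B) * I *
      ‖((‖w - z‖ ^ (-(1/2) : ℝ) : ℝ) : ℂ) * f z‖ₑ) ?_) ?_
    · filter_upwards [hne] with z hz
      rcases lt_or_ge R ‖z‖ with h | h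
      · simp [hf.supp z h]
      simp only [enorm_mul _ (f z)]
      rw [lintegral_mul_const' _ _ enorm_ne_top, ← mul_assoc]
      gcongr ?_ * _
      refine (lintegral_kerA_le hm (le_max_left ‖w‖ R) (h.trans (le_max_right _ _)) hz.symm).trans
        (le_of_eq ?_)
      rw [ENNReal.ofReal_mul (by positivity), mul_right_comm, ← ofReal_norm (_ : ℂ),
        Complex.norm_real, Real.norm_of_nonneg (by positivity)]
    · rw [lintegral_const_mul' _ _ (ENNReal.mul_ne_top ENNReal.ofReal_ne_top (wgt_finite _).ne)]
      exact ENNReal.mul_lt_top (ENNReal.mul_lt_top ENNReal.ofReal_lt_top (wgt_finite _)) hw.2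
  calc cv ck (fun ζ => m ζ * cv ckb f ζ) w
      = ∫ ζ, ∫ z, ck (w - ζ) * (m ζ * ckb (ζ - z)) * f z := by
        rw [cv]; congr 1; funext ζ
        rw [cv, ← mul_assoc, ← integral_const_mul]
        congr 1; funext z; ring
    _ = ∫ z, ∫ ζ, ck (w - ζ) * (m ζ * ckb (ζ - z)) * f z := integral_integral_swap hprod
    _ = _ := by
        congr 1; funext z
        rw [kerA, integral_mul_const]

lemma exists_neumann (T : E2 →L[ℂ] E2) (hT : ‖T‖ ≤ 1 / 2) (g : E2) :
    ∃ r : E2, r = T (g + r) ∧ ‖r‖ₑ ≤ 2 * ‖T g‖ₑ := by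
  set u := Units.oneSub T (by linarith)
  set r : E2 := (↑u⁻¹ : E2 →L[ℂ] E2) (T g)
  have h1 : r - T r = T g := by
    have : ((u : E2 →L[ℂ] E2) * (↑u⁻¹ : E2 →L[ℂ] E2)) (T g) = T g := by
      rw [Units.mul_inv]; rfl
    simpa [u] using this
  have h2 : r = T (g + r) := by rw [map_add, ← h1]; abel
  refine ⟨r, h2, ?_⟩
  have h3 : ‖r‖ ≤ ‖T g‖ + 1 / 2 * ‖r‖ := by
    calc ‖r‖ = ‖T g + T r‖ := by rw [← map_add, ← h2]
      _ ≤ ‖T g‖ + ‖T r‖ := norm_add_le _ _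
      _ ≤ _ := by gcongr; exact (T.le_opNorm r).trans (by gcongr)
  have h4 : ENNReal.ofReal ‖r‖ ≤ ENNReal.ofReal (2 * ‖T g‖) :=
    ENNReal.ofReal_le_ofReal (by linarith)
  rw [ENNReal.ofReal_mul (by norm_num), ENNReal.ofReal_ofNat] at h4
  rwa [← ofReal_norm, ← ofReal_norm]

lemma exists_abs_of_eventually_cocompact {p : ℝ → Prop} (h : ∀ᶠ τ in cocompact ℝ, p τ) :
    ∃ τ₀, ∀ τ, τ₀ ≤ |τ| → p τ := by
  rw [← Metric.cobounded_eq_cocompact, ← comap_norm_atTop, eventually_comap, eventually_atTop] at h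
  obtain ⟨a, ha⟩ := h
  exact ⟨a, fun τ hτ => ha _ hτ τ rfl⟩

/-- The oscillating multiplier. -/
def osm (χ : ℂ → ℂ) (τ : ℝ) (z₀ ζ : ℂ) : ℂ := ph (-τ) (ζ - z₀) * χ (ζ - z₀)

lemma osm_pot {B S R₁ : ℝ} {χ : ℂ → ℂ} (h : Pot B S χ) (τ : ℝ) {z₀ : ℂ} (hz₀ : ‖z₀‖ ≤ R₁) :
    Pot B (S + R₁) (osm χ τ z₀) where
  meas := (h.ph_mul (-τ)).meas.comp (measurable_id.sub_const z₀)
  bdd z := (h.ph_mul (-τ)).bdd _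
  supp z hz := by
    refine (h.ph_mul (-τ)).supp _ ?_
    have := norm_sub_norm_le z z₀
    linarith

lemma Pot.memLp {M R : ℝ} {Q : ℂ → ℂ} (h : Pot M R Q) : MemLp Q ⊤ volume :=
  memLp_top_of_bound h.meas.aestronglyMeasurable M (ae_of_all _ h.bdd)

lemma Pot.enorm_le {M R : ℝ} {Q : ℂ → ℂ} (h : Pot M R Q) (z : ℂ) : ‖Q z‖ₑ ≤ ENNReal.ofReal M := by
  rw [← ofReal_norm]; exact ENNReal.ofReal_le_ofReal (h.bdd z)

lemma Pot.lintegral_mul_le {M R : ℝ} {Q : ℂ → ℂ} (h : Pot M R Q) (f : ℂ → ℂ) :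
    ∫⁻ z, ‖Q z * f z‖ₑ ^ 2 ≤ ENNReal.ofReal M ^ 2 * ∫⁻ z, ‖cut R f z‖ₑ ^ 2 := by
  rw [← lintegral_const_mul' _ _ (by finiteness)]
  refine lintegral_mono fun z => ?_
  rcases lt_or_ge R ‖z‖ with hz | hz
  · simp [h.supp z hz]
  rw [cut_of_le hz, enorm_mul, mul_pow]
  gcongr
  exact h.enorm_le z

lemma Pot.mul_cv {B S R : ℝ} {m f : ℂ → ℂ} (hm : Pot B S m) (hf : L2B R f) :
    L2B S fun ζ => m ζ * cv ckb f ζ := by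
  have h := (hf.cv locInt_ckb measurable_ckb S).bdd_mul hm.memLp
  refine ⟨h.memLp.ae_eq (ae_of_all _ fun z => ?_), fun z hz => by rw [hm.supp z hz, zero_mul]⟩
  rcases lt_or_ge S ‖z‖ with hz | hz
  · simp [hm.supp z hz]
  · simp only [cut_of_le hz]

lemma kernel_memLp {B S M R : ℝ} {m q : ℂ → ℂ} (hm : Pot B S m) (hq : Pot M R q) :
    MemLp (fun p : ℂ × ℂ => kerT R m p * (q p.2 / 4)) 2 (volume.prod volume) ∧
      ∫⁻ p : ℂ × ℂ, ‖kerT R m p * (q p.2 / 4)‖ₑ ^ 2 ∂((volume : Measure ℂ).prod volume) ≤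
        ENNReal.ofReal (M / 4) ^ 2 *
          ∫⁻ p : ℂ × ℂ, ‖kerT R m p‖ₑ ^ 2 ∂((volume : Measure ℂ).prod volume) := by
  have hle : ∫⁻ p : ℂ × ℂ, ‖kerT R m p * (q p.2 / 4)‖ₑ ^ 2 ∂((volume : Measure ℂ).prod volume) ≤
      ENNReal.ofReal (M / 4) ^ 2 *
        ∫⁻ p : ℂ × ℂ, ‖kerT R m p‖ₑ ^ 2 ∂((volume : Measure ℂ).prod volume) := by
    rw [← lintegral_const_mul' _ _ (by finiteness)]
    refine lintegral_mono fun p => ?_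
    rw [enorm_mul, mul_pow, mul_comm]
    gcongr
    rw [← ofReal_norm, norm_div, Complex.norm_ofNat]
    exact ENNReal.ofReal_le_ofReal (by gcongr; exact hq.bdd _)
  refine ⟨memLp_two_iff.2 ⟨Measurable.aestronglyMeasurable ?_, hle.trans_lt
    (ENNReal.mul_lt_top (by finiteness) (memLp_two_iff.1 (kerT_memLp R hm)).2)⟩, hle⟩
  exact (measurable_kerT R hm.meas).mul ((hq.meas.comp measurable_snd).div_const 4)

lemma kernel_apply {B S M R : ℝ} {m q : ℂ → ℂ} (hm : Pot B S m) (hq : Pot M R q) (f : E2) :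
    hsOp (kernel_memLp hm hq).1 f =ᵐ[volume]
      cut R fun w => 1 / 4 * cv ck (fun ζ => m ζ * cv ckb (fun z => q z * f z) ζ) w := by
  have hqf : L2B R fun z => q z * f z :=
    ⟨(Lp.memLp f).mul hq.memLp, fun z hz => by rw [hq.supp z hz, zero_mul]⟩
  filter_upwards [hsOp_apply (kernel_memLp hm hq).1 f, cauchy_comp_eq hm hqf] with w h1 h2
  rw [h1]
  rcases lt_or_ge R ‖w‖ with hw | hw
  · simp [kerT, cut_of_lt hw]
  rw [cut_of_le hw, h2, ← integral_const_mul]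
  congr 1; funext z
  rcases lt_or_ge R ‖z‖ with hz | hz
  · simp [hq.supp z hz]
  · simp only [kerT, cut_of_le hz, cut_of_le hw]; ring

/-- The constant in the bound for the remainder of the exponentially growing solutions. -/
def rC₁ (B S R : ℝ) : ℝ≥0∞ :=
  4 * ((∫⁻ z, ‖cut (R + S) ck z‖ₑ) ^ 2 * ENNReal.ofReal B ^ 2)

/-- The constant in the bound for pairings with the remainder. -/
def rC (B S M R : ℝ) : ℝ≥0∞ :=
  rC₁ B S R + (ENNReal.ofReal B ^ 2 * (4 * (1 + (∫⁻ z, ‖cut (S + R) ckb z‖ₑ) ^ 2 *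
    (ENNReal.ofReal M ^ 2 * rC₁ B S R))) + 1)

lemma rC₁_ne_top (B S R : ℝ) : rC₁ B S R ≠ ⊤ := by
  have h : (∫⁻ z, ‖cut (R + S) ck z‖ₑ) ≠ ⊤ := (cut_integrable locInt_ck (R + S)).2.ne
  unfold rC₁; finiteness

lemma rC_ne_top (B S M R : ℝ) : rC B S M R ≠ ⊤ := by
  have h : (∫⁻ z, ‖cut (S + R) ckb z‖ₑ) ≠ ⊤ := (cut_integrable locInt_ckb (S + R)).2.ne
  have h1 := rC₁_ne_top B S R
  unfold rC; finiteness

lemma cv_ck_neg (f : ℂ → ℂ) (x : ℂ) : cv (fun w => ck (-w)) f x = -cv ck f x := by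
  rw [cv, cv, ← integral_neg]
  congr 1; funext z
  rw [ck, ck, mul_neg, div_neg, neg_mul]

lemma lintegral_cut_cauchy_le {B S R : ℝ} {m f : ℂ → ℂ} (hm : Pot B S m) (hf : L2B R f) :
    4 * ∫⁻ w, ‖cut R (fun w => 1 / 4 * cv ck (fun ζ => m ζ * cv ckb f ζ) w) w‖ₑ ^ 2 ≤
      rC₁ B S R * ∫⁻ ζ, ‖cut S (cv ckb f) ζ‖ₑ ^ 2 := by
  rw [rC₁, mul_assoc, mul_assoc]
  gcongr
  refine le_trans ?_ ((lintegral_cut_cv_le measurable_ck (S := R) (hm.mul_cv hf)).trans ?_)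
  · refine lintegral_mono fun w => pow_le_pow_left' ?_ 2
    rcases lt_or_ge R ‖w‖ with h | h
    · simp [cut_of_lt h]
    rw [cut_of_le h, cut_of_le h, enorm_mul]
    refine mul_le_of_le_one_left' ?_
    rw [← ofReal_norm]
    norm_num
  · gcongr
    exact hm.lintegral_mul_le _

lemma hsOp_kernel_norm {B S M R : ℝ} {m q : ℂ → ℂ} (hm : Pot B S m) (hq : Pot M R q)
    (hs : ENNReal.ofReal (M / 4) ^ 2 *
      ∫⁻ p : ℂ × ℂ, ‖kerT R m p‖ₑ ^ 2 ∂((volume : Measure ℂ).prod volume) ≤ 1 / 4) :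
    ‖hsOp (kernel_memLp hm hq).1‖ ≤ 1 / 2 := by
  refine (hsOp_norm _).trans ?_
  have h := (kernel_memLp hm hq).2.trans hs
  rw [← eLpNorm_two_sq] at h
  have h2 : eLpNorm (fun p : ℂ × ℂ => kerT R m p * (q p.2 / 4)) 2 (volume.prod volume) ≤
      ENNReal.ofReal (1 / 2) := by
    refine (ENNReal.pow_le_pow_left_iff two_ne_zero).1 (h.trans (le_of_eq ?_))
    rw [← ENNReal.ofReal_pow (by norm_num), show ((1:ℝ)/2) ^ 2 = 1 / 4 by norm_num,
      ENNReal.ofReal_div_of_pos (by norm_num)]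
    simp
  exact ENNReal.toReal_le_of_le_ofReal (by norm_num) h2

theorem exists_remainder_of_le {B S M R : ℝ} {m q : ℂ → ℂ} (hm : Pot B S m) (hq : Pot M R q)
    (hs : ENNReal.ofReal (M / 4) ^ 2 *
      ∫⁻ p : ℂ × ℂ, ‖kerT R m p‖ₑ ^ 2 ∂((volume : Measure ℂ).prod volume) ≤ 1 / 4) :
    ∃ r, L2B R r ∧
      (∀ᵐ w, ‖w‖ ≤ R → r w =
        1 / 4 * cv ck (fun ζ => m ζ * cv ckb (fun z => q z * (1 + r z)) ζ) w) ∧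
      ∫⁻ z, ‖r z‖ₑ ^ 2 ≤ rC₁ B S R * ∫⁻ ζ, ‖cut S (cv ckb q) ζ‖ₑ ^ 2 := by
  set T := hsOp (kernel_memLp hm hq).1
  have h1L := (cut_one_l2 R).memLp
  set g : E2 := h1L.toLp
  obtain ⟨r, hr, hrn⟩ := exists_neumann T (hsOp_kernel_norm hm hq hs) g
  have hae : ∀ᵐ w, r w =
      cut R (fun w => 1 / 4 * cv ck (fun ζ => m ζ * cv ckb (fun z => q z * (1 + r z)) ζ) w) w := by
    have h1 := kernel_apply hm hq (g + r)
    have h2 : (fun z => q z * (g + r : E2) z) =ᵐ[volume] fun z => q z * (1 + r z) := by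
      filter_upwards [Lp.coeFn_add g r, h1L.coeFn_toLp] with z hz1 hz2
      rw [hz1, Pi.add_apply, hz2]
      rcases lt_or_ge R ‖z‖ with hz | hz
      · simp [hq.supp z hz]
      · rw [cut_of_le hz]
    rw [cv_congr h2] at h1
    change hsOp (kernel_memLp hm hq).1 (g + r) =ᵐ[volume] _ at h1
    filter_upwards [h1] with w hw
    rw [← hw]
    exact congrFun (congrArg (fun f : E2 => (f : ℂ → ℂ)) hr) w
  have hqr : (fun z => q z * (1 + cut R r z)) = fun z => q z * (1 + r z) := by
    funext z
    rcases lt_or_ge R ‖z‖ with hz | hz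
    · simp [hq.supp z hz]
    · rw [cut_of_le hz]
  refine ⟨cut R r, ⟨(Lp.memLp r).indicator Metric.isClosed_closedBall.measurableSet,
    fun z hz => cut_of_lt hz⟩, ?_, ?_⟩
  · filter_upwards [hae] with w hw hwR
    rw [hqr, cut_of_le hwR, hw, cut_of_le hwR]
  · refine le_trans ?_ (lintegral_cut_cauchy_le hm hq.l2)
    calc ∫⁻ z, ‖cut R r z‖ₑ ^ 2 ≤ ∫⁻ z, ‖r z‖ₑ ^ 2 := by
          refine lintegral_mono fun z => pow_le_pow_left' ?_ 2
          rw [enorm_le_iff_norm_le]; exact norm_cut_le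
      _ = ‖r‖ₑ ^ 2 := by rw [← eLpNorm_two_sq, Lp.enorm_def]
      _ ≤ (2 * ‖T g‖ₑ) ^ 2 := pow_le_pow_left' hrn 2
      _ = 4 * ∫⁻ z, ‖T g z‖ₑ ^ 2 := by
          rw [mul_pow, Lp.enorm_def, eLpNorm_two_sq]; norm_num
      _ = _ := by
          congr 1
          refine lintegral_congr_ae ?_
          have h2 : (fun z => q z * g z) =ᵐ[volume] q := by
            filter_upwards [h1L.coeFn_toLp] with z hz2
            rw [hz2]
            rcases lt_or_ge R ‖z‖ with hz | hz
            · simp [hq.supp z hz]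
            · rw [cut_of_le hz, mul_one]
          have h1 := kernel_apply hm hq g
          rw [cv_congr h2] at h1
          filter_upwards [h1] with w hw
          rw [hw]

lemma lintegral_cut_add_le {S : ℝ} {f g h : ℂ → ℂ} (hf : AEStronglyMeasurable f volume)
    (he : ∀ᵐ z, h z = f z + g z) :
    ∫⁻ z, ‖cut S h z‖ₑ ^ 2 ≤ 4 * ((∫⁻ z, ‖cut S f z‖ₑ ^ 2) + ∫⁻ z, ‖cut S g z‖ₑ ^ 2) := by
  have hfm : AEMeasurable (fun z => ‖cut S f z‖ₑ ^ 2) volume :=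
    (hf.indicator Metric.isClosed_closedBall.measurableSet).enorm.pow_const 2
  rw [← lintegral_add_left' hfm, ← lintegral_const_mul' _ _ (by norm_num)]
  refine lintegral_mono_ae ?_
  filter_upwards [he] with z hz
  rcases lt_or_ge S ‖z‖ with h | h
  · simp [cut_of_lt h]
  simp only [cut_of_le h, hz]
  exact (pow_le_pow_left' (enorm_add_le _ _) 2).trans (ennreal_add_sq_le _ _)

lemma pairing_remainder_le {B S M R : ℝ} {m q r h : ℂ → ℂ} (hm : Pot B S m) (hq : Pot M R q)
    (hr : L2B R r) (hre : ∀ᵐ w, ‖w‖ ≤ R → r w =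
        1 / 4 * cv ck (fun ζ => m ζ * cv ckb (fun z => q z * (1 + r z)) ζ) w)
    (hrn : ∫⁻ z, ‖r z‖ₑ ^ 2 ≤ rC₁ B S R * ∫⁻ ζ, ‖cut S (cv ckb q) ζ‖ₑ ^ 2) (hh : L2B R h) :
    ‖∫ z, h z * r z‖ₑ ≤ rC B S M R * ((∫⁻ ζ, ‖cut S (cv ck h) ζ‖ₑ ^ 2) +
      ∫⁻ ζ, ‖cut S (cv ckb q) ζ‖ₑ ^ 2) := by
  set X := ∫⁻ ζ, ‖cut S (cv ck h) ζ‖ₑ ^ 2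
  set D := ∫⁻ ζ, ‖cut S (cv ckb q) ζ‖ₑ ^ 2
  have hqr : L2B R fun z => q z * r z := hr.bdd_mul hq.memLp
  have hρ : L2B R fun z => q z * (1 + r z) := by
    simpa only [mul_add, mul_one] using hq.l2.add hqr
  have hG := hm.mul_cv hρ
  set G : ℂ → ℂ := fun ζ => m ζ * cv ckb (fun z => q z * (1 + r z)) ζ
  have hGn : ∫⁻ ζ, ‖G ζ‖ₑ ^ 2 ≤ ENNReal.ofReal B ^ 2 * (4 * (1 +
      (∫⁻ z, ‖cut (S + R) ckb z‖ₑ) ^ 2 * (ENNReal.ofReal M ^ 2 * rC₁ B S R))) * D := by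
    refine (hm.lintegral_mul_le _).trans ?_
    rw [mul_assoc, mul_assoc]
    gcongr
    refine (lintegral_cut_add_le (f := cv ckb q) (g := cv ckb fun z => q z * r z)
      (cv_aesm locInt_ckb hq.l2.memLp.1) ?_).trans ?_
    · filter_upwards [ae_integrable_cv locInt_ckb hq.l2, ae_integrable_cv locInt_ckb hqr]
        with z h1 h2
      rw [← cv_add h1 h2]
      simp only [mul_add, mul_one]
    · gcongr
      rw [add_mul, one_mul]
      gcongr
      refine (lintegral_cut_cv_le measurable_ckb hqr).trans ?_
      rw [mul_assoc, mul_assoc]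
      gcongr
      refine (hq.lintegral_mul_le r).trans ?_
      rw [hr.cut_eq]
      gcongr
  have e : ∫ z, h z * r z = -(1 / 4 * ∫ z, G z * cut S (cv ck h) z) := by
    calc ∫ z, h z * r z = ∫ z, 1 / 4 * (cv ck G z * h z) := by
          refine integral_congr_ae ?_
          filter_upwards [hre] with z hz
          rcases lt_or_ge R ‖z‖ with h1 | h1
          · simp [hh.supp z h1]
          · rw [hz h1]; ring
      _ = 1 / 4 * ∫ z, G z * cv (fun w => ck (-w)) h z := by
          rw [integral_const_mul, integral_cv_mul locInt_ck (hG.mono (le_max_left S R))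
            (hh.mono (le_max_right S R))]
      _ = _ := by
          rw [← mul_neg, ← integral_neg]
          congr 2; funext z
          rw [cv_ck_neg]
          rcases lt_or_ge S ‖z‖ with h1 | h1
          · simp [hG.supp z h1]
          · rw [cut_of_le h1]; ring
  have h1 : ‖∫ z, h z * r z‖ₑ ^ 2 ≤ (∫⁻ ζ, ‖G ζ‖ₑ ^ 2) * X := by
    refine le_trans (pow_le_pow_left' ?_ 2) (lintegral_mul_sq_le volume hG.memLp.1.enorm
      ((cv_aesm locInt_ck hh.memLp.1).indicator Metric.isClosed_closedBall.measurableSet).enorm)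
    rw [e, enorm_neg, enorm_mul]
    refine (mul_le_of_le_one_left' ?_).trans ((enorm_integral_le_lintegral_enorm _).trans
      (le_of_eq (lintegral_congr fun z => enorm_mul _ _)))
    rw [← ofReal_norm]; norm_num
  refine (ENNReal.pow_le_pow_left_iff two_ne_zero).1 (h1.trans ?_)
  set c := ENNReal.ofReal B ^ 2 * (4 * (1 +
      (∫⁻ z, ‖cut (S + R) ckb z‖ₑ) ^ 2 * (ENNReal.ofReal M ^ 2 * rC₁ B S R)))
  calc (∫⁻ ζ, ‖G ζ‖ₑ ^ 2) * X ≤ c * D * X := by gcongr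
    _ = c * (D * X) := mul_assoc _ _ _
    _ ≤ (c + 1) ^ 2 * (X + D) ^ 2 := by
        gcongr
        · calc c ≤ (c + 1) * 1 := by rw [mul_one]; exact le_self_add
            _ ≤ (c + 1) * (c + 1) := mul_le_mul' le_rfl le_add_self
            _ = _ := (sq _).symm
        · rw [sq]
          exact mul_le_mul' le_add_self le_self_add
    _ ≤ _ := by
        rw [← mul_pow, rC]
        exact pow_le_pow_left' (mul_le_mul' le_add_self le_rfl) 2

theorem exists_remainder {B S M R : ℝ} (R₁ : ℝ) {χ Q : ℂ → ℂ} (hχ : Pot B S χ) (hQ : Pot M R Q) :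
    ∃ τ₀ : ℝ, ∃ C : ℝ≥0∞, C ≠ ⊤ ∧ ∀ τ, τ₀ ≤ |τ| → ∀ z₀, ‖z₀‖ ≤ R₁ → ∃ r, L2B R r ∧
      (∀ᵐ w, ‖w‖ ≤ R → r w = 1 / 4 * cv ck (fun ζ => osm χ τ z₀ ζ *
        cv ckb (fun z => ph τ (z - z₀) * Q z * (1 + r z)) ζ) w) ∧
      ∫⁻ z, ‖r z‖ₑ ^ 2 ≤ C * dec (S + R₁) τ Q z₀ ∧
      ∀ h, L2B R h → ‖∫ z, h z * r z‖ₑ ≤ C * ((∫⁻ ζ, ‖cut (S + R₁) (cv ck h) ζ‖ₑ ^ 2) +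
        dec (S + R₁) τ Q z₀) := by
  have hev : ∀ᶠ τ in cocompact ℝ, ENNReal.ofReal (M / 4) ^ 2 * ∫⁻ p : ℂ × ℂ,
      ‖kerT (R + R₁) (fun ζ => ph τ ζ * χ ζ) p‖ₑ ^ 2 ∂((volume : Measure ℂ).prod volume) ≤ 1 / 4 := by
    have h := ENNReal.Tendsto.const_mul (a := ENNReal.ofReal (M / 4) ^ 2)
      (tendsto_kerT (R + R₁) hχ) (Or.inr (by finiteness))
    rw [mul_zero] at h
    exact h.eventually_le_const (by norm_num)
  obtain ⟨τ₀, hτ₀⟩ := exists_abs_of_eventually_cocompact hev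
  refine ⟨τ₀, rC B (S + R₁) M R, rC_ne_top _ _ _ _, fun τ hτ z₀ hz₀ => ?_⟩
  have hm := osm_pot hχ τ hz₀
  obtain ⟨r, hr, hre, hrn⟩ := exists_remainder_of_le hm (hQ.mul_ph τ z₀) (le_trans
    (mul_le_mul' le_rfl (lintegral_kerT_translate_le (fun ζ => ph (-τ) ζ * χ ζ) hz₀)) (hτ₀ (-τ) (by rwa [abs_neg])))
  refine ⟨r, hr, hre, hrn.trans ?_, fun h hh =>
    pairing_remainder_le hm (hQ.mul_ph τ z₀) hr hre hrn hh⟩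
  unfold dec
  gcongr
  exact le_self_add

/-- The holomorphic exponential with quadratic phase. -/
def ee (τ : ℝ) (z₀ z : ℂ) : ℂ := Complex.exp (τ * (z - z₀) ^ 2)

/-- The antiholomorphic exponential with quadratic phase. -/
def eb (τ : ℝ) (z₀ z : ℂ) : ℂ := star (ee τ z₀ z)

lemma eb_eq (τ : ℝ) (z₀ z : ℂ) : eb τ z₀ z = ph (-τ) (z - z₀) * ee τ z₀ z := by
  simp only [eb, ee, ph, Complex.star_def, ← Complex.exp_conj, ← Complex.exp_add]
  congr 1
  set w := z - z₀
  apply Complex.ext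
  · simp [sq]
  · simp [sq]; ring

lemma ee_eq (τ : ℝ) (z₀ z : ℂ) : ee τ z₀ z = ph τ (z - z₀) * eb τ z₀ z := by
  rw [eb_eq, ← mul_assoc, mul_comm (ph τ _), ph_mul_neg, one_mul]

lemma ee_hasDerivAt (τ : ℝ) (z₀ z : ℂ) :
    HasDerivAt (ee τ z₀) (2 * τ * (z - z₀) * ee τ z₀ z) z := by
  have h := (((hasDerivAt_id z).sub_const z₀).pow 2).const_mul (τ : ℂ)
  refine h.cexp.congr_deriv ?_
  simp only [ee, id, Nat.cast_ofNat, Pi.pow_apply]; ring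

lemma ee_contDiff (τ : ℝ) (z₀ : ℂ) : ContDiff ℝ ∞ (ee τ z₀) := by
  have h : ContDiff ℂ ∞ (ee τ z₀) :=
    (contDiff_const.mul ((contDiff_id.sub contDiff_const).pow 2)).cexp
  exact h.restrict_scalars ℝ

lemma eb_contDiff (τ : ℝ) (z₀ : ℂ) : ContDiff ℝ ∞ (eb τ z₀) := contDiff_star (ee_contDiff τ z₀)

lemma dd_ee (τ : ℝ) (z₀ v z : ℂ) : dd v (ee τ z₀) z = v * (2 * τ * (z - z₀) * ee τ z₀ z) := by
  rw [dd, ((ee_hasDerivAt τ z₀ z).hasFDerivAt.restrictScalars ℝ).fderiv]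
  simp

lemma dbar_ee (τ : ℝ) (z₀ z : ℂ) : dbar (ee τ z₀) z = 0 := by
  simp only [dbar, dd_ee, ← mul_assoc, Complex.I_mul_I]; ring

lemma dz_eb (τ : ℝ) (z₀ z : ℂ) : dz (eb τ z₀) z = 0 := by
  simp only [dz]
  rw [show eb τ z₀ = fun w => star (ee τ z₀ w) from rfl, dd_star, dd_star, dd_ee, dd_ee]
  simp only [star_mul', ← mul_assoc, Complex.star_def, Complex.conj_I, mul_neg, Complex.I_mul_I]
  simp

lemma dbar_mul {f g : ℂ → ℂ} {z : ℂ} (hf : DifferentiableAt ℝ f z) (hg : DifferentiableAt ℝ g z) :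
    dbar (fun z => f z * g z) z = f z * dbar g z + dbar f z * g z := by
  simp only [dbar, dd_mul hf hg]; ring

lemma dz_mul {f g : ℂ → ℂ} {z : ℂ} (hf : DifferentiableAt ℝ f z) (hg : DifferentiableAt ℝ g z) :
    dz (fun z => f z * g z) z = f z * dz g z + dz f z * g z := by
  simp only [dz, dd_mul hf hg]; ring

lemma dbar_const_mul {f : ℂ → ℂ} {z : ℂ} (hf : DifferentiableAt ℝ f z) (c : ℂ) :
    dbar (fun z => c * f z) z = c * dbar f z := by
  simp only [dbar, dd_const_mul hf]; ring

lemma dz_const_mul {f : ℂ → ℂ} {z : ℂ} (hf : DifferentiableAt ℝ f z) (c : ℂ) :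
    dz (fun z => c * f z) z = c * dz f z := by
  simp only [dz, dd_const_mul hf]; ring

lemma dd_comm {f : ℂ → ℂ} (hf : ContDiff ℝ ∞ f) (v w z : ℂ) :
    dd v (dd w f) z = dd w (dd v f) z := by
  have h := (hf.contDiffAt (x := z)).isSymmSndFDerivAt (by
    simpa using WithTop.coe_le_coe.2 (le_top : (2 : ℕ∞) ≤ ⊤))
  have hd : DifferentiableAt ℝ (fderiv ℝ f) z :=
    (hf.fderiv_right (m := ∞) (by simp)).differentiable (by simp) z
  have e : ∀ v w, dd v (dd w f) z = fderiv ℝ (fderiv ℝ f) z v w := fun v w => by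
    have : dd w f = fun z => fderiv ℝ f z w := rfl
    rw [dd, this, fderiv_clm_apply hd (differentiableAt_const w)]
    simp
  rw [e, e]; exact h v w

lemma lap_eq_dz_dbar {f : ℂ → ℂ} (hf : ContDiff ℝ ∞ f) (z : ℂ) : lap f z = 4 * dz (dbar f) z := by
  have hd : ∀ v, DifferentiableAt ℝ (dd v f) z := fun v =>
    (dd_contDiff hf v).differentiable (by simp) z
  have e : ∀ v, dd v (dbar f) z = (1 / 2) * (dd v (dd 1 f) z + Complex.I * dd v (dd Complex.I f) z) := by
    intro v
    have : dbar f = fun z => (1 / 2) * (dd 1 f z + Complex.I * dd Complex.I f z) := by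
      funext z; simp only [dbar]; ring
    have hs : DifferentiableAt ℝ (fun z => dd 1 f z + Complex.I * dd Complex.I f z) z :=
      (hd 1).add ((hd _).const_mul _)
    rw [this, dd_const_mul hs, dd_add (hd 1) ((hd _).const_mul _),
      dd_const_mul (hd _)]
  simp only [lap, dz, e]
  rw [dd_comm hf Complex.I 1]
  linear_combination (dd Complex.I (dd Complex.I f) z) * Complex.I_mul_I

lemma lap_ee (τ : ℝ) (z₀ z : ℂ) : lap (ee τ z₀) z = 0 := by
  rw [lap_eq_dz_dbar (ee_contDiff τ z₀)]
  have : dbar (ee τ z₀) = fun _ => 0 := funext (dbar_ee τ z₀)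
  rw [this]; simp [dz, dd]

lemma dz_eventuallyEq {f g : ℂ → ℂ} {z : ℂ} (h : f =ᶠ[𝓝 z] g) : dz f z = dz g z := by
  simp only [dz, (dd_eventuallyEq h _).eq_of_nhds]

lemma cv_ckb_star (f : ℂ → ℂ) (x : ℂ) : cv ckb (fun z => star (f z)) x = star (cv ck f x) := by
  simp only [cv, ckb, ← star_mul']
  exact integral_conj

lemma dz_cv_ckb {χ : ℂ → ℂ} (hχ : ContDiff ℝ ∞ χ) (hc : HasCompactSupport χ) (x : ℂ) :
    dz (cv ckb χ) x = χ x := by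
  have h : cv ckb χ = fun x => star (cv ck (fun z => star (χ z)) x) := by
    funext x; rw [← cv_ckb_star]; simp
  have h2 := dbar_cv_cauchy (contDiff_star hχ) (compact_star hc) x
  rw [h]
  simp only [dz, dd_star]
  have h3 := congrArg star h2
  simp only [dbar, star_star] at h3
  rw [← h3]
  simp [sub_eq_add_neg]

/-- The composition of the two Cauchy transforms with a multiplier in between. -/
def cc (m ρ : ℂ → ℂ) : ℂ → ℂ := cv ck fun ζ => m ζ * cv ckb ρ ζ

/-- The transposed operator of `cc`. -/
def cct (m h : ℂ → ℂ) : ℂ → ℂ := cv ckb fun ζ => m ζ * cv ck h ζ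

lemma Pot.mul_cv_ck {B S R : ℝ} {m f : ℂ → ℂ} (hm : Pot B S m) (hf : L2B R f) :
    L2B S fun ζ => m ζ * cv ck f ζ := by
  have h := (hf.cv locInt_ck measurable_ck S).bdd_mul hm.memLp
  refine ⟨h.memLp.ae_eq (ae_of_all _ fun z => ?_), fun z hz => by rw [hm.supp z hz, zero_mul]⟩
  rcases lt_or_ge S ‖z‖ with hz | hz
  · simp [hm.supp z hz]
  · simp only [cut_of_le hz]

lemma cv_ckb_neg (f : ℂ → ℂ) (x : ℂ) : cv (fun w => ckb (-w)) f x = -cv ckb f x := by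
  rw [cv, cv, ← integral_neg]
  congr 1; funext z
  rw [ckb, ckb, ck, ck, mul_neg, div_neg, star_neg, neg_mul]

lemma integral_cc_mul {B S R T : ℝ} {m ρ h : ℂ → ℂ} (hm : Pot B S m) (hρ : L2B T ρ) (hh : L2B R h) :
    ∫ z, cc m ρ z * h z = ∫ z, ρ z * cct m h z := by
  have h1 := hm.mul_cv hρ
  have h2 := hm.mul_cv_ck hh
  rw [cc, integral_cv_mul locInt_ck (h1.mono (le_max_left S R)) (hh.mono (le_max_right S R))]
  have e1 : ∀ z, m z * cv ckb ρ z * cv (fun w => ck (-w)) h z =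
      -(cv ckb ρ z * (m z * cv ck h z)) := fun z => by rw [cv_ck_neg]; ring
  simp only [e1]
  rw [integral_neg, integral_cv_mul locInt_ckb (hρ.mono (le_max_left T S))
    (h2.mono (le_max_right T S)), ← integral_neg]
  congr 1; funext z
  rw [cv_ckb_neg, cct]; ring

lemma L2B.mul_continuous {R : ℝ} {f φ : ℂ → ℂ} (hf : L2B R f) (hφ : Continuous φ) :
    L2B R fun z => f z * φ z := by
  obtain ⟨C, hC⟩ := (isCompact_closedBall (0:ℂ) R).exists_bound_of_continuousOn hφ.continuousOn
  have h1 : MemLp (cut R φ) ⊤ volume := by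
    refine memLp_top_of_bound (hφ.aestronglyMeasurable.indicator
      Metric.isClosed_closedBall.measurableSet) (max C 0) (ae_of_all _ fun z => ?_)
    rcases lt_or_ge R ‖z‖ with hz | hz
    · rw [cut_of_lt hz]; simp
    · rw [cut_of_le hz]; exact (hC z (by simpa using hz)).trans (le_max_left _ _)
  refine ⟨(hf.bdd_mul h1).memLp.ae_eq (ae_of_all _ fun z => ?_), fun z hz => by
    rw [hf.supp z hz, zero_mul]⟩
  rcases lt_or_ge R ‖z‖ with hz | hz
  · simp [hf.supp z hz]
  · simp only [cut_of_le hz]; ring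

lemma exists_cutoff_pot (R : ℝ) : ∃ (B S : ℝ) (χ : ℂ → ℂ), ContDiff ℝ ∞ χ ∧ HasCompactSupport χ ∧
    Pot B S χ ∧ ∀ z, ‖z‖ < R + 1 → χ z = 1 := by
  obtain ⟨χ, h1, h2, h3⟩ := exists_cutoff R
  obtain ⟨B, hB⟩ := h2.exists_bound_of_continuous h1.continuous
  obtain ⟨S, hS⟩ := L2B.of_smooth h1.continuous h2
  exact ⟨B, S, χ, h1, h2, ⟨h1.continuous.measurable, hB, hS.supp⟩, h3⟩

lemma osm_contDiff {χ : ℂ → ℂ} (h : ContDiff ℝ ∞ χ) (τ : ℝ) (z₀ : ℂ) : ContDiff ℝ ∞ (osm χ τ z₀) :=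
  ((ph_contDiff (-τ)).comp (contDiff_id.sub contDiff_const)).mul
    (h.comp (contDiff_id.sub contDiff_const))

lemma osm_compact {χ : ℂ → ℂ} (h : HasCompactSupport χ) (τ : ℝ) (z₀ : ℂ) :
    HasCompactSupport (osm χ τ z₀) :=
  (h.comp_homeomorph (Homeomorph.subRight z₀)).mul_left

lemma cc_contDiff {χ ρ : ℂ → ℂ} (hχ : ContDiff ℝ ∞ χ) (hχc : HasCompactSupport χ)
    (hρ : ContDiff ℝ ∞ ρ) (hρc : HasCompactSupport ρ) (τ : ℝ) (z₀ : ℂ) :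
    ContDiff ℝ ∞ (cc (osm χ τ z₀) ρ) :=
  cv_contDiff locInt_ck ((osm_contDiff hχ τ z₀).mul (cv_contDiff locInt_ckb hρ hρc))
    (osm_compact hχc τ z₀).mul_right

lemma lap_ee_mul_cc {R R₁ : ℝ} {χ ρ : ℂ → ℂ} (hχ : ContDiff ℝ ∞ χ) (hχc : HasCompactSupport χ)
    (hχ1 : ∀ z, ‖z‖ < R + R₁ + 1 → χ z = 1) (hρ : ContDiff ℝ ∞ ρ) (hρc : HasCompactSupport ρ)
    (τ : ℝ) {z₀ : ℂ} (hz₀ : ‖z₀‖ ≤ R₁) {z : ℂ} (hz : ‖z‖ ≤ R) :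
    lap (fun w => ee τ z₀ w * (1 / 4 * cc (osm χ τ z₀) ρ w)) z = eb τ z₀ z * ρ z := by
  have hcc := cc_contDiff hχ hχc hρ hρc τ z₀
  have hd : Differentiable ℝ (cc (osm χ τ z₀) ρ) := hcc.differentiable (by simp)
  have he : Differentiable ℝ (ee τ z₀) := (ee_contDiff τ z₀).differentiable (by simp)
  have hcb : Differentiable ℝ (cv ckb ρ) := (cv_contDiff locInt_ckb hρ hρc).differentiable (by simp)
  have heb : Differentiable ℝ (eb τ z₀) := (eb_contDiff τ z₀).differentiable (by simp)
  rw [lap_eq_dz_dbar ((ee_contDiff τ z₀).mul (contDiff_const.mul hcc))]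
  have e1 : dbar (fun w => ee τ z₀ w * (1 / 4 * cc (osm χ τ z₀) ρ w)) =ᶠ[𝓝 z]
      fun w => 1 / 4 * (eb τ z₀ w * cv ckb ρ w) := by
    have : ∀ᶠ w in 𝓝 z, ‖w‖ < R + 1 :=
      continuous_norm.continuousAt.eventually_lt continuousAt_const (by linarith)
    filter_upwards [this] with w hw
    rw [dbar_mul (he w) ((hd w).const_mul _), dbar_ee, dbar_const_mul (hd w), cc,
      dbar_cv_cauchy ((osm_contDiff hχ τ z₀).mul (cv_contDiff locInt_ckb hρ hρc))
        (osm_compact hχc τ z₀).mul_right, eb_eq, osm,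
      hχ1 _ ((norm_sub_le w z₀).trans_lt (by linarith))]
    ring
  have hm : DifferentiableAt ℝ (fun w => eb τ z₀ w * cv ckb ρ w) z := (heb z).mul (hcb z)
  rw [dz_eventuallyEq e1, dz_const_mul hm, dz_mul (heb z) (hcb z), dz_eb,
    dz_cv_ckb hρ hρc]
  ring

/-- The transposed Cauchy transforms express `P` in terms of `(Δ + κ²)P`. -/
lemma WF.cct_eq {κ R R₁ B S : ℝ} {P g χ : ℂ → ℂ} (h : WF κ P g) (hP : L2B R P) (hg : L2B R g)
    (hχ : ContDiff ℝ ∞ χ) (hχc : HasCompactSupport χ) (hχp : Pot B S χ)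
    (hχ1 : ∀ z, ‖z‖ < R + R₁ + 1 → χ z = 1) (τ : ℝ) {z₀ : ℂ} (hz₀ : ‖z₀‖ ≤ R₁) :
    ∀ᵐ z, 1 / 4 * cct (osm χ τ z₀) (fun w => (g w + κ ^ 2 * P w) * ee τ z₀ w) z +
      P z * eb τ z₀ z = 0 := by
  have hm := osm_pot hχp τ hz₀
  set H : ℂ → ℂ := fun w => (g w + κ ^ 2 * P w) * ee τ z₀ w with hHdef
  have hκP : L2B R fun w => (κ : ℂ) ^ 2 * P w := hP.bdd_mul (memLp_top_const _)
  have hH : L2B R H := (hg.add hκP).mul_continuous (ee_contDiff τ z₀).continuous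
  have hPe := hP.mul_continuous (eb_contDiff τ z₀).continuous
  have hmH := hm.mul_cv_ck hH
  have hloc : LocallyIntegrable (cct (osm χ τ z₀) H) := by
    refine locallyIntegrable_iff.2 fun K hK => ?_
    obtain ⟨T, hT⟩ := hK.isBounded.subset_closedBall 0
    exact ((integrable_indicator_iff Metric.isClosed_closedBall.measurableSet).1
      (hmH.cv locInt_ckb measurable_ckb T).integrable).mono_set hT
  refine ae_eq_zero_of_integral_contDiff_smul_eq_zero
    ((hloc.smul (1 / 4 : ℂ)).add hPe.integrable.locallyIntegrable) fun ρ' hρ' hρc' => ?_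
  set ρ : ℂ → ℂ := fun z => (ρ' z : ℂ) with hρdef
  have hρ : ContDiff ℝ ∞ ρ := Complex.ofRealCLM.contDiff.comp hρ'
  have hρc : HasCompactSupport ρ := hρc'.comp_left Complex.ofReal_zero
  obtain ⟨T, hT⟩ := L2B.of_smooth hρ.continuous hρc
  have hcc := cc_contDiff hχ hχc hρ hρc τ z₀
  have hφ : ContDiff ℝ ∞ fun w => ee τ z₀ w * (1 / 4 * cc (osm χ τ z₀) ρ w) :=
    (ee_contDiff τ z₀).mul (contDiff_const.mul hcc)
  have e1 := h _ hφ
  have i1 := (hg.mul_continuous hφ.continuous).integrable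
  have i2 := (hκP.mul_continuous hφ.continuous).integrable
  have e2 : ∫ z, P z * (lap (fun w => ee τ z₀ w * (1 / 4 * cc (osm χ τ z₀) ρ w)) z +
      κ ^ 2 * (ee τ z₀ z * (1 / 4 * cc (osm χ τ z₀) ρ z))) =
      (∫ z, P z * eb τ z₀ z * ρ z) +
        ∫ z, κ ^ 2 * P z * (ee τ z₀ z * (1 / 4 * cc (osm χ τ z₀) ρ z)) := by
    rw [← integral_add (hPe.mul_continuous hρ.continuous).integrable i2]
    congr 1; funext z
    rcases lt_or_ge R ‖z‖ with hz | hz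
    · simp [hP.supp z hz]
    · rw [lap_ee_mul_cc hχ hχc hχ1 hρ hρc τ hz₀ hz]; ring
  have e3 : (∫ z, g z * (ee τ z₀ z * (1 / 4 * cc (osm χ τ z₀) ρ z))) +
      ∫ z, κ ^ 2 * P z * (ee τ z₀ z * (1 / 4 * cc (osm χ τ z₀) ρ z)) =
      1 / 4 * ∫ z, ρ z * cct (osm χ τ z₀) H z := by
    rw [← integral_cc_mul hm hT hH, ← integral_add i1 i2, ← integral_const_mul]
    congr 1; funext z; simp only [hHdef]; ring
  have i3 : Integrable fun z => ρ z * cct (osm χ τ z₀) H z := by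
    have := cv_mul_integrable locInt_ckb (hmH.mono (le_max_left (S + R₁) T)) (hT.mono (le_max_right _ _))
    simpa only [cct, mul_comm] using this
  have e4 : ∫ z, ρ' z • ((1 / 4 : ℂ) * cct (osm χ τ z₀) H z + P z * eb τ z₀ z) =
      1 / 4 * (∫ z, ρ z * cct (osm χ τ z₀) H z) + ∫ z, P z * eb τ z₀ z * ρ z := by
    rw [← integral_const_mul, ← integral_add (i3.const_mul _)
      (hPe.mul_continuous hρ.continuous).integrable]
    congr 1; funext z; simp only [hρdef, Complex.real_smul]; ring
  refine e4.trans ?_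
  rw [e2] at e1
  rw [← e3, e1]; ring

/-- Complex geometrical optics solutions. -/
lemma isWeakSol_cgo {κ R R₁ B S M : ℝ} {χ v r : ℂ → ℂ} (hv : Pot M R v)
    (hχ : ContDiff ℝ ∞ χ) (hχc : HasCompactSupport χ) (hχp : Pot B S χ)
    (hχ1 : ∀ z, ‖z‖ < R + R₁ + 1 → χ z = 1) (τ : ℝ) {z₀ : ℂ} (hz₀ : ‖z₀‖ ≤ R₁) (hr : L2B R r)
    (hQ : L2B R fun z => ph τ (z - z₀) * cut R (fun z => -(κ ^ 2 + v z)) z * (1 + r z))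
    (hre : ∀ᵐ w, ‖w‖ ≤ R → r w = 1 / 4 * cv ck (fun ζ => osm χ τ z₀ ζ *
        cv ckb (fun z => ph τ (z - z₀) * cut R (fun z => -(κ ^ 2 + v z)) z * (1 + r z)) ζ) w) :
    IsWeakSol κ R v (cut R fun z => ee τ z₀ z * (1 + r z)) := by
  have hu : L2B R (cut R fun z => ee τ z₀ z * (1 + r z)) := by
    have h1 : L2B R (cut R fun _ => 1) := by
      refine L2B.of_bounded (C := 1) (aestronglyMeasurable_const.indicator
        Metric.isClosed_closedBall.measurableSet) (fun z => ?_) fun z hz => cut_of_lt hz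
      exact norm_cut_le.trans (by simp)
    have h2 := (h1.add hr).mul_continuous (ee_contDiff τ z₀).continuous
    refine ⟨h2.memLp.ae_eq (ae_of_all _ fun z => ?_), fun z hz => cut_of_lt hz⟩
    rcases lt_or_ge R ‖z‖ with hz | hz
    · simp [cut_of_lt hz, hr.supp z hz]
    · simp only [cut_of_le hz]; ring
  refine ⟨hu, fun P g hP hg h => ?_⟩
  have hm := osm_pot hχp τ hz₀
  set u : ℂ → ℂ := cut R fun z => ee τ z₀ z * (1 + r z)
  set ρ : ℂ → ℂ := fun z => ph τ (z - z₀) * cut R (fun z => -(κ ^ 2 + v z)) z * (1 + r z)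
  set H : ℂ → ℂ := fun w => (g w + κ ^ 2 * P w) * ee τ z₀ w with hHdef
  have hκP : L2B R fun w => (κ : ℂ) ^ 2 * P w := hP.bdd_mul (memLp_top_const _)
  have hH : L2B R H := (hg.add hκP).mul_continuous (ee_contDiff τ z₀).continuous
  have hH0 : ∫ z, H z = 0 := by
    have h1 := h _ (ee_contDiff τ z₀)
    simp only [lap_ee, zero_add] at h1
    have : ∀ z, H z = g z * ee τ z₀ z + P z * (κ ^ 2 * ee τ z₀ z) := fun z => by
      simp only [hHdef]; ring
    simp only [this]
    have hc : Continuous fun z => (κ : ℂ) ^ 2 * ee τ z₀ z :=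
      continuous_const.mul (ee_contDiff τ z₀).continuous
    rw [integral_add (hg.mul_continuous (ee_contDiff τ z₀).continuous).integrable
      (hP.mul_continuous hc).integrable, h1]
    ring
  have hHr : ∫ z, H z * r z = 1 / 4 * ∫ z, ρ z * cct (osm χ τ z₀) H z := by
    rw [← integral_cc_mul hm hQ hH, ← integral_const_mul]
    refine integral_congr_ae ?_
    filter_upwards [hre] with z hz
    rcases lt_or_ge R ‖z‖ with hz' | hz'
    · simp [hH.supp z hz']
    · rw [hz hz', cc]; ring
  have hgκ : ∫ z, (g z + κ ^ 2 * P z) * u z = ∫ z, P z * ((κ ^ 2 + v z) * u z) := by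
    calc ∫ z, (g z + κ ^ 2 * P z) * u z = ∫ z, (H z + H z * r z) := by
          congr 1; funext z
          rcases lt_or_ge R ‖z‖ with hz | hz
          · simp [hHdef, hP.supp z hz, hg.supp z hz]
          · simp only [u, cut_of_le hz, hHdef]; ring
      _ = ∫ z, 1 / 4 * (ρ z * cct (osm χ τ z₀) H z) := by
          rw [integral_add hH.integrable (hH.integrable_mul hr), hH0, hHr, zero_add,
            integral_const_mul]
      _ = _ := by
          refine integral_congr_ae ?_
          filter_upwards [h.cct_eq hP hg hχ hχc hχp hχ1 τ hz₀] with z hz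
          rcases lt_or_ge R ‖z‖ with hz' | hz'
          · simp [hQ.supp z hz', hP.supp z hz']
          · simp only [ρ, u, cut_of_le hz']
            rw [ee_eq]
            linear_combination (ph τ (z - z₀) * (-(κ ^ 2 + v z)) * (1 + r z)) * hz
  have hκu : L2B R fun z => ((κ : ℂ) ^ 2) * u z := hu.bdd_mul (memLp_top_const _)
  have hvu := hu.bdd_mul hv.memLp
  have e1 : ∫ z, (g z + κ ^ 2 * P z) * u z = (∫ z, g z * u z) + ∫ z, P z * (κ ^ 2 * u z) := by
    rw [← integral_add (hg.integrable_mul hu) (hP.integrable_mul hκu)]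
    congr 1; funext z; ring
  have e2 : ∫ z, P z * ((κ ^ 2 + v z) * u z) =
      (∫ z, P z * (v z * u z)) + ∫ z, P z * (κ ^ 2 * u z) := by
    rw [← integral_add (hP.integrable_mul hvu) (hP.integrable_mul hκu)]
    congr 1; funext z; ring
  rw [e1, e2] at hgκ
  exact add_right_cancel hgκ

/-- The potential `κ² + v` in the disc, up to sign. -/
def cpot (κ R : ℝ) (v : ℂ → ℂ) : ℂ → ℂ := cut R fun z => -(κ ^ 2 + v z)

lemma cpot_pot {M R : ℝ} (κ : ℝ) {v : ℂ → ℂ} (hv : Pot M R v) : Pot (κ ^ 2 + M) R (cpot κ R v) where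
  meas := (measurable_const.add hv.meas).neg.indicator Metric.isClosed_closedBall.measurableSet
  bdd z := by
    refine norm_cut_le.trans ?_
    rw [norm_neg]
    refine (norm_add_le _ _).trans (add_le_add ?_ (hv.bdd z))
    simp
  supp z hz := cut_of_lt hz

theorem exists_cgo {κ R R₁ B S M : ℝ} {χ v : ℂ → ℂ} (hv : Pot M R v)
    (hχ : ContDiff ℝ ∞ χ) (hχc : HasCompactSupport χ) (hχp : Pot B S χ)
    (hχ1 : ∀ z, ‖z‖ < R + R₁ + 1 → χ z = 1) :
    ∃ τ₀ : ℝ, ∃ C : ℝ≥0∞, C ≠ ⊤ ∧ ∀ τ, τ₀ ≤ |τ| → ∀ z₀, ‖z₀‖ ≤ R₁ → ∃ r, L2B R r ∧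
      IsWeakSol κ R v (cut R fun z => ee τ z₀ z * (1 + r z)) ∧
      ∫⁻ z, ‖r z‖ₑ ^ 2 ≤ C * dec (S + R₁) τ (cpot κ R v) z₀ ∧
      ∀ h, L2B R h → ‖∫ z, h z * r z‖ₑ ≤ C * ((∫⁻ ζ, ‖cut (S + R₁) (cv ck h) ζ‖ₑ ^ 2) +
        dec (S + R₁) τ (cpot κ R v) z₀) := by
  have hQ := cpot_pot κ hv
  obtain ⟨τ₀, C, hC, h⟩ := exists_remainder R₁ hχp hQ
  refine ⟨τ₀, C, hC, fun τ hτ z₀ hz₀ => ?_⟩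
  obtain ⟨r, hr, hre, hrn, hrp⟩ := h τ hτ z₀ hz₀
  refine ⟨r, hr, isWeakSol_cgo hv hχ hχc hχp hχ1 τ hz₀ hr ?_ hre, hrn, hrp⟩
  have h1 := hQ.mul_ph τ z₀
  simpa only [mul_add, mul_one, cpot] using h1.l2.add (hr.bdd_mul h1.memLp)

lemma L2B.conj {R : ℝ} {f : ℂ → ℂ} (hf : L2B R f) : L2B R fun z => star (f z) :=
  ⟨hf.memLp.star, fun z hz => by rw [hf.supp z hz, star_zero]⟩

lemma integral_star (f : ℂ → ℂ) : ∫ z, star (f z) = star (∫ z, f z) := integral_conj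

lemma IsWeakSol.conj {κ R : ℝ} {v u : ℂ → ℂ} (h : IsWeakSol κ R (fun z => star (v z)) u) :
    IsWeakSol κ R v fun z => star (u z) := by
  refine ⟨h.l2.conj, fun P g hP hg hW => ?_⟩
  have h1 := h.eq _ _ hP.conj hg.conj (fun φ hφ => by
    have h2 := hW _ (contDiff_star hφ)
    have h3 := congrArg star h2
    rw [star_neg, ← integral_star, ← integral_star] at h3
    simp only [lap_star] at h3
    simpa using h3)
  have h4 := congrArg star h1
  rw [← integral_star, ← integral_star] at h4
  simpa using h4

lemma Pot.conj {M R : ℝ} {Q : ℂ → ℂ} (h : Pot M R Q) : Pot M R fun z => star (Q z) where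
  meas := continuous_star.measurable.comp h.meas
  bdd z := by rw [norm_star]; exact h.bdd z
  supp z hz := by rw [h.supp z hz, star_zero]

lemma Pot.sub {M M' R : ℝ} {v w : ℂ → ℂ} (hv : Pot M R v) (hw : Pot M' R w) :
    Pot (M + M') R fun z => v z - w z where
  meas := hv.meas.sub hw.meas
  bdd z := (norm_sub_le _ _).trans (add_le_add (hv.bdd z) (hw.bdd z))
  supp z hz := by rw [hv.supp z hz, hw.supp z hz, sub_zero]

lemma ee_mul_star_ee_neg (τ : ℝ) (z₀ z : ℂ) :
    ee τ z₀ z * star (ee (-τ) z₀ z) = ph τ (z - z₀) := by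
  have h := eb_eq (-τ) z₀ z
  rw [eb, neg_neg] at h
  rw [h, mul_left_comm, ee, ee, ← Complex.exp_add]
  simp

lemma lintegral_cut_cv_ck_eq_dec (S τ : ℝ) (q : ℂ → ℂ) (z₀ : ℂ) :
    ∫⁻ ζ, ‖cut S (cv ck fun z => ph τ (z - z₀) * q z) ζ‖ₑ ^ 2 =
      dec S (-τ) (fun z => star (q z)) z₀ := by
  unfold dec
  refine lintegral_congr fun ζ => ?_
  rcases lt_or_ge S ‖ζ‖ with h | h
  · simp [cut_of_lt h]
  rw [cut_of_le h, cut_of_le h]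
  have : (fun z => ph (-τ) (z - z₀) * star (q z)) = fun z => star (ph τ (z - z₀) * q z) := by
    funext z; rw [star_mul', star_ph]
  rw [this, cv_ckb_star, ← ofReal_norm, ← ofReal_norm, norm_star]

lemma ennreal_mul_le_sq_add_sq (a b : ℝ≥0∞) : a * b ≤ a ^ 2 + b ^ 2 := by
  rcases le_total a b with h | h
  · exact (mul_le_mul' h le_rfl).trans ((sq b).symm.le.trans le_add_self)
  · exact (mul_le_mul' le_rfl h).trans ((sq a).symm.le.trans le_self_add)

/-- The error terms in the oscillatory integral of the difference of the potentials. -/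
def errD (S κ R τ : ℝ) (v₁ v₂ : ℂ → ℂ) (z₀ : ℂ) : ℝ≥0∞ :=
  dec S (-τ) (fun z => star (v₁ z - v₂ z)) z₀ + dec S τ (fun z => v₁ z - v₂ z) z₀ +
    (dec S τ (cpot κ R v₁) z₀ + dec S (-τ) (cpot κ R fun z => star (v₂ z)) z₀)

theorem exists_osc_bound {κ R M : ℝ} (R₁ : ℝ) {v₁ v₂ : ℂ → ℂ} (hv₁ : Pot M R v₁) (hv₂ : Pot M R v₂)
    (hO : ∀ u₁ u₂, IsWeakSol κ R v₁ u₁ → IsWeakSol κ R v₂ u₂ →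
      ∫ z, (v₁ z - v₂ z) * u₁ z * u₂ z = 0) :
    ∃ S τ₀ : ℝ, ∃ C : ℝ≥0∞, C ≠ ⊤ ∧ ∀ τ, τ₀ ≤ |τ| → ∀ z₀, ‖z₀‖ ≤ R₁ →
      ‖∫ z, ph τ (z - z₀) * (v₁ z - v₂ z)‖ₑ ≤ C * errD S κ R τ v₁ v₂ z₀ := by
  obtain ⟨B, S, χ, hχ, hχc, hχp, hχ1⟩ := exists_cutoff_pot (R + R₁)
  obtain ⟨τ₁, C₁, hC₁, h₁⟩ := exists_cgo (κ := κ) hv₁ hχ hχc hχp hχ1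
  obtain ⟨τ₂, C₂, hC₂, h₂⟩ := exists_cgo (κ := κ) hv₂.conj hχ hχc hχp hχ1
  have hq := hv₁.sub hv₂
  refine ⟨S + R₁, max τ₁ τ₂, C₁ + C₂ + ENNReal.ofReal (M + M) * (C₁ + C₂), by finiteness,
    fun τ hτ z₀ hz₀ => ?_⟩
  obtain ⟨r₁, hr₁, hu₁, hn₁, hp₁⟩ := h₁ τ ((le_max_left _ _).trans hτ) z₀ hz₀
  obtain ⟨r₂, hr₂, hu₂, hn₂, hp₂⟩ := h₂ (-τ) (by rw [abs_neg]; exact (le_max_right _ _).trans hτ)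
    z₀ hz₀
  have hO' := hO _ _ hu₁ hu₂.conj
  set q : ℂ → ℂ := fun z => v₁ z - v₂ z with hqdef
  set h : ℂ → ℂ := fun z => ph τ (z - z₀) * q z with hhdef
  have hh : Pot (M + M) R h := hq.mul_ph τ z₀
  set E := errD (S + R₁) κ R τ v₁ v₂ z₀ with hE
  have hr₁h := hr₁.bdd_mul hh.memLp
  have hr₂h := hr₂.conj.bdd_mul hh.memLp
  have i12 := hr₁h.integrable_mul hr₂.conj
  have hsum : (∫ z, h z) = -((∫ z, h z * r₁ z) + (∫ z, h z * star (r₂ z)) +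
      ∫ z, h z * r₁ z * star (r₂ z)) := by
    have j1 : Integrable fun z => h z * r₁ z + h z * star (r₂ z) :=
      hr₁h.integrable.add hr₂h.integrable
    have j2 : Integrable fun z => h z * r₁ z + h z * star (r₂ z) + h z * r₁ z * star (r₂ z) :=
      j1.add i12
    rw [← integral_add hr₁h.integrable hr₂h.integrable, ← integral_add j1 i12,
      eq_neg_iff_add_eq_zero, ← integral_add hh.l2.integrable j2, ← hO']
    congr 1; funext z
    rcases lt_or_ge R ‖z‖ with hz | hz
    · simp [hh.supp z hz, cut_of_lt hz]
    simp only [cut_of_le hz, star_mul', star_add, star_one]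
    rw [show h z = ee τ z₀ z * star (ee (-τ) z₀ z) * q z by rw [ee_mul_star_ee_neg]]
    ring
  have b1 : ‖∫ z, h z * r₁ z‖ₑ ≤ C₁ * E := by
    refine (hp₁ h hh.l2).trans (mul_le_mul' le_rfl ?_)
    rw [lintegral_cut_cv_ck_eq_dec, hE, errD]
    exact add_le_add le_self_add le_self_add
  have b2 : ‖∫ z, h z * star (r₂ z)‖ₑ ≤ C₂ * E := by
    have e : ‖∫ z, h z * star (r₂ z)‖ₑ = ‖∫ z, star (h z) * r₂ z‖ₑ := by
      rw [← ofReal_norm, ← ofReal_norm, ← norm_star (∫ z, h z * _), ← integral_star]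
      simp only [star_mul', star_star]
    rw [e]
    refine (hp₂ _ hh.conj.l2).trans (mul_le_mul' le_rfl ?_)
    have e2 : (fun z => star (h z)) = fun z => ph (-τ) (z - z₀) * star (q z) := by
      funext z; rw [hhdef, star_mul', star_ph]
    rw [e2, lintegral_cut_cv_ck_eq_dec, hE, errD]
    simp only [neg_neg, star_star]
    exact add_le_add le_add_self le_add_self
  have b3 : ‖∫ z, h z * r₁ z * star (r₂ z)‖ₑ ≤ ENNReal.ofReal (M + M) * (C₁ + C₂) * E := by
    refine (enorm_integral_le_lintegral_enorm _).trans ?_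
    calc ∫⁻ z, ‖h z * r₁ z * star (r₂ z)‖ₑ
        ≤ ∫⁻ z, ENNReal.ofReal (M + M) * (‖r₁ z‖ₑ ^ 2 + ‖r₂ z‖ₑ ^ 2) := by
          refine lintegral_mono fun z => ?_
          rw [enorm_mul, enorm_mul, mul_assoc]
          refine mul_le_mul' (hh.enorm_le z) ((ennreal_mul_le_sq_add_sq _ _).trans (le_of_eq ?_))
          congr 2
          rw [← ofReal_norm, ← ofReal_norm, norm_star]
      _ = ENNReal.ofReal (M + M) * ((∫⁻ z, ‖r₁ z‖ₑ ^ 2) + ∫⁻ z, ‖r₂ z‖ₑ ^ 2) := by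
          rw [lintegral_const_mul' _ _ ENNReal.ofReal_ne_top, lintegral_add_left'
            (hr₁.memLp.1.enorm.pow_const 2)]
      _ ≤ ENNReal.ofReal (M + M) * (C₁ * E + C₂ * E) := by
          refine mul_le_mul' le_rfl (add_le_add (hn₁.trans (mul_le_mul' le_rfl ?_))
            (hn₂.trans (mul_le_mul' le_rfl ?_)))
          · exact le_self_add.trans le_add_self
          · exact le_add_self.trans le_add_self
      _ = _ := by ring
  calc ‖∫ z, h z‖ₑ ≤ C₁ * E + C₂ * E + ENNReal.ofReal (M + M) * (C₁ + C₂) * E := by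
        rw [hsum, enorm_neg]
        exact (enorm_add_le _ _).trans (add_le_add ((enorm_add_le _ _).trans (add_le_add b1 b2)) b3)
    _ = _ := by ring

theorem exists_lintegral_errD_le {κ R M : ℝ} (S R₁ : ℝ) {v₁ v₂ : ℂ → ℂ} (hv₁ : Pot M R v₁)
    (hv₂ : Pot M R v₂) : ∃ C : ℝ≥0∞, C ≠ ⊤ ∧ ∀ τ : ℝ, 1 ≤ |τ| →
      ∫⁻ z₀ in Metric.closedBall 0 R₁, errD S κ R τ v₁ v₂ z₀ ≤
        C * ENNReal.ofReal (|τ| ^ (-(5/4) : ℝ)) := by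
  have hq := hv₁.sub hv₂
  obtain ⟨C₁, hC₁, h₁⟩ := dec_le hq.conj S R₁
  obtain ⟨C₂, hC₂, h₂⟩ := dec_le hq S R₁
  obtain ⟨C₃, hC₃, h₃⟩ := dec_le (cpot_pot κ hv₁) S R₁
  obtain ⟨C₄, hC₄, h₄⟩ := dec_le (cpot_pot κ hv₂.conj) S R₁
  refine ⟨C₁ + C₂ + (C₃ + C₄), by finiteness, fun τ hτ => ?_⟩
  have hτ' : 1 ≤ |(-τ)| := by rwa [abs_neg]
  have m1 := measurable_dec hq.conj S (-τ)
  have m2 := measurable_dec hq S τ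
  have m3 := measurable_dec (cpot_pot κ hv₁) S τ
  have k1 := h₁ (-τ) hτ'
  have k4 := h₄ (-τ) hτ'
  rw [abs_neg] at k1 k4
  simp only [errD]
  have m12 : Measurable fun z₀ => dec S (-τ) (fun z => star (v₁ z - v₂ z)) z₀ +
      dec S τ (fun z => v₁ z - v₂ z) z₀ := m1.add m2
  rw [lintegral_add_left m12, lintegral_add_left m1, lintegral_add_left m3]
  refine (add_le_add (add_le_add k1 (h₂ τ hτ)) (add_le_add (h₃ τ hτ) k4)).trans (le_of_eq ?_)
  ring

end GKL

end

section

open Real MeasureTheory Set Filter Topology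
open scoped ENNReal ContDiff FourierTransform

namespace GKL

/-- The tensor product of two functions of a real variable. -/
def tp (α β : ℝ → ℂ) (z : ℂ) : ℂ := α z.re * β z.im

lemma tp_continuous {α β : ℝ → ℂ} (hα : Continuous α) (hβ : Continuous β) : Continuous (tp α β) :=
  (hα.comp Complex.continuous_re).mul (hβ.comp Complex.continuous_im)

lemma tp_compact {α β : ℝ → ℂ} (hα : HasCompactSupport α) (hβ : HasCompactSupport β) :
    HasCompactSupport (tp α β) := by
  refine HasCompactSupport.of_support_subset_isCompact (K := Complex.equivRealProdCLM.symm ''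
    (tsupport α ×ˢ tsupport β)) ((hα.isCompact.prod hβ.isCompact).image
      Complex.equivRealProdCLM.symm.continuous) fun z hz => ?_
  refine ⟨(z.re, z.im), ⟨subset_tsupport _ ?_, subset_tsupport _ ?_⟩, ?_⟩
  · exact left_ne_zero_of_mul hz
  · exact right_ne_zero_of_mul hz
  · apply Complex.ext <;> simp

lemma fourier_integrable {β : ℝ → ℂ} (hβ : ContDiff ℝ ∞ β) (hc : HasCompactSupport β) :
    Integrable (𝓕 β) := by
  have := (𝓕 (hc.toSchwartzMap hβ)).integrable (μ := volume)
  rwa [SchwartzMap.fourier_coe] at this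

lemma fourier_inversion {β : ℝ → ℂ} (hβ : ContDiff ℝ ∞ β) (hc : HasCompactSupport β) (y : ℝ) :
    ∫ s : ℝ, Complex.exp (((2 * π * s * y : ℝ) : ℂ) * Complex.I) * 𝓕 β s = β y := by
  have h := congrFun (hβ.continuous.fourierInv_fourier_eq
    (hβ.continuous.integrable_of_hasCompactSupport hc) (fourier_integrable hβ hc)) y
  rw [Real.fourierInv_eq'] at h
  rw [← h]
  refine integral_congr_ae (ae_of_all _ fun s => ?_)
  simp only [smul_eq_mul, RCLike.inner_apply, conj_trivial]
  congr 4; ring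

lemma cv_ph_tp {α β : ℝ → ℂ} (hα : Continuous α) (hαc : HasCompactSupport α)
    (hβ : Continuous β) (hβc : HasCompactSupport β) {τ : ℝ} (hτ : 0 < τ) (z : ℂ) :
    τ * cv (ph τ) (tp α β) z = (π / 2 : ℝ) * ∫ s : ℝ, α (z.re - π / (2 * τ) * s) *
      (Complex.exp (((2 * π * s * z.im : ℝ) : ℂ) * Complex.I) * 𝓕 β s) := by
  have e := Complex.volume_preserving_equiv_real_prod.symm
  have hi : Integrable fun w => ph τ w * tp α β (z - w) := by
    have := cv_integrable (k := ph τ) (ph_contDiff τ).continuous.locallyIntegrable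
      (tp_continuous hα hβ) (tp_compact hαc hβc) z
    have h2 := (integrable_comp_sub_left _ z).2 this
    simpa using h2
  have hi' : Integrable (fun p : ℝ × ℝ => ph τ (Complex.measurableEquivRealProd.symm p) *
      tp α β (z - Complex.measurableEquivRealProd.symm p))
      ((volume : Measure ℝ).prod (volume : Measure ℝ)) :=
    (e.integrable_comp_emb Complex.measurableEquivRealProd.symm.measurableEmbedding).2 hi
  rw [cv_eq_integral, ← e.integral_comp Complex.measurableEquivRealProd.symm.measurableEmbedding,
      Measure.volume_eq_prod, integral_prod _ hi']
  have inner : ∀ x : ℝ, ∫ y : ℝ, ph τ (Complex.measurableEquivRealProd.symm (x, y)) *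
      tp α β (z - Complex.measurableEquivRealProd.symm (x, y)) =
      α (z.re - x) * (Complex.exp (((4 * τ * x * z.im : ℝ) : ℂ) * Complex.I) *
        𝓕 β (2 * τ / π * x)) := fun x => by
    rw [← integral_sub_left_eq_self _ volume z.im, Real.fourier_eq', ← mul_assoc,
      ← integral_const_mul]
    refine integral_congr_ae (ae_of_all _ fun y => ?_)
    have e1 : ph τ (Complex.measurableEquivRealProd.symm (x, z.im - y)) =
      Complex.exp (((4 * τ * x * (z.im - y) : ℝ) : ℂ) * Complex.I) := by rw [ph]; rfl
    have e2 : tp α β (z - Complex.measurableEquivRealProd.symm (x, z.im - y)) =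
        α (z.re - x) * β y := by
      have h1 : (z - Complex.measurableEquivRealProd.symm (x, z.im - y)).re = z.re - x := by
        rw [Complex.sub_re]; rfl
      have h2 : (z - Complex.measurableEquivRealProd.symm (x, z.im - y)).im = y := by
        rw [Complex.sub_im]; exact sub_sub_cancel _ _
      rw [tp, h1, h2]
    simp only [e1, e2, smul_eq_mul, RCLike.inner_apply, conj_trivial]
    have e3 : Complex.exp (((4 * τ * x * (z.im - y) : ℝ) : ℂ) * Complex.I) =
        Complex.exp (((4 * τ * x * z.im : ℝ) : ℂ) * Complex.I) *
          Complex.exp (((-2 * π * (2 * τ / π * x * y) : ℝ) : ℂ) * Complex.I) := by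
      rw [← Complex.exp_add]
      congr 1
      have : (π : ℂ) ≠ 0 := by exact_mod_cast pi_ne_zero
      push_cast; field_simp; ring
    rw [e3]; ring
  simp only [inner]
  set G : ℝ → ℂ := fun s => α (z.re - π / (2 * τ) * s) *
      (Complex.exp (((2 * π * s * z.im : ℝ) : ℂ) * Complex.I) * 𝓕 β s) with hG
  have hG2 : ∀ x : ℝ, α (z.re - x) * (Complex.exp (((4 * τ * x * z.im : ℝ) : ℂ) * Complex.I) *
        𝓕 β (2 * τ / π * x)) = G (2 * τ / π * x) := fun x => by
    simp only [hG]
    have h1 : π / (2 * τ) * (2 * τ / π * x) = x := by field_simp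
    have h2 : 2 * π * (2 * τ / π * x) * z.im = 4 * τ * x * z.im := by field_simp; ring
    rw [h1, h2]
  simp only [hG2]
  rw [Measure.integral_comp_mul_left, abs_of_pos (by positivity), Complex.real_smul, ← mul_assoc]
  congr 1
  have : (π : ℂ) ≠ 0 := by exact_mod_cast pi_ne_zero
  have h2 : (τ : ℂ) ≠ 0 := by exact_mod_cast hτ.ne'
  push_cast; field_simp

lemma cv_ph_tp_bound {α β : ℝ → ℂ} (hα : Continuous α) (hαc : HasCompactSupport α)
    (hβ : ContDiff ℝ ∞ β) (hβc : HasCompactSupport β) : ∃ C : ℝ, ∀ τ : ℝ, 0 < τ → ∀ z,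
      ‖τ * cv (ph τ) (tp α β) z‖ ≤ C := by
  obtain ⟨A, hA⟩ := hαc.exists_bound_of_continuous hα
  refine ⟨π / 2 * ∫ s, A * ‖𝓕 β s‖, fun τ hτ z => ?_⟩
  rw [cv_ph_tp hα hαc hβ.continuous hβc hτ, norm_mul, Complex.norm_real, Real.norm_eq_abs,
    abs_of_pos (by positivity)]
  gcongr
  refine norm_integral_le_of_norm_le ((fourier_integrable hβ hβc).norm.const_mul A)
    (ae_of_all _ fun s => ?_)
  rw [norm_mul, norm_mul, Complex.norm_exp_ofReal_mul_I, one_mul]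
  gcongr
  exact hA _

lemma cv_ph_tp_tendsto {α β : ℝ → ℂ} (hα : Continuous α) (hαc : HasCompactSupport α)
    (hβ : ContDiff ℝ ∞ β) (hβc : HasCompactSupport β) (z : ℂ) :
    Tendsto (fun τ : ℝ => τ * cv (ph τ) (tp α β) z) atTop (𝓝 ((π / 2 : ℝ) * tp α β z)) := by
  obtain ⟨A, hA⟩ := hαc.exists_bound_of_continuous hα
  have hF := fourier_integrable hβ hβc
  have hE : Continuous fun s : ℝ => Complex.exp (((2 * π * s * z.im : ℝ) : ℂ) * Complex.I) := by
    fun_prop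
  have h : Tendsto (fun τ : ℝ => ∫ s : ℝ, α (z.re - π / (2 * τ) * s) *
      (Complex.exp (((2 * π * s * z.im : ℝ) : ℂ) * Complex.I) * 𝓕 β s)) atTop
      (𝓝 (∫ s : ℝ, α z.re * (Complex.exp (((2 * π * s * z.im : ℝ) : ℂ) * Complex.I) * 𝓕 β s))) := by
    refine tendsto_integral_filter_of_dominated_convergence (fun s => A * ‖𝓕 β s‖)
      (Eventually.of_forall fun τ => ?_) (Eventually.of_forall fun τ => ae_of_all _ fun s => ?_)
      (hF.norm.const_mul A) (ae_of_all _ fun s => ?_)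
    · exact (hα.comp (by fun_prop)).aestronglyMeasurable.mul (hE.aestronglyMeasurable.mul hF.1)
    · rw [norm_mul, norm_mul, Complex.norm_exp_ofReal_mul_I, one_mul]
      gcongr
      exact hA _
    · refine Tendsto.mul_const _ ((hα.tendsto _).comp ?_)
      have h1 : Tendsto (fun τ : ℝ => π / (2 * τ)) atTop (𝓝 0) :=
        (tendsto_id.const_mul_atTop (by norm_num : (0:ℝ) < 2)).const_div_atTop π
      simpa using (h1.mul_const s).const_sub z.re
  rw [integral_const_mul, fourier_inversion hβ hβc] at h
  refine (h.const_mul _).congr' ?_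
  filter_upwards [eventually_gt_atTop 0] with τ hτ
  exact (cv_ph_tp hα hαc hβ.continuous hβc hτ z).symm

end GKL

end

section

open Real MeasureTheory Set Filter Topology
open scoped ENNReal ContDiff

namespace GKL

lemma integral_mul_tp_eq_zero {κ R M : ℝ} {v₁ v₂ : ℂ → ℂ} (hv₁ : Pot M R v₁) (hv₂ : Pot M R v₂)
    (hO : ∀ u₁ u₂, IsWeakSol κ R v₁ u₁ → IsWeakSol κ R v₂ u₂ →
      ∫ z, (v₁ z - v₂ z) * u₁ z * u₂ z = 0) {α β : ℝ → ℂ} (hα : Continuous α)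
    (hαc : HasCompactSupport α) (hβ : ContDiff ℝ ∞ β) (hβc : HasCompactSupport β) :
    ∫ z, (v₁ z - v₂ z) * tp α β z = 0 := by
  have hφ := tp_continuous hα hβ.continuous
  have hφc := tp_compact hαc hβc
  obtain ⟨R₁, hR₁⟩ := L2B.of_smooth hφ hφc
  obtain ⟨A, hA⟩ := hφc.exists_bound_of_continuous hφ
  obtain ⟨B, hB⟩ := cv_ph_tp_bound hα hαc hβ hβc
  obtain ⟨S, τ₀, C, hC, h₁⟩ := exists_osc_bound R₁ hv₁ hv₂ hO
  obtain ⟨C', hC', h₂⟩ := exists_lintegral_errD_le (κ := κ) S R₁ hv₁ hv₂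
  have hq := hv₁.sub hv₂
  set q : ℂ → ℂ := fun z => v₁ z - v₂ z with hqdef
  have hlim : Tendsto (fun τ : ℝ => ∫ z, q z * (τ * cv (ph τ) (tp α β) z)) atTop
      (𝓝 (∫ z, q z * ((π / 2 : ℝ) * tp α β z))) := by
    refine tendsto_integral_filter_of_dominated_convergence (fun z => ‖q z‖ * B)
      (Eventually.of_forall fun τ => ?_) ?_ (hq.l2.integrable.norm.mul_const B)
      (ae_of_all _ fun z => (cv_ph_tp_tendsto hα hαc hβ hβc z).const_mul _)
    · exact hq.meas.aestronglyMeasurable.mul ((cv_aesm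
        (ph_contDiff τ).continuous.locallyIntegrable hφ.aestronglyMeasurable).const_mul _)
    · filter_upwards [eventually_gt_atTop 0] with τ hτ
      refine ae_of_all _ fun z => ?_
      rw [norm_mul]
      gcongr
      exact hB τ hτ z
  have hswap : ∀ τ : ℝ, ∫ z, q z * (τ * cv (ph τ) (tp α β) z) =
      τ * ∫ x, cv (ph τ) q x * tp α β x := fun τ => by
    rw [integral_cv_mul (ph_contDiff τ).continuous.locallyIntegrable
      (hq.l2.mono (le_max_left R R₁)) (hR₁.mono (le_max_right R R₁)), ← integral_const_mul]
    simp only [ph_neg]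
    exact integral_congr_ae (ae_of_all _ fun z => by simp only []; ring)
  have hbound : ∀ᶠ τ : ℝ in atTop, ‖∫ z, q z * (τ * cv (ph τ) (tp α β) z)‖ₑ ≤
      (C * ENNReal.ofReal A * C') * ENNReal.ofReal (τ ^ (-(1/4) : ℝ)) := by
    filter_upwards [eventually_ge_atTop 1, eventually_ge_atTop τ₀] with τ hτ hτ₀
    have hτ' : |τ| = τ := abs_of_pos (by linarith)
    rw [hswap, enorm_mul]
    have h3 : ‖∫ x, cv (ph τ) q x * tp α β x‖ₑ ≤
        (C * ENNReal.ofReal A) * (C' * ENNReal.ofReal (|τ| ^ (-(5/4) : ℝ))) := by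
      refine (enorm_integral_le_lintegral_enorm _).trans ?_
      refine le_trans ?_ (mul_le_mul' le_rfl (h₂ τ (by rw [hτ']; exact hτ)))
      rw [← lintegral_const_mul' _ _ (by finiteness),
        ← lintegral_indicator Metric.isClosed_closedBall.measurableSet]
      refine lintegral_mono fun x => ?_
      by_cases hx : ‖x‖ ≤ R₁
      · rw [indicator_of_mem (by simpa using hx), enorm_mul]
        have h4 := h₁ τ (by rw [hτ']; exact hτ₀) x hx
        have h5 : cv (ph τ) q x = ∫ z, ph τ (z - x) * (v₁ z - v₂ z) := by
          rw [cv]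
          refine integral_congr_ae (ae_of_all _ fun z => ?_)
          simp only []
          rw [← neg_sub z x, ph_neg]
        have h6 : ‖tp α β x‖ₑ ≤ ENNReal.ofReal A := by
          rw [← ofReal_norm]; exact ENNReal.ofReal_le_ofReal (hA x)
        rw [h5]
        refine (mul_le_mul' h4 h6).trans (le_of_eq ?_)
        ring
      · rw [hR₁.supp x (not_le.1 hx)]; simp
    have h7 : ‖(τ : ℂ)‖ₑ = ENNReal.ofReal τ := by
      rw [← ofReal_norm, Complex.norm_real, Real.norm_eq_abs, hτ']
    have h8 : ENNReal.ofReal (τ ^ (-(1/4) : ℝ)) =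
        ENNReal.ofReal τ * ENNReal.ofReal (|τ| ^ (-(5/4) : ℝ)) := by
      rw [hτ', ← ENNReal.ofReal_mul (by linarith)]
      congr 1
      rw [← Real.rpow_one_add' (by linarith) (by norm_num)]
      norm_num
    rw [h7, h8]
    refine (mul_le_mul' le_rfl h3).trans (le_of_eq ?_)
    ring
  have hzero : Tendsto (fun τ : ℝ => ∫ z, q z * (τ * cv (ph τ) (tp α β) z)) atTop (𝓝 0) := by
    rw [tendsto_zero_iff_enorm_tendsto_zero]
    refine tendsto_of_tendsto_of_tendsto_of_le_of_le' tendsto_const_nhds ?_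
      (Eventually.of_forall fun _ => zero_le) hbound
    have h9 : Tendsto (fun τ : ℝ => ENNReal.ofReal (τ ^ (-(1/4) : ℝ))) atTop (𝓝 0) := by
      have := ENNReal.tendsto_ofReal (tendsto_rpow_neg_atTop (y := 1/4) (by norm_num))
      simpa using this
    simpa using ENNReal.Tendsto.const_mul h9 (Or.inr (by finiteness))
  have h := tendsto_nhds_unique hlim hzero
  have h10 : ∫ z, q z * ((π / 2 : ℝ) * tp α β z) = (π / 2 : ℝ) * ∫ z, q z * tp α β z := by
    rw [← integral_const_mul]
    exact integral_congr_ae (ae_of_all _ fun z => by simp only []; ring)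
  rw [h10] at h
  refine (mul_eq_zero.1 h).resolve_left ?_
  exact_mod_cast (by positivity : π / 2 ≠ 0)

/-- An integrable function orthogonal to all tensor products of test functions vanishes. -/
lemma ae_eq_zero_of_integral_tp {q : ℂ → ℂ} (hq : Integrable q)
    (h : ∀ α β : ℝ → ℂ, ContDiff ℝ ∞ α → HasCompactSupport α → ContDiff ℝ ∞ β →
      HasCompactSupport β → ∫ z, q z * tp α β z = 0) : q =ᵐ[volume] 0 := by
  have e := Complex.volume_preserving_equiv_real_prod.symm
  have em := Complex.measurableEquivRealProd.symm.measurableEmbedding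
  set p : ℝ × ℝ → ℂ := fun x => q (Complex.measurableEquivRealProd.symm x) with hp
  have hpi : Integrable p ((volume : Measure ℝ).prod (volume : Measure ℝ)) :=
    (e.integrable_comp_emb em).2 hq
  have hmulsnd : ∀ β : ℝ → ℂ, Continuous β → HasCompactSupport β →
      Integrable (fun x : ℝ × ℝ => β x.2 * p x) ((volume : Measure ℝ).prod (volume : Measure ℝ)) := by
    intro β hβ hβc
    obtain ⟨B, hB⟩ := hβc.exists_bound_of_continuous hβ
    exact hpi.bdd_mul (c := B) (hβ.comp continuous_snd).aestronglyMeasurable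
      (ae_of_all _ fun x => hB _)
  have hslice : ∀ β : ℝ → ℂ, ContDiff ℝ ∞ β → HasCompactSupport β →
      ∀ᵐ x : ℝ, ∫ y, β y * p (x, y) = 0 := by
    intro β hβ hβc
    have hi := hmulsnd β hβ.continuous hβc
    refine ae_eq_zero_of_integral_contDiff_smul_eq_zero
      (hi.integral_prod_left.locallyIntegrable) fun g hg hgc => ?_
    have hg' : ContDiff ℝ ∞ fun x => (g x : ℂ) := Complex.ofRealCLM.contDiff.comp hg
    have hgc' : HasCompactSupport fun x => (g x : ℂ) :=
      hgc.comp_left (g := fun x : ℝ => (x : ℂ)) Complex.ofReal_zero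
    obtain ⟨B, hB⟩ := hgc'.exists_bound_of_continuous hg'.continuous
    have hi2 : Integrable (fun x : ℝ × ℝ => (g x.1 : ℂ) * (β x.2 * p x))
        ((volume : Measure ℝ).prod (volume : Measure ℝ)) :=
      hi.bdd_mul (c := B) (hg'.continuous.comp continuous_fst).aestronglyMeasurable
        (ae_of_all _ fun x => hB _)
    have h0 := h _ β hg' hgc' hβ hβc
    rw [← e.integral_comp em, Measure.volume_eq_prod] at h0
    have h1 : ∫ x : ℝ × ℝ, (g x.1 : ℂ) * (β x.2 * p x) ∂((volume : Measure ℝ).prod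
        (volume : Measure ℝ)) = 0 := by
      rw [← h0]
      refine integral_congr_ae (ae_of_all _ fun x => ?_)
      have : tp (fun x => (g x : ℂ)) β (Complex.measurableEquivRealProd.symm x) =
        g x.1 * β x.2 := rfl
      simp only [this, hp]; ring
    rw [integral_prod _ hi2] at h1
    rw [← h1]
    refine integral_congr_ae (ae_of_all _ fun x => ?_)
    simp only [integral_const_mul, Complex.real_smul]
  have hsection : ∀ s : Set ℝ, MeasurableSet s → ∀ᵐ y : ℝ, ∫ x in s, p (x, y) = 0 := by
    intro s hs
    have his : Integrable p (((volume : Measure ℝ).restrict s).prod (volume : Measure ℝ)) := by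
      have : ((volume : Measure ℝ).restrict s).prod (volume : Measure ℝ) =
          ((volume : Measure ℝ).prod (volume : Measure ℝ)).restrict (s ×ˢ univ) := by
        rw [← Measure.prod_restrict, Measure.restrict_univ]
      rw [this]; exact hpi.restrict
    refine ae_eq_zero_of_integral_contDiff_smul_eq_zero
      (his.integral_prod_right.locallyIntegrable) fun g hg hgc => ?_
    have hg' : ContDiff ℝ ∞ fun x => (g x : ℂ) := Complex.ofRealCLM.contDiff.comp hg
    have hgc' : HasCompactSupport fun x => (g x : ℂ) :=
      hgc.comp_left (g := fun x : ℝ => (x : ℂ)) Complex.ofReal_zero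
    obtain ⟨B, hB⟩ := hgc'.exists_bound_of_continuous hg'.continuous
    have hi2 : Integrable (fun x : ℝ × ℝ => (g x.2 : ℂ) * p x)
        (((volume : Measure ℝ).restrict s).prod (volume : Measure ℝ)) :=
      his.bdd_mul (c := B) (hg'.continuous.comp continuous_snd).aestronglyMeasurable
        (ae_of_all _ fun x => hB _)
    have h1 := (integral_prod _ hi2).symm.trans (integral_prod_symm _ hi2)
    simp only [integral_const_mul] at h1
    simp only [Complex.real_smul]
    rw [← h1]
    refine integral_eq_zero_of_ae (ae_restrict_of_ae ?_)
    filter_upwards [hslice _ hg' hgc'] with x hx using hx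
  have hsetInt : ∀ s : Set (ℝ × ℝ), MeasurableSet s →
      ∫ x in s, p x ∂((volume : Measure ℝ).prod (volume : Measure ℝ)) = 0 := by
    have huniv : ∫ x, p x ∂((volume : Measure ℝ).prod (volume : Measure ℝ)) = 0 := by
      rw [integral_prod_symm _ hpi]
      refine integral_eq_zero_of_ae ?_
      filter_upwards [hsection univ MeasurableSet.univ] with y hy
      simpa using hy
    intro s hs
    refine MeasurableSpace.induction_on_inter (C := fun s _ =>
      ∫ x in s, p x ∂((volume : Measure ℝ).prod (volume : Measure ℝ)) = 0)
      generateFrom_prod.symm isPiSystem_prod (by simp) ?_ ?_ ?_ s hs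
    · rintro _ ⟨a, ha, b, hb, rfl⟩
      have hi : Integrable p (((volume : Measure ℝ).restrict a).prod
          ((volume : Measure ℝ).restrict b)) := by
        rw [Measure.prod_restrict]; exact hpi.restrict
      rw [← Measure.prod_restrict, integral_prod_symm _ hi]
      exact integral_eq_zero_of_ae (ae_restrict_of_ae (hsection a ha))
    · intro t ht h0
      have := integral_add_compl ht hpi
      rwa [h0, zero_add, huniv] at this
    · intro f hd hm h0
      rw [integral_iUnion hm hd hpi.integrableOn]
      simp [h0]
  have hp0 : p =ᵐ[(volume : Measure ℝ).prod (volume : Measure ℝ)] 0 :=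
    hpi.ae_eq_zero_of_forall_setIntegral_eq_zero fun s hs _ => hsetInt s hs
  have h2 := Complex.volume_preserving_equiv_real_prod.quasiMeasurePreserving.ae_eq_comp
    (g := p) (g' := 0) hp0
  filter_upwards [h2] with z hz
  simpa [hp] using hz

theorem pot_unique {κ R M : ℝ} {v₁ v₂ : ℂ → ℂ} (hv₁ : Pot M R v₁) (hv₂ : Pot M R v₂)
    (hO : ∀ u₁ u₂, IsWeakSol κ R v₁ u₁ → IsWeakSol κ R v₂ u₂ →
      ∫ z, (v₁ z - v₂ z) * u₁ z * u₂ z = 0) : v₁ =ᵐ[volume] v₂ := by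
  have := ae_eq_zero_of_integral_tp (hv₁.sub hv₂).l2.integrable fun α β hα hαc hβ hβc =>
    integral_mul_tp_eq_zero hv₁ hv₂ hO hα.continuous hαc hβ hβc
  filter_upwards [this] with z hz using sub_eq_zero.1 hz

/-- The standard identification of `ℂ` with the Euclidean plane. -/
def eC : ℂ ≃ₗᵢ[ℝ] R2 := Complex.orthonormalBasisOneI.repr

lemma eC_measurePreserving : MeasurePreserving eC volume volume := eC.measurePreserving

lemma eC_symm_measurePreserving : MeasurePreserving eC.symm volume volume :=
  eC.symm.measurePreserving

lemma eC_embedding : MeasurableEmbedding eC := eC.toHomeomorph.measurableEmbedding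

lemma eC_one : eC 1 = EuclideanSpace.single 0 1 := by
  have := Complex.orthonormalBasisOneI.repr_self 0
  rwa [Complex.coe_orthonormalBasisOneI] at this

lemma eC_I : eC Complex.I = EuclideanSpace.single 1 1 := by
  have := Complex.orthonormalBasisOneI.repr_self 1
  rwa [Complex.coe_orthonormalBasisOneI] at this

lemma Gplus_eC {κ : ℝ} (hκ : 0 < κ) {x z : ℂ} (h : x ≠ z) :
    Gplus κ (eC x - eC z) = gG κ (x - z) := by
  have h' : eC x - eC z ≠ 0 := sub_ne_zero.2 fun h' => h (eC.injective h')
  rw [Gplus_eq κ hκ _ h', gG, ← map_sub, eC.norm_map]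

lemma lap_comp_eC (u : R2 → ℂ) (z : ℂ) : lap (fun w => u (eC w)) z = laplacian2 u (eC z) := by
  have h : ∀ (f : R2 → ℂ) (v : ℂ), dd v (fun w => f (eC w)) =
      fun w => (fun y => fderiv ℝ f y (eC v)) (eC w) := fun f v => by
    funext w
    have := eC.toContinuousLinearEquiv.comp_right_fderiv (f := f) (x := w)
    exact congrArg (fun L => L v) this
  rw [lap, h u 1, h u Complex.I, h (fun y => fderiv ℝ u y (eC 1)) 1,
    h (fun y => fderiv ℝ u y (eC Complex.I)) Complex.I, laplacian2, Fin.sum_univ_two, eC_one, eC_I]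

/-- Transfer of the absence of Dirichlet eigenfunctions to the complex plane. -/
lemma dirichlet_eC {κ : ℝ} {D : Set R2} (h : NotDirichletEigenvalue κ D) (u : ℂ → ℂ)
    (hc : ContinuousOn u (closure (eC ⁻¹' D))) (hd : ContDiffOn ℝ 2 u (eC ⁻¹' D))
    (he : ∀ x ∈ eC ⁻¹' D, lap u x + (κ : ℂ) ^ 2 * u x = 0)
    (h0 : ∀ x ∈ frontier (eC ⁻¹' D), u x = 0) : ∀ x ∈ eC ⁻¹' D, u x = 0 := by
  have hcl : closure (eC ⁻¹' D) = eC ⁻¹' closure D := (eC.toHomeomorph.preimage_closure D).symm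
  have hfr : frontier (eC ⁻¹' D) = eC ⁻¹' frontier D := (eC.toHomeomorph.preimage_frontier D).symm
  have hlap : ∀ x, laplacian2 (fun y => u (eC.symm y)) x = lap u (eC.symm x) := fun x => by
    have := lap_comp_eC (fun y => u (eC.symm y)) (eC.symm x)
    simpa using this.symm
  have key := h (fun y => u (eC.symm y))
    (hc.comp eC.symm.continuous.continuousOn fun x hx => by rw [hcl]; simpa using hx)
    (hd.comp eC.symm.contDiff.contDiffOn fun x hx => by simpa using hx)
    (fun x hx => by rw [hlap]; exact he _ (by simpa using hx))
    (fun x hx => h0 _ (by rw [hfr]; simpa using hx))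
  intro x hx
  simpa using key (eC x) hx

/-- A bounded potential vanishing almost everywhere on `U` has a representative on `ℂ` which is
measurable, bounded and vanishes everywhere on `U`. -/
lemma exists_pot {R : ℝ} {U : Set R2} (hU : IsOpen U) (hUR : ∀ z : ℂ, R < ‖z‖ → eC z ∈ U)
    {v : R2 → ℂ} (hv : MemLp v ⊤ volume) (hv0 : ∀ᵐ x ∂volume, x ∈ closure U → v x = 0) :
    ∃ (M : ℝ) (w : ℂ → ℂ), Pot M R w ∧ (∀ z, eC z ∈ U → w z = 0) ∧
      ∀ᵐ z, v (eC z) = w z := by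
  obtain ⟨M, hM⟩ := (eLpNormEssSup_lt_top_iff_isBoundedUnder.1
    (by simpa using hv.2) : IsBoundedUnder (· ≤ ·) (ae volume) fun x => ‖v x‖₊)
  rw [eventually_map] at hM
  set v' := hv.1.mk v
  have hm : Measurable v' := hv.1.stronglyMeasurable_mk.measurable
  have hvv : v =ᵐ[volume] v' := hv.1.ae_eq_mk
  have hm' : Measurable fun z => v' (eC z) := hm.comp eC.continuous.measurable
  set S : Set ℂ := {z | ‖v' (eC z)‖ ≤ M} ∩ (eC ⁻¹' U)ᶜ with hS
  have hSm : MeasurableSet S := (measurableSet_le hm'.norm measurable_const).inter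
    (hU.preimage eC.continuous).measurableSet.compl
  refine ⟨M, S.indicator fun z => v' (eC z), ⟨hm'.indicator hSm, fun z => ?_, fun z hz => ?_⟩,
    fun z hz => ?_, ?_⟩
  · by_cases h : z ∈ S
    · rw [indicator_of_mem h]; exact h.1
    · rw [indicator_of_notMem h, norm_zero]; exact M.2
  · exact indicator_of_notMem (fun h => h.2 (hUR z hz)) _
  · exact indicator_of_notMem (fun h => h.2 hz) _
  · filter_upwards [eC_measurePreserving.quasiMeasurePreserving.ae hM,
      eC_measurePreserving.quasiMeasurePreserving.ae hvv,
      eC_measurePreserving.quasiMeasurePreserving.ae hv0] with z h1 h2 h3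
    by_cases h : eC z ∈ U
    · rw [h3 (subset_closure h), indicator_of_notMem (fun h' => h'.2 h)]
    · have hz : z ∈ S := ⟨by rw [Set.mem_ofPred, ← h2]; exact h1, h⟩
      rw [indicator_of_mem hz, h2]

/-- A potential on the plane together with its representative on `ℂ`. -/
structure Rep (M R : ℝ) (Ω : Set R2) (v : R2 → ℂ) (w : ℂ → ℂ) : Prop where
  pot : Pot M R w
  meas : MeasurableSet Ω
  bdd : ∀ z : ℂ, eC z ∈ Ω → ‖z‖ ≤ R
  zero : ∀ z, eC z ∉ Ω → w z = 0
  ae : ∀ᵐ z, v (eC z) = w z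

lemma Rep.l2 {M R : ℝ} {Ω : Set R2} {v f : R2 → ℂ} {w : ℂ → ℂ} (h : Rep M R Ω v w)
    (hf : MemLp f 2 (volume.restrict Ω)) : L2B R fun z => w z * f (eC z) := by
  have h1 : MemLp (fun z => Ω.indicator f (eC z)) 2 volume :=
    ((memLp_indicator_iff_restrict h.meas).2 hf).comp_measurePreserving eC_measurePreserving
  have h2 : L2B R fun z => Ω.indicator f (eC z) :=
    ⟨h1, fun z hz => indicator_of_notMem (fun h' => hz.not_ge (h.bdd z h')) _⟩
  convert h2.bdd_mul h.pot.memLp using 2 with z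
  by_cases hz : eC z ∈ Ω
  · rw [indicator_of_mem hz]
  · rw [h.zero z hz, zero_mul, zero_mul]

lemma Rep.kernel_ae {κ M R : ℝ} (hκ : 0 < κ) {Ω : Set R2} {v : R2 → ℂ} {w : ℂ → ℂ}
    (h : Rep M R Ω v w) (f : R2 → ℂ) (x : ℂ) :
    ∀ᵐ z, Ω.indicator (fun y => Gplus κ (eC x - y) * v y * f y) (eC z) =
      gG κ (x - z) * (w z * f (eC z)) := by
  filter_upwards [h.ae, compl_mem_ae_iff.2 (measure_singleton x)] with z h1 h2
  by_cases hz : eC z ∈ Ω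
  · rw [indicator_of_mem hz, Gplus_eC hκ (Ne.symm h2), h1, mul_assoc]
  · rw [indicator_of_notMem hz, h.zero z hz, zero_mul, mul_zero]

lemma Rep.integral_eq {κ M R : ℝ} (hκ : 0 < κ) {Ω : Set R2} {v : R2 → ℂ} {w : ℂ → ℂ}
    (h : Rep M R Ω v w) (f : R2 → ℂ) (x : ℂ) :
    ∫ y in Ω, Gplus κ (eC x - y) * v y * f y = cv (gG κ) (fun z => w z * f (eC z)) x := by
  rw [← integral_indicator h.meas, ← eC_measurePreserving.integral_comp eC_embedding]
  exact integral_congr_ae (h.kernel_ae hκ f x)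

lemma Rep.integrableOn {κ M R : ℝ} (hκ : 0 < κ) {Ω : Set R2} {v f : R2 → ℂ} {w : ℂ → ℂ}
    (h : Rep M R Ω v w) (hf : MemLp f 2 (volume.restrict Ω)) (x : ℂ) :
    IntegrableOn (fun y => Gplus κ (eC x - y) * v y * f y) Ω := by
  rw [← integrable_indicator_iff h.meas, ← eC_measurePreserving.integrable_comp_emb eC_embedding]
  exact (gG_integrable κ (h.l2 hf) x).congr ((h.kernel_ae hκ f x).mono fun z hz => hz.symm)

lemma Rep.green_eq {κ M R : ℝ} (hκ : 0 < κ) {Ω : Set R2} {v : R2 → ℂ} {w : ℂ → ℂ}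
    (h : Rep M R Ω v w) {G : R2 → R2 → ℂ} (hG : IsOutgoingGreen κ Ω v G) {x y : ℂ} (hxy : x ≠ y) :
    G (eC x) (eC y) = -gG κ (x - y) + cv (gG κ) (fun z => w z * G (eC z) (eC y)) x := by
  rw [(hG (eC y)).2 (eC x) fun h' => hxy (eC.injective h'), Gplus_eC hκ hxy,
    h.integral_eq hκ (fun z => G z (eC y))]

lemma Rep.isSource {κ M R : ℝ} (hκ : 0 < κ) {Ω : Set R2} {v : R2 → ℂ} {w : ℂ → ℂ}
    (h : Rep M R Ω v w) {G : R2 → R2 → ℂ} (hG : IsOutgoingGreen κ Ω v G) :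
    IsSource κ R w fun y z => w z * G (eC z) (eC y) where
  l2 y := h.l2 (hG (eC y)).1
  eq y := by
    filter_upwards [compl_mem_ae_iff.2 (measure_singleton y)] with z hz
    rw [h.green_eq hκ hG hz]

/-- Unique solvability on `Ω` gives uniqueness for the homogeneous equation on the disc. -/
lemma Rep.unique {κ M R : ℝ} (hκ : 0 < κ) {Ω : Set R2} {v : R2 → ℂ} {w : ℂ → ℂ}
    (h : Rep M R Ω v w) {G : R2 → R2 → ℂ} (hG : IsOutgoingGreen κ Ω v G)
    (hu : UniqueSolvability κ Ω v) (q : ℂ → ℂ) (hq : L2B R q)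
    (hqe : ∀ᵐ x, ‖x‖ ≤ R → q x = cv (gG κ) (fun z => w z * q z) x) : q =ᵐ[volume] 0 := by
  have hp : MemLp (fun x => q (eC.symm x)) 2 (volume.restrict Ω) :=
    (hq.memLp.comp_measurePreserving eC_symm_measurePreserving).restrict Ω
  have hg := (hG 0).1
  have e0 : ∀ᵐ x : R2, x ≠ 0 := compl_mem_ae_iff.2 (measure_singleton 0)
  have key := hu 0 (fun x => G x 0) (fun x => G x 0 + q (eC.symm x)) hg (hg.add hp)
    (ae_restrict_of_ae (e0.mono fun x hx => (hG 0).2 x hx)) (by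
      rw [ae_restrict_iff' h.meas]
      filter_upwards [e0, eC_symm_measurePreserving.quasiMeasurePreserving.ae hqe] with x hx hqx hxΩ
      obtain ⟨z, rfl⟩ := eC.surjective x
      simp only [LinearIsometryEquiv.symm_apply_apply] at hqx ⊢
      have i1 := h.integrableOn hκ hg z
      have i2 := h.integrableOn hκ hp z
      have := integral_add i1 i2
      simp only [← mul_add] at this
      rw [this, ← add_assoc, ← (hG 0).2 _ hx, h.integral_eq hκ (fun x => q (eC.symm x)),
        hqx (h.bdd z hxΩ)]
      simp only [LinearIsometryEquiv.symm_apply_apply])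
  rw [EventuallyEq, ae_restrict_iff' h.meas] at key
  have hw0 : ∀ᵐ z, w z * q z = 0 := by
    filter_upwards [eC_measurePreserving.quasiMeasurePreserving.ae key] with z hz
    by_cases hzΩ : eC z ∈ Ω
    · have := hz hzΩ
      rw [eC.symm_apply_apply] at this
      rw [left_eq_add.1 this, mul_zero]
    · rw [h.zero z hzΩ, zero_mul]
  filter_upwards [hqe] with x hx
  rcases le_or_gt ‖x‖ R with hR | hR
  · rw [hx hR, cv]
    refine integral_eq_zero_of_ae ?_
    filter_upwards [hw0] with z hz
    simp [hz]
  · exact hq.supp x hR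

end GKL

end

open GKL in
theorem gelfand_krein_levitan_uniqueness_analytic_curve
    (κ : ℝ) (hκ : 0 < κ)
    (U : Set R2) (hUopen : IsOpen U) (hUconn : IsConnected U) (hKcpt : IsCompact Uᶜ)
    (Ω : Set R2) (hΩopen : IsOpen Ω) (hΩbdd : Bornology.IsBounded Ω) (hKΩ : Uᶜ ⊆ Ω)
    (D : Set R2) (hDopen : IsOpen D) (hDbdd : Bornology.IsBounded D) (hDconn : IsConnected D)
    (Γ : Set R2) (hΓ : Γ = frontier D)
    (hΓconn : IsConnected Γ) (hΓan : IsRealAnalyticClosedCurve Γ)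
    (hDU : closure D ⊆ U)
    (hκD : NotDirichletEigenvalue κ D)
    (Λ : Set R2) (hΛne : Λ.Nonempty) (hΛΓ : Λ ⊆ Γ)
    (hΛopen : ∃ V : Set R2, IsOpen V ∧ Λ = V ∩ Γ)
    (v₁ v₂ : R2 → ℂ) (R₁ R₂ : R2 → R2 → ℂ)
    (hv₁L : MemLp v₁ ⊤ volume) (hv₂L : MemLp v₂ ⊤ volume)
    (hv₁0 : ∀ᵐ x ∂volume, x ∈ closure U → v₁ x = 0)
    (hv₂0 : ∀ᵐ x ∂volume, x ∈ closure U → v₂ x = 0)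
    (hu₁ : UniqueSolvability κ Ω v₁) (hu₂ : UniqueSolvability κ Ω v₂)
    (hR₁ : IsOutgoingGreen κ Ω v₁ R₁) (hR₂ : IsOutgoingGreen κ Ω v₂ R₂)
    (him : ∀ x ∈ Λ, ∀ y ∈ Λ, (R₁ x y).im = (R₂ x y).im) :
    v₁ =ᵐ[volume] v₂ := by
  obtain ⟨R, hR⟩ := hΩbdd.subset_closedBall 0
  have hΩR : ∀ z : ℂ, eC z ∈ Ω → ‖z‖ ≤ R := fun z hz => by simpa using hR hz
  have hUR : ∀ z : ℂ, R < ‖z‖ → eC z ∈ U := fun z hz => by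
    by_contra h
    exact hz.not_ge (hΩR z (hKΩ h))
  obtain ⟨M₁, w₁, hw₁, hw₁U, hvw₁⟩ := exists_pot hUopen hUR hv₁L hv₁0
  obtain ⟨M₂, w₂, hw₂, hw₂U, hvw₂⟩ := exists_pot hUopen hUR hv₂L hv₂0
  have hp₁ : Pot (max M₁ M₂) R w₁ := ⟨hw₁.meas, fun z => (hw₁.bdd z).trans (le_max_left _ _), hw₁.supp⟩
  have hp₂ : Pot (max M₁ M₂) R w₂ := ⟨hw₂.meas, fun z => (hw₂.bdd z).trans (le_max_right _ _), hw₂.supp⟩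
  have hUΩ : ∀ z : ℂ, eC z ∉ Ω → eC z ∈ U := fun z hz => by
    by_contra h
    exact hz (hKΩ h)
  have hr₁ : Rep (max M₁ M₂) R Ω v₁ w₁ :=
    ⟨hp₁, hΩopen.measurableSet, hΩR, fun z hz => hw₁U z (hUΩ z hz), hvw₁⟩
  have hr₂ : Rep (max M₁ M₂) R Ω v₂ w₂ :=
    ⟨hp₂, hΩopen.measurableSet, hΩR, fun z hz => hw₂U z (hUΩ z hz), hvw₂⟩
  have hF₁ := hr₁.isSource hκ hR₁
  have hF₂ := hr₂.isSource hκ hR₂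
  obtain ⟨V, hV, rfl⟩ := hΛopen
  obtain ⟨γ, hγa, -, hγd, -, hγ⟩ := hΓan
  obtain ⟨_, hxV, hxΓ⟩ := hΛne
  obtain ⟨t₀, rfl⟩ : _ ∈ range γ := hγ ▸ hxΓ
  have hfr : frontier (eC ⁻¹' D) = range fun t => eC.symm (γ t) := by
    rw [show frontier (eC ⁻¹' D) = eC ⁻¹' frontier D from
      (eC.toHomeomorph.preimage_frontier D).symm, ← hΓ, hγ]
    ext z
    simp only [Set.mem_preimage, Set.mem_range, LinearIsometryEquiv.symm_apply_eq]
  have hcl : closure (eC ⁻¹' D) ⊆ eC ⁻¹' U := by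
    rw [show closure (eC ⁻¹' D) = eC ⁻¹' closure D from (eC.toHomeomorph.preimage_closure D).symm]
    exact preimage_mono hDU
  have hS := source_eq hκ hF₁ hF₂ (U := eC ⁻¹' U) (D := eC ⁻¹' D) (V := eC ⁻¹' V)
    (γ := fun t => eC.symm (γ t)) (t₀ := t₀) (hUopen.preimage eC.continuous)
    (hUconn.isPreconnected.preimage_of_isOpenMap eC.injective eC.toHomeomorph.isOpenMap
      (by rw [eC.surjective.range_eq]; exact subset_univ _))
    hUR hw₁U hw₂U (hDopen.preimage eC.continuous) (hDconn.nonempty.preimage eC.surjective) hcl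
    (dirichlet_eC hκD)
    (fun t => (eC.symm.toContinuousLinearEquiv.analyticAt _).comp (hγa t))
    (fun t => by
      have h := (eC.symm.toContinuousLinearEquiv : R2 →L[ℝ] ℂ).hasFDerivAt.comp_hasDerivAt t
        (hγa t).differentiableAt.hasDerivAt
      rw [show deriv (fun t => eC.symm (γ t)) t = eC.symm (deriv γ t) from h.deriv]
      simpa using hγd t)
    hfr (hV.preimage eC.continuous) (by simpa using hxV)
    (fun s t hs ht hne => by
      have hs' : γ s ∈ V ∩ Γ := ⟨by simpa using hs, hγ ▸ mem_range_self s⟩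
      have ht' : γ t ∈ V ∩ Γ := ⟨by simpa using ht, hγ ▸ mem_range_self t⟩
      have h := him _ ht' _ hs'
      have e₁ := hr₁.green_eq hκ hR₁ hne
      have e₂ := hr₂.green_eq hκ hR₂ hne
      simp only [LinearIsometryEquiv.apply_symm_apply] at e₁ e₂ ⊢
      rw [e₁, e₂, Complex.add_im, Complex.add_im] at h
      exact add_left_cancel h)
  have hw : w₁ =ᵐ[volume] w₂ := pot_unique (κ := κ) hp₁ hp₂ fun u₁ u₂ h₁ h₂ =>
    integral_mul_weakSol hp₁.memLp hp₂.memLp hp₂.supp hF₁ hF₂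
      (fun x y hx hy => hS x (hUR x hx) y (hUR y hy)) (hr₂.unique hκ hR₂ hu₂) h₁ h₂
  have hz : ∀ᵐ z, v₁ (eC z) = v₂ (eC z) := by
    filter_upwards [hvw₁, hvw₂, hw] with z h1 h2 h3
    rw [h1, h2, h3]
  filter_upwards [eC_symm_measurePreserving.quasiMeasurePreserving.ae hz] with x hx
  simpa using hx
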